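/- The limit superior s_W = limsup_{x→∞} |W(x)|/x satisfies 1/2 ≤ s_W ≤ 2260. -/

import Mathlib

open Finset Filter ArithmeticFunction

/-- `W x = ∑_{1 ≤ n ≤ x} (-2)^{Ω(n)}`. -/
noncomputable def W (x : ℝ) : ℝ :=
  ∑ n ∈ Finset.Icc 1 ⌊x⌋₊, (-2 : ℝ) ^ (cardFactors n)

-- Part E1
/-- Trapezoid error term. -/
noncomputable def emE (n : ℕ) (s : ℂ) : ℂ :=
  ((n:ℂ)^(-s) + ((n:ℂ)+1)^(-s))/2 - (((n:ℂ)+1)^(1-s) - (n:ℂ)^(1-s))/(1-s)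

lemma emE_eq_integral {n : ℕ} (hn : 1 ≤ n) {s : ℂ} (hs : s ≠ 1) :
    emE n s = s*(s+1)/2 * ∫ u in (n:ℝ)..(n+1), (((u-n)*(n+1-u) : ℝ):ℂ) * (u:ℂ)^(-s-2) := by
  have hn0 : (0:ℝ) < n := by exact_mod_cast hn
  -- antiderivative
  -- ∂ [ (u-n)(n+1-u) (-(s)) u^{-s-1}/2 *... ]
  have key : ∀ u ∈ Set.uIcc (n:ℝ) (n+1), HasDerivAt
      (fun u:ℝ => -(s/2)*((((u-n)*(n+1-u):ℝ):ℂ) * (u:ℂ)^(-s-1))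
         - (((2*n+1-2*u:ℝ):ℂ)/2 * (u:ℂ)^(-s)) - (u:ℂ)^(1-s)/(1-s))
      (s*(s+1)/2 * ((((u-n)*(n+1-u) : ℝ):ℂ) * (u:ℂ)^(-s-2))) u := by
    intro u hu
    rw [Set.uIcc_of_le (by linarith)] at hu
    have hu0 : (0:ℝ) < u := lt_of_lt_of_le hn0 hu.1
    have hus : (u:ℂ) ∈ Complex.slitPlane := by
      rw [Complex.ofReal_mem_slitPlane]; exact hu0
    have hune : (u:ℂ) ≠ 0 := by exact_mod_cast hu0.ne'
    have hp : ∀ a:ℂ, HasDerivAt (fun u:ℝ => (u:ℂ)^a) (a*(u:ℂ)^(a-1)) u := by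
      intro a
      have h0 : HasDerivAt (fun z:ℂ => z^a) (a*(u:ℂ)^(a-1)) (u:ℂ) := by
        simpa using (hasDerivAt_id (u:ℂ)).cpow_const (c := a) hus
      exact h0.comp_ofReal
    have hq : HasDerivAt (fun u:ℝ => (((u-n)*(n+1-u):ℝ):ℂ)) (((2*n+1-2*u:ℝ):ℂ)) u := by
      have : HasDerivAt (fun u:ℝ => (u-n)*(n+1-u)) (2*n+1-2*u) u := by
        have h1 : HasDerivAt (fun u:ℝ => u-(n:ℝ)) 1 u := (hasDerivAt_id u).sub_const _
        have h2 : HasDerivAt (fun u:ℝ => (n:ℝ)+1-u) (-1) u := (hasDerivAt_id u).const_sub _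
        exact (h1.mul h2).congr_deriv (by ring)
      exact this.ofReal_comp
    have hr : HasDerivAt (fun u:ℝ => (((2*n+1-2*u:ℝ):ℂ)/2)) (-1) u := by
      have : HasDerivAt (fun u:ℝ => (2*n+1-2*u:ℝ)) (-2) u := by
        have h2 := ((hasDerivAt_id u).const_mul 2).const_sub (2*(n:ℝ)+1)
        simpa using h2
      exact (this.ofReal_comp.div_const 2).congr_deriv (by norm_num)
    have h1s : (1-s) ≠ 0 := sub_ne_zero.mpr (Ne.symm hs)
    have := (((hq.mul (hp (-s-1))).const_mul (-(s/2))).sub (hr.mul (hp (-s)))).sub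
      ((hp (1-s)).div_const (1-s))
    refine this.congr_deriv ?_
    have e1 : (u:ℂ)^(-s-1-1) = (u:ℂ)^(-s-2) := by congr 1; ring
    have e2 : (1-s-1:ℂ) = -s := by ring
    rw [e1, e2]
    field_simp
    ring
  have hitg : IntervalIntegrable (fun u:ℝ => s*(s+1)/2 * ((((u-n)*(n+1-u) : ℝ):ℂ) * (u:ℂ)^(-s-2)))
      MeasureTheory.volume (n:ℝ) (n+1) := by
    apply ContinuousOn.intervalIntegrable
    intro u hu
    rw [Set.uIcc_of_le (by linarith)] at hu
    have hu0 : (0:ℝ) < u := lt_of_lt_of_le hn0 hu.1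
    apply ContinuousAt.continuousWithinAt
    apply ContinuousAt.mul continuousAt_const
    apply ContinuousAt.mul
    · fun_prop
    · apply ContinuousAt.cpow
      · exact Complex.continuous_ofReal.continuousAt
      · exact continuousAt_const
      · rw [Complex.ofReal_mem_slitPlane]; exact hu0
  have := intervalIntegral.integral_eq_sub_of_hasDerivAt key hitg
  rw [← intervalIntegral.integral_const_mul, this, emE]
  push_cast
  ring_nf

lemma emE_bound {n : ℕ} (hn : 1 ≤ n) {s : ℂ} (hs : s ≠ 1) (hσ : -1 < s.re) :
    ‖emE n s‖ ≤ ‖s‖*‖s+1‖/(8*(s.re+1)) * ((n:ℝ)^(-s.re-1) - ((n:ℝ)+1)^(-s.re-1)) := by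
  have hn0 : (0:ℝ) < n := by exact_mod_cast hn
  rw [emE_eq_integral hn hs]
  have h1 : ‖∫ u in (n:ℝ)..(n+1), (((u-n)*(n+1-u) : ℝ):ℂ) * (u:ℂ)^(-s-2)‖ ≤
      ∫ u in (n:ℝ)..(n+1), (1/4)*u^(-s.re-2) := by
    apply intervalIntegral.norm_integral_le_of_norm_le (by linarith)
    · filter_upwards with u hu
      have hu0 : (0:ℝ) < u := lt_trans hn0 hu.1
      rw [norm_mul, Complex.norm_cpow_eq_rpow_re_of_pos hu0, Complex.norm_real]
      have e : (-s-2).re = -s.re-2 := by simp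
      rw [e]
      apply mul_le_mul_of_nonneg_right _ (Real.rpow_nonneg hu0.le _)
      rw [Real.norm_eq_abs, abs_of_nonneg (mul_nonneg (by linarith [hu.1]) (by linarith [hu.2]))]
      nlinarith [sq_nonneg (u-n-1/2)]
    · apply ContinuousOn.intervalIntegrable
      intro u hu
      rw [Set.uIcc_of_le (by linarith)] at hu
      have hu0 : (0:ℝ) < u := lt_of_lt_of_le hn0 hu.1
      apply ContinuousAt.continuousWithinAt
      exact continuousAt_const.mul (Real.continuousAt_rpow_const _ _ (Or.inl hu0.ne'))
  have h2 : ∫ u in (n:ℝ)..(n+1), (1/4)*u^(-s.re-2) =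
      (1/4) * (((n:ℝ)^(-s.re-1) - ((n:ℝ)+1)^(-s.re-1))/(s.re+1)) := by
    rw [intervalIntegral.integral_const_mul, integral_rpow]
    · have e : -s.re-2+1 = -s.re-1 := by ring
      rw [e]
      have h3 : -s.re-1 ≠ 0 := by linarith
      have h4 : s.re+1 ≠ 0 := by linarith
      field_simp
      ring
    · right
      constructor
      · linarith
      · rw [Set.uIcc_of_le (by linarith)]
        intro h; linarith [h.1]
  rw [norm_mul, norm_div, norm_mul]
  have h4 : (0:ℝ) < s.re+1 := by linarith
  calc ‖s‖*‖s+1‖/‖(2:ℂ)‖ * _ ≤ ‖s‖*‖s+1‖/‖(2:ℂ)‖ * ((1/4) * (((n:ℝ)^(-s.re-1) - ((n:ℝ)+1)^(-s.re-1))/(s.re+1))) := by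
        apply mul_le_mul_of_nonneg_left (h1.trans h2.le); positivity
    _ = _ := by
        simp only [Complex.norm_ofNat]
        field_simp
        ring

/-- The remainder. -/
noncomputable def emR (N : ℕ) (s : ℂ) : ℂ :=
  riemannZeta s - ∑ n ∈ Finset.Ico 1 N, (n:ℂ)^(-s) - (N:ℂ)^(-s)/2 - (N:ℂ)^(1-s)/(s-1)

lemma emR_succ {N : ℕ} (hN : 1 ≤ N) {s : ℂ} (hs : s ≠ 1) : emR N s = emE N s + emR (N+1) s := by
  unfold emR emE
  rw [Finset.sum_Ico_succ_top hN]
  have h1 : s-1 ≠ 0 := sub_ne_zero.mpr hs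
  have h2 : 1-s ≠ 0 := sub_ne_zero.mpr (Ne.symm hs)
  push_cast
  field_simp
  ring

lemma emR_add {N : ℕ} (hN : 1 ≤ N) {s : ℂ} (hs : s ≠ 1) (k : ℕ) :
    emR N s = ∑ i ∈ Finset.range k, emE (N+i) s + emR (N+k) s := by
  induction k with
  | zero => simp
  | succ k ih =>
    rw [Finset.sum_range_succ, ih, emR_succ (by omega) hs]
    ring_nf

lemma emE_sum_bound {N : ℕ} (hN : 1 ≤ N) {s : ℂ} (hs : s ≠ 1) (hσ : -1 < s.re) (k : ℕ) :
    ∑ i ∈ Finset.range k, ‖emE (N+i) s‖ ≤ ‖s‖*‖s+1‖/(8*(s.re+1)) * (N:ℝ)^(-s.re-1) := by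
  have h4 : (0:ℝ) < s.re+1 := by linarith
  have : ∑ i ∈ Finset.range k, ‖emE (N+i) s‖ ≤ ‖s‖*‖s+1‖/(8*(s.re+1)) * ((N:ℝ)^(-s.re-1) - ((N:ℝ)+k)^(-s.re-1)) := by
    induction k with
    | zero => simp
    | succ k ih =>
      rw [Finset.sum_range_succ]
      have := emE_bound (n := N+k) (by omega) hs hσ
      push_cast at this ⊢
      rw [← add_assoc]
      have := add_le_add ih this
      rw [← mul_add] at this
      refine this.trans (le_of_eq ?_)
      ring
  refine this.trans ?_
  apply mul_le_mul_of_nonneg_left _ (by positivity)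
  have : (0:ℝ) ≤ ((N:ℝ)+k)^(-s.re-1) := by positivity
  linarith

-- Part E1b
lemma emE_bound2 {n : ℕ} (hn : 1 ≤ n) {s : ℂ} (hs : s ≠ 1) (hσ : -1 < s.re) :
    ‖emE n s‖ ≤ ‖s‖*‖s+1‖/8 * (n:ℝ)^(-s.re-2) := by
  have hn0 : (0:ℝ) < n := by exact_mod_cast hn
  rw [emE_eq_integral hn hs]
  have h1 : ‖∫ u in (n:ℝ)..(n+1), (((u-n)*(n+1-u) : ℝ):ℂ) * (u:ℂ)^(-s-2)‖ ≤
      (1/4)*(n:ℝ)^(-s.re-2) * |(n:ℝ)+1-n| := by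
    apply intervalIntegral.norm_integral_le_of_norm_le_const
    intro u hu
    rw [Set.uIoc_of_le (by linarith)] at hu
    have hu0 : (0:ℝ) < u := lt_trans hn0 hu.1
    rw [norm_mul, Complex.norm_cpow_eq_rpow_re_of_pos hu0, Complex.norm_real]
    have e : (-s-2).re = -s.re-2 := by simp
    rw [e]
    apply mul_le_mul _ _ (Real.rpow_nonneg hu0.le _) (by norm_num)
    · rw [Real.norm_eq_abs, abs_of_nonneg (mul_nonneg (by linarith [hu.1]) (by linarith [hu.2]))]
      nlinarith [sq_nonneg (u-n-1/2)]
    · exact Real.rpow_le_rpow_of_nonpos hn0 hu.1.le (by linarith)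
  rw [norm_mul, norm_div, norm_mul]
  rw [add_sub_cancel_left, abs_one, mul_one] at h1
  calc ‖s‖*‖s+1‖/‖(2:ℂ)‖ * _ ≤ ‖s‖*‖s+1‖/‖(2:ℂ)‖ * ((1/4)*(n:ℝ)^(-s.re-2)) := by
        apply mul_le_mul_of_nonneg_left h1; positivity
    _ = _ := by
        simp only [Complex.norm_ofNat]
        ring

/-- `(s-1) * emE`, entire. -/
noncomputable def emG (n : ℕ) (s : ℂ) : ℂ :=
  (s-1)*((n:ℂ)^(-s) + ((n:ℂ)+1)^(-s))/2 + (((n:ℂ)+1)^(1-s) - (n:ℂ)^(1-s))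

lemma emG_eq {n : ℕ} {s : ℂ} (hs : s ≠ 1) : emG n s = (s-1)*emE n s := by
  unfold emG emE
  have h2 : 1-s ≠ 0 := sub_ne_zero.mpr (Ne.symm hs)
  field_simp
  ring

lemma emG_diff {n : ℕ} (hn : 1 ≤ n) : Differentiable ℂ (emG n) := by
  have h1 : (n:ℂ) ≠ 0 := by exact_mod_cast (by omega : n ≠ 0)
  have h2 : (n:ℂ)+1 ≠ 0 := by exact_mod_cast (by omega : n+1 ≠ 0)
  intro s
  unfold emG
  have a1 : DifferentiableAt ℂ (fun s:ℂ => (n:ℂ)^(-s)) s := (differentiableAt_id.neg).const_cpow (Or.inl h1)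
  have a2 : DifferentiableAt ℂ (fun s:ℂ => ((n:ℂ)+1)^(-s)) s := (differentiableAt_id.neg).const_cpow (Or.inl h2)
  have a3 : DifferentiableAt ℂ (fun s:ℂ => (n:ℂ)^(1-s)) s := (differentiableAt_id.const_sub 1).const_cpow (Or.inl h1)
  have a4 : DifferentiableAt ℂ (fun s:ℂ => ((n:ℂ)+1)^(1-s)) s := (differentiableAt_id.const_sub 1).const_cpow (Or.inl h2)
  exact (((differentiableAt_id.sub_const 1).mul (a1.add a2)).div_const 2).add (a4.sub a3)

lemma emR_tendsto_one {s : ℂ} (hσ : 1 < s.re) : Tendsto (fun N => emR N s) atTop (nhds 0) := by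
  unfold emR
  have hs0 : s ≠ 0 := by rintro rfl; simp at hσ; linarith
  have t1 : Tendsto (fun N:ℕ => ∑ n ∈ Finset.Ico 1 N, (n:ℂ)^(-s)) atTop (nhds (riemannZeta s)) := by
    have hsum : Summable (fun n:ℕ => 1/(n:ℂ)^s) := Complex.summable_one_div_nat_cpow.mpr hσ
    have := hsum.hasSum.tendsto_sum_nat
    rw [← zeta_eq_tsum_one_div_nat_cpow hσ] at this
    refine this.congr' ?_
    filter_upwards [eventually_ge_atTop 1] with N hN
    rw [Finset.range_eq_Ico, ← Finset.sum_Ico_consecutive _ (Nat.zero_le 1) hN]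
    simp only [Nat.Ico_zero_eq_range, Finset.sum_range_one]
    simp [Complex.zero_cpow hs0, Complex.cpow_neg]
  have tp : ∀ a:ℂ, a.re < 0 → Tendsto (fun N:ℕ => (N:ℂ)^a) atTop (nhds 0) := by
    intro a ha
    rw [tendsto_zero_iff_norm_tendsto_zero]
    have : Tendsto (fun N:ℕ => (N:ℝ)^(-(-a.re))) atTop (nhds 0) :=
      (tendsto_rpow_neg_atTop (by linarith : 0 < -a.re)).comp tendsto_natCast_atTop_atTop
    refine this.congr' ?_
    filter_upwards [eventually_ge_atTop 1] with N hN
    rw [Complex.norm_natCast_cpow_of_pos (by omega), neg_neg]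
  have t2 := (tp (-s) (by simp; linarith)).div_const 2
  have t3 := (tp (1-s) (by simp; linarith)).div_const (s-1)
  have := (((tendsto_const_nhds (x := riemannZeta s)).sub t1).sub t2).sub t3
  simpa using this

lemma emR_one {s : ℂ} (hs : s ≠ 1) : (s-1)*emR 1 s = riemannZeta₁ s - (s-1)/2 - 1 := by
  unfold emR
  rw [riemannZeta_eq_inv_sub_mul hs]
  have h1 : s-1 ≠ 0 := sub_ne_zero.mpr hs
  simp
  field_simp

lemma emE_hasSum_aux {s : ℂ} (hs : s ≠ 1) (hσ : -1 < s.re) : Summable (fun i => emE (1+i) s) := by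
  apply Summable.of_norm
  apply summable_of_sum_range_le (fun i => norm_nonneg _)
    (fun k => emE_sum_bound (N := 1) le_rfl hs hσ k)

lemma emE_hasSum_one {s : ℂ} (hσ : 1 < s.re) : HasSum (fun i => emE (1+i) s) (emR 1 s) := by
  have hs1 : s ≠ 1 := by rintro rfl; simp at hσ
  have h := (emE_hasSum_aux hs1 (by linarith))
  have h1 := h.hasSum.tendsto_sum_nat
  have h2 : Tendsto (fun k => ∑ i ∈ Finset.range k, emE (1+i) s) atTop (nhds (emR 1 s)) := by
    have : Tendsto (fun k => emR 1 s - emR (k+1) s) atTop (nhds (emR 1 s - 0)) :=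
      tendsto_const_nhds.sub ((emR_tendsto_one hσ).comp (tendsto_add_atTop_nat 1))
    rw [sub_zero] at this
    refine this.congr (fun k => ?_)
    rw [emR_add le_rfl hs1 k, add_comm 1 k]; ring
  rw [← tendsto_nhds_unique h1 h2]
  exact h.hasSum

lemma emG_tsum {s : ℂ} (hσ : -1 < s.re) :
    ∑' i, emG (1+i) s = riemannZeta₁ s - (s-1)/2 - 1 := by
  set a : ℝ := (s.re-1)/2 with ha
  have ha1 : -1 < a := by rw [ha]; linarith
  set R : ℝ := ‖s‖ + 3 with hR
  set V : Set ℂ := {z | a < z.re} ∩ Metric.ball 0 R with hV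
  have hVo : IsOpen V := (isOpen_lt continuous_const Complex.continuous_re).inter Metric.isOpen_ball
  have hVc : Convex ℝ V := (convex_halfSpace_re_gt a).inter (convex_ball 0 R)
  have hs_mem : s ∈ V := by
    refine ⟨?_, ?_⟩
    · show a < s.re
      rw [ha]; linarith
    · simp [hR]
  have hR0 : 0 ≤ R := by positivity
  have hd : DifferentiableOn ℂ (fun w => ∑' i, emG (1+i) w) V := by
    apply Complex.differentiableOn_tsum_of_summable_norm
      (u := fun i:ℕ => (R+1)*(R*(R+1)/8) * ((1+i:ℕ):ℝ)^(-(a+2)))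
    · apply Summable.mul_left
      have : Summable (fun n:ℕ => (n:ℝ)^(-(a+2))) := Real.summable_nat_rpow.mpr (by linarith)
      exact this.comp_injective (add_right_injective 1)
    · intro i
      exact (emG_diff (by omega)).differentiableOn
    · exact hVo
    · intro i w hw
      have hw1 : a < w.re := hw.1
      have hw2 : ‖w‖ < R := by simpa using hw.2
      by_cases h1 : w = 1
      · subst h1
        simp [emG]
        positivity
      · rw [emG_eq h1, norm_mul]
        have b := emE_bound2 (n := 1+i) (by omega) h1 (by linarith)
        have n1 : ‖w-1‖ ≤ R+1 := (norm_sub_le _ _).trans (by simp; linarith)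
        have n2 : ‖w+1‖ ≤ R+1 := (norm_add_le _ _).trans (by simp; linarith)
        have n3 : ((1+i:ℕ):ℝ)^(-w.re-2) ≤ ((1+i:ℕ):ℝ)^(-(a+2)) := by
          apply Real.rpow_le_rpow_of_exponent_le
          · push_cast; linarith [Nat.cast_nonneg (α := ℝ) i]
          · linarith
        rw [mul_assoc]
        apply mul_le_mul n1 _ (norm_nonneg _) (by positivity)
        refine b.trans ?_
        gcongr
  have hA1 : AnalyticOnNhd ℂ (fun w => ∑' i, emG (1+i) w) V := hd.analyticOnNhd hVo
  have hA2 : AnalyticOnNhd ℂ (fun w => riemannZeta₁ w - (w-1)/2 - 1) V := by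
    apply DifferentiableOn.analyticOnNhd _ hVo
    apply Differentiable.differentiableOn
    exact (differentiable_riemannZeta₁.sub ((differentiable_id.sub_const 1).div_const 2)).sub_const 1
  have h2 : (((max a 1) + 1/2 : ℝ) : ℂ) ∈ V := by
    have h0 : |s.re| ≤ ‖s‖ := Complex.abs_re_le_norm s
    have h00 := le_abs_self s.re
    refine ⟨?_, ?_⟩
    · show a < _
      rw [Complex.ofReal_re]; linarith [le_max_left a 1]
    · simp only [Metric.mem_ball, dist_zero_right, Complex.norm_real, Real.norm_eq_abs]
      rw [abs_of_nonneg (by linarith [le_max_right a 1])]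
      have : max a 1 ≤ ‖s‖ + 1 := max_le (by rw [ha]; linarith [norm_nonneg s]) (by linarith [norm_nonneg s])
      rw [hR]; linarith
  have := hA1.eqOn_of_preconnected_of_eventuallyEq hA2 hVc.isPreconnected h2 ?_
  · exact this hs_mem
  · have hopen : IsOpen {z:ℂ | 1 < z.re} := isOpen_lt continuous_const Complex.continuous_re
    have hm : (((max a 1) + 1/2 : ℝ) : ℂ) ∈ {z:ℂ | 1 < z.re} := by
      rw [Set.mem_setOf_eq, Complex.ofReal_re]; linarith [le_max_right a 1]
    filter_upwards [hopen.mem_nhds hm] with w hw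
    have hw : 1 < w.re := hw
    have hw1 : w ≠ 1 := by rintro rfl; simp at hw
    rw [← emR_one hw1, ← (emE_hasSum_one hw).tsum_eq, ← tsum_mul_left]
    exact tsum_congr (fun i => emG_eq hw1)

lemma emR_hasSum {s : ℂ} (hs : s ≠ 1) (hσ : -1 < s.re) : HasSum (fun i => emE (1+i) s) (emR 1 s) := by
  have h := emE_hasSum_aux hs hσ
  have h1 : s-1 ≠ 0 := sub_ne_zero.mpr hs
  have : (s-1)*emR 1 s = (s-1) * ∑' i, emE (1+i) s := by
    rw [emR_one hs, ← emG_tsum hσ, ← tsum_mul_left]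
    exact tsum_congr (fun i => emG_eq hs)
  rw [mul_left_cancel₀ h1 this]
  exact h.hasSum

/-- Euler–Maclaurin (trapezoid) for zeta. -/
lemma emR_bound {N : ℕ} (hN : 1 ≤ N) {s : ℂ} (hs : s ≠ 1) (hσ : -1 < s.re) :
    ‖emR N s‖ ≤ ‖s‖*‖s+1‖/(8*(s.re+1)) * (N:ℝ)^(-s.re-1) := by
  have h0 : Tendsto (fun k => emR (N+k) s) atTop (nhds 0) := by
    have h1 := (emR_hasSum hs hσ).tendsto_sum_nat
    have h2 : Tendsto (fun k => emR (1+k) s) atTop (nhds 0) := by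
      have : Tendsto (fun k => emR 1 s - ∑ i ∈ Finset.range k, emE (1+i) s) atTop (nhds (emR 1 s - emR 1 s)) :=
        tendsto_const_nhds.sub h1
      rw [sub_self] at this
      refine this.congr (fun k => ?_)
      rw [emR_add le_rfl hs k]; ring
    have h3 := h2.comp (tendsto_add_atTop_nat (N-1))
    refine h3.congr (fun k => ?_)
    simp only [Function.comp]
    congr 1; omega
  have h4 : Tendsto (fun k => ‖emR N s - emR (N+k) s‖) atTop (nhds ‖emR N s - 0‖) :=
    (tendsto_const_nhds.sub h0).norm
  rw [sub_zero] at h4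
  refine le_of_tendsto h4 (Eventually.of_forall fun k => ?_)
  rw [emR_add hN hs k, add_sub_cancel_right]
  exact (norm_sum_le _ _).trans (emE_sum_bound hN hs hσ k)

-- Part E2
/-- Nonvanishing case of the Jensen derivative formula. -/
lemma jd_kernel {U : Set ℂ} (hU : IsOpen U) {r : ℝ} (hr : 0 < r) (hrU : Metric.closedBall 0 r ⊆ U)
    {g : ℂ → ℂ} (hg : DifferentiableOn ℂ g U) (hg0 : ∀ z ∈ Metric.closedBall (0:ℂ) r, g z ≠ 0) :
    ∫ θ in (0:ℝ)..2*Real.pi, Real.cos θ * Real.log ‖g (circleMap 0 r θ)‖ =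
      Real.pi * r * (deriv g 0 / g 0).re := by
  set V : Set ℂ := U ∩ g ⁻¹' {0}ᶜ with hV
  have hVo : IsOpen V := hg.continuousOn.isOpen_inter_preimage hU isOpen_compl_singleton
  obtain ⟨e, he, heV⟩ := (isCompact_closedBall (0:ℂ) r).exists_thickening_subset_open hVo
    (fun z hz => ⟨hrU hz, hg0 z hz⟩)
  rw [thickening_closedBall he hr.le] at heV
  have hgb : DifferentiableOn ℂ g (Metric.ball 0 (e+r)) := hg.mono (heV.trans Set.inter_subset_left)
  have hgn : ∀ z ∈ Metric.ball (0:ℂ) (e+r), g z ≠ 0 := fun z hz => (heV hz).2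
  have hld : DifferentiableOn ℂ (fun z => deriv g z / g z) (Metric.ball 0 (e+r)) :=
    (hgb.deriv Metric.isOpen_ball).div hgb hgn
  obtain ⟨G, hG0, hG⟩ := hld.isExactOn_ball.with_val_at 0 (Complex.log (g 0))
  have h0m : (0:ℂ) ∈ Metric.ball (0:ℂ) (e+r) := by simp; linarith
  have hexp : ∀ z ∈ Metric.ball (0:ℂ) (e+r), g z = Complex.exp (G z) := by
    intro z hz
    have hc : ∀ w ∈ Metric.ball (0:ℂ) (e+r), HasDerivAt (fun w => g w * Complex.exp (-G w)) 0 w := by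
      intro w hw
      have h1 : HasDerivAt g (deriv g w) w :=
        (hgb.differentiableAt (Metric.isOpen_ball.mem_nhds hw)).hasDerivAt
      have h2 := h1.mul ((hG w hw).neg.cexp)
      refine h2.congr_deriv ?_
      have := hgn w hw
      field_simp
      ring
    have hconst := Metric.isOpen_ball.is_const_of_deriv_eq_zero
      (convex_ball (0:ℂ) (e+r)).isPreconnected
      (fun w hw => (hc w hw).differentiableAt.differentiableWithinAt)
      (fun w hw => (hc w hw).deriv) hz h0m
    simp only [hG0] at hconst
    rw [Complex.exp_neg, Complex.exp_neg, Complex.exp_log (hgn 0 h0m),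
      mul_inv_cancel₀ (hgn 0 h0m)] at hconst
    field_simp [Complex.exp_ne_zero] at hconst
    exact hconst
  have hGd : DifferentiableOn ℂ G (Metric.ball 0 (e+r)) :=
    fun z hz => (hG z hz).differentiableAt.differentiableWithinAt
  have hsub : Metric.closedBall (0:ℂ) r ⊆ Metric.ball 0 (e+r) :=
    Metric.closedBall_subset_ball (by linarith)
  have c1 := Complex.two_pi_I_inv_smul_circleIntegral_sub_sq_inv_smul_of_differentiable
    Metric.isOpen_ball hsub hGd (w₀ := 0) (by simpa using hr)
  rw [(hG 0 h0m).deriv] at c1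
  have c2 : (∮ z in C(0, r), G z) = 0 :=
    Complex.circleIntegral_eq_zero_of_differentiable_on_off_countable hr.le Set.countable_empty
      (hGd.continuousOn.mono hsub)
      (fun z hz => (hG z (hsub (Metric.ball_subset_closedBall hz.1))).differentiableAt)
  have hGc : Continuous (fun θ:ℝ => G (circleMap 0 r θ)) := by
    have := hGd.continuousOn.mono hsub
    apply this.comp_continuous (continuous_circleMap 0 r)
    intro θ; exact Metric.sphere_subset_closedBall (circleMap_mem_sphere 0 hr.le θ)
  have hrc : (r:ℂ) ≠ 0 := by exact_mod_cast hr.ne'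
  have cm : ∀ θ:ℝ, circleMap 0 r θ = r * Complex.exp (θ*Complex.I) := by intro θ; simp [circleMap]
  have c3 : ∫ θ in (0:ℝ)..2*Real.pi, Complex.exp (-(θ*Complex.I)) * G (circleMap 0 r θ) =
      2*Real.pi*r*(deriv g 0/g 0) := by
    rw [circleIntegral] at c1
    simp only [deriv_circleMap, sub_zero, smul_eq_mul] at c1
    have : ∀ θ:ℝ, circleMap 0 r θ * Complex.I * ((circleMap 0 r θ ^2)⁻¹ * G (circleMap 0 r θ)) =
        (Complex.I/r) * (Complex.exp (-(θ*Complex.I)) * G (circleMap 0 r θ)) := by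
      intro θ
      rw [Complex.exp_neg]
      have h1 := Complex.exp_ne_zero (θ*Complex.I)
      simp only [cm]
      field_simp
    simp only [this] at c1
    rw [intervalIntegral.integral_const_mul] at c1
    rw [← c1]
    generalize (∫ (x : ℝ) in 0..2 * Real.pi, Complex.exp (-(↑x * Complex.I)) * G (circleMap 0 r x)) = J
    have := Real.pi_ne_zero
    have : (Real.pi:ℂ) ≠ 0 := by exact_mod_cast this
    field_simp
  have c4 : ∫ θ in (0:ℝ)..2*Real.pi, Complex.exp (θ*Complex.I) * G (circleMap 0 r θ) = 0 := by
    rw [circleIntegral] at c2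
    simp only [deriv_circleMap, smul_eq_mul] at c2
    have : ∀ θ:ℝ, circleMap 0 r θ * Complex.I * G (circleMap 0 r θ) =
        (Complex.I*r) * (Complex.exp (θ*Complex.I) * G (circleMap 0 r θ)) := by
      intro θ
      simp only [cm]
      ring
    simp only [this] at c2
    rw [intervalIntegral.integral_const_mul] at c2
    rcases mul_eq_zero.mp c2 with h | h
    · rcases mul_eq_zero.mp h with h | h
      · exact absurd h Complex.I_ne_zero
      · exact absurd h hrc
    · exact h
  have c5 : ∫ θ in (0:ℝ)..2*Real.pi, ((Real.cos θ:ℝ):ℂ) * G (circleMap 0 r θ) =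
      Real.pi*r*(deriv g 0/g 0) := by
    have i1 : IntervalIntegrable (fun θ:ℝ => Complex.exp (-(θ*Complex.I)) * G (circleMap 0 r θ))
      MeasureTheory.volume 0 (2*Real.pi) := by
      apply Continuous.intervalIntegrable
      exact Continuous.mul (by fun_prop) hGc
    have i2 : IntervalIntegrable (fun θ:ℝ => Complex.exp (θ*Complex.I) * G (circleMap 0 r θ))
      MeasureTheory.volume 0 (2*Real.pi) := by
      apply Continuous.intervalIntegrable
      exact Continuous.mul (by fun_prop) hGc
    have := intervalIntegral.integral_add i1 i2
    rw [c3, c4] at this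
    have e : ∀ θ:ℝ, ((Real.cos θ:ℝ):ℂ) * G (circleMap 0 r θ) =
        (1/2) * (Complex.exp (-(θ*Complex.I)) * G (circleMap 0 r θ)
          + Complex.exp (θ*Complex.I) * G (circleMap 0 r θ)) := by
      intro θ
      rw [Complex.ofReal_cos, Complex.cos]
      ring_nf
    simp only [e]
    rw [intervalIntegral.integral_const_mul, this]
    ring
  have c6 := congrArg Complex.re c5
  have i3 : IntervalIntegrable (fun θ:ℝ => ((Real.cos θ:ℝ):ℂ) * G (circleMap 0 r θ))
      MeasureTheory.volume 0 (2*Real.pi) := by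
      apply Continuous.intervalIntegrable
      exact (Complex.continuous_ofReal.comp Real.continuous_cos).mul hGc
  have := Complex.reCLM.intervalIntegral_comp_comm i3
  simp only [Complex.reCLM_apply] at this
  rw [← this] at c6
  have e2 : ((Real.pi:ℂ)*r*(deriv g 0/g 0)).re = Real.pi*r*(deriv g 0/g 0).re := by
    rw [← Complex.ofReal_mul, Complex.re_ofReal_mul]
  rw [e2] at c6
  rw [← c6]
  apply intervalIntegral.integral_congr
  intro θ _
  simp only [Complex.re_ofReal_mul]
  rw [hexp _ (hsub (Metric.sphere_subset_closedBall (circleMap_mem_sphere 0 hr.le θ))),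
    Complex.norm_exp, Real.log_exp]

/-- factor out one zero -/
lemma factor_one {U : Set ℂ} (hU : IsOpen U) {f : ℂ → ℂ} (hf : DifferentiableOn ℂ f U) {ρ : ℂ}
    (hρ : ρ ∈ U) (hne : ¬ ∀ᶠ z in nhds ρ, f z = 0) :
    ∃ (n : ℕ) (h : ℂ → ℂ), DifferentiableOn ℂ h U ∧ h ρ ≠ 0 ∧ (∀ z ∈ U, f z = (z-ρ)^n * h z) := by
  have ha : AnalyticAt ℂ f ρ := hf.analyticAt (hU.mem_nhds hρ)
  obtain ⟨n, g, hg, hg0, hfg⟩ := (ha.exists_eventuallyEq_pow_smul_nonzero_iff).mpr hne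
  have hh : ∀ z ≠ ρ, Function.update (fun z => f z/(z-ρ)^n) ρ (g ρ) z = f z/(z-ρ)^n := by
    intro z hz; simp [Function.update_of_ne hz]
  refine ⟨n, Function.update (fun z => f z/(z-ρ)^n) ρ (g ρ), ?_, by simpa using hg0, ?_⟩
  · intro z hz
    apply DifferentiableAt.differentiableWithinAt
    by_cases h : z = ρ
    · subst h
      have : Function.update (fun w => f w/(w-z)^n) z (g z) =ᶠ[nhds z] g := by
        filter_upwards [hfg] with w hw
        by_cases hwz : w = z
        · subst hwz; simp
        · rw [hh w hwz, hw, smul_eq_mul]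
          have : (w-z)^n ≠ 0 := pow_ne_zero _ (sub_ne_zero.mpr hwz)
          field_simp
      exact this.differentiableAt_iff.mpr hg.differentiableAt
    · have : Function.update (fun w => f w/(w-ρ)^n) ρ (g ρ) =ᶠ[nhds z] (fun w => f w/(w-ρ)^n) := by
        filter_upwards [isOpen_ne.mem_nhds h] with w hw
        exact hh w hw
      refine this.differentiableAt_iff.mpr ?_
      refine (hf.differentiableAt (hU.mem_nhds hz)).div (by fun_prop) ?_
      exact pow_ne_zero _ (sub_ne_zero.mpr h)
  · intro z hz
    by_cases h : z = ρ
    · subst h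
      have := hfg.self_of_nhds
      simpa using this
    · rw [hh z h]
      have : (z-ρ)^n ≠ 0 := pow_ne_zero _ (sub_ne_zero.mpr h)
      field_simp

lemma factor_all {U : Set ℂ} (hU : IsOpen U) {K : Set ℂ} (hK : K ⊆ U) (S : Finset ℂ) :
    ∀ (f : ℂ → ℂ), DifferentiableOn ℂ f U → (∀ ρ ∈ S, ρ ∈ U) →
    (∀ z ∈ K, f z = 0 → z ∈ S) → (∀ ρ ∈ S, ¬ ∀ᶠ z in nhds ρ, f z = 0) →
    ∃ (m : ℂ → ℕ) (g : ℂ → ℂ), DifferentiableOn ℂ g U ∧ (∀ z ∈ K, g z ≠ 0) ∧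
      (∀ z ∈ U, f z = (∏ ρ ∈ S, (z-ρ)^(m ρ)) * g z) := by
  classical
  induction S using Finset.induction_on with
  | empty =>
    intro f hf _ hz _
    refine ⟨fun _ => 0, f, hf, fun z hzK h0 => by simpa using hz z hzK h0, by simp⟩
  | insert ρ S hρS ih =>
    intro f hf hSU hz hne
    obtain ⟨n, h, hh, hh0, hfh⟩ := factor_one hU hf (hSU ρ (by simp)) (hne ρ (by simp))
    obtain ⟨m, g, hg, hg0, hhg⟩ := ih h hh (fun σ hσ => hSU σ (by simp [hσ])) (by
        intro z hzK hz0
        have h1 : f z = 0 := by rw [hfh z (hK hzK), hz0, mul_zero]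
        have h2 := hz z hzK h1
        rw [Finset.mem_insert] at h2
        rcases h2 with h2 | h2
        · subst h2; exact absurd hz0 hh0
        · exact h2) (by
        intro σ hσ hev
        apply hne σ (by simp [hσ])
        filter_upwards [hev, hU.mem_nhds (hSU σ (by simp [hσ]))] with z hz1 hz2
        rw [hfh z hz2, hz1, mul_zero])
    refine ⟨Function.update m ρ n, g, hg, hg0, ?_⟩
    intro z hzU
    rw [Finset.prod_insert hρS, hfh z hzU, hhg z hzU]
    rw [Function.update_self, mul_assoc]
    congr 2
    apply Finset.prod_congr rfl
    intro σ hσ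
    rw [Function.update_of_ne]
    rintro rfl; exact hρS hσ

lemma logDeriv_prod_pow (S : Finset ℂ) (m : ℂ → ℕ) (g : ℂ → ℂ) (a : ℂ) (hS : ∀ ρ ∈ S, m ρ ≠ 0 → ρ ≠ a)
    (hg : DifferentiableAt ℂ g a) (hg0 : g a ≠ 0) :
    logDeriv (fun z => (∏ ρ ∈ S, (z-ρ)^(m ρ)) * g z) a = ∑ ρ ∈ S, (m ρ:ℂ)/(a-ρ) + logDeriv g a := by
  have hp : ∀ ρ ∈ S, (a-ρ)^(m ρ) ≠ 0 := by
    intro ρ hρ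
    by_cases h : m ρ = 0
    · simp [h]
    · exact pow_ne_zero _ (sub_ne_zero.mpr (Ne.symm (hS ρ hρ h)))
  rw [logDeriv_mul a (Finset.prod_ne_zero_iff.mpr hp) hg0 (by fun_prop) hg]
  congr 1
  rw [logDeriv_prod (f := fun ρ z => (z-ρ)^(m ρ)) hp (fun ρ _ => by fun_prop)]
  apply Finset.sum_congr rfl
  intro ρ _
  rw [logDeriv_fun_pow (by fun_prop)]
  rw [logDeriv_apply]
  simp [div_eq_mul_inv]

/-- Jensen derivative inequality -/
lemma jd_ineq {U : Set ℂ} (hU : IsOpen U) {r : ℝ} (hr : 0 < r) (hrU : Metric.closedBall 0 r ⊆ U)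
    {f : ℂ → ℂ} (hf : DifferentiableOn ℂ f U) (hs0 : ∀ z ∈ Metric.sphere (0:ℂ) r, f z ≠ 0)
    (hneg : ∀ z ∈ Metric.closedBall (0:ℂ) r, f z = 0 → z.re < 0)
    (S : Finset ℂ) (hSb : ∀ ρ ∈ S, ρ ∈ Metric.closedBall (0:ℂ) r ∧ f ρ = 0) (hS : ∀ z ∈ Metric.closedBall (0:ℂ) r, f z = 0 → z ∈ S)
    (hne : ∀ ρ ∈ S, ¬ ∀ᶠ z in nhds ρ, f z = 0) (Q : Finset ℂ) (hQ : Q ⊆ S) :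
    -(logDeriv f 0).re ≤ -(1/(Real.pi*r)) * (∫ θ in (0:ℝ)..2*Real.pi, Real.cos θ * Real.log ‖f (circleMap 0 r θ)‖)
      + ∑ ρ ∈ Q, ρ.re*(1/‖ρ‖^2 - 1/r^2) := by
  obtain ⟨m, g, hg, hg0, hfg⟩ := factor_all hU hrU S f hf (fun ρ hρ => hrU (hSb ρ hρ).1) hS hne
  have h0m : (0:ℂ) ∈ Metric.closedBall (0:ℂ) r := by simp [hr.le]
  have hball : ∀ ρ ∈ S, ‖ρ‖ < r := by
    intro ρ hρ
    have h1 := hSb ρ hρ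
    rcases lt_or_eq_of_le (show ‖ρ‖ ≤ r by simpa using h1.1) with h | h
    · exact h
    · exact absurd h1.2 (hs0 ρ (by simpa using h))
  have hre : ∀ ρ ∈ S, ρ.re < 0 := fun ρ hρ => hneg ρ (hSb ρ hρ).1 (hSb ρ hρ).2
  have hρ0 : ∀ ρ ∈ S, ρ ≠ 0 := by
    rintro ρ hρ rfl
    have := hre 0 hρ
    simp at this
  have hm1 : ∀ ρ ∈ S, 1 ≤ m ρ := by
    intro ρ hρ
    by_contra hcon
    have hm0 : m ρ = 0 := by omega
    have h1 := hfg ρ (hrU (hSb ρ hρ).1)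
    rw [(hSb ρ hρ).2] at h1
    have h2 : ∏ σ ∈ S, (ρ-σ)^(m σ) ≠ 0 := by
      rw [Finset.prod_ne_zero_iff]
      intro σ hσ
      by_cases h : ρ = σ
      · subst h; simp [hm0]
      · exact pow_ne_zero _ (sub_ne_zero.mpr h)
    exact mul_ne_zero h2 (hg0 ρ (hSb ρ hρ).1) h1.symm
  -- log derivative
  have hL : logDeriv f 0 = ∑ ρ ∈ S, (m ρ:ℂ)/(0-ρ) + logDeriv g 0 := by
    rw [← logDeriv_prod_pow S m g 0 (fun ρ hρ _ => hρ0 ρ hρ)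
      (hg.differentiableAt (hU.mem_nhds (hrU h0m))) (hg0 0 h0m)]
    have he : f =ᶠ[nhds 0] (fun z => (∏ ρ ∈ S, (z-ρ)^(m ρ)) * g z) := by
      filter_upwards [hU.mem_nhds (hrU h0m)] with z hz
      exact hfg z hz
    rw [logDeriv_apply, logDeriv_apply, he.deriv_eq, he.self_of_nhds]
  -- integral
  have hB : ∀ ρ ∈ S, ∫ θ in (0:ℝ)..2*Real.pi, Real.cos θ * Real.log ‖circleMap 0 r θ - ρ‖ =
      Real.pi*r*(-ρ.re/r^2) := by
    intro ρ hρ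
    have hk := jd_kernel (U := Set.univ) isOpen_univ hr (Set.subset_univ _)
      (g := fun z => (r:ℂ) - (starRingEnd ℂ ρ/r) * z) (by fun_prop) (by
        intro z hz h0
        have h1 : (r:ℂ) = (starRingEnd ℂ ρ/r) * z := sub_eq_zero.mp h0
        have h2 := congrArg norm h1
        rw [norm_mul, norm_div, Complex.norm_real, RCLike.norm_conj, Real.norm_of_nonneg hr.le] at h2
        have h3 : ‖z‖ ≤ r := by simpa using hz
        have h4 := hball ρ hρ
        have : ‖ρ‖/r*‖z‖ < r := by
          calc ‖ρ‖/r*‖z‖ ≤ ‖ρ‖/r*r := by gcongr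
            _ = ‖ρ‖ := by field_simp
            _ < r := h4
        linarith)
    have hd : deriv (fun z:ℂ => (r:ℂ) - (starRingEnd ℂ ρ/r) * z) 0 = -(starRingEnd ℂ ρ/r) := by
      have : HasDerivAt (fun z:ℂ => (r:ℂ) - (starRingEnd ℂ ρ/r) * z) (-(starRingEnd ℂ ρ/r * 1)) 0 :=
        ((hasDerivAt_id (0:ℂ)).const_mul _).const_sub _
      rw [this.deriv, mul_one]
    rw [hd] at hk
    have e1 : (-(starRingEnd ℂ ρ/r) / ((r:ℂ) - starRingEnd ℂ ρ/r * 0)).re = -ρ.re/r^2 := by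
      have : (-(starRingEnd ℂ ρ/r) / ((r:ℂ) - starRingEnd ℂ ρ/r * 0)) = -(starRingEnd ℂ ρ)/((r^2:ℝ):ℂ) := by
        push_cast
        have hrc : (r:ℂ) ≠ 0 := by exact_mod_cast hr.ne'
        field_simp
        ring
      rw [this, Complex.div_ofReal_re]; simp
    rw [e1] at hk
    rw [← hk]
    apply intervalIntegral.integral_congr
    intro θ _
    dsimp only
    congr 2
    -- ‖z-ρ‖ = ‖r - conj ρ z / r‖ on circle
    have cm : circleMap 0 r θ = r * Complex.exp (θ*Complex.I) := by simp [circleMap]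
    have hu : ‖Complex.exp (θ*Complex.I)‖ = 1 := Complex.norm_exp_ofReal_mul_I θ
    set w := Complex.exp (θ*Complex.I) with hw
    have hwc : w * starRingEnd ℂ w = 1 := by
      rw [Complex.mul_conj, Complex.normSq_eq_norm_sq, hu]; simp
    have hrc : (r:ℂ) ≠ 0 := by exact_mod_cast hr.ne'
    have e2 : (r:ℂ) - starRingEnd ℂ ρ/r * (r*w) = w * starRingEnd ℂ (r*w - ρ) := by
      rw [map_sub, map_mul, Complex.conj_ofReal]
      have : starRingEnd ℂ ρ/r * (r*w) = starRingEnd ℂ ρ * w := by field_simp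
      rw [this]
      linear_combination -(r:ℂ)*hwc
    rw [cm, e2, norm_mul, hu, RCLike.norm_conj, one_mul]
  have hG := jd_kernel hU hr hrU hg hg0
  have hint1 : ∀ ρ ∈ S, IntervalIntegrable (fun θ => (m ρ:ℝ)*(Real.cos θ * Real.log ‖circleMap 0 r θ - ρ‖))
      MeasureTheory.volume 0 (2*Real.pi) := by
    intro ρ hρ
    apply Continuous.intervalIntegrable
    apply continuous_const.mul
    apply Real.continuous_cos.mul
    apply Continuous.log
    · exact ((continuous_circleMap 0 r).sub continuous_const).norm
    · intro θ h
      rw [norm_eq_zero, sub_eq_zero] at h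
      have h1 := hball ρ hρ
      rw [← h, norm_circleMap_zero, abs_of_pos hr] at h1
      exact lt_irrefl _ h1
  have hint2 : IntervalIntegrable (fun θ => Real.cos θ * Real.log ‖g (circleMap 0 r θ)‖)
      MeasureTheory.volume 0 (2*Real.pi) := by
    apply Continuous.intervalIntegrable
    apply Real.continuous_cos.mul
    have hmem : ∀ θ, circleMap 0 r θ ∈ Metric.closedBall (0:ℂ) r := fun θ =>
      Metric.sphere_subset_closedBall (circleMap_mem_sphere 0 hr.le θ)
    apply Continuous.log
    · exact ((hg.continuousOn.mono hrU).comp_continuous (continuous_circleMap 0 r) hmem).norm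
    · intro θ h
      exact hg0 _ (hmem θ) (norm_eq_zero.mp h)
  have hI : ∫ θ in (0:ℝ)..2*Real.pi, Real.cos θ * Real.log ‖f (circleMap 0 r θ)‖ =
      ∑ ρ ∈ S, (m ρ:ℝ)*(Real.pi*r*(-ρ.re/r^2)) + Real.pi*r*(logDeriv g 0).re := by
    have e : ∀ θ:ℝ, Real.cos θ * Real.log ‖f (circleMap 0 r θ)‖ =
        ∑ ρ ∈ S, (m ρ:ℝ)*(Real.cos θ * Real.log ‖circleMap 0 r θ - ρ‖)
         + Real.cos θ * Real.log ‖g (circleMap 0 r θ)‖ := by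
      intro θ
      have hmem : circleMap 0 r θ ∈ Metric.closedBall (0:ℂ) r :=
        Metric.sphere_subset_closedBall (circleMap_mem_sphere 0 hr.le θ)
      rw [hfg _ (hrU hmem), norm_mul, norm_prod, Real.log_mul, Real.log_prod, mul_add, Finset.mul_sum]
      · congr 1
        apply Finset.sum_congr rfl
        intro ρ _
        rw [norm_pow, Real.log_pow]; ring
      · intro ρ hρ h
        rw [norm_pow] at h
        have := (pow_eq_zero_iff (by have := hm1 ρ hρ; omega)).mp h
        rw [norm_eq_zero, sub_eq_zero] at this
        have h1 := hball ρ hρ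
        rw [← this, norm_circleMap_zero, abs_of_pos hr] at h1
        exact lt_irrefl _ h1
      · rw [← norm_prod]
        intro h
        rw [norm_eq_zero, Finset.prod_eq_zero_iff] at h
        obtain ⟨ρ, hρ, h⟩ := h
        have := (pow_eq_zero_iff (by have := hm1 ρ hρ; omega)).mp h
        rw [sub_eq_zero] at this
        have h1 := hball ρ hρ
        rw [← this, norm_circleMap_zero, abs_of_pos hr] at h1
        exact lt_irrefl _ h1
      · exact norm_ne_zero_iff.mpr (hg0 _ hmem)
    simp only [e]
    have hint1' : IntervalIntegrable (fun θ => ∑ ρ ∈ S, (m ρ:ℝ)*(Real.cos θ * Real.log ‖circleMap 0 r θ - ρ‖))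
        MeasureTheory.volume 0 (2*Real.pi) := by
      have := IntervalIntegrable.sum _ hint1
      refine this.congr ?_
      intro θ _
      simp
    rw [intervalIntegral.integral_add hint1' hint2,
      intervalIntegral.integral_finsetSum hint1, hG, logDeriv_apply]
    congr 1
    apply Finset.sum_congr rfl
    intro ρ hρ
    rw [intervalIntegral.integral_const_mul, hB ρ hρ]
  have hpi := Real.pi_pos
  rw [hI, hL]
  have e3 : (∑ ρ ∈ S, (m ρ:ℂ)/(0-ρ) + logDeriv g 0).re = -∑ ρ ∈ S, (m ρ:ℝ)*(ρ.re/‖ρ‖^2) + (logDeriv g 0).re := by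
    rw [Complex.add_re, Complex.re_sum, ← Finset.sum_neg_distrib]
    congr 1
    apply Finset.sum_congr rfl
    intro ρ hρ
    have : (m ρ:ℂ)/(0-ρ) = -((m ρ:ℝ):ℂ) * ρ⁻¹ := by
      have := hρ0 ρ hρ
      rw [zero_sub, div_neg, div_eq_mul_inv]; push_cast; ring
    rw [this, ← Complex.ofReal_neg, Complex.re_ofReal_mul, Complex.inv_re, Complex.normSq_eq_norm_sq]
    ring
  rw [e3]
  have e4 : -(1/(Real.pi*r)) * (∑ ρ ∈ S, (m ρ:ℝ)*(Real.pi*r*(-ρ.re/r^2)) + Real.pi*r*(logDeriv g 0).re)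
      = ∑ ρ ∈ S, (m ρ:ℝ)*(ρ.re/r^2) - (logDeriv g 0).re := by
    rw [mul_add, Finset.mul_sum, sub_eq_add_neg]
    congr 1
    · apply Finset.sum_congr rfl
      intro ρ _
      field_simp
    · field_simp
  rw [e4]
  have e5 : ∑ ρ ∈ S, (m ρ:ℝ)*(ρ.re*(1/‖ρ‖^2-1/r^2)) ≤ ∑ ρ ∈ Q, ρ.re*(1/‖ρ‖^2 - 1/r^2) := by
    have hterm : ∀ ρ ∈ S, ρ.re*(1/‖ρ‖^2-1/r^2) ≤ 0 := by
      intro ρ hρ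
      apply mul_nonpos_of_nonpos_of_nonneg (hre ρ hρ).le
      rw [sub_nonneg]
      apply one_div_le_one_div_of_le
      · have := norm_pos_iff.mpr (hρ0 ρ hρ); positivity
      · have := (hball ρ hρ).le; gcongr
    calc ∑ ρ ∈ S, (m ρ:ℝ)*(ρ.re*(1/‖ρ‖^2-1/r^2)) ≤ ∑ ρ ∈ S, (ρ.re*(1/‖ρ‖^2-1/r^2)) := by
          apply Finset.sum_le_sum
          intro ρ hρ
          have h1 : (1:ℝ) ≤ m ρ := by exact_mod_cast hm1 ρ hρ
          nlinarith [hterm ρ hρ]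
      _ ≤ _ := by
          rw [← Finset.sum_sdiff hQ]
          have : ∑ ρ ∈ S \ Q, (ρ.re*(1/‖ρ‖^2-1/r^2)) ≤ 0 :=
            Finset.sum_nonpos (fun ρ hρ => hterm ρ (Finset.mem_sdiff.mp hρ).1)
          linarith
  have e6 : ∑ ρ ∈ S, (m ρ:ℝ)*(ρ.re*(1/‖ρ‖^2-1/r^2)) = ∑ ρ ∈ S, (m ρ:ℝ)*(ρ.re/‖ρ‖^2) - ∑ ρ ∈ S, (m ρ:ℝ)*(ρ.re/r^2) := by
    rw [← Finset.sum_sub_distrib]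
    apply Finset.sum_congr rfl
    intro ρ _; ring
  linarith

-- Part E3
lemma rpow_le_E {L y σ : ℝ} (hy1 : 1 ≤ y) (hyL : y ≤ Real.exp L) :
    y^(1-σ) ≤ Real.exp (L*max 0 (1-σ)) := by
  have hL : 0 ≤ L := by
    by_contra h
    have : Real.exp L < 1 := (by rw [← Real.exp_zero]; exact Real.exp_lt_exp.mpr (by linarith))
    linarith
  rcases le_total (1-σ) 0 with h | h
  · calc y^(1-σ) ≤ 1 := Real.rpow_le_one_of_one_le_of_nonpos hy1 h
      _ ≤ _ := Real.one_le_exp (by positivity)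
  · rw [max_eq_right h]
    calc y^(1-σ) ≤ (Real.exp L)^(1-σ) := Real.rpow_le_rpow (by linarith) hyL h
      _ = _ := by rw [← Real.exp_mul]

lemma zeta_upper {L : ℝ} (hL : 5 ≤ L) {s : ℂ} (hσ0 : 0 ≤ s.re) (hσ1 : s.re ≤ 11/5)
    (ht0 : 3/5 ≤ |s.im|) (ht1 : |s.im| ≤ Real.exp L) :
    ‖riemannZeta s‖ ≤ (L+3)*Real.exp (L*max 0 (1-s.re)) := by
  set E := Real.exp (L*max 0 (1-s.re)) with hE
  have hE0 : 0 < E := Real.exp_pos _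
  have hs1 : s ≠ 1 := by rintro rfl; norm_num at ht0
  have h148 : (100:ℝ) ≤ Real.exp L := by
    calc (100:ℝ) ≤ (2.7182818283:ℝ)^5 := by norm_num
      _ ≤ (Real.exp 1)^5 := by gcongr; exact Real.exp_one_gt_d9.le
      _ = Real.exp 5 := by rw [← Real.exp_nat_mul]; norm_num
      _ ≤ _ := Real.exp_le_exp.mpr hL
  set N := ⌊Real.exp L⌋₊ with hN
  have hNle : (N:ℝ) ≤ Real.exp L := Nat.floor_le (Real.exp_pos L).le
  have hNgt : Real.exp L - 1 < N := by have := Nat.lt_floor_add_one (Real.exp L); rw [← hN] at this; linarith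
  have hN99 : (99:ℝ) < N := by linarith
  have hN1 : 1 ≤ N := by
    have : (0:ℝ) < N := by linarith
    exact_mod_cast this
  have hN0 : (0:ℝ) < N := by linarith
  have hz : riemannZeta s = (∑ n ∈ Finset.Ico 1 N, (n:ℂ)^(-s) + (N:ℂ)^(-s)/2) + (N:ℂ)^(1-s)/(s-1) + emR N s := by
    unfold emR; ring
  have hpow : ∀ n:ℕ, 1 ≤ n → n ≤ N → ‖(n:ℂ)^(-s)‖ ≤ E * (n:ℝ)⁻¹ := by
    intro n h1 h2
    rw [Complex.norm_natCast_cpow_of_pos (by omega), Complex.neg_re]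
    have hn0 : (0:ℝ) < n := by exact_mod_cast h1
    have : (n:ℝ)^(-s.re) = (n:ℝ)^(1-s.re) * (n:ℝ)⁻¹ := by
      rw [← Real.rpow_neg_one, ← Real.rpow_add hn0]; ring_nf
    rw [this]
    gcongr
    exact rpow_le_E (by exact_mod_cast h1) (le_trans (by exact_mod_cast h2) hNle)
  have b1 : ‖∑ n ∈ Finset.Ico 1 N, (n:ℂ)^(-s) + (N:ℂ)^(-s)/2‖ ≤ E*(L+1) := by
    have h1 : ‖∑ n ∈ Finset.Ico 1 N, (n:ℂ)^(-s)‖ ≤ ∑ n ∈ Finset.Ico 1 N, E*(n:ℝ)⁻¹ :=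
      norm_sum_le_of_le _ (fun n hn => by
        rw [Finset.mem_Ico] at hn; exact hpow n hn.1 hn.2.le)
    have h2 : ‖(N:ℂ)^(-s)/2‖ ≤ E*(N:ℝ)⁻¹ := by
      rw [norm_div]
      have := hpow N hN1 le_rfl
      simp only [Complex.norm_ofNat]
      linarith [norm_nonneg ((N:ℂ)^(-s))]
    have h3 : ∑ n ∈ Finset.Ico 1 N, E*(n:ℝ)⁻¹ + E*(N:ℝ)⁻¹ = E * (harmonic N : ℝ) := by
      rw [← Finset.sum_Ico_succ_top hN1 (fun n:ℕ => E*(n:ℝ)⁻¹), ← Finset.mul_sum]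
      congr 1
      rw [harmonic_eq_sum_Icc]
      push_cast
      rfl
    have h4 := harmonic_le_one_add_log N
    have h5 : Real.log N ≤ L := by
      rw [← Real.log_exp L]; exact Real.log_le_log hN0 hNle
    calc _ ≤ _ := norm_add_le _ _
      _ ≤ _ := add_le_add h1 h2
      _ = E * (harmonic N : ℝ) := h3
      _ ≤ _ := by gcongr; linarith
  have hNpow : ∀ a:ℝ, a = 1 - s.re → (N:ℝ)^a ≤ E := by
    rintro a rfl; exact rpow_le_E (by linarith) hNle
  have b2 : ‖(N:ℂ)^(1-s)/(s-1)‖ ≤ E*(5/3) := by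
    rw [norm_div, Complex.norm_natCast_cpow_of_pos (by omega)]
    have h1 : 3/5 ≤ ‖s-1‖ := by
      refine ht0.trans ?_
      have := Complex.abs_im_le_norm (s-1)
      simpa using this
    have h2 := hNpow ((1-s).re) (by simp)
    calc _ ≤ E/(3/5) := by gcongr
      _ = _ := by ring
  have b3 : ‖emR N s‖ ≤ E*(3/20) := by
    refine (emR_bound hN1 hs1 (by linarith)).trans ?_
    have hn1 : ‖s‖ ≤ N + 16/5 := by
      refine (Complex.norm_le_abs_re_add_abs_im s).trans ?_
      rw [abs_of_nonneg hσ0]; linarith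
    have hn2 : ‖s+1‖ ≤ N + 21/5 := by
      refine (norm_add_le _ _).trans ?_
      rw [norm_one]; linarith
    have e1 : (N:ℝ)^(-s.re-1) = (N:ℝ)^(1-s.re) * ((N:ℝ)^2)⁻¹ := by
      rw [← Real.rpow_natCast, ← Real.rpow_neg hN0.le, ← Real.rpow_add hN0]; norm_num; ring_nf
    rw [e1]
    have h2 := hNpow _ rfl
    calc ‖s‖*‖s+1‖/(8*(s.re+1)) * ((N:ℝ)^(1-s.re) * ((N:ℝ)^2)⁻¹) ≤ (N+16/5)*(N+21/5)/(8*(0+1)) * (E*((N:ℝ)^2)⁻¹) := by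
          gcongr
      _ = E*((N+16/5)*(N+21/5)/(8*(N:ℝ)^2)) := by field_simp; ring
      _ ≤ E*(3/20) := by
          apply mul_le_mul_of_nonneg_left _ hE0.le
          rw [div_le_iff₀ (by positivity)]
          nlinarith
  rw [hz]
  calc _ ≤ _ := norm_add₃_le
    _ ≤ E*(L+1) + E*(5/3) + E*(3/20) := by gcongr
    _ ≤ (L+3)*E := by nlinarith

-- Part E3b
lemma zeta_real_le {x : ℝ} (h0 : 0 < x) (h1 : x ≤ 3) : (riemannZeta ((1+x:ℝ):ℂ)).re ≤ 1 + 1/x := by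
  have hs1 : ((1+x:ℝ):ℂ) ≠ 1 := by
    intro h
    have : (1+x:ℝ) = 1 := by exact_mod_cast h
    linarith
  have hb := emR_bound (N := 1) le_rfl hs1 (by simp; linarith)
  have hb2 : ‖emR 1 ((1+x:ℝ):ℂ)‖ ≤ (1+x)/8 := by
    refine hb.trans ?_
    have : ((1+x:ℝ):ℂ)+1 = ((2+x:ℝ):ℂ) := by push_cast; ring
    rw [this, Complex.norm_real, Complex.norm_real, Real.norm_of_nonneg (by linarith), Real.norm_of_nonneg (by linarith)]
    simp only [Nat.cast_one, Real.one_rpow, mul_one, Complex.ofReal_re]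
    apply le_of_eq
    have : (2+x) ≠ 0 := by linarith
    have h2 : (1+x+1) ≠ 0 := by linarith
    field_simp
    ring
  have he : riemannZeta ((1+x:ℝ):ℂ) = emR 1 ((1+x:ℝ):ℂ) + ((1/2+1/x:ℝ):ℂ) := by
    unfold emR
    have hx : (x:ℂ) ≠ 0 := by exact_mod_cast h0.ne'
    simp only [Finset.Ico_self, Finset.sum_empty, Nat.cast_one, Complex.one_cpow]
    push_cast
    have : (1:ℂ)+x-1 = x := by ring
    rw [this]; ring
  rw [he, Complex.add_re, Complex.ofReal_re]
  have := (Complex.re_le_norm _).trans hb2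
  linarith

lemma inv_zeta_eq {s : ℂ} (hs : 1 < s.re) : (riemannZeta s)⁻¹ = LSeries (fun n => ((moebius n:ℤ):ℂ)) s := by
  have h := LSeries_zeta_mul_Lseries_moebius hs
  rw [LSeries_zeta_eq_riemannZeta hs] at h
  exact DivisionMonoid.inv_eq_of_mul _ _ h

lemma norm_inv_zeta_le {s : ℂ} (hs : 1 < s.re) (hs3 : s.re ≤ 4) :
    ‖(riemannZeta s)⁻¹‖ ≤ 1 + 1/(s.re-1) := by
  refine le_trans ?_ (zeta_real_le (x := s.re-1) (by linarith) (by linarith))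
  rw [inv_zeta_eq hs, LSeries]
  have hsum : Summable (fun n:ℕ => 1/((n:ℂ))^((1+(s.re-1):ℝ):ℂ)) :=
    Complex.summable_one_div_nat_cpow.mpr (by simp; linarith)
  have h2 := Complex.hasSum_re hsum.hasSum
  rw [← zeta_eq_tsum_one_div_nat_cpow (by simp; linarith)] at h2
  rw [← h2.tsum_eq]
  have hsm : Summable (fun n => ‖LSeries.term (fun n => ((moebius n:ℤ):ℂ)) s n‖) :=
    (LSeriesSummable_moebius_iff.mpr hs).norm
  refine (norm_tsum_le_tsum_norm hsm).trans ?_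
  apply hsm.tsum_le_tsum _ h2.summable
  intro n
  rcases Nat.eq_zero_or_pos n with rfl | hn
  · simp
    rw [Complex.zero_cpow]
    · simp
    · intro h
      have := congrArg Complex.re h
      simp at this; linarith
  · rw [LSeries.norm_term_eq, if_neg (by omega)]
    have e : (1/((n:ℂ))^((1+(s.re-1):ℝ):ℂ)).re = 1/(n:ℝ)^s.re := by
      rw [show (1+(s.re-1):ℝ) = s.re by ring]
      rw [← Complex.ofReal_natCast, ← Complex.ofReal_cpow (by positivity)]
      rw [← Complex.ofReal_one, ← Complex.ofReal_div, Complex.ofReal_re]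
    rw [e]
    gcongr
    rw [Complex.norm_intCast]
    exact_mod_cast abs_moebius_le_one

lemma vm_hasSum {σ : ℝ} (hσ : 1 < σ) (t : ℝ) :
    HasSum (fun n:ℕ => vonMangoldt n * (n:ℝ)^(-σ) * Real.cos (t*Real.log n))
      (-(logDeriv riemannZeta (σ+t*Complex.I)).re) := by
  have hs : 1 < ((σ:ℂ)+t*Complex.I).re := by simpa using hσ
  have h1 : HasSum _ _ := (LSeriesSummable_vonMangoldt hs).hasSum
  rw [← LSeries, LSeries_vonMangoldt_eq_deriv_riemannZeta_div hs] at h1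
  have h2 := Complex.hasSum_re h1
  have e : (-deriv riemannZeta ((σ:ℂ)+t*Complex.I) / riemannZeta ((σ:ℂ)+t*Complex.I)).re
     = -(logDeriv riemannZeta (σ+t*Complex.I)).re := by
    rw [logDeriv_apply, neg_div, Complex.neg_re]
  rw [e] at h2
  refine h2.congr_fun ?_ |> fun h => h
  intro n
  rcases Nat.eq_zero_or_pos n with rfl | hn
  · simp
  · have hn0 : (0:ℝ) < n := by exact_mod_cast hn
    rw [LSeries.term_of_ne_zero (by omega), div_eq_mul_inv, ← Complex.cpow_neg]
    have e2 : ((n:ℂ))^(-((σ:ℂ)+t*Complex.I)) = (((n:ℝ)^(-σ):ℝ):ℂ) * Complex.exp ((-(t*Real.log n):ℝ)*Complex.I) := by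
      rw [Complex.cpow_def_of_ne_zero (by exact_mod_cast hn.ne'), Real.rpow_def_of_pos hn0]
      push_cast
      rw [← Complex.exp_add]
      congr 1; ring
    rw [e2, Complex.re_ofReal_mul, Complex.re_ofReal_mul, Complex.exp_ofReal_mul_I_re, Real.cos_neg]
    ring

lemma vm_real_le {x : ℝ} (h0 : 0 < x) (h1 : x ≤ 1/10) :
    -(logDeriv riemannZeta ((1+x:ℝ):ℂ)).re ≤ 1/x := by
  set c : ℂ := ((1+x:ℝ):ℂ) with hc
  set f : ℂ → ℂ := fun s => riemannZeta₁ s - (s-1)/2 - 1 with hf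
  have hc1 : c ≠ 1 := by
    intro h
    rw [hc] at h
    have : (1+x:ℝ) = 1 := by exact_mod_cast h
    linarith
  have hfd : Differentiable ℂ f :=
    (differentiable_riemannZeta₁.sub ((differentiable_id.sub_const 1).div_const 2)).sub_const 1
  have hbd : ∀ z:ℂ, ‖z - c‖ ≤ 1/2 → ‖f z‖ ≤ 1/4 := by
    intro z hz
    by_cases h1z : z = 1
    · subst h1z
      simp only [hf, riemannZeta₁_one]
      norm_num
    have hre : |(z-c).re| ≤ 1/2 := (Complex.abs_re_le_norm _).trans hz
    have hcre : c.re = 1+x := by simp [hc]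
    rw [Complex.sub_re, hcre, abs_le] at hre
    have e : f z = (z-1)*emR 1 z := by rw [emR_one h1z]
    rw [e, norm_mul]
    have hb := emR_bound (N := 1) le_rfl h1z (by linarith)
    simp only [Nat.cast_one, Real.one_rpow, mul_one] at hb
    have n1 : ‖z-1‖ ≤ 3/5 := by
      have : z-1 = (z-c)+(x:ℂ) := by rw [hc]; push_cast; ring
      rw [this]
      refine (norm_add_le _ _).trans ?_
      rw [Complex.norm_real, Real.norm_of_nonneg h0.le]; linarith
    have n2 : ‖z‖ ≤ 8/5 := by
      have : z = (z-1)+1 := by ring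
      rw [this]
      refine (norm_add_le _ _).trans ?_
      rw [norm_one]; linarith
    have n3 : ‖z+1‖ ≤ 13/5 := (norm_add_le _ _).trans (by rw [norm_one]; linarith)
    have n4 : ‖emR 1 z‖ ≤ (8/5)*(13/5)/(8*(3/2)) := by
      refine hb.trans ?_
      gcongr
      linarith
    calc ‖z-1‖*‖emR 1 z‖ ≤ (3/5)*((8/5)*(13/5)/(8*(3/2))) := by gcongr
      _ ≤ _ := by norm_num
  have hder : ‖deriv f c‖ ≤ (1/4)/(1/2) :=
    Complex.norm_deriv_le_of_forall_mem_sphere_norm_le (by norm_num) hfd.diffContOnCl (fun z hz => by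
      apply hbd
      rw [mem_sphere_iff_norm] at hz
      exact hz.le)
  have hz1 : deriv riemannZeta₁ c = deriv f c + 1/2 := by
    have : riemannZeta₁ = fun s => f s + ((s-1)/2 + 1) := by
      funext s; simp only [hf]; ring
    conv_lhs => rw [this]
    have h2 : HasDerivAt (fun s:ℂ => (s-1)/2+1) (1/2) c :=
      (((hasDerivAt_id c).sub_const 1).div_const 2).add_const 1
    have := (hfd c).hasDerivAt.add h2
    exact this.deriv
  have hz0 : riemannZeta₁ c = f c + ((c-1)/2+1) := by simp only [hf]; ring
  -- logDeriv
  have hxc : c - 1 = (x:ℂ) := by rw [hc]; push_cast; ring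
  have hcre : 1 < c.re := by simp [hc, h0]
  have hzne : riemannZeta c ≠ 0 := riemannZeta_ne_zero_of_one_lt_re hcre
  have hx0 : (x:ℂ) ≠ 0 := by exact_mod_cast h0.ne'
  have heq : riemannZeta₁ c = x * riemannZeta c := by
    rw [riemannZeta_eq_inv_sub_mul hc1, hxc]; field_simp
  have h1ne : riemannZeta₁ c ≠ 0 := by rw [heq]; exact mul_ne_zero hx0 hzne
  have hev : riemannZeta₁ =ᶠ[nhds c] (fun s => (s-1)*riemannZeta s) := by
    filter_upwards [isOpen_ne.mem_nhds hc1] with s hs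
    rw [riemannZeta_eq_inv_sub_mul hs]
    have : s-1 ≠ 0 := sub_ne_zero.mpr hs
    field_simp
  have hld : logDeriv riemannZeta₁ c = 1/(x:ℂ) + logDeriv riemannZeta c := by
    have : logDeriv (fun s => (s-1)*riemannZeta s) c = 1/(x:ℂ) + logDeriv riemannZeta c := by
      rw [logDeriv_mul c (by rw [hxc]; exact hx0) hzne (by fun_prop) (differentiableAt_riemannZeta hc1)]
      congr 1
      rw [logDeriv_apply, hxc]
      simp
    rw [← this, logDeriv_apply, logDeriv_apply, hev.deriv_eq, hev.self_of_nhds]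
  have hpos : 0 ≤ (logDeriv riemannZeta₁ c).re := by
    rw [logDeriv_apply]
    -- riemannZeta₁ c is near 1+x/2, derivative near 1/2
    have k1 : ‖f c‖ ≤ 1/4 := hbd c (by simp)
    set a := deriv f c
    set b := f c
    have hnum : (riemannZeta₁ c) = b + ((x/2+1:ℝ):ℂ) := by rw [hz0, hxc]; push_cast; ring
    have hbim : b.im = 0 := by
      have himz : (riemannZeta₁ c).im = 0 := by
        rw [heq]
        have : (riemannZeta c).im = 0 := by
          rw [← Complex.conj_eq_iff_im, ← riemannZeta_conj, hc, Complex.conj_ofReal]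
        rw [Complex.im_ofReal_mul, this, mul_zero]
      have := congrArg Complex.im hnum
      rw [himz, Complex.add_im, Complex.ofReal_im] at this
      linarith
    have hbre := abs_le.mp ((Complex.abs_re_le_norm b).trans k1)
    have hare := abs_le.mp ((Complex.abs_re_le_norm a).trans hder)
    have hreal : riemannZeta₁ c = ((b.re + (x/2+1):ℝ):ℂ) := by
      rw [hnum]
      apply Complex.ext <;> simp [hbim]
    rw [hreal, Complex.div_ofReal_re, hz1, Complex.add_re]
    apply div_nonneg
    · norm_num; linarith
    · linarith
  rw [hld, Complex.add_re] at hpos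
  have : (1/(x:ℂ)).re = 1/x := by rw [← Complex.ofReal_one, ← Complex.ofReal_div, Complex.ofReal_re]
  rw [this] at hpos
  linarith

lemma vm_abs_le {x : ℝ} (h0 : 0 < x) (h1 : x ≤ 1/10) (t : ℝ) :
    |(logDeriv riemannZeta ((1+x:ℝ)+t*Complex.I)).re| ≤ 1/x := by
  have a := vm_hasSum (σ := 1+x) (by linarith) t
  have b := vm_hasSum (σ := 1+x) (by linarith) 0
  have hb := vm_real_le h0 h1
  simp only [zero_mul, Real.cos_zero, mul_one, Complex.ofReal_zero, add_zero] at b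
  have hn : ∀ n:ℕ, 0 ≤ vonMangoldt n * (n:ℝ)^(-(1+x)) := fun n =>
    mul_nonneg vonMangoldt_nonneg (Real.rpow_nonneg (Nat.cast_nonneg n) _)
  rw [abs_le]
  constructor
  · have := hasSum_le (fun n => mul_le_of_le_one_right (hn n) (Real.cos_le_one _)) a b
    linarith
  · have := hasSum_le (fun n => by
      have := mul_le_mul_of_nonneg_left (Real.neg_one_le_cos (t*Real.log n)) (hn n)
      simp only [mul_neg, mul_one] at this
      exact this) b.neg a
    linarith

lemma trig_ineq {x : ℝ} (h0 : 0 < x) (h1 : x ≤ 1/10) (t : ℝ) :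
    0 ≤ 5*(1/x) + 8*(-(logDeriv riemannZeta ((1+x:ℝ)+t*Complex.I)).re)
      + 4*(-(logDeriv riemannZeta ((1+x:ℝ)+(2*t:ℝ)*Complex.I)).re)
      + (-(logDeriv riemannZeta ((1+x:ℝ)+(3*t:ℝ)*Complex.I)).re) := by
  have a0 := vm_hasSum (σ := 1+x) (by linarith) 0
  have a1 := vm_hasSum (σ := 1+x) (by linarith) t
  have a2 := vm_hasSum (σ := 1+x) (by linarith) (2*t)
  have a3 := vm_hasSum (σ := 1+x) (by linarith) (3*t)
  have hb := vm_real_le h0 h1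
  simp only [zero_mul, Real.cos_zero, mul_one, Complex.ofReal_zero, add_zero] at a0
  have := (((a0.mul_left 5).add (a1.mul_left 8)).add (a2.mul_left 4)).add a3
  have h := this.nonneg (fun n => by
    have hn : 0 ≤ vonMangoldt n * (n:ℝ)^(-(1+x)) :=
      mul_nonneg vonMangoldt_nonneg (Real.rpow_nonneg (Nat.cast_nonneg n) _)
    have e2 : Real.cos (2*t*Real.log n) = 2*Real.cos (t*Real.log n)^2-1 := by
      rw [← Real.cos_two_mul]; ring_nf
    have e3 : Real.cos (3*t*Real.log n) = 4*Real.cos (t*Real.log n)^3-3*Real.cos (t*Real.log n) := by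
      rw [← Real.cos_three_mul]; ring_nf
    have hc := Real.neg_one_le_cos (t*Real.log n)
    simp only [e2, e3]
    set u := Real.cos (t*Real.log n)
    have : 0 ≤ (vonMangoldt n * (n:ℝ)^(-(1+x))) * ((1+u)*(1+2*u)^2) := by
      apply mul_nonneg hn; apply mul_nonneg (by linarith); positivity
    refine this.trans (le_of_eq ?_)
    ring)
  linarith

-- Part E2b
lemma log_aux {u : ℝ} (h0 : 0 < u) (h1 : u ≤ 19/20) : u * Real.log (1+2/u) ≤ 109/100 := by
  have he := Real.exp_one_gt_d9
  have hl : Real.log (31/10) ≤ 1141/1000 := by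
    have h : Real.log ((31/10)/Real.exp 1) ≤ (31/10)/Real.exp 1 - 1 := Real.log_le_sub_one_of_pos (by positivity)
    rw [Real.log_div (by norm_num) (by positivity), Real.log_exp] at h
    have : (31/10)/Real.exp 1 ≤ 1141/1000 := by
      rw [div_le_iff₀ (by positivity)]; linarith
    linarith
  have h2 : Real.log ((1+2/u)/(31/10)) ≤ (1+2/u)/(31/10) - 1 := Real.log_le_sub_one_of_pos (by positivity)
  rw [Real.log_div (by positivity) (by norm_num)] at h2
  have h3 : u*Real.log (1+2/u) ≤ u*((1+2/u)/(31/10) - 1 + 1141/1000) := by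
    apply mul_le_mul_of_nonneg_left _ h0.le; linarith
  have h4 : u*((1+2/u)/(31/10) - 1 + 1141/1000) = 20/31 + u*(10/31+141/1000) := by
    field_simp; ring
  rw [h4] at h3
  linarith

lemma log_L3 {L : ℝ} (hL : 20 ≤ L) : Real.log (L+3) ≤ (L+3)/(2008/100) + 2 := by
  have he := Real.exp_one_gt_d9
  have h3 : 2008/100 ≤ Real.exp 3 := by
    have : Real.exp 3 = Real.exp 1 ^ 3 := by rw [← Real.exp_nat_mul]; norm_num
    rw [this]
    calc (2008/100:ℝ) ≤ 2.7182^3 := by norm_num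
      _ ≤ _ := by gcongr; linarith
  have h : Real.log ((L+3)/Real.exp 3) ≤ (L+3)/Real.exp 3 - 1 := Real.log_le_sub_one_of_pos (by positivity)
  rw [Real.log_div (by linarith) (by positivity), Real.log_exp] at h
  have : (L+3)/Real.exp 3 ≤ (L+3)/(2008/100) := by gcongr
  linarith

/-- Choose a radius avoiding finitely many points. -/
lemma exists_radius (c : ℂ) : ∃ r : ℝ, 9/10 < r ∧ r < 19/20 ∧ ∀ z, ‖z‖ = r → riemannZeta (c+z) ≠ 0 := by
  have hfin := (isCompact_closedBall c 1).inter_riemannZetaZeros_finite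
  have h2 : ((fun z => ‖z - c‖) '' (Metric.closedBall c 1 ∩ riemannZetaZeros)).Finite := hfin.image _
  have hinf : (Set.Ioo (9/10:ℝ) (19/20)).Infinite := Set.Ioo_infinite (by norm_num)
  obtain ⟨r, hr, hr2⟩ := hinf.exists_notMem_finite h2
  refine ⟨r, hr.1, hr.2, fun z hz h0 => hr2 ⟨c+z, ⟨?_, h0⟩, by simpa using hz⟩⟩
  simp [hz]; linarith [hr.2]

lemma zeta_not_ev_zero (ρ : ℂ) : ¬ ∀ᶠ z in nhds ρ, riemannZeta z = 0 := by
  intro h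
  have hfin := (isCompact_closedBall ρ 1).inter_riemannZetaZeros_finite
  have h2 : Metric.closedBall ρ 1 ∩ riemannZetaZeros ∈ nhds ρ :=
    Filter.inter_mem (Metric.closedBall_mem_nhds ρ one_pos) h
  exact infinite_of_mem_nhds ρ h2 hfin

set_option maxHeartbeats 1000000 in
/-- Jensen-derivative bound for zeta. -/
lemma jd_zeta {L η M : ℝ} (hL : 20 ≤ L) (hη0 : 0 ≤ η) (hηL : η*L ≤ 1/40) (hM : 2*η*M ≤ 109/100) {c : ℂ}
    (hc0 : 1-η ≤ c.re) (hc1 : c.re ≤ 2) (ht0 : 8/5 ≤ |c.im|) (ht1 : |c.im|+1 ≤ Real.exp L)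
    (hz : ∀ s:ℂ, |s.im-c.im| ≤ 1 → c.re ≤ s.re → riemannZeta s ≠ 0)
    (hMb : ∀ s:ℂ, |s.im-c.im| ≤ 1 → c.re ≤ s.re → s.re ≤ c.re+2*η → -Real.log ‖riemannZeta s‖ ≤ M)
    (Q : Finset ℂ) (hQ : ∀ ρ ∈ Q, riemannZeta ρ = 0 ∧ ‖ρ-c‖ ≤ 9/10) :
    -(logDeriv riemannZeta c).re ≤ 69/100*L - ∑ ρ ∈ Q, (c-ρ).re*(1/‖c-ρ‖^2 - 124/100) := by
  obtain ⟨r, hr1, hr2, hrz⟩ := exists_radius c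
  have hη1 : η ≤ 1/800 := by nlinarith
  have hr0 : 0 < r := by linarith
  set f : ℂ → ℂ := fun z => riemannZeta (c+z) with hf
  have him : ∀ z:ℂ, ‖z‖ < 1 → |(c+z).im - c.im| ≤ 1 := fun z hz => by
    simp only [Complex.add_im, add_sub_cancel_left]
    exact (Complex.abs_im_le_norm z).trans hz.le
  have hne1 : ∀ z:ℂ, ‖z‖ < 1 → c+z ≠ 1 := fun z hz h => by
    have h1 := him z hz
    rw [h] at h1
    simp at h1; linarith
  have hfd : DifferentiableOn ℂ f (Metric.ball 0 1) := by
    intro z hz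
    have : DifferentiableAt ℂ riemannZeta (c+z) := differentiableAt_riemannZeta (hne1 z (by simpa using hz))
    exact (this.comp z (by fun_prop : DifferentiableAt ℂ (fun z => c+z) z)).differentiableWithinAt
  have hfin : (Metric.closedBall (0:ℂ) r ∩ {z | f z = 0}).Finite := by
    have h := (isCompact_closedBall c r).inter_riemannZetaZeros_finite
    refine (h.image (fun z => z - c)).subset ?_
    rintro z ⟨h1, h2⟩
    exact ⟨c+z, ⟨by simpa using h1, h2⟩, by simp⟩
  classical
  set S := hfin.toFinset with hSdef
  have hne : ∀ ρ ∈ S, ¬ ∀ᶠ z in nhds ρ, f z = 0 := by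
    intro ρ _ h
    apply zeta_not_ev_zero (c+ρ)
    have ht : Tendsto (fun z => z - c) (nhds (c+ρ)) (nhds ρ) := by
      have : Continuous (fun z:ℂ => z - c) := by fun_prop
      have := this.tendsto (c+ρ)
      simpa using this
    filter_upwards [ht.eventually h] with z hz
    simpa [hf] using hz
  have key := jd_ineq (f := f) Metric.isOpen_ball hr0 (Metric.closedBall_subset_ball (by linarith)) hfd
    (fun z hz => hrz z (by simpa using hz))
    (fun z hzm h0 => by
      by_contra hre
      push Not at hre
      have hz' : ‖z‖ < 1 := lt_of_le_of_lt (by simpa using hzm) (by linarith : r < 1)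
      exact hz (c+z) (him z hz') (by rw [Complex.add_re]; linarith) h0
      ) S (fun ρ hρ => by simpa [hSdef] using hρ) (fun z hz h0 => by simp [hSdef, h0]; simpa using hz) hne
      (Q.image (fun ρ => ρ - c)) (by
        intro ρ hρ
        rw [Finset.mem_image] at hρ
        obtain ⟨w, hw, rfl⟩ := hρ
        have := hQ w hw
        simp [hSdef, hf, this.1]
        linarith [this.2])
  have hld : logDeriv f 0 = logDeriv riemannZeta c := by
    rw [logDeriv_apply, logDeriv_apply]
    simp only [hf, add_zero]
    rw [deriv_comp_const_add, add_zero]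
  rw [hld, Finset.sum_image (by intro a _ b _ h; simpa using h)] at key
  have hsumle : ∑ x ∈ Q, (x-c).re*(1/‖x-c‖^2 - 1/r^2) ≤ -∑ ρ ∈ Q, (c-ρ).re*(1/‖c-ρ‖^2 - 124/100) := by
    rw [← Finset.sum_neg_distrib]
    apply Finset.sum_le_sum
    intro ρ hρ
    have h1 := hQ ρ hρ
    rw [norm_sub_rev c ρ]
    have hre : 0 < (c-ρ).re := by
      by_contra h
      push Not at h
      refine hz ρ ?_ ?_ h1.1
      · have := (Complex.abs_im_le_norm (ρ-c)).trans h1.2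
        rw [Complex.sub_im] at this; linarith
      · rw [Complex.sub_re] at h; linarith
    have e : (ρ-c).re = -(c-ρ).re := by simp
    rw [e, neg_mul, neg_le_neg_iff]
    apply mul_le_mul_of_nonneg_left _ hre.le
    have : 1/r^2 ≤ 124/100 := by
      rw [div_le_div_iff₀ (by positivity) (by norm_num)]; nlinarith
    linarith
  -- integral
  set g : ℝ → ℝ := fun θ => Real.cos θ * Real.log ‖f (circleMap 0 r θ)‖ with hg
  have hcm : ∀ θ, ‖circleMap 0 r θ‖ = r := fun θ => by simp [abs_of_pos hr0]
  have hgc : Continuous g := by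
    apply Real.continuous_cos.mul
    rw [continuous_iff_continuousAt]
    intro θ
    have h1 : ContinuousAt f (circleMap 0 r θ) :=
      (hfd.differentiableAt (Metric.isOpen_ball.mem_nhds (by simp [hcm, abs_of_pos hr0]; linarith))).continuousAt
    have h2 : ContinuousAt (fun θ => f (circleMap 0 r θ)) θ :=
      ContinuousAt.comp (f := circleMap 0 r) h1 (continuous_circleMap 0 r).continuousAt
    exact h2.norm.log (by rw [norm_ne_zero_iff]; exact hrz _ (hcm θ))
  have hper : Function.Periodic g (2*Real.pi) := by
    intro θ
    simp only [hg, Real.cos_add_two_pi, periodic_circleMap 0 r θ]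
  have hsplit : ∫ θ in (0:ℝ)..2*Real.pi, g θ = (∫ θ in (-(Real.pi/2))..(Real.pi/2), g θ) + ∫ θ in (Real.pi/2)..(3*Real.pi/2), g θ := by
    rw [intervalIntegral.integral_add_adjacent_intervals (hgc.intervalIntegrable _ _) (hgc.intervalIntegrable _ _)]
    have := hper.intervalIntegral_add_eq 0 (-(Real.pi/2))
    rw [zero_add] at this
    rw [this]
    congr 1; ring
  have hre : ∀ θ, (circleMap 0 r θ).re = r*Real.cos θ := fun θ => by
    simp [circleMap, Complex.exp_ofReal_mul_I_re]
  have hpi := Real.pi_pos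
  have hright : -(109/100/r*Real.pi) ≤ ∫ θ in (-(Real.pi/2))..(Real.pi/2), g θ := by
    have : ∫ θ in (-(Real.pi/2))..(Real.pi/2), (-(109/100/r)) = -(109/100/r*Real.pi) := by
      rw [intervalIntegral.integral_const]; simp; ring
    rw [← this]
    apply intervalIntegral.integral_mono_on (by linarith) (by simp) (hgc.intervalIntegrable _ _)
    intro θ hθ
    have hcos := Real.cos_nonneg_of_mem_Icc hθ
    rcases hcos.eq_or_lt with h | hcpos
    · simp only [hg, ← h, zero_mul]
      have : 0 < 109/100/r := by positivity
      linarith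
    set u := r*Real.cos θ with hu
    have hu0 : 0 < u := by positivity
    have hu1 : u ≤ 19/20 := by nlinarith [Real.cos_le_one θ]
    set s := c + circleMap 0 r θ with hs
    have hsre : s.re = c.re + u := by rw [hs, Complex.add_re, hre]
    have hsim : |s.im - c.im| ≤ 1 := him _ (by rw [hcm]; linarith)
    have main : u * (-Real.log ‖riemannZeta s‖) ≤ 109/100 := by
      by_cases hcase : u < 2*η
      · have h1 := hMb s hsim (by linarith) (by linarith)
        rcases le_or_gt 0 M with hM0 | hM0
        · calc u * (-Real.log ‖riemannZeta s‖) ≤ u*M := by gcongr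
            _ ≤ 2*η*M := by gcongr
            _ ≤ _ := hM
        · have : u*(-Real.log ‖riemannZeta s‖) ≤ u*M := by gcongr
          nlinarith
      · push Not at hcase
        have hs1 : u/2 ≤ s.re - 1 := by linarith
        have hs1' : 1 < s.re := by linarith
        have hinv := norm_inv_zeta_le hs1' (by linarith)
        have hle : -Real.log ‖riemannZeta s‖ ≤ Real.log (1+2/u) := by
          rw [← Real.log_inv, ← norm_inv]
          apply Real.log_le_log
          · rw [norm_pos_iff]; exact inv_ne_zero (hz s hsim (by linarith))
          · refine hinv.trans ?_
            have : 1/(s.re-1) ≤ 2/u := by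
              rw [div_le_div_iff₀ (by linarith) hu0]; linarith
            linarith
        exact (mul_le_mul_of_nonneg_left hle hu0.le).trans (log_aux hu0 hu1)
    have hgu : g θ = (u*Real.log ‖riemannZeta s‖)/r := by
      simp only [hg, hf, hu, ← hs]
      field_simp
    rw [hgu, ← neg_div]
    apply div_le_div_of_nonneg_right _ hr0.le
    linarith
  have hleft : -(2*(Real.log (L+3) + 1/40) + L*r*(Real.pi/2)) ≤ ∫ θ in (Real.pi/2)..(3*Real.pi/2), g θ := by
    have hi : ∫ θ in (Real.pi/2)..(3*Real.pi/2), ((Real.log (L+3)+1/40)*Real.cos θ - (L*r)*Real.cos θ^2) = -(2*(Real.log (L+3) + 1/40) + L*r*(Real.pi/2)) := by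
      rw [intervalIntegral.integral_sub, intervalIntegral.integral_const_mul, intervalIntegral.integral_const_mul, integral_cos, integral_cos_sq]
      · have e1 : Real.sin (3*Real.pi/2) = -1 := by
          rw [show 3*Real.pi/2 = Real.pi/2 + Real.pi by ring, Real.sin_add_pi, Real.sin_pi_div_two]
        have e2 : Real.cos (3*Real.pi/2) = 0 := by
          rw [show 3*Real.pi/2 = Real.pi/2 + Real.pi by ring, Real.cos_add_pi, Real.cos_pi_div_two]; simp
        rw [e1, e2, Real.sin_pi_div_two, Real.cos_pi_div_two]
        ring
      · exact (by fun_prop : Continuous _).intervalIntegrable _ _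
      · exact (by fun_prop : Continuous _).intervalIntegrable _ _
    rw [← hi]
    apply intervalIntegral.integral_mono_on (by linarith) ((by fun_prop : Continuous _).intervalIntegrable _ _) (hgc.intervalIntegrable _ _)
    intro θ hθ
    have hcos : Real.cos θ ≤ 0 := Real.cos_nonpos_of_pi_div_two_le_of_le hθ.1 (by linarith [hθ.2])
    have hcos1 := Real.neg_one_le_cos θ
    set s := c + circleMap 0 r θ with hs
    have hsre : s.re = c.re + r*Real.cos θ := by rw [hs, Complex.add_re, hre]
    have hsim : |s.im - c.im| ≤ 1 := him _ (by rw [hcm]; linarith)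
    have hrc : -(19/20) ≤ r*Real.cos θ := by nlinarith
    have hrc2 : r*Real.cos θ ≤ 0 := by nlinarith
    have hsim2 : |s.im - c.im| ≤ 19/20 := by
      simp only [hs, Complex.add_im, add_sub_cancel_left]
      refine (Complex.abs_im_le_norm _).trans ?_
      rw [hcm]; exact hr2.le
    have hb := zeta_upper (L := L) (s := s) (by linarith) (by linarith) (by linarith) (by
        have : |c.im| ≤ |s.im| + |s.im-c.im| := by
          have := abs_sub_abs_le_abs_sub c.im s.im
          rw [abs_sub_comm c.im] at this; linarith
        linarith) (by
        have := abs_sub_abs_le_abs_sub s.im c.im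
        linarith)
    have hlog : Real.log ‖riemannZeta s‖ ≤ Real.log (L+3) + 1/40 - L*r*Real.cos θ := by
      have hne := hrz _ (hcm θ)
      have h1 := Real.log_le_log (norm_pos_iff.mpr hne) hb
      rw [Real.log_mul (by linarith) (Real.exp_pos _).ne', Real.log_exp] at h1
      have h2 : max 0 (1-s.re) ≤ η - r*Real.cos θ := by
        apply max_le <;> linarith
      have h3 : L*max 0 (1-s.re) ≤ L*(η - r*Real.cos θ) := by gcongr
      nlinarith
    have := mul_le_mul_of_nonpos_left hlog hcos
    simp only [hg, hf, ← hs]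
    linarith
  have hfinal : -(1/(Real.pi*r)) * (∫ θ in (0:ℝ)..2*Real.pi, g θ) ≤ 69/100*L := by
    rw [hsplit]
    have hsum := add_le_add hright hleft
    set I := (∫ θ in (-(Real.pi/2))..(Real.pi/2), g θ) + ∫ θ in (Real.pi/2)..(3*Real.pi/2), g θ
    have e : -(1/(Real.pi*r))*I = (-I)/(Real.pi*r) := by ring
    rw [e, div_le_iff₀ (by positivity)]
    have hlog := log_L3 hL
    have hpi3 := Real.pi_gt_d2
    have h109 : 109/100/r*Real.pi ≤ 109/81 * (Real.pi*r) := by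
      have : 109/100/r ≤ 109/81*r := by
        rw [div_le_iff₀ hr0]; nlinarith
      nlinarith
    have hpr : 2826/1000 ≤ Real.pi*r := by nlinarith
    have h2 : 2*(Real.log (L+3)+1/40) ≤ 2*((L+3)/(2008/100)+2+1/40) := by linarith
    have h3 : 2*((L+3)/(2008/100)+2+1/40) ≤ ((19/100)*L - 109/81) * (Real.pi*r) := by
      calc _ ≤ ((19/100)*L - 109/81) * (2826/1000) := by linarith
        _ ≤ _ := by gcongr; linarith
    linarith only [hsum, h109, h2, h3]
  linarith

-- Part E3c
lemma harnack {q : ℂ → ℝ} {c : ℂ} {R p₁ p₂ : ℝ} (hR : 0 < R)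
    (hq : InnerProductSpace.HarmonicOnNhd q (Metric.closedBall c R))
    (hq0 : ∀ z ∈ Metric.closedBall c R, 0 ≤ q z) (h1 : -R < p₁) (h12 : p₁ ≤ p₂) (h2 : p₂ < R) :
    q (c-p₂) ≤ (R+p₂)*(R-p₁)/((R+p₁)*(R-p₂)) * q (c-p₁) := by
  have hmem : ∀ p:ℝ, -R < p → p < R → (c - (p:ℂ)) ∈ Metric.ball c R := fun p ha hb => by
    simp [abs_lt, ha, hb]
  have e1 := hq.circleAverage_poissonKernel_smul (hmem p₁ h1 (by linarith))
  have e2 := hq.circleAverage_poissonKernel_smul (hmem p₂ (by linarith) h2)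
  set K := (R+p₂)*(R-p₁)/((R+p₁)*(R-p₂)) with hK
  have hcq : ContinuousOn q (Metric.sphere c R) := fun z hz =>
    (hq z (Metric.sphere_subset_closedBall hz)).1.continuousAt.continuousWithinAt
  have hne : ∀ p:ℝ, -R < p → p < R → ∀ z ∈ Metric.sphere c R, ‖(z-c)-((c-(p:ℂ))-c)‖^2 ≠ 0 := by
    intro p ha hb z hz h
    rw [mem_sphere_iff_norm] at hz
    simp only [ne_eq, OfNat.ofNat_ne_zero, not_false_eq_true, pow_eq_zero_iff, norm_eq_zero] at h
    have : z - c = -(p:ℂ) := by linear_combination h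
    rw [this, norm_neg, Complex.norm_real, Real.norm_eq_abs] at hz
    have := abs_lt.mpr ⟨ha, hb⟩
    linarith
  have hci : ∀ p:ℝ, -R < p → p < R → CircleIntegrable (poissonKernel c (c-(p:ℂ)) • q) c R := by
    intro p ha hb
    apply ContinuousOn.circleIntegrable hR.le
    apply ContinuousOn.smul _ hcq
    unfold poissonKernel
    apply ContinuousOn.div (by fun_prop) (by fun_prop)
    exact hne p ha hb
  have e3 : K * q (c-p₁) = Real.circleAverage (K • (poissonKernel c (c-(p₁:ℂ)) • q)) c R := by
    rw [Real.circleAverage_smul, e1, smul_eq_mul]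
  rw [e3, ← e2]
  apply Real.circleAverage_mono (hci _ (by linarith) h2) ((hci _ h1 (by linarith)).const_smul)
  intro z hz
  rw [abs_of_pos hR] at hz
  have hz' := hz
  rw [mem_sphere_iff_norm] at hz'
  simp only [Pi.smul_apply, Pi.smul_apply', smul_eq_mul, Pi.mul_apply]
  rw [← mul_assoc]
  apply mul_le_mul_of_nonneg_right _ (hq0 z (Metric.sphere_subset_closedBall hz))
  unfold poissonKernel
  have hn := hne p₁ h1 (by linarith) z hz
  have hn2 := hne p₂ (by linarith) h2 z hz
  have en : ∀ p:ℝ, ‖(z-c)-((c-(p:ℂ))-c)‖^2 = (R-p)^2+2*p*(R+(z-c).re) := by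
    intro p
    rw [show (z-c)-((c-(p:ℂ))-c) = (z-c)+(p:ℂ) by ring]
    rw [← Complex.normSq_eq_norm_sq, Complex.normSq_apply]
    have : R^2 = (z-c).re*(z-c).re+(z-c).im*(z-c).im := by
      rw [← hz', ← Complex.normSq_eq_norm_sq, Complex.normSq_apply]
    rw [Complex.add_re, Complex.add_im, Complex.ofReal_re, Complex.ofReal_im]
    linear_combination -this
  have ep : ∀ p:ℝ, ‖c-(p:ℂ)-c‖^2 = p^2 := fun p => by
    rw [show c-(p:ℂ)-c = -(p:ℂ) by ring, norm_neg, Complex.norm_real, Real.norm_eq_abs, sq_abs]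
  have hv : 0 ≤ R+(z-c).re := by
    have := (abs_le.mp ((Complex.abs_re_le_norm (z-c)).trans hz'.le)).1
    linarith
  have P1 := lt_of_le_of_ne (sq_nonneg _) hn.symm
  have P2 := lt_of_le_of_ne (sq_nonneg _) hn2.symm
  rw [en] at P1 P2
  rw [en, en, ep, ep, hz', hK, div_mul_div_comm, div_le_div_iff₀ P2 (mul_pos (mul_pos (by linarith) (by linarith)) P1)]
  set v := R+(z-c).re
  have key : (R-p₂)^2*((R-p₁)^2+2*p₁*v) ≤ (R-p₁)^2*((R-p₂)^2+2*p₂*v) := by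
    have : 0 ≤ (p₂-p₁)*(R^2-p₁*p₂)*v := by
      apply mul_nonneg (mul_nonneg (by linarith) _) hv
      nlinarith
    nlinarith
  have hA : 0 ≤ (R+p₂)*(R+p₁) := mul_nonneg (by linarith) (by linarith)
  have := mul_le_mul_of_nonneg_left key hA
  linarith

/-- zero-free region, upper range -/
lemma zero_free_hi {L : ℝ} (hL : 20 ≤ L) {s : ℂ} (hσ : 1 - (39/1000)/L ≤ s.re) (ht0 : 8/5 ≤ |s.im|)
    (ht1 : 3*|s.im|+1 ≤ Real.exp L) : riemannZeta s ≠ 0 := by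
  intro h0
  have hL0 : 0 < L := by linarith
  have hs1 : s.re < 1 := by
    by_contra h
    exact riemannZeta_ne_zero_of_one_le_re (not_lt.mp h) h0
  set t := s.im with ht
  set d := 1 - s.re with hd
  set x := (147/1000)/L with hx
  have hx0 : 0 < x := by positivity
  have hx1 : x ≤ 1/10 := by
    rw [hx, div_le_iff₀ hL0]; linarith
  have hjd : ∀ y:ℝ, 8/5 ≤ |y| → |y|+1 ≤ Real.exp L → ∀ Q : Finset ℂ, (∀ ρ ∈ Q, riemannZeta ρ = 0 ∧ ‖ρ-((1+x:ℝ)+y*Complex.I)‖ ≤ 9/10) →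
      -(logDeriv riemannZeta ((1+x:ℝ)+y*Complex.I)).re ≤ 69/100*L - ∑ ρ ∈ Q, (((1+x:ℝ)+y*Complex.I)-ρ).re*(1/‖((1+x:ℝ)+y*Complex.I)-ρ‖^2 - 124/100) := by
    intro y hy0 hy1 Q hQ
    have hre : (((1+x:ℝ):ℂ)+y*Complex.I).re = 1+x := by simp
    have him : (((1+x:ℝ):ℂ)+y*Complex.I).im = y := by simp
    refine jd_zeta (η := 0) (M := Real.log (1+1/x)) hL le_rfl (by norm_num) (by norm_num)
      (by rw [hre]; linarith) (by rw [hre]; linarith) (by rw [him]; exact hy0) (by rw [him]; exact hy1) ?_ ?_ Q hQ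
    · intro z _ hz
      rw [hre] at hz
      exact riemannZeta_ne_zero_of_one_le_re (by linarith)
    · intro z _ hz hz2
      rw [hre] at hz hz2
      have hzz : z.re = 1+x := by linarith
      rw [← Real.log_inv, ← norm_inv]
      apply Real.log_le_log
      · rw [norm_pos_iff]; exact inv_ne_zero (riemannZeta_ne_zero_of_one_le_re (by linarith))
      · have := norm_inv_zeta_le (s := z) (by linarith) (by linarith)
        rwa [hzz, add_sub_cancel_left] at this
  have htr := trig_ineq hx0 hx1 t
  have hdx : d ≤ (39/1000)/L := by linarith
  have hcs : (((1+x:ℝ):ℂ)+t*Complex.I) - s = ((x+d:ℝ):ℂ) := by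
    apply Complex.ext
    · simp [hd]; ring
    · simp [ht]
  have hxd : x + d ≤ (186/1000)/L := by
    have : (186/1000)/L = x + (39/1000)/L := by rw [hx]; ring
    linarith
  have hxd0 : 0 < x+d := by linarith
  have hxd1 : x + d ≤ 93/10000 := by
    refine hxd.trans ?_
    rw [div_le_iff₀ hL0]; linarith
  have j1 := hjd t ht0 (by linarith [abs_nonneg t]) {s} (by
    intro ρ hρ
    rw [Finset.mem_singleton] at hρ
    subst hρ
    refine ⟨h0, ?_⟩
    rw [norm_sub_rev, hcs, Complex.norm_real, Real.norm_of_nonneg hxd0.le]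
    linarith)
  rw [Finset.sum_singleton, hcs, Complex.norm_real, Real.norm_of_nonneg hxd0.le, Complex.ofReal_re] at j1
  have a2 : |2*t| = 2*|t| := by rw [abs_mul]; norm_num
  have a3 : |3*t| = 3*|t| := by rw [abs_mul]; norm_num
  have j2 := hjd (2*t) (by rw [a2]; linarith) (by rw [a2]; linarith) ∅ (by simp)
  have j3 := hjd (3*t) (by rw [a3]; linarith) (by rw [a3]; exact ht1) ∅ (by simp)
  rw [Finset.sum_empty] at j2 j3
  have e : (x+d)*(1/(x+d)^2-124/100) = 1/(x+d) - 124/100*(x+d) := by field_simp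
  rw [e] at j1
  have g1 : 1/(x+d) ≥ L/(186/1000) := by
    rw [ge_iff_le, div_le_div_iff₀ (by norm_num) hxd0]
    rw [le_div_iff₀ hL0] at hxd
    linarith
  have g2 : 1/x = L/(147/1000) := by rw [hx]; field_simp
  rw [g2] at htr
  linarith

lemma zeta_low {s : ℂ} (hσ0 : 9/10 ≤ s.re) (hσ1 : s.re ≤ 2) (ht : |s.im| ≤ 21/10) (hs : s ≠ 1) :
    3/20 * ‖s+1‖ ≤ ‖s-1‖ * ‖riemannZeta s‖ := by
  have h1 : riemannZeta₁ s = (s+1)/2 + (s-1)*emR 1 s := by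
    rw [emR_one hs]; ring
  have hz : riemannZeta₁ s = (s-1)*riemannZeta s := by
    rw [riemannZeta_eq_inv_sub_mul hs]
    have : s-1 ≠ 0 := sub_ne_zero.mpr hs
    field_simp
  rw [← norm_mul, ← hz, h1]
  have hb := emR_bound (N := 1) le_rfl hs (by linarith)
  simp only [Nat.cast_one, Real.one_rpow, mul_one] at hb
  have hn : ‖s-1‖*‖s‖ ≤ 26/10*(1+s.re) := by
    have hsq : (‖s-1‖*‖s‖)^2 ≤ (26/10*(1+s.re))^2 := by
      rw [mul_pow, ← Complex.normSq_eq_norm_sq, ← Complex.normSq_eq_norm_sq, Complex.normSq_apply, Complex.normSq_apply]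
      simp only [Complex.sub_re, Complex.sub_im, Complex.one_re, Complex.one_im, sub_zero]
      have : s.im*s.im ≤ 441/100 := by rw [← abs_mul_abs_self]; nlinarith [abs_nonneg s.im]
      have h2 : s.im*s.im ≥ 0 := mul_self_nonneg _
      set y := s.im*s.im
      set a := s.re
      have p1 : (a-1)*(a-1)+y ≤ (a-1)*(a-1)+441/100 := by linarith
      have p2 : a*a+y ≤ a*a+441/100 := by linarith
      calc ((a-1)*(a-1)+y)*(a*a+y) ≤ ((a-1)*(a-1)+441/100)*(a*a+441/100) := by
            apply mul_le_mul p1 p2 (add_nonneg (mul_self_nonneg _) h2) (add_nonneg (mul_self_nonneg _) (by norm_num))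
        _ ≤ _ := by nlinarith [mul_nonneg (sub_nonneg.2 hσ0) (sub_nonneg.2 hσ1)]
    exact le_of_sq_le_sq hsq (by linarith)
  have hm : ‖(s-1)*emR 1 s‖ ≤ 13/40*‖s+1‖ := by
    rw [norm_mul]
    calc ‖s-1‖*‖emR 1 s‖ ≤ ‖s-1‖*(‖s‖*‖s+1‖/(8*(s.re+1))) := by gcongr
      _ = (‖s-1‖*‖s‖)*‖s+1‖/(8*(s.re+1)) := by ring
      _ ≤ (26/10*(1+s.re))*‖s+1‖/(8*(s.re+1)) := by
        apply div_le_div_of_nonneg_right _ (by linarith)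
        gcongr
      _ = 13/40*‖s+1‖ := by
        have : s.re+1 ≠ 0 := by linarith
        have h2 : 1+s.re ≠ 0 := by linarith
        field_simp; ring
  have h3 := norm_sub_le_norm_add ((s+1)/2) ((s-1)*emR 1 s)
  have h4 : ‖(s+1)/2‖ = ‖s+1‖/2 := by rw [norm_div]; norm_num
  rw [h4] at h3
  linarith [norm_nonneg (s+1)]

lemma zero_free {L : ℝ} (hL : 20 ≤ L) {s : ℂ} (hσ : 1 - (39/1000)/L ≤ s.re)
    (ht1 : 3*|s.im|+1 ≤ Real.exp L) : riemannZeta s ≠ 0 := by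
  rcases le_or_gt 1 s.re with h | h
  · exact riemannZeta_ne_zero_of_one_le_re h
  rcases le_or_gt (8/5) |s.im| with h2 | h2
  · exact zero_free_hi hL hσ h2 ht1
  intro h0
  have hs : s ≠ 1 := by rintro rfl; simp at h
  have hx1 : (39/1000)/L ≤ 1/10 := by
    rw [div_le_iff₀ (by linarith)]; linarith
  have := zeta_low (s := s) (by linarith) (by linarith) (by linarith) hs
  rw [h0, norm_zero, mul_zero] at this
  have h3 : 0 < ‖s+1‖ := by
    rw [norm_pos_iff]
    intro h
    have := congrArg Complex.re h
    simp at this; linarith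
  linarith

-- Part E4
lemma abs_im_near {a b r : ℝ} (h : |a-b| ≤ r) : |b|-r ≤ |a| ∧ |a| ≤ |b|+r := by
  have h1 := abs_sub_abs_le_abs_sub a b
  have h2 := abs_sub_abs_le_abs_sub b a
  rw [abs_sub_comm] at h2
  constructor <;> linarith

lemma zeta_analyticAt {s : ℂ} (hs : s ≠ 1) : AnalyticAt ℂ riemannZeta s := analyticOn_riemannZeta s hs

/-- crude lower bound -/
lemma crude {L : ℝ} (hL : 20 ≤ L) {s : ℂ} (hσ0 : 1-(239/10000)/L ≤ s.re) (hσ1 : s.re ≤ 4)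
    (ht0 : 7/10 ≤ |s.im|) (ht1 : 3*|s.im|+2 ≤ Real.exp L) :
    -Real.log ‖riemannZeta s‖ ≤ 25/2*(Real.log (L+3)+1/25+Real.log (1+L/(6/100))) := by
  have hL0 : 0 < L := by linarith
  have hlog1 : 0 ≤ Real.log (L+3) := Real.log_nonneg (by linarith)
  have hlog2 : 0 ≤ Real.log (1+L/(6/100)) := Real.log_nonneg (by
    have : 0 ≤ L/(6/100) := by positivity
    linarith)
  have right : ∀ z:ℂ, 1+(6/100)/L ≤ z.re → z.re ≤ 4 → -Real.log ‖riemannZeta z‖ ≤ Real.log (1+L/(6/100)) := by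
    intro z h1 h2
    have hp : 0 < (6/100)/L := by positivity
    rw [← Real.log_inv, ← norm_inv]
    apply Real.log_le_log
    · rw [norm_pos_iff]; exact inv_ne_zero (riemannZeta_ne_zero_of_one_le_re (by linarith))
    · have := norm_inv_zeta_le (s := z) (by linarith) h2
      refine this.trans ?_
      have e : 1/(z.re-1) ≤ 1/((6/100)/L) := by
        apply one_div_le_one_div_of_le hp; linarith
      rw [one_div_div] at e
      linarith
  rcases le_or_gt (1+(6/100)/L) s.re with h | h
  · have := right s h hσ1
    linarith
  set x := (6/100)/L with hx
  set c : ℂ := ((1+x:ℝ):ℂ) + s.im*Complex.I with hc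
  have hcre : c.re = 1+x := by simp [hc]
  have hcim : c.im = s.im := by simp [hc]
  set R := (985/10000)/L with hR
  have hR0 : 0 < R := by positivity
  have hx0 : 0 < x := by positivity
  have hR1 : R ≤ 1/100 := by rw [hR, div_le_iff₀ hL0]; linarith
  set M1 := Real.log (L+3)+1/25 with hM1
  set p := c.re - s.re with hp
  have hp0 : 0 ≤ p := by linarith
  have hxe : x + (239/10000)/L = (839/10000)/L := by rw [hx]; ring
  have hp1 : p ≤ (839/10000)/L := by linarith
  have hpR : (839/10000)/L < R := by rw [hR]; exact div_lt_div_of_pos_right (by norm_num) hL0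
  have hball : ∀ z ∈ Metric.closedBall c R, 1-(385/10000)/L ≤ z.re ∧ z.re ≤ 11/5 ∧ |s.im|-1/100 ≤ |z.im| ∧ |z.im| ≤ |s.im|+1/100 := by
    intro z hz
    rw [mem_closedBall_iff_norm] at hz
    have h1 := abs_le.mp ((Complex.abs_re_le_norm (z-c)).trans hz)
    have h2 := abs_im_near (((Complex.abs_im_le_norm (z-c)).trans hz).trans hR1)
    rw [hcim] at h2
    rw [Complex.sub_re, hcre] at h1
    have e : R - x = (385/10000)/L := by rw [hR, hx]; ring
    have hx1 : x ≤ 1/100 := by rw [hx, div_le_iff₀ hL0]; linarith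
    exact ⟨by linarith, by linarith, h2⟩
  have hz0 : ∀ z ∈ Metric.closedBall c R, riemannZeta z ≠ 0 := by
    intro z hz
    obtain ⟨h1, h2, h3, h4⟩ := hball z hz
    apply zero_free hL _ (by linarith)
    refine le_trans (sub_le_sub_left (div_le_div_of_nonneg_right (by norm_num) hL0.le) 1) h1
  have hz1 : ∀ z ∈ Metric.closedBall c R, z ≠ 1 := by
    rintro z hz rfl
    obtain ⟨h1, h2, h3, h4⟩ := hball 1 hz
    rw [Complex.one_im, abs_zero] at h3
    linarith
  have hk := harnack (q := fun z => M1 - Real.log ‖riemannZeta z‖) (c := c) (R := R) (p₁ := 0) (p₂ := p) hR0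
    (by
      intro z hz
      apply InnerProductSpace.HarmonicAt.sub
      · exact InnerProductSpace.harmonicAt_const M1
      · exact (zeta_analyticAt (hz1 z hz)).harmonicAt_log_norm (hz0 z hz))
    (by
      intro z hz
      obtain ⟨h1, h2, h3, h4⟩ := hball z hz
      have hb := zeta_upper (L := L) (s := z) (by linarith) (by
        have : (385/10000)/L ≤ 1 := by rw [div_le_iff₀ hL0]; linarith
        linarith) h2 (by linarith) (by linarith)
      have h5 := Real.log_le_log (norm_pos_iff.mpr (hz0 z hz)) hb
      rw [Real.log_mul (by linarith) (Real.exp_pos _).ne', Real.log_exp] at h5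
      have h6 : L*max 0 (1-z.re) ≤ L*((385/10000)/L) := by
        gcongr
        apply max_le (by positivity) (by linarith)
      rw [mul_div_cancel₀ _ hL0.ne'] at h6
      simp only [sub_nonneg]
      linarith) (by linarith) hp0 (by linarith)
  have hs : c - (p:ℂ) = s := by
    apply Complex.ext
    · simp [hp]
    · simp [hcim]
  rw [hs] at hk
  have hcc := right c (by rw [hcre]) (by rw [hcre]; linarith [show x ≤ 1/100 by rw [hx, div_le_iff₀ hL0]; linarith])
  simp only [Complex.ofReal_zero, sub_zero, add_zero] at hk
  have hK : (R+p)*R/(R*(R-p)) ≤ 25/2 := by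
    rw [div_le_iff₀ (mul_pos hR0 (by linarith))]
    have e1 : (839/10000)/L = 839/985*R := by rw [hR]; ring
    rw [e1] at hp1
    nlinarith
  have hnn : 0 ≤ M1 + Real.log (1+L/(6/100)) := by linarith
  have hq : M1 - Real.log ‖riemannZeta c‖ ≤ M1 + Real.log (1+L/(6/100)) := by linarith
  have hKn : 0 ≤ (R+p)*R/(R*(R-p)) := by
    apply div_nonneg (mul_nonneg (by linarith) hR0.le) (mul_nonneg hR0.le (by linarith))
  have h1 := mul_le_mul_of_nonneg_left hq hKn
  have h2 := mul_le_mul_of_nonneg_right hK hnn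
  linarith

lemma log_aux2 {L : ℝ} (hL : 20 ≤ L) : 2*((239/10000)/L)*(25/2*(Real.log (L+3)+1/25+Real.log (1+L/(6/100)))) ≤ 109/100 := by
  have hL0 : 0 < L := by linarith
  have h1 := log_L3 hL
  have h2 : Real.log (1+L/(6/100)) ≤ Real.log (L+3) + 3 := by
    have h3 : 17 ≤ Real.exp 3 := by
      have : Real.exp 3 = Real.exp 1 ^ 3 := by rw [← Real.exp_nat_mul]; norm_num
      rw [this]
      have he := Real.exp_one_gt_d9
      calc (17:ℝ) ≤ 2.7182^3 := by norm_num
        _ ≤ _ := by gcongr; linarith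
    have e3 : Real.log (L+3) + 3 = Real.log ((L+3)*Real.exp 3) := by
      rw [Real.log_mul (by linarith) (Real.exp_pos _).ne', Real.log_exp]
    rw [e3]
    apply Real.log_le_log (by positivity)
    nlinarith
  have h4 : Real.log (L+3)+1/25+Real.log (1+L/(6/100)) ≤ L/2 := by linarith
  calc _ ≤ 2*((239/10000)/L)*(25/2*(L/2)) := by gcongr
    _ = 239/10000*(25/2) := by field_simp
    _ ≤ _ := by norm_num

lemma q_nonneg {L : ℝ} (hL : 20 ≤ L) {c : ℂ} (hσ0 : 1-(239/10000)/L ≤ c.re) (hσ1 : c.re ≤ 2)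
    (ht0 : 17/10 ≤ |c.im|) (ht1 : 3*|c.im|+5 ≤ Real.exp L) :
    0 ≤ (logDeriv riemannZeta c).re + 69/100*L := by
  have hL0 : 0 < L := by linarith
  have := jd_zeta (L := L) (η := (239/10000)/L) (M := 25/2*(Real.log (L+3)+1/25+Real.log (1+L/(6/100)))) hL (by positivity)
    (by rw [div_mul_cancel₀ _ hL0.ne']; norm_num) (log_aux2 hL) hσ0 hσ1 (by linarith) (by linarith [abs_nonneg c.im])
    (by
      intro s hs hsr
      have := abs_im_near hs
      apply zero_free hL _ (by linarith)
      refine le_trans (sub_le_sub_left (div_le_div_of_nonneg_right (by norm_num) hL0.le) 1) (hσ0.trans hsr))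
    (by
      intro s hs h1 h2
      have := abs_im_near hs
      have hη : (239/10000)/L ≤ 1/10 := by rw [div_le_iff₀ hL0]; linarith
      exact crude hL (by linarith) (by linarith) (by linarith) (by linarith)) ∅ (by simp)
  rw [Finset.sum_empty] at this
  linarith

lemma hasDerivAt_log_norm {f : ℝ → ℂ} {f' : ℂ} {y : ℝ} (hf : HasDerivAt f f' y) (h0 : f y ≠ 0) :
    HasDerivAt (fun y => Real.log ‖f y‖) (f'/f y).re y := by
  have h1 := hf.norm_sq
  have h2 := (h1.log (by positivity)).div_const 2
  have e : (fun y => Real.log ‖f y‖) = fun y => Real.log (‖f y‖^2)/2 := by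
    funext y; rw [Real.log_pow]; push_cast; ring
  rw [e]
  refine h2.congr_deriv ?_
  rw [← Complex.normSq_eq_norm_sq, Complex.div_re]
  have : Complex.normSq (f y) ≠ 0 := by simpa using h0
  rw [Complex.inner, Complex.mul_re, Complex.conj_re, Complex.conj_im]
  field_simp
  ring

/-- monotonicity: the key Harnack consequence -/
lemma inv_zeta_harnack {L : ℝ} (hL : 20 ≤ L) {t : ℝ} (ht0 : 21/10 ≤ |t|) (ht1 : 3*|t|+7 ≤ Real.exp L)
    {y : ℝ} (hy0 : -((239/10000)/L) < y) (hy1 : y ≤ (717/10000)/L) :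
    -Real.log ‖riemannZeta ((1+y:ℝ)+t*Complex.I)‖ + 1408/1000*Real.log (y+(239/10000)/L) - 69/100*L*y
    ≤ -Real.log ‖riemannZeta ((1+(717/10000)/L:ℝ)+t*Complex.I)‖ + 1408/1000*Real.log ((717/10000)/L+(239/10000)/L) - 69/100*L*((717/10000)/L) := by
  have hL0 : 0 < L := by linarith
  set η := (239/10000)/L with hη
  set x := (717/10000)/L with hx
  have hη0 : 0 < η := by positivity
  have hx0 : 0 < x := by positivity
  have hη1 : η ≤ 1/800 := by rw [hη, div_le_iff₀ hL0]; linarith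
  have hx1 : x ≤ 36/10000 := by rw [hx, div_le_iff₀ hL0]; linarith
  have hxe : x + η = (956/10000)/L := by rw [hx, hη]; ring
  have hre : ∀ u:ℝ, (((1+u:ℝ):ℂ)+t*Complex.I).re = 1+u := fun u => by simp
  have him : ∀ u:ℝ, (((1+u:ℝ):ℂ)+t*Complex.I).im = t := fun u => by simp
  have hne1 : ∀ u:ℝ, (((1+u:ℝ):ℂ)+t*Complex.I) ≠ 1 := fun u h => by
    have := congrArg Complex.im h
    rw [him, Complex.one_im] at this
    rw [this, abs_zero] at ht0; norm_num at ht0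
  have hz0 : ∀ u:ℝ, -η ≤ u → riemannZeta (((1+u:ℝ):ℂ)+t*Complex.I) ≠ 0 := fun u hu => by
    apply zero_free hL
    · rw [hre]
      have : η ≤ (39/1000)/L := by rw [hη]; exact div_le_div_of_nonneg_right (by norm_num) hL0.le
      linarith
    · rw [him]; linarith
  -- bound on q
  have hqx : (logDeriv riemannZeta (((1+x:ℝ):ℂ)+t*Complex.I)).re + 69/100*L ≤ 14638/1000*L := by
    have h1 := (abs_le.mp (vm_abs_le hx0 (by linarith) t)).2
    have : 1/x = L*(10000/717) := by rw [hx]; field_simp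
    rw [this] at h1
    linarith
  have hqy : ∀ u:ℝ, -η < u → u ≤ x → (logDeriv riemannZeta (((1+u:ℝ):ℂ)+t*Complex.I)).re + 69/100*L ≤ (1408/1000)/(u+η) := by
    intro u hu0 hu1
    set c : ℂ := ((1-η+4/10:ℝ):ℂ)+t*Complex.I with hc
    have hcre : c.re = 1-η+4/10 := by simp [hc]
    have hcim : c.im = t := by simp [hc]
    have hball : ∀ z ∈ Metric.closedBall c (4/10), 1-η ≤ z.re ∧ z.re ≤ 2 ∧ |t|-4/10 ≤ |z.im| ∧ |z.im| ≤ |t|+4/10 := by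
      intro z hz
      rw [mem_closedBall_iff_norm] at hz
      have h1 := abs_le.mp ((Complex.abs_re_le_norm (z-c)).trans hz)
      have h2 := abs_im_near ((Complex.abs_im_le_norm (z-c)).trans hz)
      rw [hcim] at h2
      rw [Complex.sub_re, hcre] at h1
      exact ⟨by linarith, by linarith, h2⟩
    have hk := harnack (q := fun z => (logDeriv riemannZeta z).re + 69/100*L) (c := c) (R := 4/10)
      (p₁ := 4/10-(x+η)) (p₂ := 4/10-(u+η)) (by norm_num)
      (by
        intro z hz
        obtain ⟨h1, h2, h3, h4⟩ := hball z hz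
        have hz1 : z ≠ 1 := by
          rintro rfl
          rw [Complex.one_im, abs_zero] at h3; linarith
        have hzz : riemannZeta z ≠ 0 := by
          apply zero_free hL _ (by linarith)
          have : η ≤ (39/1000)/L := by rw [hη]; exact div_le_div_of_nonneg_right (by norm_num) hL0.le
          linarith
        have ha := zeta_analyticAt hz1
        have : AnalyticAt ℂ (logDeriv riemannZeta) z := ha.deriv.div ha hzz
        exact this.harmonicAt_re.add (InnerProductSpace.harmonicAt_const _))
      (by
        intro z hz
        obtain ⟨h1, h2, h3, h4⟩ := hball z hz
        exact q_nonneg hL h1 h2 (by linarith) (by linarith))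
      (by linarith) (by linarith) (by linarith)
    have e1 : c - ((4/10-(x+η):ℝ):ℂ) = ((1+x:ℝ):ℂ)+t*Complex.I := by
      rw [hc]; push_cast; ring
    have e2 : c - ((4/10-(u+η):ℝ):ℂ) = ((1+u:ℝ):ℂ)+t*Complex.I := by
      rw [hc]; push_cast; ring
    rw [e1, e2] at hk
    refine hk.trans ?_
    have hd : 0 < u+η := by linarith
    have hq0 : (0:ℝ) ≤ 14638/1000*L := by linarith
    have hK : (4/10+(4/10-(u+η)))*(4/10-(4/10-(x+η)))/((4/10+(4/10-(x+η)))*(4/10-(4/10-(u+η)))) ≤ (10061/10000)*(x+η)/(u+η) := by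
      rw [div_le_div_iff₀ (mul_pos (by linarith) (by linarith)) hd]
      have h1 : (4/10+(4/10-(u+η))) ≤ 8/10 := by linarith
      have h2 : 8/10 ≤ 10061/10000*(4/10+(4/10-(x+η))) := by linarith
      have h3 : 0 ≤ (x+η)*(u+η) := mul_nonneg (by linarith) hd.le
      have h4 := mul_le_mul_of_nonneg_right (h1.trans h2) h3
      linarith
    have hK0 : 0 ≤ (10061/10000)*(x+η)/(u+η) := by positivity
    calc _ ≤ (4/10+(4/10-(u+η)))*(4/10-(4/10-(x+η)))/((4/10+(4/10-(x+η)))*(4/10-(4/10-(u+η)))) * (14638/1000*L) := by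
          apply mul_le_mul_of_nonneg_left hqx
          apply div_nonneg (mul_nonneg (by linarith) (by linarith)) (mul_nonneg (by linarith) (by linarith))
      _ ≤ (10061/10000)*(x+η)/(u+η) * (14638/1000*L) := mul_le_mul_of_nonneg_right hK hq0
      _ = (10061/10000*(956/10000)*(14638/1000))/(u+η) := by
          rw [hxe]; field_simp
      _ ≤ _ := by
          apply div_le_div_of_nonneg_right _ hd.le
          norm_num
  have hder : ∀ u:ℝ, -η < u → HasDerivAt (fun u:ℝ => -Real.log ‖riemannZeta ((1+u:ℝ)+t*Complex.I)‖ + 1408/1000*Real.log (u+η) - 69/100*L*u)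
      (-(logDeriv riemannZeta (((1+u:ℝ):ℂ)+t*Complex.I)).re + 1408/1000*(1/(u+η)) - 69/100*L*1) u := by
    intro u hu
    have h1 : HasDerivAt (fun u:ℝ => ((1+u:ℝ):ℂ)+t*Complex.I) 1 u := by
      have := (((hasDerivAt_id u).const_add 1).ofReal_comp).add_const (t*Complex.I)
      simpa using this
    have h2 := (differentiableAt_riemannZeta (hne1 u)).hasDerivAt.comp u h1
    have h3 := hasDerivAt_log_norm h2 (hz0 u hu.le)
    have h4 : HasDerivAt (fun u:ℝ => Real.log (u+η)) (1/(u+η)) u := by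
      have := ((hasDerivAt_id u).add_const η).log (by simp; linarith)
      simpa using this
    have h5 := ((h3.neg).add (h4.const_mul (1408/1000))).sub ((hasDerivAt_id u).const_mul (69/100*L))
    refine h5.congr_deriv ?_
    simp [logDeriv_apply]
  have hmono := monotoneOn_of_deriv_nonneg (D := Set.Icc y x) (convex_Icc y x)
    (f := fun u:ℝ => -Real.log ‖riemannZeta ((1+u:ℝ)+t*Complex.I)‖ + 1408/1000*Real.log (u+η) - 69/100*L*u)
    (fun u hu => (hder u (by linarith [hu.1])).continuousAt.continuousWithinAt)
    (fun u hu => (hder u (by rw [interior_Icc] at hu; linarith [hu.1])).differentiableAt.differentiableWithinAt)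
    (fun u hu => by
      rw [interior_Icc] at hu
      rw [(hder u (by linarith [hu.1])).deriv]
      have := hqy u (by linarith [hu.1]) hu.2.le
      have e : (1408/1000)/(u+η) = 1408/1000*(1/(u+η)) := by ring
      rw [e] at this
      linarith)
  exact hmono (Set.left_mem_Icc.mpr hy1) (Set.right_mem_Icc.mpr hy1) hy1

-- Part E4b
/-- The entire-ish version of `1/ζ`. -/
noncomputable def iz (s : ℂ) : ℂ := (s-1)/riemannZeta₁ s

lemma zeta1_eq {s : ℂ} (hs : s ≠ 1) : riemannZeta₁ s = (s-1)*riemannZeta s := by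
  rw [riemannZeta_eq_inv_sub_mul hs]
  have : s-1 ≠ 0 := sub_ne_zero.mpr hs
  field_simp

lemma iz_eq {s : ℂ} (hs : s ≠ 1) : iz s = (riemannZeta s)⁻¹ := by
  unfold iz
  rw [zeta1_eq hs]
  have : s-1 ≠ 0 := sub_ne_zero.mpr hs
  rw [div_mul_cancel_left₀ this]

lemma iz_one : iz 1 = 0 := by simp [iz]

lemma zeta1_ne_zero {L : ℝ} (hL : 20 ≤ L) {s : ℂ} (hσ : 1 - (39/1000)/L ≤ s.re)
    (ht1 : 3*|s.im|+1 ≤ Real.exp L) : riemannZeta₁ s ≠ 0 := by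
  by_cases hs : s = 1
  · subst hs; rw [riemannZeta₁_one]; norm_num
  · rw [zeta1_eq hs]
    exact mul_ne_zero (sub_ne_zero.mpr hs) (zero_free hL hσ ht1)

lemma iz_low {s : ℂ} (hσ0 : 9/10 ≤ s.re) (hσ1 : s.re ≤ 2) (ht : |s.im| ≤ 21/10) : ‖iz s‖ ≤ 7 := by
  by_cases hs : s = 1
  · subst hs; rw [iz_one]; norm_num
  rw [iz_eq hs, norm_inv]
  have h := zeta_low hσ0 hσ1 ht hs
  have h1 : ‖s-1‖ ≤ ‖s+1‖ := by
    have : ‖s-1‖^2 ≤ ‖s+1‖^2 := by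
      rw [← Complex.normSq_eq_norm_sq, ← Complex.normSq_eq_norm_sq, Complex.normSq_apply, Complex.normSq_apply]
      simp only [Complex.sub_re, Complex.sub_im, Complex.one_re, Complex.one_im, sub_zero, Complex.add_re, Complex.add_im, add_zero]
      nlinarith
    exact le_of_sq_le_sq this (norm_nonneg _)
  have h2 : 0 < ‖s-1‖ := norm_pos_iff.mpr (sub_ne_zero.mpr hs)
  have h3 : 3/20 ≤ ‖riemannZeta s‖ := by
    by_contra hc
    push Not at hc
    nlinarith
  calc ‖riemannZeta s‖⁻¹ ≤ (3/20)⁻¹ := by gcongr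
    _ ≤ 7 := by norm_num

set_option exponentiation.threshold 1000 in
lemma inv_zeta_line {L : ℝ} (hL : 20 ≤ L) {t y : ℝ} (ht0 : 21/10 ≤ |t|) (ht1 : 3*|t|+7 ≤ Real.exp L)
    (hy0 : 0 ≤ y) (hy1 : y ≤ (717/10000)/L) :
    ‖(riemannZeta ((1+y:ℝ)+t*Complex.I))⁻¹‖ ≤ 672/100 * ‖(riemannZeta ((1+(717/10000)/L:ℝ)+t*Complex.I))⁻¹‖ := by
  have hL0 : 0 < L := by linarith
  have hη : 0 < (239/10000)/L := by positivity
  have h := inv_zeta_harnack hL ht0 ht1 (y := y) (by linarith) hy1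
  have e2 : (717/10000)/L+(239/10000)/L = 4*((239/10000)/L) := by ring
  rw [e2, Real.log_mul (by norm_num) (by positivity)] at h
  have e3 : 69/100*L*((717/10000)/L) = 69/100*(717/10000) := by field_simp
  rw [e3] at h
  have hlogy : 69/100*L*y ≤ 1408/1000*(Real.log (y+(239/10000)/L) - Real.log ((239/10000)/L)) := by
    have h1 := Real.one_sub_inv_le_log_of_pos (x := (y+(239/10000)/L)/((239/10000)/L)) (by positivity)
    rw [Real.log_div (by positivity) (by positivity), inv_div] at h1
    have h2 : 1 - (239/10000)/L/(y+(239/10000)/L) = y/(y+(239/10000)/L) := by field_simp; ring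
    rw [h2] at h1
    have h3 : y/(4*((239/10000)/L)) ≤ y/(y+(239/10000)/L) := by
      apply div_le_div_of_nonneg_left hy0 (by positivity); linarith
    have h4 : y/(4*((239/10000)/L)) = y*L*(10000/956) := by field_simp; ring
    have : 0 ≤ y*L := by positivity
    linarith
  have hz1 : riemannZeta ((1+y:ℝ)+t*Complex.I) ≠ 0 := riemannZeta_ne_zero_of_one_le_re (by simpa using hy0)
  have hz2 : riemannZeta ((1+(717/10000)/L:ℝ)+t*Complex.I) ≠ 0 := riemannZeta_ne_zero_of_one_le_re (by simp; positivity)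
  have hl : 1408/1000*Real.log 4 - 69/100*(717/10000) ≤ Real.log (672/100) := by
    have h4 : Real.log 4 = 2*Real.log 2 := by
      rw [show (4:ℝ) = 2^2 by norm_num, Real.log_pow]; norm_num
    have ha : 352/125*Real.log 2 ≤ Real.log (705/100) := by
      have : (352:ℕ)*Real.log 2 ≤ (125:ℕ)*Real.log (705/100) := by
        rw [← Real.log_pow, ← Real.log_pow]
        apply Real.log_le_log (by positivity)
        norm_num
      push_cast at this
      linarith
    have hb : Real.log (705/100) - 69/100*(717/10000) ≤ Real.log (672/100) := by
      have : Real.log ((705/100)/(672/100)) ≤ (705/100)/(672/100) - 1 := Real.log_le_sub_one_of_pos (by norm_num)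
      rw [Real.log_div (by norm_num) (by norm_num)] at this
      linarith
    rw [h4]; linarith
  have hfin : Real.log ‖(riemannZeta ((1+y:ℝ)+t*Complex.I))⁻¹‖ ≤ Real.log (672/100 * ‖(riemannZeta ((1+(717/10000)/L:ℝ)+t*Complex.I))⁻¹‖) := by
    rw [Real.log_mul (by norm_num) (by rw [norm_ne_zero_iff]; exact inv_ne_zero hz2), norm_inv, norm_inv, Real.log_inv, Real.log_inv]
    linarith
  refine (Real.log_le_log_iff ?_ ?_).mp hfin
  · rw [norm_pos_iff]; exact inv_ne_zero hz1
  · have : 0 < ‖(riemannZeta ((1+(717/10000)/L:ℝ)+t*Complex.I))⁻¹‖ := norm_pos_iff.mpr (inv_ne_zero hz2)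
    positivity

lemma inv_zeta_B {L : ℝ} (hL : 20 ≤ L) {s : ℂ} (hσ0 : 1-(239/10000)*(3/4)/L ≤ s.re) (hσ1 : s.re ≤ 2)
    (ht1 : 3*|s.im|+7 ≤ Real.exp L) : ‖iz s‖ ≤ 64*(1+14*L) := by
  have hL0 : 0 < L := by linarith
  have hsm : (239/10000)*(3/4)/L ≤ 1/10 := by rw [div_le_iff₀ hL0]; linarith
  rcases le_or_gt |s.im| (21/10) with hlow | hhi
  · have := iz_low (s := s) (by linarith) (by linarith) hlow
    linarith
  have hs : s ≠ 1 := by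
    rintro rfl
    rw [Complex.one_im, abs_zero] at hhi; norm_num at hhi
  rw [iz_eq hs]
  set y := s.re - 1 with hy
  have hη0 : 0 < (239/10000)/L := by positivity
  have e34 : (239/10000)*(3/4)/L = 3/4*((239/10000)/L) := by ring
  rw [e34] at hσ0
  have hy0 : -(3/4*((239/10000)/L)) ≤ y := by linarith
  have hxp : 0 < (717/10000)/L := by positivity
  rcases lt_or_ge ((717/10000)/L) y with hbig | hyx
  · have := norm_inv_zeta_le (s := s) (by linarith) (by linarith)
    refine this.trans ?_
    have h1 : 1/(s.re-1) ≤ 1/((717/10000)/L) := by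
      apply one_div_le_one_div_of_le hxp hbig.le
    rw [one_div_div] at h1
    have : L/(717/10000) ≤ 14*L := by
      rw [div_le_iff₀ (by norm_num)]; linarith
    linarith
  have h := inv_zeta_harnack hL hhi.le ht1 (y := y) (by linarith) (by linarith)
  have e1 : (((1+y:ℝ):ℂ)+s.im*Complex.I) = s := by
    apply Complex.ext <;> simp [hy]
  rw [e1] at h
  have e2 : (717/10000)/L+(239/10000)/L = 16*((239/10000)/L/4) := by ring
  have hq : 0 < (239/10000)/L/4 := by positivity
  rw [e2, Real.log_mul (by norm_num) hq.ne'] at h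
  have hlogy : Real.log ((239/10000)/L/4) ≤ Real.log (y+(239/10000)/L) :=
    Real.log_le_log hq (by linarith)
  have hly : 69/100*L*y ≤ 69/100*L*((717/10000)/L) := by
    apply mul_le_mul_of_nonneg_left _ (by positivity); linarith
  have hz2 : riemannZeta ((1+(717/10000)/L:ℝ)+s.im*Complex.I) ≠ 0 := riemannZeta_ne_zero_of_one_le_re (by simp; positivity)
  have hz1 : riemannZeta s ≠ 0 := by
    apply zero_free hL _ (by linarith)
    have : 3/4*((239/10000)/L) ≤ (39/1000)/L := by
      rw [← mul_div_assoc]; exact div_le_div_of_nonneg_right (by norm_num) hL0.le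
    linarith
  have hz3 : -Real.log ‖riemannZeta ((1+(717/10000)/L:ℝ)+s.im*Complex.I)‖ ≤ Real.log (1+14*L) := by
    rw [← Real.log_inv, ← norm_inv]
    apply Real.log_le_log
    · rw [norm_pos_iff]; exact inv_ne_zero hz2
    · have := norm_inv_zeta_le (s := ((1+(717/10000)/L:ℝ)+s.im*Complex.I)) (by simp; positivity) (by
        simp
        have : (717/10000)/L ≤ 1 := by rw [div_le_iff₀ hL0]; linarith
        linarith)
      refine this.trans ?_
      have e : (((1+(717/10000)/L:ℝ):ℂ)+s.im*Complex.I).re - 1 = (717/10000)/L := by simp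
      rw [e, one_div_div]
      have : L/(717/10000) ≤ 14*L := by
        rw [div_le_iff₀ (by norm_num)]; linarith
      linarith
  have h64 : 1408/1000*Real.log 16 ≤ Real.log 64 := by
    have h4 : Real.log 16 = 4*Real.log 2 := by
      rw [show (16:ℝ) = 2^4 by norm_num, Real.log_pow]; norm_num
    have h6 : Real.log 64 = 6*Real.log 2 := by
      rw [show (64:ℝ) = 2^6 by norm_num, Real.log_pow]; norm_num
    have := Real.log_pos (by norm_num : (1:ℝ) < 2)
    rw [h4, h6]; linarith
  have hfin : Real.log ‖(riemannZeta s)⁻¹‖ ≤ Real.log (64*(1+14*L)) := by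
    rw [Real.log_mul (by norm_num) (by positivity), norm_inv, Real.log_inv]
    linarith
  exact (Real.log_le_log_iff (norm_pos_iff.mpr (inv_ne_zero hz1)) (by positivity)).mp hfin

-- Part F1
/-- Incomplete Gaussian integral. -/
noncomputable def gQ (T y : ℝ) : ℝ := ∫ w in (0:ℝ)..y, Real.exp (-(T^2*w^2/2))

lemma gQ_cont (T : ℝ) : Continuous (fun w : ℝ => Real.exp (-(T^2*w^2/2))) := by fun_prop

lemma gQ_zero (T : ℝ) : gQ T 0 = 0 := by simp [gQ]

lemma gQ_sub {T a b : ℝ} (ha : 0 ≤ a) (hab : a ≤ b) :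
    (b-a)*Real.exp (-(T^2*b^2/2)) ≤ gQ T b - gQ T a := by
  unfold gQ
  rw [intervalIntegral.integral_interval_sub_left ((gQ_cont T).intervalIntegrable _ _) ((gQ_cont T).intervalIntegrable _ _)]
  rw [← smul_eq_mul, ← intervalIntegral.integral_const]
  apply intervalIntegral.integral_mono_on hab (by simp) ((gQ_cont T).intervalIntegrable _ _)
  intro w hw
  apply Real.exp_le_exp.mpr
  have : w^2 ≤ b^2 := by
    apply pow_le_pow_left₀ (by linarith [hw.1]) hw.2
  nlinarith [mul_le_mul_of_nonneg_left this (sq_nonneg T)]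

lemma gQ_mono {T a b : ℝ} (ha : 0 ≤ a) (hab : a ≤ b) : gQ T a ≤ gQ T b := by
  have := gQ_sub (T := T) ha hab
  have h2 : 0 ≤ (b-a)*Real.exp (-(T^2*b^2/2)) := mul_nonneg (by linarith) (Real.exp_pos _).le
  linarith

lemma gQ_nonneg {T a : ℝ} (ha : 0 ≤ a) : 0 ≤ gQ T a := by
  have := gQ_mono (T := T) le_rfl ha
  rwa [gQ_zero] at this

lemma gQ_le {T y : ℝ} (hT : 0 < T) (hy : 0 ≤ y) : gQ T y ≤ Real.sqrt (Real.pi/2)/T := by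
  unfold gQ
  have h1 : (fun w : ℝ => Real.exp (-(T^2*w^2/2))) = fun w => Real.exp (-(T^2/2)*w^2) := by
    ext w; congr 1; ring
  rw [h1, intervalIntegral.integral_of_le hy]
  have hi : MeasureTheory.Integrable (fun w : ℝ => Real.exp (-(T^2/2)*w^2)) := integrable_exp_neg_mul_sq (by positivity)
  calc _ ≤ ∫ w in Set.Ioi (0:ℝ), Real.exp (-(T^2/2)*w^2) := by
        apply MeasureTheory.setIntegral_mono_set hi.integrableOn
        · exact Filter.Eventually.of_forall (fun w => (Real.exp_pos _).le)
        · exact (Set.Ioc_subset_Ioi_self).eventuallyLE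
    _ = Real.sqrt (Real.pi/2)/T := by
        rw [integral_gaussian_Ioi]
        have : Real.pi/(T^2/2) = Real.pi/2*(2/T)^2 := by field_simp
        rw [this, Real.sqrt_mul (by positivity), Real.sqrt_sq (by positivity)]
        field_simp

lemma sqrt_pi_half : Real.sqrt (Real.pi/2) ≤ 12535/10000 := by
  rw [Real.sqrt_le_left (by norm_num)]
  have := Real.pi_lt_d4
  norm_num; linarith

/-- `τ e^{-τ²/2} ≤ e^{-1/2}`. -/
lemma tau_exp (τ : ℝ) : τ*Real.exp (-(τ^2/2)) ≤ 607/1000 := by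
  have h1 : τ ≤ Real.exp (τ-1) := by have := Real.add_one_le_exp (τ-1); linarith
  calc τ*Real.exp (-(τ^2/2)) ≤ Real.exp (τ-1)*Real.exp (-(τ^2/2)) := by gcongr
    _ = Real.exp (τ-1-τ^2/2) := by rw [← Real.exp_add]; ring_nf
    _ ≤ Real.exp (-(1/2)) := by apply Real.exp_le_exp.mpr; nlinarith [sq_nonneg (τ-1)]
    _ ≤ 607/1000 := by
      rw [Real.exp_neg]
      rw [inv_le_comm₀ (Real.exp_pos _) (by norm_num)]
      have : (607/1000:ℝ)⁻¹^2 ≤ (Real.exp (1/2))^2 := by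
        rw [← Real.exp_nat_mul]
        have := Real.exp_one_gt_d9
        norm_num at this ⊢
        linarith
      exact le_of_sq_le_sq this (Real.exp_pos _).le

/-- Right hand part of the inner sum. -/
lemma mv_right {T x : ℝ} (hT : 0 < T) (hx : 0 ≤ x) {M : ℕ} (hM : 1 ≤ M) (r : ℕ) :
    ∑ i ∈ range r, (if M < 2*i+1 then ((2*i+1:ℕ):ℝ)^(-1-x)*Real.exp (-(T^2*(Real.log (2*i+1:ℕ)-Real.log M)^2/2)) else 0)
      ≤ (M:ℝ)^(-x)*((931/1000)/T) := by
  have hM0 : (0:ℝ) < M := by exact_mod_cast hM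
  set C := (M:ℝ)^(-x) with hC
  have hC0 : 0 < C := Real.rpow_pos_of_pos hM0 _
  set w : ℕ → ℝ := fun m => Real.log ((max m M : ℕ):ℝ) - Real.log M with hw
  have hw0 : ∀ m, 0 ≤ w m := by
    intro m
    simp only [hw]
    rw [sub_nonneg]
    apply Real.log_le_log hM0
    exact_mod_cast le_max_right m M
  -- term bound
  have key : ∀ i ∈ range r, (if M < 2*i+1 then ((2*i+1:ℕ):ℝ)^(-1-x)*Real.exp (-(T^2*(Real.log (2*i+1:ℕ)-Real.log M)^2/2)) else 0)
      ≤ 1/2*C*(gQ T (w (2*(i+1)-1)) - gQ T (w (2*i-1))) + (if 2*i = M then 1/2*C*((607/1000)/T) else 0) := by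
    intro i _
    split_ifs with h1 h2
    · -- M even
      set m : ℕ := 2*i+1 with hm
      have hmM : m = M+1 := by omega
      have e1 : 2*(i+1)-1 = m := by omega
      have e2 : w (2*i-1) = 0 := by
        simp only [hw]; rw [max_eq_right (by omega)]; simp
      have e3 : w m = Real.log m - Real.log M := by
        simp only [hw]; rw [max_eq_left (by omega)]
      rw [e1, e2, gQ_zero]
      have hg := gQ_sub (T := T) le_rfl (hw0 m)
      rw [gQ_zero, e3] at hg
      rw [e3]
      set E := Real.exp (-(T^2*(Real.log m-Real.log M)^2/2)) with hE
      have hE0 : 0 < E := Real.exp_pos _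
      have hm0 : (0:ℝ) < m := by positivity
      have hlog : 1/(m:ℝ) ≤ Real.log m - Real.log M := by
        rw [← Real.log_div hm0.ne' hM0.ne']
        have := Real.one_sub_inv_le_log_of_pos (x := (m:ℝ)/M) (by positivity)
        rw [inv_div] at this
        have h3 : 1-(M:ℝ)/m = 1/m := by
          rw [hmM]; push_cast; field_simp; ring
        linarith
      have hpow : (m:ℝ)^(-1-x) ≤ (1/m)*C := by
        rw [sub_eq_add_neg, Real.rpow_add hm0, Real.rpow_neg_one, one_div]
        apply mul_le_mul_of_nonneg_left _ (by positivity)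
        apply Real.rpow_le_rpow_of_nonpos hM0 _ (by linarith)
        exact_mod_cast (by omega : M ≤ m)
      have hq : (m:ℝ)^(-1-x)*E ≤ C*((1/m)*E) := by
        calc _ ≤ (1/m)*C*E := by gcongr
          _ = _ := by ring
      have ha : (1/m)*E ≤ gQ T (Real.log m - Real.log M) := by
        have : (1/m)*E ≤ (Real.log m - Real.log M - 0)*E := by gcongr; linarith
        linarith
      have hb : (1/m)*E ≤ (607/1000)/T := by
        rw [le_div_iff₀ hT]
        calc (1/m)*E*T = (T/m)*E := by ring
          _ ≤ (T/m)*Real.exp (-((T/m)^2/2)) := by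
            gcongr
            apply Real.exp_le_exp.mpr
            have : (1/(m:ℝ))^2 ≤ (Real.log m - Real.log M)^2 := pow_le_pow_left₀ (by positivity) hlog 2
            have := mul_le_mul_of_nonneg_left this (sq_nonneg T)
            have e : (T/m)^2 = T^2*(1/m)^2 := by ring
            rw [e]; linarith
          _ ≤ _ := tau_exp _
      calc _ ≤ C*((1/m)*E) := hq
        _ = 1/2*C*((1/m)*E)+1/2*C*((1/m)*E) := by ring
        _ ≤ _ := by rw [sub_zero]; gcongr
    · set m : ℕ := 2*i+1 with hm
      have e1 : 2*(i+1)-1 = m := by omega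
      have e3 : w m = Real.log m - Real.log M := by
        simp only [hw]; rw [max_eq_left (by omega)]
      have hi : M ≤ 2*i-1 := by omega
      have e2 : w (2*i-1) = Real.log ((2*i-1:ℕ):ℝ) - Real.log M := by
        simp only [hw]; rw [max_eq_left hi]
      have hm0 : (0:ℝ) < m := by positivity
      have hm20 : (0:ℝ) < ((2*i-1:ℕ):ℝ) := by exact_mod_cast (by omega : 0 < 2*i-1)
      have hlog : 2/(m:ℝ) ≤ w m - w (2*i-1) := by
        rw [e2, e3, sub_sub_sub_cancel_right, ← Real.log_div hm0.ne' hm20.ne']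
        have := Real.one_sub_inv_le_log_of_pos (x := (m:ℝ)/((2*i-1:ℕ):ℝ)) (by positivity)
        rw [inv_div] at this
        have h3 : 1-((2*i-1:ℕ):ℝ)/m = 2/m := by
          have : (m:ℝ) = ((2*i-1:ℕ):ℝ)+2 := by exact_mod_cast (by omega : m = 2*i-1+2)
          rw [this] at hm0 ⊢; field_simp; ring
        linarith
      have hle : w (2*i-1) ≤ w m := by
        have : 0 < 2/(m:ℝ) := by positivity
        linarith
      have hg := gQ_sub (T := T) (hw0 (2*i-1)) hle
      rw [e1, add_zero]
      rw [← e3]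
      set E := Real.exp (-(T^2*(w m)^2/2)) with hE
      have hE0 : 0 < E := Real.exp_pos _
      have hpow : (m:ℝ)^(-1-x) ≤ (1/m)*C := by
        rw [sub_eq_add_neg, Real.rpow_add hm0, Real.rpow_neg_one, one_div]
        apply mul_le_mul_of_nonneg_left _ (by positivity)
        apply Real.rpow_le_rpow_of_nonpos hM0 _ (by linarith)
        exact_mod_cast (by omega : M ≤ m)
      calc (m:ℝ)^(-1-x)*E ≤ (1/m)*C*E := by gcongr
        _ = 1/2*C*((2/m)*E) := by ring
        _ ≤ 1/2*C*((w m - w (2*i-1))*E) := by gcongr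
        _ ≤ _ := by gcongr
    · have : gQ T (w (2*i-1)) ≤ gQ T (w (2*(i+1)-1)) := by
        apply gQ_mono (hw0 _)
        simp only [hw]
        gcongr 1
        apply Real.log_le_log
        · exact_mod_cast lt_max_of_lt_right hM
        · exact_mod_cast max_le_max (by omega) le_rfl
      have h5 : 0 ≤ 1/2*C*(gQ T (w (2*(i+1)-1)) - gQ T (w (2*i-1))) := by
        apply mul_nonneg (by positivity); linarith
      have : 0 ≤ 1/2*C*((607/1000)/T) := by positivity
      linarith
    · have : gQ T (w (2*i-1)) ≤ gQ T (w (2*(i+1)-1)) := by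
        apply gQ_mono (hw0 _)
        simp only [hw]
        gcongr 1
        apply Real.log_le_log
        · exact_mod_cast lt_max_of_lt_right hM
        · exact_mod_cast max_le_max (by omega) le_rfl
      have h5 : 0 ≤ 1/2*C*(gQ T (w (2*(i+1)-1)) - gQ T (w (2*i-1))) := by
        apply mul_nonneg (by positivity); linarith
      linarith
  refine (Finset.sum_le_sum key).trans ?_
  rw [Finset.sum_add_distrib, ← Finset.mul_sum, Finset.sum_range_sub (fun i => gQ T (w (2*i-1)))]
  have h1 : ∑ i ∈ range r, (if 2*i = M then 1/2*C*((607/1000)/T) else 0) ≤ 1/2*C*((607/1000)/T) := by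
    have : ∀ i, (2*i = M) → i = M/2 := by intro i h; omega
    calc _ ≤ ∑ i ∈ range r, (if i = M/2 then 1/2*C*((607/1000)/T) else 0) := by
          apply Finset.sum_le_sum; intro i _
          split_ifs with h1 h2 h2
          · exact le_rfl
          · exact absurd (this i h1) h2
          · positivity
          · exact le_rfl
      _ ≤ _ := by
          rw [Finset.sum_ite_eq']
          split_ifs
          · exact le_rfl
          · positivity
  have h2 : gQ T (w (2*r-1)) ≤ (12535/10000)/T := (gQ_le hT (hw0 _)).trans (by gcongr; exact sqrt_pi_half)
  have h3 : 0 ≤ gQ T (w (2*0-1)) := gQ_nonneg (hw0 _)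
  calc _ ≤ 1/2*C*((12535/10000)/T) + 1/2*C*((607/1000)/T) := by gcongr; linarith
    _ ≤ C*((931/1000)/T) := by
      have : 1/2*C*((12535/10000)/T) + 1/2*C*((607/1000)/T) = C/T*(930.25/1000) := by ring
      rw [this]
      have h6 : C*((931/1000)/T) = C/T*(931/1000) := by ring
      rw [h6]
      have : 0 < C/T := by positivity
      gcongr; norm_num

-- Part F2
lemma mv_left_term {T x : ℝ} (hT : 5000 ≤ T) (hx1 : x ≤ 1) {M m : ℕ} (hm : 1 ≤ m) (hmM : m < M) :
    (m:ℝ)^(-1-x)*Real.exp (-(T^2*(Real.log m-Real.log M)^2/2)) ≤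
      1001/1000*(M:ℝ)^(-x)*(1/((m:ℝ)+1)*Real.exp (-((9998/10000*T)^2*(Real.log M-Real.log m)^2/2))) := by
  have hm0 : (0:ℝ) < m := by exact_mod_cast hm
  have hm1 : (1:ℝ) ≤ m := by exact_mod_cast hm
  have hM0 : (0:ℝ) < M := by exact_mod_cast (by omega : 0 < M)
  have hmM' : (m:ℝ)+1 ≤ M := by exact_mod_cast hmM
  set w := Real.log M - Real.log m with hw
  have hw1 : 1/(M:ℝ) ≤ w := by
    rw [hw, ← Real.log_div hM0.ne' hm0.ne']
    have := Real.one_sub_inv_le_log_of_pos (x := (M:ℝ)/m) (by positivity)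
    rw [inv_div] at this
    have h2 : 1/(M:ℝ) ≤ 1 - m/M := by
      rw [one_sub_div hM0.ne']; gcongr; linarith
    linarith
  have hw0 : 0 < w := lt_of_lt_of_le (by positivity) hw1
  have hMm : (M:ℝ) = m*Real.exp w := by
    rw [hw, Real.exp_sub, Real.exp_log hM0, Real.exp_log hm0]; field_simp
  have h3w : 1/(m:ℝ) ≤ 3*w := by
    rcases le_or_gt (1/3) w with h | h
    · have : 1/(m:ℝ) ≤ 1 := by rw [div_le_one hm0]; exact hm1
      linarith
    · have e : 1/(m:ℝ) = Real.exp w*(1/M) := by rw [hMm]; field_simp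
      rw [e]
      have : Real.exp w ≤ 3 := by
        have h1 := Real.exp_le_exp.mpr (by linarith : w ≤ 1)
        have := Real.exp_one_lt_d9
        linarith
      exact mul_le_mul this hw1 (by positivity) (by norm_num)
  have hpow : (m:ℝ)^(-1-x) = (1/m)*((M:ℝ)^(-x)*Real.exp (x*w)) := by
    rw [sub_eq_add_neg, Real.rpow_add hm0, Real.rpow_neg_one, one_div]
    congr 1
    rw [Real.rpow_def_of_pos hm0, Real.rpow_def_of_pos hM0, ← Real.exp_add]
    congr 1; rw [hw]; ring
  have h1m : 1/(m:ℝ) ≤ 1/((m:ℝ)+1)*Real.exp (3*w) := by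
    have h1 : 1+1/(m:ℝ) ≤ Real.exp (3*w) := by
      have := Real.add_one_le_exp (3*w); linarith
    calc 1/(m:ℝ) = 1/((m:ℝ)+1)*(1+1/m) := by field_simp
      _ ≤ _ := mul_le_mul_of_nonneg_left h1 (by positivity)
  have hsq : (Real.log m - Real.log M)^2 = w^2 := by rw [hw]; ring
  rw [hsq, hpow]
  have hexp : Real.exp (3*w)*Real.exp (x*w)*Real.exp (-(T^2*w^2/2)) ≤ 1001/1000*Real.exp (-((9998/10000*T)^2*w^2/2)) := by
    have h1 : (1001/1000:ℝ) ≥ Real.exp (9/10000) := by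
      have := Real.exp_bound_div_one_sub_of_interval (x := 9/10000) (by norm_num) (by norm_num)
      refine this.trans ?_
      norm_num
    calc _ = Real.exp (3*w+x*w-T^2*w^2/2) := by rw [← Real.exp_add, ← Real.exp_add]; ring_nf
      _ ≤ Real.exp (9/10000 + -((9998/10000*T)^2*w^2/2)) := by
        apply Real.exp_le_exp.mpr
        have hxw : x*w ≤ w := by nlinarith
        have hTw : (5000*w)^2 ≤ (T*w)^2 := by
          apply pow_le_pow_left₀ (by positivity); gcongr
        nlinarith [sq_nonneg (w - 4/10000)]
      _ ≤ _ := by rw [Real.exp_add]; gcongr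
  have hMx : 0 < (M:ℝ)^(-x) := Real.rpow_pos_of_pos hM0 _
  calc 1/(m:ℝ)*((M:ℝ)^(-x)*Real.exp (x*w))*Real.exp (-(T^2*w^2/2))
      ≤ (1/((m:ℝ)+1)*Real.exp (3*w))*((M:ℝ)^(-x)*Real.exp (x*w))*Real.exp (-(T^2*w^2/2)) := by gcongr
    _ = (1/((m:ℝ)+1))*(M:ℝ)^(-x)*(Real.exp (3*w)*Real.exp (x*w)*Real.exp (-(T^2*w^2/2))) := by ring
    _ ≤ (1/((m:ℝ)+1))*(M:ℝ)^(-x)*(1001/1000*Real.exp (-((9998/10000*T)^2*w^2/2))) := by gcongr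
    _ = _ := by ring

/-- Left hand part of the inner sum. -/
lemma mv_left {T x : ℝ} (hT : 5000 ≤ T) (hx1 : x ≤ 1) {M : ℕ} (hM : 1 ≤ M) (r : ℕ) :
    ∑ i ∈ range r, (if 2*i+1 < M then ((2*i+1:ℕ):ℝ)^(-1-x)*Real.exp (-(T^2*(Real.log (2*i+1:ℕ)-Real.log M)^2/2)) else 0)
      ≤ (M:ℝ)^(-x)*((933/1000)/T) := by
  have hM0 : (0:ℝ) < M := by exact_mod_cast hM
  have hT0 : 0 < T := by linarith
  set S := 9998/10000*T with hS
  have hS0 : 0 < S := by positivity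
  set C := 1001/1000*(M:ℝ)^(-x) with hC
  have hC0 : 0 < C := by have := Real.rpow_pos_of_pos hM0 (-x); positivity
  set v : ℕ → ℝ := fun m => Real.log M - Real.log ((min m M : ℕ):ℝ) with hv
  have hv0 : ∀ i, 0 ≤ v (2*i+1) := by
    intro i
    simp only [hv]
    rw [sub_nonneg]
    apply Real.log_le_log
    · exact_mod_cast (by omega : 0 < min (2*i+1) M)
    · exact_mod_cast min_le_right _ M
  have hvm : ∀ i, v (2*(i+1)+1) ≤ v (2*i+1) := by
    intro i
    simp only [hv]
    gcongr 1
    apply Real.log_le_log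
    · exact_mod_cast (by omega : 0 < min (2*i+1) M)
    · exact_mod_cast min_le_min (by omega) le_rfl
  have key : ∀ i ∈ range r, (if 2*i+1 < M then ((2*i+1:ℕ):ℝ)^(-1-x)*Real.exp (-(T^2*(Real.log (2*i+1:ℕ)-Real.log M)^2/2)) else 0)
      ≤ 1/2*C*(gQ S (v (2*i+1)) - gQ S (v (2*(i+1)+1))) + (if 2*i+2 = M then 1/2*C*((607/1000)/S) else 0) := by
    intro i _
    split_ifs with h1 h2
    · set m : ℕ := 2*i+1 with hm
      have hmM : M = m+1 := by omega
      have e2 : v (2*(i+1)+1) = 0 := by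
        simp only [hv]; rw [min_eq_right (by omega)]; simp
      have e3 : v m = Real.log M - Real.log m := by
        simp only [hv]; rw [min_eq_left (by omega)]
      rw [e2, gQ_zero]
      have hg := gQ_sub (T := S) le_rfl (hv0 i)
      have hm0 : (0:ℝ) < m := by positivity
      have ht := mv_left_term hT hx1 (by omega : 1 ≤ m) h1
      rw [← e3] at ht
      change (v m - 0)*_ ≤ gQ S (v m) - _ at hg
      rw [gQ_zero] at hg
      have hM' : (M:ℝ) = m+1 := by exact_mod_cast hmM
      have hlog : 1/((m:ℝ)+1) ≤ v m := by
        rw [e3, ← Real.log_div hM0.ne' hm0.ne']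
        have := Real.one_sub_inv_le_log_of_pos (x := (M:ℝ)/m) (by positivity)
        rw [inv_div] at this
        have h3 : 1-(m:ℝ)/M = 1/(m+1) := by
          rw [hM']; field_simp; ring
        linarith
      set E := Real.exp (-(S^2*(v m)^2/2)) with hE
      have hE0 : 0 < E := Real.exp_pos _
      have ha : (1/((m:ℝ)+1))*E ≤ gQ S (v m) := by
        have : (1/((m:ℝ)+1))*E ≤ (v m - 0)*E := by gcongr; linarith
        linarith
      have hb : (1/((m:ℝ)+1))*E ≤ (607/1000)/S := by
        rw [le_div_iff₀ hS0]
        calc (1/((m:ℝ)+1))*E*S = (S/(m+1))*E := by ring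
          _ ≤ (S/(m+1))*Real.exp (-((S/(m+1))^2/2)) := by
            gcongr
            apply Real.exp_le_exp.mpr
            have : (1/((m:ℝ)+1))^2 ≤ (v m)^2 := pow_le_pow_left₀ (by positivity) hlog 2
            have := mul_le_mul_of_nonneg_left this (sq_nonneg S)
            have e : (S/((m:ℝ)+1))^2 = S^2*(1/(m+1))^2 := by ring
            rw [e]; linarith
          _ ≤ _ := tau_exp _
      calc _ ≤ C*((1/((m:ℝ)+1))*E) := ht
        _ = 1/2*C*((1/((m:ℝ)+1))*E)+1/2*C*((1/((m:ℝ)+1))*E) := by ring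
        _ ≤ _ := by rw [sub_zero]; gcongr
    · set m : ℕ := 2*i+1 with hm
      have e1 : 2*(i+1)+1 = m+2 := by omega
      have e3 : v m = Real.log M - Real.log m := by
        simp only [hv]; rw [min_eq_left (by omega)]
      have e2 : v (m+2) = Real.log M - Real.log (m+2:ℕ) := by
        simp only [hv]; rw [min_eq_left (by omega)]
      have hm0 : (0:ℝ) < m := by positivity
      have ht := mv_left_term hT hx1 (by omega : 1 ≤ m) h1
      rw [← e3] at ht
      have hlog : 2*(1/((m:ℝ)+1)) ≤ v m - v (m+2) := by
        rw [e2, e3, sub_sub_sub_cancel_left, ← Real.log_div (by positivity) hm0.ne']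
        have := Real.le_log_one_add_of_nonneg (x := 2/(m:ℝ)) (by positivity)
        have h3 : 1+2/(m:ℝ) = ((m+2:ℕ):ℝ)/m := by push_cast; field_simp
        have h4 : 2*(2/(m:ℝ))/(2/m+2) = 2*(1/((m:ℝ)+1)) := by field_simp; ring
        rw [h3, h4] at this
        exact this
      have hv2 : 0 ≤ v (m+2) := by have := hv0 (i+1); rwa [e1] at this
      have hle : v (m+2) ≤ v m := by have := hvm i; rwa [e1] at this
      have hg := gQ_sub (T := S) hv2 hle
      rw [e1, add_zero]
      set E := Real.exp (-(S^2*(v m)^2/2)) with hE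
      have hE0 : 0 < E := Real.exp_pos _
      calc _ ≤ C*((1/((m:ℝ)+1))*E) := ht
        _ = 1/2*C*((2*(1/((m:ℝ)+1)))*E) := by ring
        _ ≤ 1/2*C*((v m - v (m+2))*E) := by gcongr
        _ ≤ _ := by gcongr
    · have := gQ_mono (T := S) (hv0 (i+1)) (hvm i)
      have h5 : 0 ≤ 1/2*C*(gQ S (v (2*i+1)) - gQ S (v (2*(i+1)+1))) := by
        apply mul_nonneg (by positivity); linarith
      have : 0 ≤ 1/2*C*((607/1000)/S) := by positivity
      linarith
    · have := gQ_mono (T := S) (hv0 (i+1)) (hvm i)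
      have h5 : 0 ≤ 1/2*C*(gQ S (v (2*i+1)) - gQ S (v (2*(i+1)+1))) := by
        apply mul_nonneg (by positivity); linarith
      linarith
  refine (Finset.sum_le_sum key).trans ?_
  rw [Finset.sum_add_distrib, ← Finset.mul_sum, Finset.sum_range_sub' (fun i => gQ S (v (2*i+1)))]
  have h1 : ∑ i ∈ range r, (if 2*i+2 = M then 1/2*C*((607/1000)/S) else 0) ≤ 1/2*C*((607/1000)/S) := by
    have : ∀ i, (2*i+2 = M) → i = (M-2)/2 := by intro i h; omega
    calc _ ≤ ∑ i ∈ range r, (if i = (M-2)/2 then 1/2*C*((607/1000)/S) else 0) := by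
          apply Finset.sum_le_sum; intro i _
          split_ifs with h1 h2 h2
          · exact le_rfl
          · exact absurd (this i h1) h2
          · positivity
          · exact le_rfl
      _ ≤ _ := by
          rw [Finset.sum_ite_eq']
          split_ifs
          · exact le_rfl
          · positivity
  have h2 : gQ S (v (2*0+1)) ≤ (12535/10000)/S := (gQ_le hS0 (hv0 _)).trans (by gcongr; exact sqrt_pi_half)
  have h3 : 0 ≤ gQ S (v (2*r+1)) := gQ_nonneg (hv0 _)
  calc _ ≤ 1/2*C*((12535/10000)/S) + 1/2*C*((607/1000)/S) := by gcongr; linarith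
    _ ≤ (M:ℝ)^(-x)*((933/1000)/T) := by
      have hMx : 0 < (M:ℝ)^(-x) := Real.rpow_pos_of_pos hM0 _
      have : 1/2*C*((12535/10000)/S) + 1/2*C*((607/1000)/S) = (M:ℝ)^(-x)/T*(1001/1000*(930.25/1000)/(9998/10000)) := by
        rw [hC, hS]; field_simp; ring
      rw [this]
      have h6 : (M:ℝ)^(-x)*((933/1000)/T) = (M:ℝ)^(-x)/T*(933/1000) := by ring
      rw [h6]
      exact mul_le_mul_of_nonneg_left (by norm_num) (by positivity)

lemma mv_inner {T x : ℝ} (hT : 5000 ≤ T) (hx : 0 ≤ x) (hx1 : x ≤ 1) {M : ℕ} (hM : 1 ≤ M) (r : ℕ) :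
    ∑ i ∈ range r, (if 2*i+1 = M then 0 else ((2*i+1:ℕ):ℝ)^(-1-x)*Real.exp (-(T^2*(Real.log (2*i+1:ℕ)-Real.log M)^2/2)))
      ≤ (M:ℝ)^(-x)*((187/100)/T) := by
  have h1 := mv_left hT hx1 hM r
  have h2 := mv_right (by linarith : 0 < T) hx hM r
  have hM0 : (0:ℝ) < M := by exact_mod_cast hM
  have hMx : 0 < (M:ℝ)^(-x) := Real.rpow_pos_of_pos hM0 _
  have hs := add_le_add h1 h2
  rw [← Finset.sum_add_distrib] at hs
  calc _ ≤ _ := by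
        apply Finset.sum_le_sum
        intro i _
        have : 0 ≤ ((2*i+1:ℕ):ℝ)^(-1-x)*Real.exp (-(T^2*(Real.log (2*i+1:ℕ)-Real.log M)^2/2)) := by positivity
        rcases lt_trichotomy (2*i+1) M with h | h | h
        · rw [if_neg h.ne, if_pos h, if_neg (by omega), add_zero]
        · rw [if_pos h, if_neg (by omega), if_neg (by omega), add_zero]
        · rw [if_neg h.ne', if_neg (by omega), if_pos h, zero_add]
    _ ≤ _ := hs
    _ ≤ _ := by
      rw [← mul_add, ← add_div]
      have : 0 < T := by linarith
      gcongr; norm_num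

-- Part F3
/-- The sampling points. -/
noncomputable def tj (j : ℤ) : ℝ := (2*j+1)*Real.pi/Real.log 2

lemma summable_gauss {A l : ℝ} (hA : 0 < A) (hl : l ≠ 0) (θ : ℝ) :
    Summable (fun k : ℤ => Real.exp (-(A*(k*l-θ)^2))) := by
  have hτ : 0 < ((A*l^2/Real.pi:ℝ)*Complex.I).im := by
    simp only [Complex.mul_im, Complex.ofReal_re, Complex.I_im, mul_one, Complex.ofReal_im, Complex.I_re, mul_zero, add_zero]
    have := Real.pi_pos
    positivity
  have h := (summable_jacobiTheta₂_term_iff ((-(A*l*θ/Real.pi):ℝ)*Complex.I) ((A*l^2/Real.pi:ℝ)*Complex.I)).mpr hτ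
  have h2 := (h.norm).mul_left (Real.exp (-(A*θ^2)))
  refine h2.congr (fun k => ?_)
  rw [norm_jacobiTheta₂_term, ← Real.exp_add]
  congr 1
  simp only [Complex.mul_im, Complex.ofReal_re, Complex.I_im, mul_one, Complex.ofReal_im, Complex.I_re, mul_zero, add_zero]
  have := Real.pi_pos.ne'
  field_simp
  ring

lemma tj_eq (j : ℤ) : tj j = j*(2*Real.pi/Real.log 2) - (-(Real.pi/Real.log 2)) := by
  unfold tj; ring

lemma l2pos : 0 < Real.log 2 := Real.log_pos (by norm_num)

lemma summable_tj {T : ℝ} (hT : 0 < T) : Summable (fun j : ℤ => Real.exp (-((tj j)^2/(2*T^2)))) := by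
  have hl := l2pos
  have hp := Real.pi_pos
  refine (summable_gauss (A := 1/(2*T^2)) (l := 2*Real.pi/Real.log 2) (by positivity) (by positivity) (-(Real.pi/Real.log 2))).congr (fun j => ?_)
  rw [tj_eq]; congr 1; ring

lemma gp {T : ℝ} (hT : 0 < T) (θ : ℝ) :
    ‖∑' j : ℤ, Complex.exp (((-((tj j)^2/(2*T^2)):ℝ):ℂ) + ((θ*tj j:ℝ):ℂ)*Complex.I)‖ ≤
      Real.log 2/Real.sqrt (2*Real.pi)*T*∑' k : ℤ, Real.exp (-(T^2/2*(k*Real.log 2-θ)^2)) := by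
  have hl := l2pos
  have hp := Real.pi_pos
  set a : ℝ := 2*Real.pi/(Real.log 2^2*T^2) with ha
  have ha0 : 0 < a := by positivity
  have h := Complex.tsum_exp_neg_quadratic (a := (a:ℂ)) (by simpa using ha0) (((-(a/2):ℝ):ℂ)+((θ/Real.log 2:ℝ):ℂ)*Complex.I)
  have e1 : ∀ j : ℤ, Complex.exp (((-((tj j)^2/(2*T^2)):ℝ):ℂ) + ((θ*tj j:ℝ):ℂ)*Complex.I) =
      Complex.exp (((-(Real.pi*a/4):ℝ):ℂ) + ((θ*Real.pi/Real.log 2:ℝ):ℂ)*Complex.I) *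
      Complex.exp (-Real.pi*a*(j:ℂ)^2 + 2*Real.pi*(((-(a/2):ℝ):ℂ)+((θ/Real.log 2:ℝ):ℂ)*Complex.I)*j) := by
    intro j
    rw [← Complex.exp_add]
    congr 1
    apply Complex.ext
    · have h1 : (-((tj j)^2/(2*T^2))) = -(Real.pi*a/4) + (-Real.pi*a*(j:ℝ)^2 + 2*Real.pi*(-(a/2))*j) := by
        rw [ha]; unfold tj; field_simp; ring
      have e : ((j:ℂ)^2).re = (j:ℝ)^2 := by norm_cast
      have e' : ((j:ℂ)^2).im = 0 := by norm_cast
      simp only [Complex.add_im, Complex.mul_im, Complex.ofReal_im, Complex.ofReal_re, Complex.I_im, Complex.I_re, mul_zero, mul_one, zero_add, add_zero, Complex.neg_re, Complex.neg_im, Complex.mul_re, Complex.add_re, e, e', Complex.intCast_re, Complex.intCast_im, Complex.re_ofNat, Complex.im_ofNat, zero_mul, sub_zero, neg_zero]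
      rw [h1]
    · have h1 : θ*tj j = θ*Real.pi/Real.log 2 + 2*Real.pi*(θ/Real.log 2)*j := by
        unfold tj; field_simp; ring
      have e : ((j:ℂ)^2).re = (j:ℝ)^2 := by norm_cast
      have e' : ((j:ℂ)^2).im = 0 := by norm_cast
      have := congrArg (fun r : ℝ => (r:ℂ).re) h1
      simp only [Complex.ofReal_re] at this
      simp only [Complex.add_im, Complex.mul_im, Complex.ofReal_im, Complex.ofReal_re, Complex.I_im, Complex.I_re, mul_zero, mul_one, zero_add, add_zero, Complex.neg_re, Complex.neg_im, Complex.mul_re, Complex.add_re, e, e', Complex.intCast_re, Complex.intCast_im, Complex.re_ofNat, Complex.im_ofNat, zero_mul, sub_zero, neg_zero]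
      rw [this]
  rw [tsum_congr e1, tsum_mul_left, h]
  rw [norm_mul, norm_mul, Complex.norm_exp]
  have hre : ((((-(Real.pi*a/4):ℝ):ℂ) + ((θ*Real.pi/Real.log 2:ℝ):ℂ)*Complex.I)).re = -(Real.pi*a/4) := by
    rw [Complex.add_re, Complex.re_ofReal_mul, Complex.ofReal_re, Complex.I_re, mul_zero, add_zero]
  rw [hre]
  have hA : ‖1/(a:ℂ)^(1/2:ℂ)‖ = Real.log 2/Real.sqrt (2*Real.pi)*T := by
    rw [norm_div, norm_one]
    have : (a:ℂ)^(1/2:ℂ) = ((a^(1/2:ℝ):ℝ):ℂ) := by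
      rw [Complex.ofReal_cpow ha0.le]; norm_num
    rw [this, Complex.norm_real, ← Real.sqrt_eq_rpow, Real.norm_of_nonneg (Real.sqrt_nonneg _)]
    have : a = 2*Real.pi*(1/(Real.log 2*T))^2 := by rw [ha]; field_simp
    rw [this, Real.sqrt_mul (by positivity), Real.sqrt_sq (by positivity)]
    have : Real.sqrt (2*Real.pi) ≠ 0 := by positivity
    field_simp
  rw [hA]
  have hterm : ∀ k : ℤ, ‖Complex.exp (-Real.pi/a*((k:ℂ)+Complex.I*(((-(a/2):ℝ):ℂ)+((θ/Real.log 2:ℝ):ℂ)*Complex.I))^2)‖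
      = Real.exp (Real.pi*a/4)*Real.exp (-(T^2/2*(k*Real.log 2-θ)^2)) := by
    intro k
    rw [Complex.norm_exp, ← Real.exp_add]
    congr 1
    have e : ((k:ℂ)+Complex.I*(((-(a/2):ℝ):ℂ)+((θ/Real.log 2:ℝ):ℂ)*Complex.I)) = ((k-θ/Real.log 2:ℝ):ℂ) + ((-(a/2):ℝ):ℂ)*Complex.I := by
      push_cast
      ring_nf
      rw [Complex.I_sq]; ring
    have e2 : (-(Real.pi:ℂ)/a) = ((-Real.pi/a:ℝ):ℂ) := by push_cast; ring
    rw [e, e2, Complex.re_ofReal_mul, sq, Complex.mul_re]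
    simp only [Complex.add_re, Complex.add_im, Complex.ofReal_re, Complex.mul_re, Complex.mul_im, Complex.I_re, Complex.I_im, Complex.ofReal_im, mul_zero, mul_one, zero_add, add_zero, sub_zero]
    have : Real.pi/a = T^2/2*Real.log 2^2 := by rw [ha]; field_simp
    have h5 : -Real.pi/a*((k-θ/Real.log 2)*(k-θ/Real.log 2) - -(a/2)*-(a/2)) = -(Real.pi/a*(k-θ/Real.log 2)^2) + Real.pi*a/4 := by
      field_simp; ring
    rw [h5, this]
    field_simp
    ring
  have hsum : Summable (fun k : ℤ => ‖Complex.exp (-Real.pi/a*((k:ℂ)+Complex.I*(((-(a/2):ℝ):ℂ)+((θ/Real.log 2:ℝ):ℂ)*Complex.I))^2)‖) := by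
    simp only [hterm]
    exact (summable_gauss (by positivity) hl.ne' θ).mul_left _
  have h3 := norm_tsum_le_tsum_norm hsum
  simp only [hterm] at h3
  rw [tsum_mul_left] at h3
  calc Real.exp (-(Real.pi*a/4))*(Real.log 2/Real.sqrt (2*Real.pi)*T*_) ≤ Real.exp (-(Real.pi*a/4))*(Real.log 2/Real.sqrt (2*Real.pi)*T*(Real.exp (Real.pi*a/4)*∑' k : ℤ, Real.exp (-(T^2/2*(k*Real.log 2-θ)^2)))) := by
        gcongr
    _ = (Real.exp (-(Real.pi*a/4))*Real.exp (Real.pi*a/4))*(Real.log 2/Real.sqrt (2*Real.pi)*T*∑' k : ℤ, Real.exp (-(T^2/2*(k*Real.log 2-θ)^2))) := by ring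
    _ = _ := by rw [← Real.exp_add]; simp

-- Part F4
lemma odd_sum1 {x : ℝ} (hx : 0 < x) (r : ℕ) :
    ∑ i ∈ range (r+1), ((2*i+1:ℕ):ℝ)^(-1-2*x) ≤ 1+(1-((2*r+1:ℕ):ℝ)^(-(2*x)))/(4*x) := by
  induction r with
  | zero => simp
  | succ r ih =>
    rw [Finset.sum_range_succ]
    set m : ℝ := ((2*(r+1)+1:ℕ):ℝ) with hm
    have hm2 : ((2*r+1:ℕ):ℝ) = m-2 := by rw [hm]; push_cast; ring
    have hm3 : 3 ≤ m := by rw [hm]; push_cast; linarith [(Nat.cast_nonneg r : (0:ℝ) ≤ r)]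
    rw [hm2] at ih
    have hm0 : 0 < m := by linarith
    have key : m^(-(2*x))*(1+4*x/m) ≤ (m-2)^(-(2*x)) := by
      have e : m-2 = m*(1-2/m) := by field_simp
      have h1 : 0 < 1-2/m := by rw [sub_pos, div_lt_one hm0]; linarith
      rw [e, Real.mul_rpow hm0.le h1.le]
      apply mul_le_mul_of_nonneg_left _ (by positivity)
      rw [Real.rpow_def_of_pos h1]
      have h2 := Real.log_le_sub_one_of_pos h1
      have h3 := Real.add_one_le_exp (Real.log (1-2/m)*-(2*x))
      have h4 : 4*x/m ≤ Real.log (1-2/m)*-(2*x) := by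
        have : (1-2/m-1)*(-(2*x)) = 4*x/m := by ring
        rw [← this]
        apply mul_le_mul_of_nonpos_right h2 (by linarith)
      linarith
    have e2 : m^(-1-2*x) = m^(-(2*x))/m := by
      rw [sub_eq_add_neg, Real.rpow_add hm0, Real.rpow_neg_one]; ring
    have h5 : m^(-1-2*x) ≤ ((m-2)^(-(2*x)) - m^(-(2*x)))/(4*x) := by
      rw [le_div_iff₀ (by positivity), e2]
      have : m^(-(2*x))/m*(4*x) = m^(-(2*x))*(1+4*x/m) - m^(-(2*x)) := by ring
      linarith
    have h6 : 1+(1-(m-2)^(-(2*x)))/(4*x) + ((m-2)^(-(2*x)) - m^(-(2*x)))/(4*x) = 1+(1-m^(-(2*x)))/(4*x) := by ring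
    linarith

lemma odd_sum1' {x : ℝ} (hx : 0 < x) (r : ℕ) :
    ∑ i ∈ range r, ((2*i+1:ℕ):ℝ)^(-1-2*x) ≤ 1+1/(4*x) := by
  have h := odd_sum1 hx r
  rw [Finset.sum_range_succ] at h
  have h1 : 0 ≤ ((2*r+1:ℕ):ℝ)^(-1-2*x) := by positivity
  have h2 : 0 ≤ ((2*r+1:ℕ):ℝ)^(-(2*x)) := by positivity
  have h3 : (1-((2*r+1:ℕ):ℝ)^(-(2*x)))/(4*x) ≤ 1/(4*x) := by gcongr; linarith
  linarith

lemma odd_sum2 (r : ℕ) : ∑ i ∈ range (r+1), 1/((2*i+1:ℕ):ℝ)^2 ≤ 5/4 - 1/(4*((r:ℝ)+1)) := by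
  induction r with
  | zero => norm_num
  | succ r ih =>
    rw [Finset.sum_range_succ]
    have hr : (0:ℝ) ≤ r := Nat.cast_nonneg r
    have : 1/((2*(r+1)+1:ℕ):ℝ)^2 ≤ 1/(4*((r:ℝ)+1)) - 1/(4*(((r+1:ℕ):ℝ)+1)) := by
      have e : 1/(4*((r:ℝ)+1)) - 1/(4*(((r+1:ℕ):ℝ)+1)) = 1/(4*((r:ℝ)+1)*(r+2)) := by
        push_cast; field_simp; ring
      rw [e]
      apply one_div_le_one_div_of_le (by positivity)
      push_cast; nlinarith
    linarith

lemma odd_sum2' {x : ℝ} (hx : 0 ≤ x) (r : ℕ) :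
    ∑ i ∈ range r, ((2*i+1:ℕ):ℝ)^(-1-x)*((2*i+1:ℕ):ℝ)^(-1-x) ≤ 5/4 := by
  have h := odd_sum2 r
  rw [Finset.sum_range_succ] at h
  have h1 : 0 ≤ 1/((2*r+1:ℕ):ℝ)^2 := by positivity
  have h2 : 0 ≤ 1/(4*((r:ℝ)+1)) := by positivity
  refine le_trans (Finset.sum_le_sum (fun i _ => ?_)) (by linarith : ∑ i ∈ range r, 1/((2*i+1:ℕ):ℝ)^2 ≤ 5/4)
  have hm : (1:ℝ) ≤ ((2*i+1:ℕ):ℝ) := by exact_mod_cast (by omega : 1 ≤ 2*i+1)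
  have h3 : ((2*i+1:ℕ):ℝ)^(-1-x) ≤ ((2*i+1:ℕ):ℝ)^(-1:ℝ) := Real.rpow_le_rpow_of_exponent_le hm (by linarith)
  rw [Real.rpow_neg_one] at h3
  calc _ ≤ (((2*i+1:ℕ):ℝ))⁻¹*(((2*i+1:ℕ):ℝ))⁻¹ := by gcongr
    _ = _ := by field_simp

/-- weights -/
noncomputable def mvA (T x : ℝ) (r n : ℕ) : ℝ :=
  ∑ i ∈ range r, ∑ i' ∈ range r, ((2*i+1:ℕ):ℝ)^(-1-x)*((2*i'+1:ℕ):ℝ)^(-1-x)*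
    Real.exp (-(T^2/2*(n*Real.log 2-(Real.log (2*i'+1:ℕ)-Real.log (2*i+1:ℕ)))^2))

lemma mvA_le {T x : ℝ} (hT : 5000 ≤ T) (hx : 0 < x) (hx1 : x ≤ 1) (r n : ℕ) :
    mvA T x r n ≤ (if n = 0 then 5/4 else 0) + (187/100)/T*(1+1/(4*x))*((2:ℝ)^(-x))^n := by
  have hT0 : 0 < T := by linarith
  have hin : ∀ i ∈ range r, ∑ i' ∈ range r, ((2*i+1:ℕ):ℝ)^(-1-x)*((2*i'+1:ℕ):ℝ)^(-1-x)*
    Real.exp (-(T^2/2*(n*Real.log 2-(Real.log (2*i'+1:ℕ)-Real.log (2*i+1:ℕ)))^2)) ≤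
     (if n = 0 then ((2*i+1:ℕ):ℝ)^(-1-x)*((2*i+1:ℕ):ℝ)^(-1-x) else 0) + ((2*i+1:ℕ):ℝ)^(-1-2*x)*(((2:ℝ)^(-x))^n*((187/100)/T)) := by
    intro i hi
    set m : ℕ := 2*i+1 with hm
    have hm0 : (0:ℝ) < m := by positivity
    have h := mv_inner hT hx.le hx1 (M := 2^n*m) (Nat.one_le_iff_ne_zero.mpr (by positivity)) r
    have hMx : ((2^n*m:ℕ):ℝ)^(-x) = ((2:ℝ)^(-x))^n*(m:ℝ)^(-x) := by
      push_cast
      rw [Real.mul_rpow (by positivity) hm0.le, ← Real.rpow_natCast, ← Real.rpow_mul (by norm_num), ← Real.rpow_natCast, ← Real.rpow_mul (by norm_num), mul_comm (n:ℝ)]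
    rw [hMx] at h
    have hlog : Real.log ((2^n*m:ℕ):ℝ) = n*Real.log 2+Real.log m := by
      push_cast
      rw [Real.log_mul (by positivity) hm0.ne', Real.log_pow]
    have hsplit : ∀ i' ∈ range r, (m:ℝ)^(-1-x)*((2*i'+1:ℕ):ℝ)^(-1-x)*
        Real.exp (-(T^2/2*(n*Real.log 2-(Real.log (2*i'+1:ℕ)-Real.log m))^2)) ≤
        (if i' = i then (if n = 0 then (m:ℝ)^(-1-x)*(m:ℝ)^(-1-x) else 0) else 0) +
        (m:ℝ)^(-1-x)*(if 2*i'+1 = 2^n*m then 0 else ((2*i'+1:ℕ):ℝ)^(-1-x)*Real.exp (-(T^2*(Real.log (2*i'+1:ℕ)-Real.log (2^n*m:ℕ))^2/2))) := by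
      intro i' _
      have ee : Real.exp (-(T^2/2*(n*Real.log 2-(Real.log (2*i'+1:ℕ)-Real.log m))^2)) = Real.exp (-(T^2*(Real.log (2*i'+1:ℕ)-Real.log (2^n*m:ℕ))^2/2)) := by
        rw [hlog]; congr 1; ring
      rw [ee]
      by_cases h1 : 2*i'+1 = 2^n*m
      · have hn : n = 0 := by
          by_contra hn
          obtain ⟨k, rfl⟩ := Nat.exists_eq_succ_of_ne_zero hn
          rw [pow_succ] at h1
          have : 2*i'+1 = 2*(2^k*m) := by rw [h1]; ring
          omega
        subst hn
        have hi' : i' = i := by rw [pow_zero, one_mul] at h1; omega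
        subst hi'
        rw [if_pos rfl, if_pos rfl, if_pos h1, mul_zero, add_zero]
        apply mul_le_of_le_one_right (by positivity)
        rw [Real.exp_le_one_iff]
        have : 0 ≤ T^2*(Real.log (2*i'+1:ℕ)-Real.log (2^0*m:ℕ))^2/2 := by positivity
        linarith
      · rw [if_neg h1]
        have : (0:ℝ) ≤ (if i' = i then (if n = 0 then (m:ℝ)^(-1-x)*(m:ℝ)^(-1-x) else 0) else 0) := by
          split_ifs <;> positivity
        rw [mul_assoc]
        linarith
    refine (Finset.sum_le_sum hsplit).trans ?_
    rw [Finset.sum_add_distrib, Finset.sum_ite_eq', if_pos hi, ← Finset.mul_sum]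
    apply add_le_add le_rfl
    calc _ ≤ (m:ℝ)^(-1-x)*(((2:ℝ)^(-x))^n*(m:ℝ)^(-x)*((187/100)/T)) := by gcongr
      _ = ((m:ℝ)^(-1-x)*(m:ℝ)^(-x))*(((2:ℝ)^(-x))^n*((187/100)/T)) := by ring
      _ = _ := by rw [← Real.rpow_add hm0]; ring_nf
  unfold mvA
  refine (Finset.sum_le_sum hin).trans ?_
  rw [Finset.sum_add_distrib, ← Finset.sum_mul]
  apply add_le_add
  · split_ifs
    · exact odd_sum2' hx.le r
    · simp
  · calc _ ≤ (1+1/(4*x))*(((2:ℝ)^(-x))^n*((187/100)/T)) := by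
          apply mul_le_mul_of_nonneg_right (odd_sum1' hx r) (by positivity)
      _ = _ := by ring

lemma mvA_symm (T x : ℝ) (r : ℕ) (k : ℤ) :
    ∑ i ∈ range r, ∑ i' ∈ range r, ((2*i+1:ℕ):ℝ)^(-1-x)*((2*i'+1:ℕ):ℝ)^(-1-x)*
    Real.exp (-(T^2/2*(k*Real.log 2-(Real.log (2*i'+1:ℕ)-Real.log (2*i+1:ℕ)))^2)) = mvA T x r k.natAbs := by
  unfold mvA
  rcases le_total 0 k with h | h
  · have : ((k.natAbs:ℕ):ℝ) = (k:ℝ) := by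
      rw [Nat.cast_natAbs, abs_of_nonneg h]
    rw [this]
  · have : ((k.natAbs:ℕ):ℝ) = -(k:ℝ) := by
      rw [Nat.cast_natAbs, abs_of_nonpos h]; push_cast; rfl
    rw [this, Finset.sum_comm]
    refine Finset.sum_congr rfl (fun i _ => Finset.sum_congr rfl (fun i' _ => ?_))
    rw [mul_comm (((2*i'+1:ℕ):ℝ)^(-1-x))]
    congr 2
    ring

lemma mv_k {T x : ℝ} (hT : 5000 ≤ T) (hx : 0 < x) (hx1 : x ≤ 1) (r : ℕ) :
    ∑' k : ℤ, mvA T x r k.natAbs ≤ 5/4 + (187/100)/T*(1+1/(4*x))*(1+2/(x*Real.log 2)) := by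
  have hl := l2pos
  have hT0 : 0 < T := by linarith
  set q := (2:ℝ)^(-x) with hq
  have hq0 : 0 < q := by positivity
  have hq1 : q < 1 := Real.rpow_lt_one_of_one_lt_of_neg (by norm_num) (by linarith)
  have hg := hasSum_geometric_of_lt_one hq0.le hq1
  have hZ : HasSum (fun k : ℤ => q^k.natAbs) ((1-q)⁻¹ + q*(1-q)⁻¹) := by
    apply HasSum.of_nat_of_neg_add_one
    · simpa using hg
    · have := hg.mul_left q
      have e : (fun n : ℕ => q^((-((n:ℤ)+1)).natAbs)) = fun n : ℕ => q*q^n := by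
        funext n
        have : (-((n:ℤ)+1)).natAbs = n+1 := by omega
        rw [this, pow_succ, mul_comm]
      rw [e]; exact this
  have hD : HasSum (fun k : ℤ => (if k.natAbs = 0 then (5/4:ℝ) else 0) + (187/100)/T*(1+1/(4*x))*q^k.natAbs)
      (5/4 + (187/100)/T*(1+1/(4*x))*((1-q)⁻¹ + q*(1-q)⁻¹)) := by
    apply HasSum.add _ (hZ.mul_left _)
    have := hasSum_ite_eq (0:ℤ) (5/4:ℝ)
    have e : (fun k : ℤ => if k.natAbs = 0 then (5/4:ℝ) else 0) = fun k : ℤ => if k = 0 then (5/4:ℝ) else 0 := by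
      funext k
      simp only [Int.natAbs_eq_zero]
    rw [e]; exact this
  have hle : ∀ k : ℤ, mvA T x r k.natAbs ≤ (if k.natAbs = 0 then (5/4:ℝ) else 0) + (187/100)/T*(1+1/(4*x))*q^k.natAbs := by
    intro k
    have := mvA_le hT hx hx1 r k.natAbs
    rw [← hq] at this
    exact this
  have hS : Summable (fun k : ℤ => mvA T x r k.natAbs) := by
    refine Summable.of_nonneg_of_le (fun k => ?_) hle hD.summable
    unfold mvA; positivity
  refine (hS.tsum_le_tsum hle hD.summable).trans ?_
  rw [hD.tsum_eq]
  have hqi : q⁻¹ ≥ 1+x*Real.log 2 := by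
    rw [hq, Real.rpow_neg (by norm_num), inv_inv, Real.rpow_def_of_pos (by norm_num)]
    have := Real.add_one_le_exp (Real.log 2*x); linarith
  have h1 : (1-q)⁻¹ + q*(1-q)⁻¹ ≤ 1+2/(x*Real.log 2) := by
    have hq1' : 0 < 1-q := by linarith
    have hxl : 0 < x*Real.log 2 := by positivity
    have : q*(1+x*Real.log 2) ≤ 1 := by
      have := mul_le_mul_of_nonneg_left hqi hq0.le
      rwa [mul_inv_cancel₀ hq0.ne'] at this
    have e : (1-q)⁻¹ + q*(1-q)⁻¹ = 1+2*q/(1-q) := by field_simp; ring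
    rw [e]
    have : 2*q/(1-q) ≤ 2/(x*Real.log 2) := by
      rw [div_le_div_iff₀ hq1' hxl]; linarith
    linarith
  have h2 : 0 ≤ (187/100)/T*(1+1/(4*x)) := by positivity
  have h3 := mul_le_mul_of_nonneg_left h1 h2
  linarith

-- Part F5
noncomputable def mvf (x : ℝ) (a : ℕ → ℂ) (r : ℕ) (t : ℝ) : ℂ :=
  ∑ i ∈ range r, a i * ((((2*i+1:ℕ):ℝ)^(-1-x) : ℝ):ℂ) * Complex.exp (((-(t*Real.log (2*i+1:ℕ)):ℝ):ℂ)*Complex.I)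

lemma mvf_sq (x : ℝ) (a : ℕ → ℂ) (r : ℕ) (t : ℝ) :
    (((‖mvf x a r t‖^2 : ℝ)):ℂ) = ∑ i ∈ range r, ∑ i' ∈ range r, a i * (starRingEnd ℂ) (a i') *
      (((((2*i+1:ℕ):ℝ)^(-1-x)*((2*i'+1:ℕ):ℝ)^(-1-x) : ℝ)):ℂ) *
      Complex.exp ((((Real.log (2*i'+1:ℕ) - Real.log (2*i+1:ℕ))*t:ℝ):ℂ)*Complex.I) := by
  rw [Complex.ofReal_pow, ← Complex.mul_conj']
  unfold mvf
  rw [map_sum, Finset.sum_mul_sum]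
  refine Finset.sum_congr rfl (fun i _ => Finset.sum_congr rfl (fun i' _ => ?_))
  rw [map_mul, map_mul, Complex.conj_ofReal, ← Complex.exp_conj, map_mul, Complex.conj_ofReal, Complex.conj_I]
  have : Complex.exp ((((Real.log (2*i'+1:ℕ) - Real.log (2*i+1:ℕ))*t:ℝ):ℂ)*Complex.I) =
     Complex.exp (((-(t*Real.log (2*i+1:ℕ)):ℝ):ℂ)*Complex.I) * Complex.exp (((-(t*Real.log (2*i'+1:ℕ)):ℝ):ℂ)*-Complex.I) := by
    rw [← Complex.exp_add]; congr 1; push_cast; ring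
  rw [this, Complex.ofReal_mul]; ring

lemma norm_gterm (T θ t : ℝ) : ‖Complex.exp (((-(t^2/(2*T^2)):ℝ):ℂ) + ((θ*t:ℝ):ℂ)*Complex.I)‖ = Real.exp (-(t^2/(2*T^2))) := by
  rw [Complex.norm_exp, Complex.add_re, Complex.re_ofReal_mul, Complex.ofReal_re, Complex.I_re]
  simp

lemma mv_sum {T x : ℝ} (hT : 5000 ≤ T) (hx : 0 < x) (hx1 : x ≤ 1) (a : ℕ → ℂ) (ha : ∀ i, ‖a i‖ ≤ 1) (r : ℕ) (J : Finset ℤ) :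
    ∑ j ∈ J, ‖mvf x a r (tj j)‖^2 * Real.exp (-((tj j)^2/(2*T^2))) ≤
      Real.log 2/Real.sqrt (2*Real.pi)*T*(5/4 + (187/100)/T*(1+1/(4*x))*(1+2/(x*Real.log 2))) := by
  have hT0 : 0 < T := by linarith
  have hl := l2pos
  have hp := Real.pi_pos
  set c := Real.log 2/Real.sqrt (2*Real.pi)*T with hc
  have hc0 : 0 ≤ c := by positivity
  have hsm : ∀ θ : ℝ, Summable (fun j : ℤ => Complex.exp (((-((tj j)^2/(2*T^2)):ℝ):ℂ) + ((θ*tj j:ℝ):ℂ)*Complex.I)) := by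
    intro θ
    apply Summable.of_norm
    simp only [norm_gterm]
    exact summable_tj hT0
  let w : ℕ → ℕ → ℝ := fun i i' => ((2*i+1:ℕ):ℝ)^(-1-x)*((2*i'+1:ℕ):ℝ)^(-1-x)
  have hw : ∀ i i', 0 ≤ w i i' := fun i i' => by positivity
  let th : ℕ → ℕ → ℝ := fun i i' => Real.log (2*i'+1:ℕ) - Real.log (2*i+1:ℕ)
  have hH : HasSum (fun j : ℤ => ((‖mvf x a r (tj j)‖^2 * Real.exp (-((tj j)^2/(2*T^2))) : ℝ):ℂ))
     (∑ i ∈ range r, ∑ i' ∈ range r, a i * (starRingEnd ℂ) (a i') * ((w i i':ℝ):ℂ) *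
      ∑' j : ℤ, Complex.exp (((-((tj j)^2/(2*T^2)):ℝ):ℂ) + ((th i i'*tj j:ℝ):ℂ)*Complex.I)) := by
    have h1 : HasSum (fun j : ℤ => ∑ i ∈ range r, ∑ i' ∈ range r, a i * (starRingEnd ℂ) (a i') * ((w i i':ℝ):ℂ) *
       Complex.exp (((-((tj j)^2/(2*T^2)):ℝ):ℂ) + ((th i i'*tj j:ℝ):ℂ)*Complex.I))
       (∑ i ∈ range r, ∑ i' ∈ range r, a i * (starRingEnd ℂ) (a i') * ((w i i':ℝ):ℂ) *
      ∑' j : ℤ, Complex.exp (((-((tj j)^2/(2*T^2)):ℝ):ℂ) + ((th i i'*tj j:ℝ):ℂ)*Complex.I)) :=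
      hasSum_sum (fun i _ => hasSum_sum (fun i' _ => (hsm (th i i')).hasSum.mul_left _))
    have e : (fun j : ℤ => ((‖mvf x a r (tj j)‖^2 * Real.exp (-((tj j)^2/(2*T^2))) : ℝ):ℂ)) =
       (fun j : ℤ => ∑ i ∈ range r, ∑ i' ∈ range r, a i * (starRingEnd ℂ) (a i') * ((w i i':ℝ):ℂ) *
       Complex.exp (((-((tj j)^2/(2*T^2)):ℝ):ℂ) + ((th i i'*tj j:ℝ):ℂ)*Complex.I)) := by
      funext j
      rw [Complex.ofReal_mul, mvf_sq, Finset.sum_mul]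
      refine Finset.sum_congr rfl (fun i _ => ?_)
      rw [Finset.sum_mul]
      refine Finset.sum_congr rfl (fun i' _ => ?_)
      rw [Complex.exp_add, Complex.ofReal_exp]; ring
    rw [e]; exact h1
  have hle : ‖∑ i ∈ range r, ∑ i' ∈ range r, a i * (starRingEnd ℂ) (a i') * ((w i i':ℝ):ℂ) *
      ∑' j : ℤ, Complex.exp (((-((tj j)^2/(2*T^2)):ℝ):ℂ) + ((th i i'*tj j:ℝ):ℂ)*Complex.I)‖ ≤
      c * ∑' k : ℤ, mvA T x r k.natAbs := by
    have hk : ∀ i i', Summable (fun k : ℤ => w i i' * Real.exp (-(T^2/2*(k*Real.log 2-th i i')^2))) := fun i i' =>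
      (summable_gauss (by positivity) hl.ne' (th i i')).mul_left _
    have e2 : ∑' k : ℤ, mvA T x r k.natAbs = ∑ i ∈ range r, ∑ i' ∈ range r, w i i' * ∑' k : ℤ, Real.exp (-(T^2/2*(k*Real.log 2-th i i')^2)) := by
      have : HasSum (fun k : ℤ => mvA T x r k.natAbs) (∑ i ∈ range r, ∑ i' ∈ range r, w i i' * ∑' k : ℤ, Real.exp (-(T^2/2*(k*Real.log 2-th i i')^2))) := by
        have h2 := hasSum_sum (s := range r) (fun i _ => hasSum_sum (s := range r) (fun i' _ => (hk i i').hasSum))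
        simp only [tsum_mul_left] at h2
        have e3 : (fun k : ℤ => mvA T x r k.natAbs) = fun k : ℤ => ∑ i ∈ range r, ∑ i' ∈ range r, w i i' * Real.exp (-(T^2/2*(k*Real.log 2-th i i')^2)) := by
          funext k; rw [← mvA_symm]
        rw [e3]; exact h2
      exact this.tsum_eq
    rw [e2, Finset.mul_sum]
    refine (norm_sum_le _ _).trans (Finset.sum_le_sum (fun i _ => ?_))
    rw [Finset.mul_sum]
    refine (norm_sum_le _ _).trans (Finset.sum_le_sum (fun i' _ => ?_))
    rw [norm_mul, norm_mul, norm_mul, RCLike.norm_conj, Complex.norm_real, Real.norm_of_nonneg (hw i i')]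
    have g := gp hT0 (th i i')
    rw [← hc] at g
    have h1 : ‖a i‖*‖a i'‖ ≤ 1 := mul_le_one₀ (ha i) (norm_nonneg _) (ha i')
    have h3 : ‖a i‖*‖a i'‖*w i i' ≤ w i i' := mul_le_of_le_one_left (hw i i') h1
    calc _ ≤ w i i' * (c*∑' k : ℤ, Real.exp (-(T^2/2*(k*Real.log 2-th i i')^2))) :=
          mul_le_mul h3 g (norm_nonneg _) (hw i i')
      _ = _ := by ring
  have hR := Complex.hasSum_ofReal.mp (by
    have := hH.summable.hasSum
    have e : (∑' j : ℤ, ((‖mvf x a r (tj j)‖^2 * Real.exp (-((tj j)^2/(2*T^2))) : ℝ):ℂ)) = ((∑' j : ℤ, ‖mvf x a r (tj j)‖^2 * Real.exp (-((tj j)^2/(2*T^2))) : ℝ):ℂ) := (Complex.ofReal_tsum _).symm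
    rw [e] at this
    exact this)
  have hS := hR.summable
  have hn : ∀ j, 0 ≤ ‖mvf x a r (tj j)‖^2 * Real.exp (-((tj j)^2/(2*T^2))) := fun j => by positivity
  refine (hS.sum_le_tsum J (fun j _ => hn j)).trans ?_
  have h5 : (((∑' j : ℤ, ‖mvf x a r (tj j)‖^2 * Real.exp (-((tj j)^2/(2*T^2)))) : ℝ):ℂ) = _ := (Complex.hasSum_ofReal.mpr hR).unique hH
  rw [← h5, Complex.norm_real] at hle
  refine (le_abs_self _).trans (hle.trans ?_)
  exact mul_le_mul_of_nonneg_left (mv_k hT hx hx1 r) hc0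

-- Part G1
/-- Moebius restricted to odd integers. -/
noncomputable def muo : ArithmeticFunction ℤ := ⟨fun n => if Odd n then moebius n else 0, by simp⟩

lemma muo_apply (n : ℕ) : muo n = if Odd n then moebius n else 0 := rfl

noncomputable def Gf (s : ℂ) : ℂ := iz s/(1-(2:ℂ)^(-s))

lemma abs_muo_le (n : ℕ) : |muo n| ≤ 1 := by
  rw [muo_apply]; split_ifs
  · exact abs_moebius_le_one
  · simp

lemma norm_muo_le (n : ℕ) : ‖((muo n : ℤ):ℂ)‖ ≤ 1 := by
  rw [Complex.norm_intCast]; exact_mod_cast abs_muo_le n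

lemma muo_summable {s : ℂ} (hs : 1 < s.re) : LSeriesSummable (fun n => ((muo n : ℤ):ℂ)) s :=
  LSeriesSummable_of_bounded_of_one_lt_re (m := 1) (fun n _ => norm_muo_le n) hs

lemma muo_LSeries {s : ℂ} (hs : 1 < s.re) : LSeries (fun n => ((muo n : ℤ):ℂ)) s = Gf s := by
  have hs1 : s ≠ 1 := by rintro rfl; simp at hs
  have h1 := DirichletCharacter.LSeries.mul_mu_eq_one (1 : DirichletCharacter ℂ 2) hs
  have h2 := DirichletCharacter.LFunctionTrivChar_eq_mul_riemannZeta (N := 2) hs1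
  rw [DirichletCharacter.LFunctionTrivChar, DirichletCharacter.LFunction_eq_LSeries _ hs] at h2
  rw [h2] at h1
  have e : ((fun n : ℕ => (1 : DirichletCharacter ℂ 2) n) * fun n => ((moebius n : ℤ):ℂ)) = fun n => ((muo n : ℤ):ℂ) := by
    funext n
    rw [Pi.mul_apply, muo_apply]
    rcases Nat.even_or_odd n with h | h
    · have : ¬ Odd n := by simpa using h
      rw [if_neg this, MulChar.map_nonunit]
      · simp
      · rw [ZMod.isUnit_iff_coprime]; simpa using h
    · rw [if_pos h, MulChar.one_apply]
      · simp
      · rw [ZMod.isUnit_iff_coprime]; simpa using h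
  rw [e] at h1
  have hp : Nat.primeFactors 2 = {2} := Nat.Prime.primeFactors Nat.prime_two
  rw [hp, Finset.prod_singleton] at h1
  unfold Gf
  rw [iz_eq hs1, div_eq_mul_inv, ← mul_inv, mul_comm (riemannZeta s)]
  push_cast at h1
  exact eq_inv_of_mul_eq_one_right h1

lemma mvf_tendsto {x : ℝ} (hx : 0 < x) (t : ℝ) :
    Tendsto (fun r => mvf x (fun i => ((muo (2*i+1) : ℤ):ℂ)) r t) atTop (nhds (Gf ((1+x:ℝ)+t*Complex.I))) := by
  set s : ℂ := (1+x:ℝ)+t*Complex.I with hs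
  have hre : 1 < s.re := by simp [hs]; exact hx
  have h := (muo_summable hre).hasSum
  have hL : ∑' n, LSeries.term (fun n => ((muo n : ℤ):ℂ)) s n = Gf s := muo_LSeries hre
  rw [hL] at h
  have hinj : Function.Injective (fun i : ℕ => 2*i+1) := fun a b h => by simpa using h
  have h2 := (hinj.hasSum_iff (f := LSeries.term (fun n => ((muo n : ℤ):ℂ)) s) (a := Gf s) (by
    intro n hn
    have : ¬ Odd n := by
      rintro ⟨k, rfl⟩; exact hn ⟨k, rfl⟩
    rw [LSeries.term_def, muo_apply, if_neg this]; simp)).mpr h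
  refine h2.tendsto_sum_nat.congr (fun r => ?_)
  unfold mvf
  refine Finset.sum_congr rfl (fun i _ => ?_)
  have h0 : (2*i+1:ℕ) ≠ 0 := by omega
  have h0' : ((2*i+1:ℕ):ℝ) > 0 := by positivity
  rw [Function.comp_apply, LSeries.term_of_ne_zero h0, div_eq_mul_inv, mul_assoc]
  congr 1
  rw [← Complex.cpow_neg, Complex.cpow_def_of_ne_zero (by exact_mod_cast h0), Real.rpow_def_of_pos h0', Complex.ofReal_exp, ← Complex.exp_add,
    ← Complex.natCast_log]
  congr 1
  rw [hs]; push_cast; ring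

lemma mv_G {T x : ℝ} (hT : 5000 ≤ T) (hx : 0 < x) (hx1 : x ≤ 1) (J : Finset ℤ) :
    ∑ j ∈ J, ‖Gf ((1+x:ℝ)+(tj j)*Complex.I)‖^2 * Real.exp (-((tj j)^2/(2*T^2))) ≤
      Real.log 2/Real.sqrt (2*Real.pi)*T*(5/4 + (187/100)/T*(1+1/(4*x))*(1+2/(x*Real.log 2))) := by
  refine le_of_tendsto' (x := atTop) (f := fun r => ∑ j ∈ J, ‖mvf x (fun i => ((muo (2*i+1) : ℤ):ℂ)) r (tj j)‖^2 * Real.exp (-((tj j)^2/(2*T^2)))) ?_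
    (fun r => mv_sum hT hx hx1 _ (fun i => norm_muo_le _) r J)
  refine tendsto_finsetSum _ (fun j _ => ?_)
  exact ((mvf_tendsto hx (tj j)).norm.pow 2).mul_const _

-- Part N1
/-- strict application -/
def fo {α : Type} (x : ℕ) (f : ℕ → α) : α := Nat.rec (f 0) (fun n _ => f (Nat.succ n)) x

abbrev nE : ℕ := 1048577
abbrev nF : ℕ := 65537
abbrev nD : ℕ := 68720590849
abbrev nB : ℕ := 137441181698
abbrev nH : ℕ := 1073741827

def mre (C S U V : ℕ) : ℕ := Nat.div (Nat.sub (Nat.add (Nat.add (Nat.mul C U) (Nat.mul nB (Nat.add S V))) (Nat.mul nB nD)) (Nat.add (Nat.mul S V) (Nat.mul nB (Nat.add C U)))) nD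
def mim (C S U V : ℕ) : ℕ := Nat.div (Nat.sub (Nat.add (Nat.add (Nat.mul C V) (Nat.mul S U)) (Nat.add (Nat.mul 2 (Nat.mul nB nB)) (Nat.mul nB nD))) (Nat.mul nB (Nat.add (Nat.add S V) (Nat.add C U)))) nD

def npk (c s y a b d e : ℕ) : ℕ :=
  Nat.add (Nat.mul nF a) (Nat.mul (Nat.add (Nat.add (Nat.mul c a) (Nat.mul s d)) (Nat.mul 131074 (Nat.add b e))) y)

def npack (k : ℕ) : ℕ → ℕ → ℕ → ℕ → ℕ → ℕ → ℕ → (ℕ → ℕ → ℕ → ℕ → Bool) → Bool :=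
  Nat.rec (fun _ _ _ R1 R2 M1 M2 F => F R1 R2 M1 M2)
    (fun _ ih y C S R1 R2 M1 M2 F =>
      fo (Nat.div C nE) fun c => fo (Nat.div S nE) fun s =>
      fo (npk c s y R1 R2 M2 M1) fun R1' =>
      fo (npk c s y R2 R1 M1 M2) fun R2' =>
      fo (npk c s y M1 M2 R1 R2) fun M1' =>
      fo (npk c s y M2 M1 R2 R1) fun M2' =>
      fo (Nat.mul y y) fun y' =>
      fo (mre C S C S) fun C' => fo (mim C S C S) fun S' =>
      ih y' C' S' R1' R2' M1' M2' F) k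

def nwt (k : ℕ) : ℕ → (ℕ → ℕ → Bool) → Bool :=
  Nat.rec (fun _ F => F 1 0)
    (fun _ ih m F => Bool.rec (F 1 0) (ih (Nat.div m 2) fun a b => fo (Nat.add 1 (Nat.mul 2 b)) fun a' => fo (Nat.mul 2 a) fun b' => F a' b')
      (Nat.beq (Nat.mod m 2) 0)) k

/-- k squarings -/
def nsqs (k : ℕ) : ℕ → ℕ → (ℕ → ℕ → Bool) → Bool :=
  Nat.rec (fun C S F => F C S)
    (fun _ ih C S F => fo (mre C S C S) fun C' => fo (mim C S C S) fun S' => ih C' S' F) k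

/-- multiply q times by (U,V) -/
def npw (q U V : ℕ) : ℕ → ℕ → (ℕ → ℕ → Bool) → Bool :=
  Nat.rec (fun C S F => F C S)
    (fun _ ih C S F => fo (mre C S U V) fun C' => fo (mim C S U V) fun S' => ih C' S' F) q

def nA : ℕ := 622932933774

def nloop (K q X f : ℕ) (chk : ℕ → ℕ → ℕ → ℕ → Bool) : ℕ → ℕ → ℕ → ℕ → ℕ → ℕ → ℕ → Bool :=
  Nat.rec (fun _ _ _ R1 R2 M1 M2 => chk R1 R2 M1 M2)
   (fun _ ih m C S R1 R2 M1 M2 =>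
     fo (Nat.div nH m) fun w =>
     nwt 12 m fun wp wm =>
     fo (mre C S C S) fun C1 => fo (mim C S C S) fun S1 =>
     nsqs K C1 S1 fun U V => npw q U V C S fun Z Y =>
     fo (Nat.div Z nE) fun z => fo (Nat.div Y nE) fun y =>
     fo (Nat.mul w (Nat.add (Nat.mul wp z) (Nat.mul wm 131074))) fun a1 =>
     fo (Nat.mul w (Nat.add (Nat.mul wm z) (Nat.mul wp 131074))) fun a2 =>
     fo (Nat.mul w (Nat.add (Nat.mul wp y) (Nat.mul wm 131074))) fun b1 =>
     fo (Nat.mul w (Nat.add (Nat.mul wm y) (Nat.mul wp 131074))) fun b2 =>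
     npack K X C1 S1 a1 a2 b1 b2 fun r1 r2 m1 m2 =>
     fo (Nat.add R1 r1) fun R1' => fo (Nat.add R2 r2) fun R2' => fo (Nat.add M1 m1) fun M1' => fo (Nat.add M2 m2) fun M2' =>
     fo (Nat.div nA (Nat.add (Nat.mul 2 m) 1)) fun th =>
     fo (Nat.sub (Nat.add nB nD) (Nat.div (Nat.mul th th) nB)) fun ur =>
     fo (Nat.sub nB th) fun ui =>
     fo (mre C S ur ui) fun C' =>
     fo (mim C S ur ui) fun S' =>
     fo (Nat.succ m) fun m' =>
     ih m' C' S' R1' R2' M1' M2') f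

/-- final check, `n` lanes starting with lane number `j` -/
def nchk (X H th1 th2 n : ℕ) : ℕ → ℕ → ℕ → Bool :=
  Nat.rec (fun _ _ _ => true)
    (fun _ ih j A B =>
      fo (Nat.mod A X) fun a => fo (Nat.mod B X) fun b =>
      fo (Nat.add (Nat.mul 2 j) 1) fun o =>
      fo (Nat.add (Nat.mul th1 o) th2) fun t =>
      Bool.rec false
        (fo (Nat.div A X) fun A' => fo (Nat.div B X) fun B' => fo (Nat.succ j) fun j' => ih j' A' B')
        (Nat.ble (Nat.mul t t) (Nat.mul (Nat.mul o o) (Nat.add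
          (Nat.sub (Nat.add (Nat.mul a a) (Nat.mul H H)) (Nat.mul 2 (Nat.mul a H)))
          (Nat.sub (Nat.add (Nat.mul b b) (Nat.mul H H)) (Nat.mul 2 (Nat.mul b H))))))) n

abbrev nX : ℕ := 2^180-57
abbrev nHX : ℕ := 2^179
/-- offset sum H (1+X+...+X^(n-1)) by doubling n = 2^k -/
def noff (k : ℕ) : ℕ := Nat.mul nHX (Nat.div (Nat.sub (Nat.pow nX (Nat.pow 2 k)) 1) (Nat.sub nX 1))

def nsc (K : ℕ) : ℕ := Nat.mul (Nat.mul nH nF) (Nat.pow nF K)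

def ntest (q : ℕ) : Bool :=
  nloop 8 q nX 4096 (fun R1 R2 M1 M2 => fo (noff 8) fun O =>
    nchk nX nHX (Nat.div (Nat.mul 290 (nsc 8)) 1000) (Nat.div (Nat.mul 2212 (nsc 8)) 10000) 256 (Nat.mul 256 q)
     (Nat.sub (Nat.add R1 O) R2) (Nat.sub (Nat.add M1 O) M2)) 4096 (nB+nD) nB 0 0 0 0

-- Part N2
lemma fo_eq {α : Type} (x : ℕ) (f : ℕ → α) : fo x f = f x := by cases x <;> rfl

lemma ndiv_bd (n : ℕ) {d : ℕ} (hd : 0 < d) : (n:ℝ)/d - 1 ≤ ((Nat.div n d : ℕ):ℝ) ∧ ((Nat.div n d : ℕ):ℝ) ≤ (n:ℝ)/d := by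
  have hd' : (0:ℝ) < d := by exact_mod_cast hd
  refine ⟨?_, Nat.cast_div_le⟩
  have h := Nat.lt_div_mul_add hd (a := n)
  have h2 : (n:ℝ) < ((n/d:ℕ):ℝ)*d + d := by exact_mod_cast h
  have h3 : (n:ℝ)/d < ((n/d:ℕ):ℝ) + 1 := by rw [div_lt_iff₀ hd']; linarith
  have : ((Nat.div n d : ℕ):ℝ) = ((n/d:ℕ):ℝ) := rfl
  rw [this]; linarith

lemma nsub_cast {a b : ℕ} (h : (b:ℝ) ≤ a) : ((Nat.sub a b : ℕ):ℝ) = (a:ℝ) - b := by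
  have : b ≤ a := by exact_mod_cast h
  exact Nat.cast_sub this

noncomputable def nvl (E : ℕ) (C S : ℕ) : ℂ := ((((C:ℝ)-2*E)/E:ℝ):ℂ) + ((((S:ℝ)-2*E)/E:ℝ):ℂ)*Complex.I

lemma cnorm_le (a b : ℝ) : ‖((a:ℝ):ℂ)+((b:ℝ):ℂ)*Complex.I‖ ≤ |a|+|b| := by
  refine (norm_add_le _ _).trans ?_
  rw [norm_mul, Complex.norm_I, mul_one, Complex.norm_real, Complex.norm_real]; rfl

lemma cre_le (a b : ℝ) : |a| ≤ ‖((a:ℝ):ℂ)+((b:ℝ):ℂ)*Complex.I‖ := by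
  have := Complex.abs_re_le_norm (((a:ℝ):ℂ)+((b:ℝ):ℂ)*Complex.I)
  simpa using this

lemma cim_le (a b : ℝ) : |b| ≤ ‖((a:ℝ):ℂ)+((b:ℝ):ℂ)*Complex.I‖ := by
  have := Complex.abs_im_le_norm (((a:ℝ):ℂ)+((b:ℝ):ℂ)*Complex.I)
  simpa using this

lemma nadd_cast (a b : ℕ) : ((Nat.add a b:ℕ):ℝ) = a+b := Nat.cast_add a b
lemma nmul_cast (a b : ℕ) : ((Nat.mul a b:ℕ):ℝ) = a*b := Nat.cast_mul a b

lemma mul_spec {C S U V : ℕ} (h1 : ‖nvl nD C S‖ ≤ 11/10) (h2 : ‖nvl nD U V‖ ≤ 11/10) :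
    ‖nvl nD (mre C S U V) (mim C S U V) - nvl nD C S * nvl nD U V‖ ≤ 2/(nD:ℝ) := by
  set c : ℝ := ((C:ℝ)-2*nD)/nD with hc
  set s : ℝ := ((S:ℝ)-2*nD)/nD with hs
  set u : ℝ := ((U:ℝ)-2*nD)/nD with hu
  set v : ℝ := ((V:ℝ)-2*nD)/nD with hv
  have hD : (0:ℝ) < (nD:ℝ) := by norm_num
  have eC : (C:ℝ) = nD*c+2*nD := by rw [hc]; field_simp; ring
  have eS : (S:ℝ) = nD*s+2*nD := by rw [hs]; field_simp; ring
  have eU : (U:ℝ) = nD*u+2*nD := by rw [hu]; field_simp; ring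
  have eV : (V:ℝ) = nD*v+2*nD := by rw [hv]; field_simp; ring
  have eB : (nB:ℝ) = 2*nD := by norm_num
  have emul : nvl nD C S * nvl nD U V = ((c*u-s*v:ℝ):ℂ) + ((c*v+s*u:ℝ):ℂ)*Complex.I := by
    unfold nvl; rw [← hc, ← hs, ← hu, ← hv]; push_cast
    linear_combination ((s:ℂ)*v)*Complex.I_mul_I
  have hprod : ‖nvl nD C S * nvl nD U V‖ ≤ 121/100 := by
    rw [norm_mul]
    calc _ ≤ (11/10:ℝ)*(11/10) := mul_le_mul h1 h2 (norm_nonneg _) (by norm_num)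
      _ = _ := by norm_num
  have hr := (cre_le (c*u-s*v) (c*v+s*u)); rw [← emul] at hr
  have hi := (cim_le (c*u-s*v) (c*v+s*u)); rw [← emul] at hi
  have hr' := abs_le.mp (hr.trans hprod)
  have hi' := abs_le.mp (hi.trans hprod)
  have hDD : (0:ℝ) < (nD:ℝ)*nD := by positivity
  have kre : (nD:ℝ)*(c*u-s*v)+2*nD-1 ≤ (mre C S U V:ℝ) ∧ (mre C S U V:ℝ) ≤ (nD:ℝ)*(c*u-s*v)+2*nD := by
    have h := ndiv_bd (Nat.sub (Nat.add (Nat.add (Nat.mul C U) (Nat.mul nB (Nat.add S V))) (Nat.mul nB nD)) (Nat.add (Nat.mul S V) (Nat.mul nB (Nat.add C U)))) (d := nD) (by norm_num)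
    have e : ((Nat.sub (Nat.add (Nat.add (Nat.mul C U) (Nat.mul nB (Nat.add S V))) (Nat.mul nB nD)) (Nat.add (Nat.mul S V) (Nat.mul nB (Nat.add C U))):ℕ):ℝ) = (nD:ℝ)*nD*(c*u-s*v+2) := by
      rw [nsub_cast]
      · simp only [nadd_cast, nmul_cast]; rw [eB, eC, eS, eU, eV]; ring
      · simp only [nadd_cast, nmul_cast]; rw [eB, eC, eS, eU, eV]
        have : 0 ≤ (nD:ℝ)*nD*(c*u-s*v+2) := mul_nonneg hDD.le (by linarith)
        nlinarith
    rw [e] at h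
    have e2 : (nD:ℝ)*nD*(c*u-s*v+2)/nD = (nD:ℝ)*(c*u-s*v)+2*nD := by field_simp
    rw [e2] at h
    exact h
  have kim : (nD:ℝ)*(c*v+s*u)+2*nD-1 ≤ (mim C S U V:ℝ) ∧ (mim C S U V:ℝ) ≤ (nD:ℝ)*(c*v+s*u)+2*nD := by
    have h := ndiv_bd (Nat.sub (Nat.add (Nat.add (Nat.mul C V) (Nat.mul S U)) (Nat.add (Nat.mul 2 (Nat.mul nB nB)) (Nat.mul nB nD))) (Nat.mul nB (Nat.add (Nat.add S V) (Nat.add C U)))) (d := nD) (by norm_num)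
    have e : ((Nat.sub (Nat.add (Nat.add (Nat.mul C V) (Nat.mul S U)) (Nat.add (Nat.mul 2 (Nat.mul nB nB)) (Nat.mul nB nD))) (Nat.mul nB (Nat.add (Nat.add S V) (Nat.add C U))):ℕ):ℝ) = (nD:ℝ)*nD*(c*v+s*u+2) := by
      rw [nsub_cast]
      · simp only [nadd_cast, nmul_cast]; rw [eB, eC, eS, eU, eV]; push_cast; ring
      · simp only [nadd_cast, nmul_cast]; rw [eB, eC, eS, eU, eV]
        have : 0 ≤ (nD:ℝ)*nD*(c*v+s*u+2) := mul_nonneg hDD.le (by linarith)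
        push_cast at *
        nlinarith
    rw [e] at h
    have e2 : (nD:ℝ)*nD*(c*v+s*u+2)/nD = (nD:ℝ)*(c*v+s*u)+2*nD := by field_simp
    rw [e2] at h
    exact h
  rw [emul]
  have e3 : nvl nD (mre C S U V) (mim C S U V) - (((c*u-s*v:ℝ):ℂ) + ((c*v+s*u:ℝ):ℂ)*Complex.I) =
     (((((mre C S U V:ℝ)-2*nD)/nD - (c*u-s*v):ℝ)):ℂ) + (((((mim C S U V:ℝ)-2*nD)/nD - (c*v+s*u):ℝ)):ℂ)*Complex.I := by
    unfold nvl; push_cast; ring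
  rw [e3]
  refine (cnorm_le _ _).trans ?_
  have a1 : |((mre C S U V:ℝ)-2*nD)/nD - (c*u-s*v)| ≤ 1/nD := by
    have : ((mre C S U V:ℝ)-2*nD)/nD - (c*u-s*v) = ((mre C S U V:ℝ)-2*nD - nD*(c*u-s*v))/nD := by field_simp
    rw [this, abs_div, abs_of_pos hD]
    apply div_le_div_of_nonneg_right _ hD.le
    rw [abs_le]; constructor <;> linarith [kre.1, kre.2]
  have a2 : |((mim C S U V:ℝ)-2*nD)/nD - (c*v+s*u)| ≤ 1/nD := by
    have : ((mim C S U V:ℝ)-2*nD)/nD - (c*v+s*u) = ((mim C S U V:ℝ)-2*nD - nD*(c*v+s*u))/nD := by field_simp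
    rw [this, abs_div, abs_of_pos hD]
    apply div_le_div_of_nonneg_right _ hD.le
    rw [abs_le]; constructor <;> linarith [kim.1, kim.2]
  have : (2:ℝ)/nD = 1/nD+1/nD := by ring
  linarith

lemma norm_le_of_near {z r : ℂ} {d : ℝ} (hr : ‖r‖ = 1) (h : ‖z-r‖ ≤ d) : ‖z‖ ≤ 1+d := by
  have : z = (z-r)+r := by ring
  rw [this]; refine (norm_add_le _ _).trans ?_; rw [hr]; linarith

lemma prod_near {z r z' r' : ℂ} {d d' : ℝ} (hr : ‖r‖ = 1) (hr' : ‖r'‖ = 1) (h : ‖z-r‖ ≤ d) (h' : ‖z'-r'‖ ≤ d') :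
    ‖z*z'-r*r'‖ ≤ d+d'+d*d' := by
  have e : z*z'-r*r' = (z-r)*(z'-r')+(z-r)*r'+r*(z'-r') := by ring
  have hd : 0 ≤ d := (norm_nonneg _).trans h
  rw [e]
  refine (norm_add_le _ _).trans ?_
  refine (add_le_add (norm_add_le _ _) le_rfl).trans ?_
  rw [norm_mul, norm_mul, norm_mul, hr, hr', mul_one, one_mul]
  have := mul_le_mul h h' (norm_nonneg _) hd
  linarith

lemma sq_step {C S : ℕ} {r : ℂ} {δ : ℝ} (hr : ‖r‖ = 1) (h : ‖nvl nD C S - r‖ + 2/nD ≤ δ) (hδ : δ ≤ 1/100) :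
    ‖nvl nD (mre C S C S) (mim C S C S) - r^2‖ + 2/nD ≤ δ*(201/100) := by
  have hD : (0:ℝ) < 2/(nD:ℝ) := by norm_num
  have h0 : ‖nvl nD C S - r‖ ≤ δ-2/nD := by linarith
  have h1 : ‖nvl nD C S‖ ≤ 11/10 := (norm_le_of_near hr h0).trans (by linarith)
  have h2 := mul_spec h1 h1
  have h3 := prod_near hr hr h0 h0
  have e : nvl nD (mre C S C S) (mim C S C S) - r^2 = (nvl nD (mre C S C S) (mim C S C S) - nvl nD C S*nvl nD C S) + (nvl nD C S*nvl nD C S - r*r) := by ring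
  rw [e]
  have h4 := norm_add_le (nvl nD (mre C S C S) (mim C S C S) - nvl nD C S*nvl nD C S) (nvl nD C S*nvl nD C S - r*r)
  have hn : 0 ≤ δ - 2/nD := (norm_nonneg _).trans h0
  have h5 : (δ-2/nD)*(δ-2/nD) ≤ δ*(1/100) := by
    apply mul_le_mul <;> linarith
  linarith

lemma nsqs_spec (k : ℕ) : ∀ (C S : ℕ), ∃ U V : ℕ, (∀ F, nsqs k C S F = F U V) ∧
    ∀ (r : ℂ) (δ : ℝ), ‖r‖ = 1 → ‖nvl nD C S - r‖ + 2/nD ≤ δ → δ*(201/100)^k ≤ 1/100 →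
      ‖nvl nD U V - r^(2^k)‖ + 2/nD ≤ δ*(201/100)^k := by
  induction k with
  | zero => intro C S; exact ⟨C, S, fun F => rfl, fun r δ _ h _ => by simpa using h⟩
  | succ k ih =>
    intro C S
    obtain ⟨U, V, h1, h2⟩ := ih (mre C S C S) (mim C S C S)
    refine ⟨U, V, fun F => ?_, fun r δ hr h hδ => ?_⟩
    · rw [← h1 F]
      show fo (mre C S C S) (fun C' => fo (mim C S C S) fun S' => nsqs k C' S' F) = _
      rw [fo_eq, fo_eq]
    · have hD : (0:ℝ) < 2/(nD:ℝ) := by norm_num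
      have hδ0 : 0 ≤ δ := by linarith [norm_nonneg (nvl nD C S - r)]
      have hp : (1:ℝ) ≤ (201/100)^k := one_le_pow₀ (by norm_num)
      have hδ1 : δ ≤ 1/100 := by
        rw [pow_succ] at hδ; nlinarith
      have h3 := sq_step hr h hδ1
      have h4 := h2 (r^2) (δ*(201/100)) (by rw [norm_pow, hr, one_pow]) h3 (by rw [pow_succ] at hδ; linarith)
      rw [← pow_mul, ← pow_succ'] at h4
      have e9 := pow_succ (201/100:ℝ) k
      rw [e9]; linarith

-- Part N3
lemma npw_spec (q U V : ℕ) : ∀ (C S : ℕ), ∃ Z Y : ℕ, (∀ F, npw q U V C S F = F Z Y) ∧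
    ∀ (r u : ℂ) (δ d : ℝ), ‖r‖ = 1 → ‖u‖ = 1 → ‖nvl nD C S - r‖ ≤ d → ‖nvl nD U V - u‖ + 2/nD ≤ δ →
      d + q*(δ*(11/10)) ≤ 1/100 →
      ‖nvl nD Z Y - r*u^q‖ ≤ d + q*(δ*(11/10)) := by
  induction q with
  | zero => intro C S; exact ⟨C, S, fun F => rfl, fun r u δ d _ _ h _ _ => by simpa using h⟩
  | succ k ih =>
    intro C S
    obtain ⟨Z, Y, h1, h2⟩ := ih (mre C S U V) (mim C S U V)
    refine ⟨Z, Y, fun F => ?_, fun r u δ d hr hu h hδ hd => ?_⟩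
    · rw [← h1 F]
      show fo (mre C S U V) (fun C' => fo (mim C S U V) fun S' => npw k U V C' S' F) = _
      rw [fo_eq, fo_eq]
    · have hD : (0:ℝ) < 2/(nD:ℝ) := by norm_num
      have hδ0 : 0 ≤ δ := by linarith [norm_nonneg (nvl nD U V - u)]
      have hd0 : 0 ≤ d := (norm_nonneg _).trans h
      have hk : (0:ℝ) ≤ (k:ℝ)*(δ*(11/10)) := by positivity
      push_cast at hd
      have hd' : d + k*(δ*(11/10)) + δ*(11/10) ≤ 1/100 := by linarith
      have n1 : ‖nvl nD C S‖ ≤ 11/10 := (norm_le_of_near hr h).trans (by linarith)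
      have hu' : ‖nvl nD U V - u‖ ≤ δ - 2/nD := by linarith
      have n2 : ‖nvl nD U V‖ ≤ 11/10 := (norm_le_of_near hu hu').trans (by linarith)
      have h3 := mul_spec n1 n2
      have h4 := prod_near hr hu h hu'
      have e : nvl nD (mre C S U V) (mim C S U V) - r*u = (nvl nD (mre C S U V) (mim C S U V) - nvl nD C S*nvl nD U V) + (nvl nD C S*nvl nD U V - r*u) := by ring
      have h5 : ‖nvl nD (mre C S U V) (mim C S U V) - r*u‖ ≤ d + δ*(11/10) := by
        rw [e]
        refine (norm_add_le _ _).trans ?_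
        have : d*(δ-2/nD) ≤ (1/100)*δ := mul_le_mul (by linarith) (by linarith) (by linarith [norm_nonneg (nvl nD U V - u)]) (by norm_num)
        linarith
      have h6 := h2 (r*u) u δ (d+δ*(11/10)) (by rw [norm_mul, hr, hu, one_mul]) hu h5 hδ (by linarith)
      have e7 : r*u*u^k = r*u^(k+1) := by ring
      rw [e7] at h6
      push_cast
      linarith

/-- weight -/
def wf : ℕ → ℕ → ℤ
  | 0, _ => 1
  | k+1, m => if m % 2 = 0 then 1 - 2*wf k (m/2) else 1

lemma nwt_spec (k : ℕ) : ∀ m : ℕ, ∃ a b : ℕ, (∀ F, nwt k m F = F a b) ∧ (a:ℤ) - b = wf k m := by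
  induction k with
  | zero => intro m; exact ⟨1, 0, fun F => rfl, by simp [wf]⟩
  | succ k ih =>
    intro m
    obtain ⟨a, b, h1, h2⟩ := ih (m/2)
    by_cases hm : m % 2 = 0
    · refine ⟨1+2*b, 2*a, fun F => ?_, ?_⟩
      · have e : Nat.beq (Nat.mod m 2) 0 = true := by show Nat.beq (m % 2) 0 = true; rw [hm]; rfl
        show (Bool.rec (F 1 0) (nwt k (Nat.div m 2) fun a b => fo (Nat.add 1 (Nat.mul 2 b)) fun a' => fo (Nat.mul 2 a) fun b' => F a' b') (Nat.beq (Nat.mod m 2) 0) : Bool) = _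
        rw [e]
        show (nwt k (m/2) fun a b => fo (Nat.add 1 (Nat.mul 2 b)) fun a' => fo (Nat.mul 2 a) fun b' => F a' b') = _
        rw [h1, fo_eq, fo_eq]; rfl
      · rw [wf, if_pos hm, ← h2]; push_cast; ring
    · refine ⟨1, 0, fun F => ?_, by rw [wf, if_neg hm]; norm_num⟩
      have e : Nat.beq (Nat.mod m 2) 0 = false := by
        by_contra h
        rw [Bool.not_eq_false] at h
        exact hm (Nat.eq_of_beq_eq_true h)
      show (Bool.rec (F 1 0) (nwt k (Nat.div m 2) fun a b => fo (Nat.add 1 (Nat.mul 2 b)) fun a' => fo (Nat.mul 2 a) fun b' => F a' b') (Nat.beq (Nat.mod m 2) 0) : Bool) = _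
      rw [e]

/-- truncation -/
lemma ntrunc (C S : ℕ) : ‖nvl nF (Nat.div C nE) (Nat.div S nE) - nvl nD C S‖ ≤ 2/(nF:ℝ) := by
  have hF : (0:ℝ) < (nF:ℝ) := by norm_num
  have hE : (0:ℝ) < (nE:ℝ) := by norm_num
  have eD : (nD:ℝ) = nE*nF := by norm_num
  have h1 := ndiv_bd C (d := nE) (by norm_num)
  have h2 := ndiv_bd S (d := nE) (by norm_num)
  have e3 : nvl nF (Nat.div C nE) (Nat.div S nE) - nvl nD C S =
     ((((Nat.div C nE:ℕ):ℝ)-(C:ℝ)/nE)/nF:ℝ) + (((((Nat.div S nE:ℕ):ℝ)-(S:ℝ)/nE)/nF:ℝ):ℂ)*Complex.I := by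
    have k1 : ∀ C : ℕ, ((C:ℝ)-2*nD)/nD = ((C:ℝ)/nE-2*nF)/nF := by
      intro C; rw [eD]; field_simp
    unfold nvl; rw [k1, k1]; push_cast; ring
  rw [e3]
  refine (cnorm_le _ _).trans ?_
  rw [abs_div, abs_div, abs_of_pos hF, ← add_div]
  apply div_le_div_of_nonneg_right _ hF.le
  have a1 : |((Nat.div C nE:ℕ):ℝ)-(C:ℝ)/nE| ≤ 1 := by rw [abs_le]; constructor <;> linarith [h1.1, h1.2]
  have a2 : |((Nat.div S nE:ℕ):ℝ)-(S:ℝ)/nE| ≤ 1 := by rw [abs_le]; constructor <;> linarith [h2.1, h2.2]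
  linarith

/-- lanes -/
def lanes (X n : ℕ) (R1 R2 : ℕ) (a : ℕ → ℤ) : Prop := (R1:ℤ) - R2 = ∑ i ∈ range n, a i * (X:ℤ)^i

noncomputable def zl (a b : ℕ → ℤ) (i : ℕ) : ℂ := (a i:ℂ) + (b i:ℂ)*Complex.I

lemma npack_spec (X k : ℕ) : ∀ (n C S R1 R2 M1 M2 : ℕ) (a b : ℕ → ℤ),
    lanes X n R1 R2 a → lanes X n M1 M2 b →
    ∃ (R1' R2' M1' M2' : ℕ) (a' b' : ℕ → ℤ), (∀ F, npack k (X^n) C S R1 R2 M1 M2 F = F R1' R2' M1' M2') ∧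
      lanes X (2^k*n) R1' R2' a' ∧ lanes X (2^k*n) M1' M2' b' ∧
      ∀ (r v : ℂ) (δ w E : ℝ), ‖r‖ = 1 → ‖v‖ ≤ w → ‖nvl nD C S - r^n‖ + 2/nD ≤ δ → δ*(201/100)^k ≤ 1/100 →
        (∀ i < n, ‖zl a b i - v*r^i‖ + w ≤ E) →
        ∀ i < 2^k*n, ‖zl a' b' i/(nF:ℂ)^k - v*r^i‖ + w ≤ E*Real.exp (δ*((201/100)^k-1)+2*k/nF) := by
  induction k with
  | zero =>
    intro n C S R1 R2 M1 M2 a b ha hb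
    refine ⟨R1, R2, M1, M2, a, b, fun F => rfl, by simpa using ha, by simpa using hb, ?_⟩
    intro r v δ w E _ _ _ _ h i hi
    simpa using h i (by simpa using hi)
  | succ k ih =>
    intro n C S R1 R2 M1 M2 a b ha hb
    set c := Nat.div C nE with hc
    set s := Nat.div S nE with hs
    have h131 : (131074:ℕ) = 2*nF := by norm_num
    set a1 : ℕ → ℤ := fun i => if i < n then nF*a i else ((c:ℤ)-2*nF)*a (i-n) - ((s:ℤ)-2*nF)*b (i-n) with ha1
    set b1 : ℕ → ℤ := fun i => if i < n then nF*b i else ((c:ℤ)-2*nF)*b (i-n) + ((s:ℤ)-2*nF)*a (i-n) with hb1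
    have split : ∀ f : ℕ → ℤ, ∑ i ∈ range (2*n), f i * (X:ℤ)^i = ∑ i ∈ range n, f i*(X:ℤ)^i + (∑ i ∈ range n, f (n+i)*(X:ℤ)^i)*(X:ℤ)^n := by
      intro f
      rw [two_mul, Finset.sum_range_add, Finset.sum_mul]
      congr 1
      refine Finset.sum_congr rfl fun i _ => ?_
      rw [pow_add]; ring
    have la : lanes X (2*n) (npk c s (X^n) R1 R2 M2 M1) (npk c s (X^n) R2 R1 M1 M2) a1 := by
      unfold lanes at *
      rw [split]
      have s1 : ∑ i ∈ range n, a1 i*(X:ℤ)^i = nF*((R1:ℤ)-R2) := by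
        rw [ha, Finset.mul_sum]
        refine Finset.sum_congr rfl fun i hi => ?_
        simp only [ha1]; rw [if_pos (Finset.mem_range.mp hi)]; ring
      have s2 : ∑ i ∈ range n, a1 (n+i)*(X:ℤ)^i = ((c:ℤ)-2*nF)*((R1:ℤ)-R2) - ((s:ℤ)-2*nF)*((M1:ℤ)-M2) := by
        rw [ha, hb, Finset.mul_sum, Finset.mul_sum, ← Finset.sum_sub_distrib]
        refine Finset.sum_congr rfl fun i hi => ?_
        simp only [ha1]; rw [if_neg (by omega), Nat.add_sub_cancel_left]; ring
      rw [s1, s2]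
      simp only [npk, Nat.add_eq, Nat.mul_eq, h131]; push_cast; ring
    have lb : lanes X (2*n) (npk c s (X^n) M1 M2 R1 R2) (npk c s (X^n) M2 M1 R2 R1) b1 := by
      unfold lanes at *
      rw [split]
      have s1 : ∑ i ∈ range n, b1 i*(X:ℤ)^i = nF*((M1:ℤ)-M2) := by
        rw [hb, Finset.mul_sum]
        refine Finset.sum_congr rfl fun i hi => ?_
        simp only [hb1]; rw [if_pos (Finset.mem_range.mp hi)]; ring
      have s2 : ∑ i ∈ range n, b1 (n+i)*(X:ℤ)^i = ((c:ℤ)-2*nF)*((M1:ℤ)-M2) + ((s:ℤ)-2*nF)*((R1:ℤ)-R2) := by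
        rw [ha, hb, Finset.mul_sum, Finset.mul_sum, ← Finset.sum_add_distrib]
        refine Finset.sum_congr rfl fun i hi => ?_
        simp only [hb1]; rw [if_neg (by omega), Nat.add_sub_cancel_left]; ring
      rw [s1, s2]
      simp only [npk, Nat.add_eq, Nat.mul_eq, h131]; push_cast; ring
    obtain ⟨R1', R2', M1', M2', a', b', g1, g2, g3, g4⟩ := ih (2*n) (mre C S C S) (mim C S C S) _ _ _ _ a1 b1 la lb
    have e2 : 2^k*(2*n) = 2^(k+1)*n := by ring
    rw [e2] at g2 g3 g4
    refine ⟨R1', R2', M1', M2', a', b', fun F => ?_, g2, g3, ?_⟩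
    · rw [← g1 F]
      show (fo (Nat.div C nE) fun c => fo (Nat.div S nE) fun s =>
        fo (npk c s (X^n) R1 R2 M2 M1) fun R1' =>
        fo (npk c s (X^n) R2 R1 M1 M2) fun R2' =>
        fo (npk c s (X^n) M1 M2 R1 R2) fun M1' =>
        fo (npk c s (X^n) M2 M1 R2 R1) fun M2' =>
        fo (Nat.mul (X^n) (X^n)) fun y' =>
        fo (mre C S C S) fun C' => fo (mim C S C S) fun S' =>
        npack k y' C' S' R1' R2' M1' M2' F) = _
      simp only [fo_eq]
      have : Nat.mul (X^n) (X^n) = X^(2*n) := by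
        show X^n*X^n = _
        rw [← pow_add, two_mul]
      rw [this]
    · intro r v δ w E hr hv h hδ hE i hi
      have hD : (0:ℝ) < 2/(nD:ℝ) := by norm_num
      have hF : (0:ℝ) < (nF:ℝ) := by norm_num
      have hFc : ((nF:ℕ):ℂ) ≠ 0 := by norm_num
      have hδ0 : 0 ≤ δ := by linarith [norm_nonneg (nvl nD C S - r^n)]
      have hw0 : 0 ≤ w := (norm_nonneg _).trans hv
      have hp : (1:ℝ) ≤ (201/100)^k := one_le_pow₀ (by norm_num)
      have ep := pow_succ (201/100:ℝ) k
      have hδ1 : δ ≤ 1/100 := by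
        rw [ep] at hδ; nlinarith
      have hrn : ‖r^n‖ = 1 := by rw [norm_pow, hr, one_pow]
      have h3 := sq_step hrn h hδ1
      rw [← pow_mul, mul_comm n 2] at h3
      have hη : ‖nvl nF c s - r^n‖ ≤ δ+2/nF := by
        have e : nvl nF c s - r^n = (nvl nF c s - nvl nD C S) + (nvl nD C S - r^n) := by ring
        rw [e]
        refine (norm_add_le _ _).trans ?_
        have := ntrunc C S
        linarith
      have hη0 : 0 ≤ δ + 2/(nF:ℝ) := by positivity
      have key : ∀ i < 2*n, ‖zl (a1) b1 i/(nF:ℂ) - v*r^i‖ + w ≤ E*(1+(δ+2/nF)) := by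
        intro i hi
        by_cases hin : i < n
        · have : zl a1 b1 i/(nF:ℂ) = zl a b i := by
            simp only [zl, ha1, hb1, if_pos hin]
            push_cast; field_simp
          rw [this]
          have h0 := hE i hin
          have : 0 ≤ E := by linarith [norm_nonneg (zl a b i - v*r^i)]
          nlinarith [mul_nonneg this hη0]
        · have hj : i - n < n := by omega
          obtain ⟨j, rfl⟩ : ∃ j, i = n+j := ⟨i-n, by omega⟩
          rw [Nat.add_sub_cancel_left] at hj
          have : zl a1 b1 (n+j)/(nF:ℂ) = nvl nF c s * zl a b j := by
            simp only [zl, ha1, hb1, if_neg hin, Nat.add_sub_cancel_left, nvl]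
            push_cast; field_simp
            linear_combination (-((s:ℂ)-2*65537)*(b j:ℂ))*Complex.I_sq
          rw [this]
          have h0 := hE j hj
          have e : nvl nF c s * zl a b j - v*r^(n+j) = (nvl nF c s - r^n)*(zl a b j - v*r^j) + r^n*(zl a b j - v*r^j) + (nvl nF c s - r^n)*(v*r^j) := by
            rw [pow_add]; ring
          rw [e]
          have t1 := norm_add_le ((nvl nF c s - r^n)*(zl a b j - v*r^j) + r^n*(zl a b j - v*r^j)) ((nvl nF c s - r^n)*(v*r^j))
          have t2 := norm_add_le ((nvl nF c s - r^n)*(zl a b j - v*r^j)) (r^n*(zl a b j - v*r^j))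
          rw [norm_mul, norm_mul, hrn, one_mul] at t2
          rw [norm_mul (nvl nF c s - r^n) (v*r^j), norm_mul v, norm_pow, hr, one_pow, mul_one] at t1
          have t3 := mul_le_mul_of_nonneg_right hη (norm_nonneg (zl a b j - v*r^j))
          have t4 := mul_le_mul hη hv (norm_nonneg v) hη0
          have t5 := mul_le_mul_of_nonneg_left h0 hη0
          linarith
      -- rescale
      have hkey2 : ∀ i < 2*n, ‖zl a1 b1 i - (nF*v)*r^i‖ + nF*w ≤ nF*(E*(1+(δ+2/nF))) := by
        intro i hi
        have := key i hi
        have e : zl a1 b1 i - (nF*v)*r^i = (nF:ℂ)*(zl a1 b1 i/(nF:ℂ) - v*r^i) := by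
          field_simp
        rw [e, norm_mul, Complex.norm_natCast]
        have := mul_le_mul_of_nonneg_left this hF.le
        linarith
      have g5 := g4 r (nF*v) (δ*(201/100)) (nF*w) _ hr (by rw [norm_mul, Complex.norm_natCast]; exact mul_le_mul_of_nonneg_left hv hF.le) h3 (by rw [ep] at hδ; linarith) hkey2 i hi
      have e6 : zl a' b' i/(nF:ℂ)^k - nF*v*r^i = nF*(zl a' b' i/(nF:ℂ)^(k+1) - v*r^i) := by
        rw [pow_succ]; field_simp
      rw [e6, norm_mul, Complex.norm_natCast, ← mul_add, mul_assoc] at g5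
      have g6 := le_of_mul_le_mul_left g5 hF
      have hEpos : 0 ≤ E ∨ n = 0 := by
        rcases Nat.eq_zero_or_pos n with h0 | h0
        · exact Or.inr h0
        · left; linarith [hE 0 h0, norm_nonneg (zl a b 0 - v*r^0)]
      rcases hEpos with hE0 | h0
      swap
      · subst h0; simp at hi
      refine g6.trans ?_
      rw [mul_assoc]
      apply mul_le_mul_of_nonneg_left _ hE0
      have x1 := Real.add_one_le_exp (δ+2/(nF:ℝ))
      calc _ ≤ Real.exp (δ+2/(nF:ℝ)) * Real.exp (δ*(201/100)*((201/100)^k-1)+2*k/nF) := by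
            apply mul_le_mul_of_nonneg_right _ (Real.exp_pos _).le; linarith
        _ = Real.exp (δ+2/(nF:ℝ) + (δ*(201/100)*((201/100)^k-1)+2*k/nF)) := (Real.exp_add _ _).symm
        _ ≤ _ := by
            apply Real.exp_le_exp.mpr
            rw [ep]; push_cast
            have : 2*((k:ℝ)+1)/65537 = 2/65537 + 2*k/65537 := by ring
            rw [this]
            linarith

-- Part N4
noncomputable def rr (m : ℕ) : ℂ := Complex.exp ((-(Real.pi*(Real.log m/Real.log 2)):ℝ)*Complex.I)

lemma rr_norm (m : ℕ) : ‖rr m‖ = 1 := Complex.norm_exp_ofReal_mul_I _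

lemma rr_4096 : rr 4096 = 1 := by
  unfold rr
  have : Real.log ((4096:ℕ):ℝ) = 12*Real.log 2 := by
    rw [show ((4096:ℕ):ℝ) = (2:ℝ)^12 by norm_num, Real.log_pow]; norm_num
  have h2 : Real.log 2 ≠ 0 := (Real.log_pos (by norm_num)).ne'
  rw [this, mul_div_cancel_right₀ _ h2, Complex.exp_eq_one_iff]
  exact ⟨-6, by push_cast; ring⟩

noncomputable def nth (m : ℕ) : ℝ := Real.pi*((Real.log ((m+1:ℕ):ℝ) - Real.log m)/Real.log 2)

lemma rr_succ (m : ℕ) : rr (m+1) = rr m * Complex.exp ((-(nth m):ℝ)*Complex.I) := by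
  unfold rr nth
  rw [← Complex.exp_add]
  congr 1
  push_cast; ring

lemma kap_bd : |(nA:ℝ)/nD - 2*Real.pi/Real.log 2| ≤ 1/10^7 := by
  have h1 := Real.log_two_gt_d9
  have h2 := Real.log_two_lt_d9
  have h3 := Real.pi_gt_d20
  have h4 := Real.pi_lt_d20
  have hl : 0 < Real.log 2 := by linarith
  have eA : (nA:ℝ) = 622932933774 := by norm_num [nA]
  rw [abs_le]
  constructor
  · rw [neg_le_sub_iff_le_add, div_le_iff₀ hl, eA]
    norm_num; linarith
  · rw [tsub_le_iff_right, eA]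
    have : (622932933774:ℝ)/nD - 1/10^7 ≤ 2*Real.pi/Real.log 2 := by
      rw [le_div_iff₀ hl]; norm_num; linarith
    linarith

lemma log_quot_bd {m : ℕ} (hm : 4096 ≤ m) : |(Real.log ((m+1:ℕ):ℝ) - Real.log m) - 2*(1/(2*m+1:ℝ))| ≤ 3*(1/8193)^3 := by
  have hm' : (4096:ℝ) ≤ m := by exact_mod_cast hm
  set x : ℝ := 1/(2*m+1) with hx
  have hx0 : 0 < x := by positivity
  have hx1 : x ≤ 1/8193 := by
    rw [hx]; apply one_div_le_one_div_of_le (by norm_num); linarith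
  have e : Real.log ((m+1:ℕ):ℝ) - Real.log m = Real.log (1+x) - Real.log (1-x) := by
    rw [← Real.log_div (by positivity) (by positivity), ← Real.log_div (by positivity) (by linarith)]
    congr 1
    have : 1+x = 2*(m+1)/(2*m+1) := by rw [hx]; field_simp; ring
    rw [this]
    have : 1-x = 2*m/(2*m+1) := by rw [hx]; field_simp; ring
    rw [this]; push_cast; field_simp
  have a1 := Real.abs_log_sub_add_sum_range_le (x := x) (by rw [abs_of_pos hx0]; linarith) 2
  have a2 := Real.abs_log_sub_add_sum_range_le (x := -x) (by rw [abs_neg, abs_of_pos hx0]; linarith) 2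
  rw [abs_neg] at a2
  rw [abs_of_pos hx0] at a1 a2
  simp only [Finset.sum_range_succ, Finset.sum_range_zero, sub_neg_eq_add] at a1 a2
  norm_num at a1 a2
  have hb : x^3/(1-x) ≤ 3/2*(1/8193)^3 := by
    rw [div_le_iff₀ (by linarith)]
    have : x^3 ≤ (1/8193)^3 := pow_le_pow_left₀ hx0.le hx1 3
    nlinarith
  rw [e]
  rw [abs_le] at a1 a2 ⊢
  constructor <;> linarith [a1.1, a1.2, a2.1, a2.2]

lemma exp_lip (a b : ℝ) : ‖Complex.exp ((a:ℝ)*Complex.I) - Complex.exp ((b:ℝ)*Complex.I)‖ ≤ |a-b| := by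
  have e : Complex.exp ((a:ℝ)*Complex.I) - Complex.exp ((b:ℝ)*Complex.I) = Complex.exp ((b:ℝ)*Complex.I)*(Complex.exp (Complex.I*((a-b:ℝ):ℂ)) - 1) := by
    rw [mul_sub, ← Complex.exp_add, mul_one]; congr 2; push_cast; ring
  rw [e, norm_mul, Complex.norm_exp_ofReal_mul_I, one_mul]
  exact Real.norm_exp_I_mul_ofReal_sub_one_le

lemma exp_cub {t : ℝ} (h0 : 0 ≤ t) (h1 : t ≤ 111/100000) : ‖(((1-t^2/2:ℝ):ℂ) + ((-t:ℝ):ℂ)*Complex.I) - Complex.exp ((-t:ℝ)*Complex.I)‖ ≤ 2/9*t^3 := by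
  have hn : ‖((-t:ℝ):ℂ)*Complex.I‖ = t := by
    rw [norm_mul, Complex.norm_I, mul_one, Complex.norm_real, Real.norm_eq_abs, abs_neg, abs_of_nonneg h0]
  have h := Complex.exp_bound (x := ((-t:ℝ):ℂ)*Complex.I) (by rw [hn]; linarith) (n := 3) (by norm_num)
  rw [hn, norm_sub_rev] at h
  have e : ∑ m ∈ range 3, (((-t:ℝ):ℂ)*Complex.I)^m/(m.factorial:ℂ) = (((1-t^2/2:ℝ):ℂ) + ((-t:ℝ):ℂ)*Complex.I) := by
    simp only [Finset.sum_range_succ, Finset.sum_range_zero, Nat.factorial]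
    push_cast
    linear_combination ((t:ℂ)^2/2)*Complex.I_sq
  rw [e] at h
  refine h.trans (le_of_eq ?_)
  norm_num [Nat.factorial]; ring

lemma rot_spec {m : ℕ} (hm : 4096 ≤ m) :
    ‖nvl nD (Nat.sub (Nat.add nB nD) (Nat.div (Nat.mul (Nat.div nA (Nat.add (Nat.mul 2 m) 1)) (Nat.div nA (Nat.add (Nat.mul 2 m) 1))) nB))
      (Nat.sub nB (Nat.div nA (Nat.add (Nat.mul 2 m) 1))) - Complex.exp ((-(nth m):ℝ)*Complex.I)‖ ≤ 3697/10^13 := by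
  have hm' : (4096:ℝ) ≤ m := by exact_mod_cast hm
  set T : ℕ := Nat.div nA (Nat.add (Nat.mul 2 m) 1) with hT
  set t : ℝ := (T:ℝ)/nD with ht
  have hD : (0:ℝ) < (nD:ℝ) := by norm_num
  have eB : (nB:ℝ) = 2*nD := by norm_num
  have eT : (T:ℝ) = t*nD := by rw [ht]; field_simp
  have ec : ((Nat.add (Nat.mul 2 m) 1:ℕ):ℝ) = 2*m+1 := by rw [nadd_cast, nmul_cast]; push_cast; ring
  have hb := ndiv_bd nA (d := Nat.add (Nat.mul 2 m) 1) (Nat.succ_pos _)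
  rw [ec, ← hT] at hb
  set x : ℝ := 1/(2*m+1) with hx
  have hx0 : 0 < x := by positivity
  have hx1 : x ≤ 1/8193 := by
    rw [hx]; apply one_div_le_one_div_of_le (by norm_num); linarith
  have eAx : (nA:ℝ)/(2*m+1) = (nA:ℝ)/nD*x*nD := by rw [hx]; field_simp
  rw [eAx] at hb
  have eA : (nA:ℝ) = 622932933774 := by norm_num [nA]
  have t0 : 0 ≤ t := by positivity
  have t1 : t ≤ (nA:ℝ)/nD*x := by
    rw [ht, div_le_iff₀ hD]; exact hb.2
  have t2 : (nA:ℝ)/nD*x - 1/nD ≤ t := by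
    rw [ht, le_div_iff₀ hD, sub_mul]
    have : 1/(nD:ℝ)*nD = 1 := by field_simp
    rw [this]; exact hb.1
  have t3 : t ≤ 11066/10^7 := by
    refine t1.trans ?_
    rw [eA]; norm_num; linarith
  -- theta
  have hk := kap_bd
  have hq := log_quot_bd hm
  rw [← hx] at hq
  have hl1 := Real.log_two_gt_d9
  have hl : 0 < Real.log 2 := by linarith
  have hpl : Real.pi/Real.log 2 ≤ 46/10 := by
    rw [div_le_iff₀ hl]; linarith [Real.pi_lt_d2]
  have hth : |(nth m) - 2*Real.pi/Real.log 2*x| ≤ 46/10*(3*(1/8193)^3) := by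
    have e : nth m - 2*Real.pi/Real.log 2*x = Real.pi/Real.log 2*((Real.log ((m+1:ℕ):ℝ) - Real.log m) - 2*x) := by
      unfold nth; ring
    rw [e, abs_mul, abs_of_pos (div_pos Real.pi_pos hl)]
    exact mul_le_mul hpl hq (abs_nonneg _) (by norm_num)
  have htt : |(-t) - (-nth m)| ≤ 53/10^12 := by
    have hkx : |(nA:ℝ)/nD*x - 2*Real.pi/Real.log 2*x| ≤ 1/10^7*(1/8193) := by
      rw [← sub_mul, abs_mul, abs_of_pos hx0]
      exact mul_le_mul hk hx1 hx0.le (by norm_num)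
    generalize 2*Real.pi/Real.log 2*x = P at *
    have : (1:ℝ)/nD ≤ 1456/10^14 := by norm_num
    rw [abs_le] at *
    generalize (nA:ℝ)/nD*x = Q at *
    generalize (1:ℝ)/nD = R at *
    norm_num at *
    constructor <;> linarith [hth.1, hth.2, hkx.1, hkx.2]
  -- value
  have hdd := ndiv_bd (Nat.mul T T) (d := nB) (by norm_num)
  rw [nmul_cast] at hdd
  have e4 : (T:ℝ)*T/nB = t^2/2*nD := by rw [eB, eT]; field_simp
  rw [e4] at hdd
  have t4 : t^2 ≤ 1 := by nlinarith
  have c1 : ((Nat.sub (Nat.add nB nD) (Nat.div (Nat.mul T T) nB):ℕ):ℝ) = 3*nD - ((Nat.div (Nat.mul T T) nB:ℕ):ℝ) := by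
    rw [nsub_cast, nadd_cast, eB]
    · ring
    · rw [nadd_cast, eB]
      nlinarith [hdd.2]
  have c2 : ((Nat.sub nB T:ℕ):ℝ) = 2*nD - t*nD := by
    rw [nsub_cast, eB, eT]
    rw [eB, eT]; nlinarith
  have v1 : ‖nvl nD (Nat.sub (Nat.add nB nD) (Nat.div (Nat.mul T T) nB)) (Nat.sub nB T) - (((1-t^2/2:ℝ):ℂ) + ((-t:ℝ):ℂ)*Complex.I)‖ ≤ 1/nD := by
    unfold nvl
    rw [c1, c2]
    have e5 : (2*(nD:ℝ)-t*nD-2*nD)/nD = -t := by field_simp; ring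
    rw [e5, add_sub_add_right_eq_sub, ← Complex.ofReal_sub, Complex.norm_real, Real.norm_eq_abs]
    have e6 : (3*(nD:ℝ) - ((Nat.div (Nat.mul T T) nB:ℕ):ℝ) - 2*nD)/nD - (1-t^2/2) = (t^2/2*nD - ((Nat.div (Nat.mul T T) nB:ℕ):ℝ))/nD := by
      field_simp; ring
    rw [e6, abs_div, abs_of_pos hD]
    apply div_le_div_of_nonneg_right _ hD.le
    rw [abs_le]; constructor <;> linarith [hdd.1, hdd.2]
  have v2 := exp_cub t0 (by linarith)
  have v3 := exp_lip (-t) (-nth m)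
  have v4 : t^3 ≤ (11066/10^7)^3 := pow_le_pow_left₀ t0 t3 3
  have v5 : (1:ℝ)/nD ≤ 1456/10^14 := by norm_num
  set Z := nvl nD (Nat.sub (Nat.add nB nD) (Nat.div (Nat.mul T T) nB)) (Nat.sub nB T)
  set Y := (((1-t^2/2:ℝ):ℂ) + ((-t:ℝ):ℂ)*Complex.I)
  have e7 : Z - Complex.exp ((-(nth m):ℝ)*Complex.I) = (Z - Y) + (Y - Complex.exp ((-t:ℝ)*Complex.I)) + (Complex.exp ((-t:ℝ)*Complex.I) - Complex.exp ((-(nth m):ℝ)*Complex.I)) := by ring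
  rw [e7]
  refine (norm_add_le _ _).trans ((add_le_add (norm_add_le _ _) le_rfl).trans ?_)
  have : (2:ℝ)/9*(11066/10^7)^3 ≤ 302/10^12 := by norm_num
  have v6 : ‖Y - Complex.exp ((-t:ℝ)*Complex.I)‖ ≤ 302/10^12 := v2.trans (by linarith)
  have v7 := v3.trans htt
  have v8 := v1.trans v5
  linarith

/-- one step of the rotation -/
lemma rot_step {m C S : ℕ} (hm : 4096 ≤ m) {d : ℝ} (h : ‖nvl nD C S - rr m‖ ≤ d) (hd : d ≤ 1/1000) :
    ‖nvl nD (mre C S (Nat.sub (Nat.add nB nD) (Nat.div (Nat.mul (Nat.div nA (Nat.add (Nat.mul 2 m) 1)) (Nat.div nA (Nat.add (Nat.mul 2 m) 1))) nB))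
      (Nat.sub nB (Nat.div nA (Nat.add (Nat.mul 2 m) 1))))
      (mim C S (Nat.sub (Nat.add nB nD) (Nat.div (Nat.mul (Nat.div nA (Nat.add (Nat.mul 2 m) 1)) (Nat.div nA (Nat.add (Nat.mul 2 m) 1))) nB))
      (Nat.sub nB (Nat.div nA (Nat.add (Nat.mul 2 m) 1)))) - rr (m+1)‖ ≤ d + 4/10^10 := by
  have h1 := rot_spec hm
  set U := (Nat.sub (Nat.add nB nD) (Nat.div (Nat.mul (Nat.div nA (Nat.add (Nat.mul 2 m) 1)) (Nat.div nA (Nat.add (Nat.mul 2 m) 1))) nB))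
  set V := (Nat.sub nB (Nat.div nA (Nat.add (Nat.mul 2 m) 1)))
  have hr := rr_norm m
  have hu : ‖Complex.exp ((-(nth m):ℝ)*Complex.I)‖ = 1 := Complex.norm_exp_ofReal_mul_I _
  have n1 : ‖nvl nD C S‖ ≤ 11/10 := (norm_le_of_near hr h).trans (by linarith)
  have n2 : ‖nvl nD U V‖ ≤ 11/10 := (norm_le_of_near hu h1).trans (by norm_num)
  have h3 := mul_spec n1 n2
  have h4 := prod_near hr hu h h1
  rw [← rr_succ] at h4
  have e : nvl nD (mre C S U V) (mim C S U V) - rr (m+1) = (nvl nD (mre C S U V) (mim C S U V) - nvl nD C S*nvl nD U V) + (nvl nD C S*nvl nD U V - rr (m+1)) := by ring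
  rw [e]
  refine (norm_add_le _ _).trans ?_
  have : (2:ℝ)/nD ≤ 2912/10^14 := by norm_num
  linarith

-- Part N5
/-- scale -/
noncomputable def nS : ℂ := (nH:ℂ)*(nF:ℂ)*(nF:ℂ)^8

lemma nS_ne : nS ≠ 0 := by unfold nS; norm_num

lemma nloop_succ (K q X f : ℕ) (chk) (m C S R1 R2 M1 M2 : ℕ) :
    nloop K q X (f+1) chk m C S R1 R2 M1 M2 =
     nwt 12 m fun wp wm =>
     nsqs K (mre C S C S) (mim C S C S) fun U V => npw q U V C S fun Z Y =>
     npack K X (mre C S C S) (mim C S C S)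
       (Nat.mul (Nat.div nH m) (Nat.add (Nat.mul wp (Nat.div Z nE)) (Nat.mul wm 131074)))
       (Nat.mul (Nat.div nH m) (Nat.add (Nat.mul wm (Nat.div Z nE)) (Nat.mul wp 131074)))
       (Nat.mul (Nat.div nH m) (Nat.add (Nat.mul wp (Nat.div Y nE)) (Nat.mul wm 131074)))
       (Nat.mul (Nat.div nH m) (Nat.add (Nat.mul wm (Nat.div Y nE)) (Nat.mul wp 131074))) fun r1 r2 m1 m2 =>
     nloop K q X f chk (Nat.succ m)
      (mre C S (Nat.sub (Nat.add nB nD) (Nat.div (Nat.mul (Nat.div nA (Nat.add (Nat.mul 2 m) 1)) (Nat.div nA (Nat.add (Nat.mul 2 m) 1))) nB))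
      (Nat.sub nB (Nat.div nA (Nat.add (Nat.mul 2 m) 1))))
      (mim C S (Nat.sub (Nat.add nB nD) (Nat.div (Nat.mul (Nat.div nA (Nat.add (Nat.mul 2 m) 1)) (Nat.div nA (Nat.add (Nat.mul 2 m) 1))) nB))
      (Nat.sub nB (Nat.div nA (Nat.add (Nat.mul 2 m) 1))))
      (Nat.add R1 r1) (Nat.add R2 r2) (Nat.add M1 m1) (Nat.add M2 m2) := by
  show (fo (Nat.div nH m) fun w =>
     nwt 12 m fun wp wm =>
     fo (mre C S C S) fun C1 => fo (mim C S C S) fun S1 =>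
     nsqs K C1 S1 fun U V => npw q U V C S fun Z Y =>
     fo (Nat.div Z nE) fun z => fo (Nat.div Y nE) fun y =>
     fo (Nat.mul w (Nat.add (Nat.mul wp z) (Nat.mul wm 131074))) fun a1 =>
     fo (Nat.mul w (Nat.add (Nat.mul wm z) (Nat.mul wp 131074))) fun a2 =>
     fo (Nat.mul w (Nat.add (Nat.mul wp y) (Nat.mul wm 131074))) fun b1 =>
     fo (Nat.mul w (Nat.add (Nat.mul wm y) (Nat.mul wp 131074))) fun b2 =>
     npack K X C1 S1 a1 a2 b1 b2 fun r1 r2 m1 m2 =>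
     fo (Nat.add R1 r1) fun R1' => fo (Nat.add R2 r2) fun R2' => fo (Nat.add M1 m1) fun M1' => fo (Nat.add M2 m2) fun M2' =>
     fo (Nat.div nA (Nat.add (Nat.mul 2 m) 1)) fun th =>
     fo (Nat.sub (Nat.add nB nD) (Nat.div (Nat.mul th th) nB)) fun ur =>
     fo (Nat.sub nB th) fun ui =>
     fo (mre C S ur ui) fun C' =>
     fo (mim C S ur ui) fun S' =>
     fo (Nat.succ m) fun m' =>
     nloop K q X f chk m' C' S' R1' R2' M1' M2') = _
  simp only [fo_eq]

lemma lanes_add {X n R1 R2 r1 r2 : ℕ} {a b : ℕ → ℤ} (h1 : lanes X n R1 R2 a) (h2 : lanes X n r1 r2 b) :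
    lanes X n (Nat.add R1 r1) (Nat.add R2 r2) (fun i => a i + b i) := by
  unfold lanes at *
  simp only [add_mul, Finset.sum_add_distrib, ← h1, ← h2, Nat.add_eq]
  push_cast; ring

/-- one term -/
lemma term_spec (X q m C S wp wm U V Z Y : ℕ) (hq : q ≤ 3) (hm : 4096 ≤ m) (hm2 : m < 8192) (hw : (wp:ℤ) - wm = wf 12 m)
    (h : ‖nvl nD C S - rr m‖ + 2/nD ≤ 17/10^7)
    (hU : ∀ (r : ℂ) (δ : ℝ), ‖r‖ = 1 → ‖nvl nD (mre C S C S) (mim C S C S) - r‖ + 2/nD ≤ δ → δ*(201/100)^8 ≤ 1/100 →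
      ‖nvl nD U V - r^(2^8)‖ + 2/nD ≤ δ*(201/100)^8)
    (hZ : ∀ (r u : ℂ) (δ d : ℝ), ‖r‖ = 1 → ‖u‖ = 1 → ‖nvl nD C S - r‖ ≤ d → ‖nvl nD U V - u‖ + 2/nD ≤ δ →
      d + q*(δ*(11/10)) ≤ 1/100 →
      ‖nvl nD Z Y - r*u^q‖ ≤ d + q*(δ*(11/10))) :
    ∃ (r1 r2 m1 m2 : ℕ) (a b : ℕ → ℤ), (∀ F, npack 8 X (mre C S C S) (mim C S C S)
       (Nat.mul (Nat.div nH m) (Nat.add (Nat.mul wp (Nat.div Z nE)) (Nat.mul wm 131074)))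
       (Nat.mul (Nat.div nH m) (Nat.add (Nat.mul wm (Nat.div Z nE)) (Nat.mul wp 131074)))
       (Nat.mul (Nat.div nH m) (Nat.add (Nat.mul wp (Nat.div Y nE)) (Nat.mul wm 131074)))
       (Nat.mul (Nat.div nH m) (Nat.add (Nat.mul wm (Nat.div Y nE)) (Nat.mul wp 131074))) F = F r1 r2 m1 m2) ∧
      lanes X 256 r1 r2 a ∧ lanes X 256 m1 m2 b ∧
      ∀ i < 256, ‖zl a b i/nS - ((wf 12 m:ℝ)/m:ℝ)*rr m^(2*(256*q+i)+1)‖ ≤ |(wf 12 m:ℝ)|/m*(45/10^4) := by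
  have hm' : (4096:ℝ) ≤ m := by exact_mod_cast hm
  have hm2' : (m:ℝ) ≤ 8192 := by exact_mod_cast hm2.le
  have h131 : (131074:ℕ) = 2*nF := by norm_num
  set W0 := Nat.div nH m with hW0
  set z := Nat.div Z nE with hz
  set y := Nat.div Y nE with hy
  set wi := wf 12 m with hwi
  have hD : (0:ℝ) < 2/(nD:ℝ) := by norm_num
  have hF : (0:ℝ) < (nF:ℝ) := by norm_num
  have hH : (0:ℝ) < (nH:ℝ) := by norm_num
  have hr := rr_norm m
  obtain ⟨r1, r2, m1, m2, a, b, g1, g2, g3, g4⟩ := npack_spec X 8 1 (mre C S C S) (mim C S C S)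
    (Nat.mul W0 (Nat.add (Nat.mul wp z) (Nat.mul wm 131074)))
    (Nat.mul W0 (Nat.add (Nat.mul wm z) (Nat.mul wp 131074)))
    (Nat.mul W0 (Nat.add (Nat.mul wp y) (Nat.mul wm 131074)))
    (Nat.mul W0 (Nat.add (Nat.mul wm y) (Nat.mul wp 131074)))
    (fun _ => W0*wi*((z:ℤ)-2*nF)) (fun _ => W0*wi*((y:ℤ)-2*nF))
    (by unfold lanes; simp only [Nat.add_eq, Nat.mul_eq, h131, ← hw]; push_cast; simp; ring)
    (by unfold lanes; simp only [Nat.add_eq, Nat.mul_eq, h131, ← hw]; push_cast; simp; ring)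
  rw [pow_one] at g1
  refine ⟨r1, r2, m1, m2, a, b, g1, g2, g3, fun i hi => ?_⟩
  -- errors
  have k1 := sq_step hr h (by norm_num)
  have k2 := hU (rr m^2) _ (by rw [norm_pow, hr, one_pow]) k1 (by norm_num)
  rw [← pow_mul] at k2
  have k3 := hZ (rr m) (rr m^(2*2^8)) _ (17/10^7) hr (by rw [norm_pow, hr, one_pow]) (by linarith) k2 (by
    have : (q:ℝ) ≤ 3 := by exact_mod_cast hq
    have h0 : (0:ℝ) ≤ 17/10^7*(201/100)*(201/100)^8*(11/10) := by positivity
    have := mul_le_mul_of_nonneg_right this h0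
    refine (add_le_add le_rfl this).trans ?_
    norm_num)
  have k4 : ‖nvl nD Z Y - rr m^(512*q+1)‖ ≤ 305/10^5 := by
    have e : rr m * (rr m^(2*2^8))^q = rr m^(512*q+1) := by rw [← pow_mul]; norm_num; ring
    rw [e] at k3
    refine k3.trans ?_
    have : (q:ℝ) ≤ 3 := by exact_mod_cast hq
    have h0 : (0:ℝ) ≤ 17/10^7*(201/100)*(201/100)^8*(11/10) := by positivity
    have := mul_le_mul_of_nonneg_right this h0
    refine (add_le_add le_rfl this).trans ?_
    norm_num
  have k5 : ‖nvl nF z y - rr m^(512*q+1)‖ ≤ 309/10^5 := by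
    have e : nvl nF z y - rr m^(512*q+1) = (nvl nF z y - nvl nD Z Y) + (nvl nD Z Y - rr m^(512*q+1)) := by ring
    rw [e]
    refine (norm_add_le _ _).trans ?_
    have := ntrunc Z Y
    have : (2:ℝ)/nF ≤ 4/10^5 := by norm_num
    linarith
  set w : ℝ := |(wi:ℝ)| *W0*nF with hwd
  have hw0 : 0 ≤ w := by positivity
  set v : ℂ := (wi:ℂ)*W0*nF*rr m^(512*q+1) with hv
  have hvn : ‖v‖ = w := by
    rw [hv, norm_mul, norm_mul, norm_mul, norm_pow, hr, one_pow, mul_one, Complex.norm_natCast, Complex.norm_natCast, hwd, Complex.norm_intCast]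
  have hinit : ∀ i < 1, ‖zl (fun _ => W0*wi*((z:ℤ)-2*nF)) (fun _ => W0*wi*((y:ℤ)-2*nF)) i - v*(rr m^2)^i‖ + w ≤ w*(1+309/10^5) := by
    intro i hi
    have : i = 0 := by omega
    subst this
    have e : zl (fun _ => W0*wi*((z:ℤ)-2*nF)) (fun _ => W0*wi*((y:ℤ)-2*nF)) 0 - v*(rr m^2)^0 = (wi:ℂ)*W0*nF*(nvl nF z y - rr m^(512*q+1)) := by
      unfold zl nvl; rw [hv]; push_cast
      have : (65537:ℂ) ≠ 0 := by norm_num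
      field_simp; ring
    rw [e, norm_mul, norm_mul, norm_mul, Complex.norm_natCast, Complex.norm_natCast, Complex.norm_intCast, ← hwd]
    have := mul_le_mul_of_nonneg_left k5 hw0
    linarith
  have k6 := g4 (rr m^2) v (17/10^7*(201/100)) w (w*(1+309/10^5)) (by rw [norm_pow, hr, one_pow]) hvn.le (by simpa only [pow_one] using k1) (by norm_num) hinit i (by simpa using hi)
  have hexp : Real.exp (17/10^7*(201/100)*((201/100)^8-1)+2*(8:ℕ)/nF) ≤ 1+116/10^5 := by
    have : (17/10^7*(201/100)*((201/100)^8-1)+2*((8:ℕ):ℝ)/nF) ≤ 1157/10^6 := by norm_num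
    refine (Real.exp_le_exp.mpr this).trans ?_
    have h1 := Real.exp_bound_div_one_sub_of_interval (x := 1157/10^6) (by norm_num) (by norm_num)
    refine h1.trans ?_
    norm_num
  have k7 : ‖zl a b i/(nF:ℂ)^8 - v*(rr m^2)^i‖ ≤ w*(44/10^4) := by
    have := mul_le_mul_of_nonneg_left hexp (show 0 ≤ w*(1+309/10^5) by positivity)
    have h2 := k6.trans this
    nlinarith
  -- rescale by nH nF
  have hFc : ((nF:ℕ):ℂ) ≠ 0 := by norm_num
  have hHc : ((nH:ℕ):ℂ) ≠ 0 := by norm_num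
  have hb := ndiv_bd nH (d := m) (by omega)
  rw [← hW0] at hb
  have e8 : zl a b i/nS - ((wi:ℝ)/m:ℝ)*rr m^(2*(256*q+i)+1) =
     (zl a b i/(nF:ℂ)^8 - v*(rr m^2)^i)/((nH:ℂ)*nF) + ((((wi:ℝ)*((W0:ℝ)/nH - 1/m)):ℝ):ℂ)*rr m^(2*(256*q+i)+1) := by
    have : v*(rr m^2)^i = (wi:ℂ)*W0*nF*rr m^(2*(256*q+i)+1) := by
      rw [hv, ← pow_mul, mul_assoc, ← pow_add]; congr 2; ring
    rw [this]; unfold nS; push_cast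
    have hmc : (m:ℂ) ≠ 0 := by exact_mod_cast (by omega : m ≠ 0)
    have : (65537:ℂ) ≠ 0 := by norm_num
    field_simp; ring
  rw [e8]
  refine (norm_add_le _ _).trans ?_
  rw [norm_div, norm_mul, norm_mul, norm_pow, hr, one_pow, mul_one, Complex.norm_natCast, Complex.norm_natCast, Complex.norm_real, Real.norm_eq_abs, abs_mul]
  have a1 : (W0:ℝ)/nH ≤ 1/m := by
    rw [div_le_div_iff₀ hH (by linarith)]
    have := hb.2
    rw [le_div_iff₀ (by linarith)] at this
    linarith
  have a2 : |(W0:ℝ)/nH - 1/m| ≤ 1/m*(1/10^5) := by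
    rw [abs_le]
    constructor
    · have : (nH:ℝ)/m/nH - 1/nH ≤ (W0:ℝ)/nH := by
        rw [← sub_div]; exact div_le_div_of_nonneg_right hb.1 hH.le
      have e : (nH:ℝ)/m/nH = 1/m := by field_simp
      rw [e] at this
      have : (1:ℝ)/nH ≤ 1/m*(1/10^5) := by
        rw [← mul_div_mul_comm, mul_one, div_le_div_iff₀ hH (by positivity)]; norm_num; linarith
      linarith
    · have : (0:ℝ) ≤ 1/m*(1/10^5) := by positivity
      linarith
  have a3 : ‖zl a b i/(nF:ℂ)^8 - v*(rr m^2)^i‖/((nH:ℝ)*nF) ≤ |(wi:ℝ)| *(1/m)*(44/10^4) := by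
    rw [div_le_iff₀ (by positivity)]
    refine k7.trans ?_
    rw [hwd]
    have : (W0:ℝ) ≤ 1/m*nH := by rw [div_le_iff₀ hH] at a1; exact a1
    have := mul_le_mul_of_nonneg_left this (show 0 ≤ |(wi:ℝ)| *nF*(44/10^4) by positivity)
    linarith
  have a4 := mul_le_mul_of_nonneg_left a2 (abs_nonneg (wi:ℝ))
  have e9 : |(wi:ℝ)|/m = |(wi:ℝ)| *(1/m) := by ring
  rw [e9]
  have : 0 ≤ |(wi:ℝ)| *(1/m) := by positivity
  linarith

lemma nloop_spec (X q : ℕ) (hq : q ≤ 3) (chk) (f : ℕ) : ∀ (m C S R1 R2 M1 M2 : ℕ) (a b : ℕ → ℤ), m + f = 8192 → 4096 ≤ m →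
    ‖nvl nD C S - rr m‖ ≤ ((m:ℝ)-4096)*(4/10^10) → lanes X 256 R1 R2 a → lanes X 256 M1 M2 b →
    ∃ (R1' R2' M1' M2' : ℕ) (a' b' : ℕ → ℤ), nloop 8 q X f chk m C S R1 R2 M1 M2 = chk R1' R2' M1' M2' ∧
      lanes X 256 R1' R2' a' ∧ lanes X 256 M1' M2' b' ∧
      ∀ i < 256, ‖zl a' b' i/nS - zl a b i/nS - ∑ k ∈ Ico m 8192, ((wf 12 k:ℝ)/k:ℝ)*rr k^(2*(256*q+i)+1)‖ ≤
         ∑ k ∈ Ico m 8192, |(wf 12 k:ℝ)|/k*(45/10^4) := by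
  induction f with
  | zero =>
    intro m C S R1 R2 M1 M2 a b hm _ _ ha hb
    refine ⟨R1, R2, M1, M2, a, b, rfl, ha, hb, fun i hi => ?_⟩
    have : m = 8192 := by omega
    subst this; simp
  | succ f ih =>
    intro m C S R1 R2 M1 M2 a b hm hm4 h ha hb
    have hm' : (4096:ℝ) ≤ m := by exact_mod_cast hm4
    have hm2 : m < 8192 := by omega
    have hm2' : (m:ℝ) ≤ 8192 := by exact_mod_cast hm2.le
    obtain ⟨wp, wm, w1, w2⟩ := nwt_spec 12 m
    obtain ⟨U, V, u1, u2⟩ := nsqs_spec 8 (mre C S C S) (mim C S C S)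
    obtain ⟨Z, Y, z1, z2⟩ := npw_spec q U V C S
    have hD : (2:ℝ)/nD ≤ 3/10^11 := by norm_num
    obtain ⟨r1, r2, m1, m2, a1, b1, g1, g2, g3, g4⟩ := term_spec X q m C S wp wm U V Z Y hq hm4 hm2 w2 (by linarith) u2 z2
    have hrot := rot_step hm4 h (by linarith)
    obtain ⟨R1', R2', M1', M2', a', b', k1, k2, k3, k4⟩ := ih (m+1) _ _ _ _ _ _ _ _ (by omega) (by omega)
      (by push_cast; refine hrot.trans (le_of_eq ?_); ring) (lanes_add ha g2) (lanes_add hb g3)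
    refine ⟨R1', R2', M1', M2', a', b', ?_, k2, k3, fun i hi => ?_⟩
    · rw [nloop_succ, w1, u1, z1, g1]; exact k1
    · have t1 := k4 i hi
      have t2 := g4 i hi
      rw [← Finset.sum_Ioo_add_eq_sum_Ico hm2, ← Finset.sum_Ioo_add_eq_sum_Ico hm2]
      have eI : Ico (m+1) 8192 = Ioo m 8192 := by ext; simp [Nat.succ_le_iff]
      rw [eI] at t1
      set P := ∑ k ∈ Ioo m 8192, ((wf 12 k:ℝ)/k:ℝ)*rr k^(2*(256*q+i)+1)
      set T := (((wf 12 m:ℝ)/m:ℝ):ℂ)*rr m^(2*(256*q+i)+1)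
      have e : zl a' b' i/nS - zl a b i/nS - (P + T) = (zl a' b' i/nS - zl (fun i => a i + a1 i) (fun i => b i + b1 i) i/nS - P) + (zl a1 b1 i/nS - T) := by
        unfold zl; push_cast; ring
      rw [e]
      exact (norm_add_le _ _).trans (add_le_add t1 t2)

-- Part N6
def nws : ℕ → ℕ
  | 0 => 0
  | n+1 => nws n + (wf 12 (4096+n)).natAbs*(10^9/(4096+n)+1)

lemma nws_eq (n : ℕ) : nws n = ∑ i ∈ range n, (wf 12 (4096+i)).natAbs*(10^9/(4096+i)+1) := by
  induction n with
  | zero => rfl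
  | succ n ih => rw [Finset.sum_range_succ, ← ih]; rfl

lemma nws_val : nws 4096 ≤ 3510000000 := by decide +kernel

lemma wsum_bd : ∑ k ∈ Ico 4096 8192, |(wf 12 k:ℝ)|/k ≤ 351/100 := by
  have h : ((nws 4096:ℕ):ℝ) ≤ 3510000000 := by exact_mod_cast nws_val
  rw [nws_eq] at h
  rw [Finset.sum_Ico_eq_sum_range]
  push_cast at h
  simp only [Nat.cast_natAbs, Int.cast_abs] at h
  have : ∑ i ∈ range (8192-4096), |(wf 12 (4096+i):ℝ)|/((4096+i:ℕ):ℝ) ≤ (∑ i ∈ range 4096, |(wf 12 (4096+i):ℝ)| * (((10^9/(4096+i):ℕ):ℝ)+1))/10^9 := by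
    rw [Finset.sum_div]
    apply Finset.sum_le_sum
    intro i _
    have hb := ndiv_bd (10^9) (d := 4096+i) (by omega)
    have e : ((Nat.div (10^9) (4096+i):ℕ):ℝ) = ((10^9/(4096+i):ℕ):ℝ) := rfl
    rw [e] at hb
    rw [div_eq_mul_inv, mul_div_assoc]
    apply mul_le_mul_of_nonneg_left _ (abs_nonneg _)
    rw [le_div_iff₀ (by norm_num)]
    have := hb.1
    rw [div_eq_mul_inv] at this
    push_cast at this ⊢
    linarith
  refine this.trans ?_
  rw [div_le_iff₀ (by norm_num)]
  push_cast
  linarith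

lemma digit0 {X n : ℕ} {e : ℕ → ℕ} (he : ∀ i < n+1, e i < X) :
    (∑ i ∈ range (n+1), e i*X^i) % X = e 0 ∧ (∑ i ∈ range (n+1), e i*X^i)/X = ∑ i ∈ range n, e (i+1)*X^i := by
  have h : ∑ i ∈ range (n+1), e i*X^i = e 0 + X*∑ i ∈ range n, e (i+1)*X^i := by
    rw [Finset.sum_range_succ', Finset.mul_sum, add_comm]
    simp only [pow_zero, mul_one]
    congr 1
    refine Finset.sum_congr rfl fun i _ => ?_
    rw [pow_succ]; ring
  have h0 := he 0 (by omega)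
  have hX : 0 < X := by omega
  rw [h]
  refine ⟨?_, ?_⟩
  · rw [Nat.add_mul_mod_self_left, Nat.mod_eq_of_lt h0]
  · rw [Nat.add_mul_div_left _ _ hX, Nat.div_eq_of_lt h0, zero_add]

lemma nsq_sub (a H : ℕ) : ((Nat.sub (Nat.add (Nat.mul a a) (Nat.mul H H)) (Nat.mul 2 (Nat.mul a H)):ℕ):ℝ) = ((a:ℝ)-H)^2 := by
  rw [nsub_cast]
  · simp only [nadd_cast, nmul_cast]; push_cast; ring
  · simp only [nadd_cast, nmul_cast]; push_cast; nlinarith [sq_nonneg ((a:ℝ)-H)]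

lemma nchk_spec (X H th1 th2 n : ℕ) : ∀ (j A B : ℕ) (e f : ℕ → ℕ), (∀ i < n, e i < X) → (∀ i < n, f i < X) →
    A = ∑ i ∈ range n, e i*X^i → B = ∑ i ∈ range n, f i*X^i → nchk X H th1 th2 n j A B = true →
    ∀ i < n, ((th1:ℝ)*(2*((j:ℝ)+i)+1)+th2)^2 ≤ (2*((j:ℝ)+i)+1)^2*(((e i:ℝ)-H)^2+((f i:ℝ)-H)^2) := by
  induction n with
  | zero => intro j A B e f _ _ _ _ _ i hi; omega
  | succ n ih =>
    intro j A B e f he hf hA hB h i hi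
    have h' : (fo (Nat.mod A X) fun a => fo (Nat.mod B X) fun b =>
      fo (Nat.add (Nat.mul 2 j) 1) fun o =>
      fo (Nat.add (Nat.mul th1 o) th2) fun t =>
      (Bool.rec false
        (fo (Nat.div A X) fun A' => fo (Nat.div B X) fun B' => fo (Nat.succ j) fun j' => nchk X H th1 th2 n j' A' B')
        (Nat.ble (Nat.mul t t) (Nat.mul (Nat.mul o o) (Nat.add
          (Nat.sub (Nat.add (Nat.mul a a) (Nat.mul H H)) (Nat.mul 2 (Nat.mul a H)))
          (Nat.sub (Nat.add (Nat.mul b b) (Nat.mul H H)) (Nat.mul 2 (Nat.mul b H)))))) : Bool)) = true := h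
    simp only [fo_eq] at h'
    have dA := digit0 he
    have dB := digit0 hf
    rw [← hA] at dA
    rw [← hB] at dB
    have mA : Nat.mod A X = e 0 := dA.1
    have mB : Nat.mod B X = f 0 := dB.1
    have qA : Nat.div A X = ∑ i ∈ range n, e (i+1)*X^i := dA.2
    have qB : Nat.div B X = ∑ i ∈ range n, f (i+1)*X^i := dB.2
    rw [mA, mB] at h'
    generalize hbb : Nat.ble (Nat.mul (Nat.add (Nat.mul th1 (Nat.add (Nat.mul 2 j) 1)) th2) (Nat.add (Nat.mul th1 (Nat.add (Nat.mul 2 j) 1)) th2)) (Nat.mul (Nat.mul (Nat.add (Nat.mul 2 j) 1) (Nat.add (Nat.mul 2 j) 1)) (Nat.add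
          (Nat.sub (Nat.add (Nat.mul (e 0) (e 0)) (Nat.mul H H)) (Nat.mul 2 (Nat.mul (e 0) H)))
          (Nat.sub (Nat.add (Nat.mul (f 0) (f 0)) (Nat.mul H H)) (Nat.mul 2 (Nat.mul (f 0) H))))) = bb at h'
    cases bb with
    | false => exact absurd h' (by simp)
    | true =>
      have h2 : nchk X H th1 th2 n (Nat.succ j) (Nat.div A X) (Nat.div B X) = true := h'
      have h3 := Nat.le_of_ble_eq_true hbb
      have h4 := (Nat.cast_le (α := ℝ)).mpr h3
      rcases Nat.eq_zero_or_pos i with h0 | h0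
      · subst h0
        simp only [nmul_cast, nadd_cast, nsq_sub] at h4
        push_cast at h4 ⊢
        rw [add_zero]
        linarith
      · obtain ⟨i, rfl⟩ : ∃ k, i = k+1 := ⟨i-1, by omega⟩
        have := ih (Nat.succ j) _ _ (fun i => e (i+1)) (fun i => f (i+1)) (fun i hi => he _ (by omega)) (fun i hi => hf _ (by omega)) qA qB h2 i (by omega)
        push_cast at this ⊢
        have e5 : (2*((j:ℝ)+(i+1))+1) = (2*((j:ℝ)+1+i)+1) := by ring
        rw [e5]; exact this

lemma ntest_lower {X H : ℕ} {th1 th2 q : ℕ} (hX : 2 ≤ X) (hH : 2*H ≤ X + 900) (hH2 : 10*(nsc 8) + 1000 ≤ H) (hq : q ≤ 3)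
    (h : nloop 8 q X 4096 (fun R1 R2 M1 M2 => fo (Nat.mul H (Nat.div (Nat.sub (Nat.pow X (Nat.pow 2 8)) 1) (Nat.sub X 1))) fun O =>
      nchk X H th1 th2 256 (Nat.mul 256 q)
     (Nat.sub (Nat.add R1 O) R2) (Nat.sub (Nat.add M1 O) M2)) 4096 (nB+nD) nB 0 0 0 0 = true) :
    ∀ i < 256, ((th1:ℝ)*(2*((256*q+i:ℕ):ℝ)+1)+th2)/((2*((256*q+i:ℕ):ℝ)+1)*(nsc 8)) - 158/10^4 ≤
      ‖∑ k ∈ Ico 4096 8192, ((wf 12 k:ℝ)/k:ℝ)*rr k^(2*(256*q+i)+1)‖ := by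
  obtain ⟨R1, R2, M1, M2, a, b, g1, g2, g3, g4⟩ := nloop_spec X q hq (fun R1 R2 M1 M2 => fo (Nat.mul H (Nat.div (Nat.sub (Nat.pow X (Nat.pow 2 8)) 1) (Nat.sub X 1))) fun O =>
      nchk X H th1 th2 256 (Nat.mul 256 q)
     (Nat.sub (Nat.add R1 O) R2) (Nat.sub (Nat.add M1 O) M2)) 4096 4096 (nB+nD) nB 0 0 0 0 (fun _ => 0) (fun _ => 0) (by norm_num) le_rfl
     (by rw [rr_4096]; unfold nvl; norm_num) (by simp [lanes]) (by simp [lanes])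
  rw [g1, fo_eq] at h
  have hO : Nat.mul H (Nat.div (Nat.sub (Nat.pow X (Nat.pow 2 8)) 1) (Nat.sub X 1)) = ∑ i ∈ range 256, H*X^i := by
    rw [← Finset.mul_sum, Nat.geomSum_eq hX]; rfl
  rw [hO] at h
  have hSn : ‖nS‖ = ((nsc 8:ℕ):ℝ) := by
    unfold nS nsc
    rw [norm_mul, norm_mul, norm_pow, Complex.norm_natCast, Complex.norm_natCast]
    simp only [nmul_cast]
    have : ((Nat.pow nF 8:ℕ):ℝ) = (nF:ℝ)^8 := Nat.cast_pow _ _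
    rw [this]
  have hSp : (0:ℝ) < ((nsc 8:ℕ):ℝ) := by rw [← hSn]; exact norm_pos_iff.mpr nS_ne
  have hw := wsum_bd
  have herr : ∀ i < 256, ‖zl a b i/nS - ∑ k ∈ Ico 4096 8192, ((wf 12 k:ℝ)/k:ℝ)*rr k^(2*(256*q+i)+1)‖ ≤ 158/10^4 := by
    intro i hi
    have := g4 i hi
    rw [← Finset.sum_mul] at this
    have e : zl (fun _ => 0) (fun _ => 0) i/nS = 0 := by simp [zl]
    rw [e, sub_zero] at this
    refine this.trans ?_
    linarith
  have hsz : ∀ i < 256, ‖zl a b i‖ ≤ 10*(nsc 8) := by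
    intro i hi
    have h1 := herr i hi
    have h2 : ‖∑ k ∈ Ico 4096 8192, (((wf 12 k:ℝ)/k:ℝ):ℂ)*rr k^(2*(256*q+i)+1)‖ ≤ 351/100 := by
      refine (norm_sum_le _ _).trans (le_trans (le_of_eq ?_) hw)
      refine Finset.sum_congr rfl fun k _ => ?_
      rw [norm_mul, norm_pow, rr_norm, one_pow, mul_one, Complex.norm_real, Real.norm_eq_abs, abs_div, Nat.abs_cast]
    have h3 : ‖zl a b i/nS‖ ≤ 10 := by
      have := norm_sub_norm_le (zl a b i/nS) (∑ k ∈ Ico 4096 8192, (((wf 12 k:ℝ)/k:ℝ):ℂ)*rr k^(2*(256*q+i)+1))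
      linarith
    rw [norm_div, hSn, div_le_iff₀ hSp] at h3
    exact h3
  have ha : ∀ i < 256, -(H:ℤ) ≤ a i ∧ a i + H < X := by
    intro i hi
    have h1 := hsz i hi
    have h2 := Complex.abs_re_le_norm (zl a b i)
    have h3 : (zl a b i).re = a i := by simp [zl]
    rw [h3] at h2
    have h4 : |(a i:ℝ)| ≤ ((10*(nsc 8):ℕ):ℝ) := by push_cast; linarith
    have h5 : |a i| ≤ ((10*(nsc 8):ℕ):ℤ) := by exact_mod_cast h4
    have h6 := abs_le.mp h5
    generalize nsc 8 = N at *
    omega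
  have hb : ∀ i < 256, -(H:ℤ) ≤ b i ∧ b i + H < X := by
    intro i hi
    have h1 := hsz i hi
    have h2 := Complex.abs_im_le_norm (zl a b i)
    have h3 : (zl a b i).im = b i := by simp [zl]
    rw [h3] at h2
    have h4 : |(b i:ℝ)| ≤ ((10*(nsc 8):ℕ):ℝ) := by push_cast; linarith
    have h5 : |b i| ≤ ((10*(nsc 8):ℕ):ℤ) := by exact_mod_cast h4
    have h6 := abs_le.mp h5
    generalize nsc 8 = N at *
    omega
  have conv : ∀ (R1 R2 : ℕ) (a : ℕ → ℤ), lanes X 256 R1 R2 a → (∀ i < 256, -(H:ℤ) ≤ a i ∧ a i + H < X) →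
      Nat.sub (Nat.add R1 (∑ i ∈ range 256, H*X^i)) R2 = ∑ i ∈ range 256, (a i + H).toNat*X^i := by
    intro R1 R2 a hl hh
    unfold lanes at hl
    have e1 : ((∑ i ∈ range 256, (a i + H).toNat*X^i:ℕ):ℤ) = (R1:ℤ) - R2 + ((∑ i ∈ range 256, H*X^i:ℕ):ℤ) := by
      rw [hl]; push_cast
      rw [← Finset.sum_add_distrib]
      refine Finset.sum_congr rfl fun i hi => ?_
      rw [Int.toNat_of_nonneg (neg_le_iff_add_nonneg.mp (hh i (Finset.mem_range.mp hi)).1)]; ring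
    simp only [Nat.sub_eq, Nat.add_eq]
    omega
  have k := nchk_spec X H th1 th2 256 _ _ _ (fun i => (a i + H).toNat) (fun i => (b i + H).toNat)
    (fun i hi => by have := ha i hi; show (a i + H).toNat < X; omega) (fun i hi => by have := hb i hi; show (b i + H).toNat < X; omega) (conv R1 R2 a g2 ha) (conv M1 M2 b g3 hb) h
  intro i hi
  have k1 := k i hi
  simp only [nmul_cast] at k1
  have ca : (((a i + H).toNat:ℕ):ℝ) - H = a i := by
    have : (((a i + H).toNat:ℕ):ℤ) = a i + H := Int.toNat_of_nonneg (by linarith [(ha i hi).1])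
    have h2 : (((a i + H).toNat:ℕ):ℝ) = ((((a i + H).toNat:ℕ):ℤ):ℝ) := by push_cast; rfl
    rw [h2, this]; push_cast; ring
  have cb : (((b i + H).toNat:ℕ):ℝ) - H = b i := by
    have : (((b i + H).toNat:ℕ):ℤ) = b i + H := Int.toNat_of_nonneg (by linarith [(hb i hi).1])
    have h2 : (((b i + H).toNat:ℕ):ℝ) = ((((b i + H).toNat:ℕ):ℤ):ℝ) := by push_cast; rfl
    rw [h2, this]; push_cast; ring
  rw [ca, cb] at k1
  have nz : ‖zl a b i‖^2 = (a i:ℝ)^2+(b i:ℝ)^2 := by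
    rw [← Complex.normSq_eq_norm_sq, Complex.normSq_apply]; simp [zl]; ring
  rw [← nz, ← mul_pow] at k1
  have eo : (2*(((256:ℕ):ℝ)*q+i)+1) = 2*((256*q+i:ℕ):ℝ)+1 := by push_cast; ring
  rw [eo] at k1
  set o : ℝ := 2*((256*q+i:ℕ):ℝ)+1 with ho
  have hop : 0 < o := by
    have : (0:ℝ) ≤ ((256*q+i:ℕ):ℝ) := Nat.cast_nonneg _
    rw [ho]; linarith
  have k3 := (le_abs_self _).trans (abs_le_of_sq_le_sq k1 (mul_nonneg hop.le (norm_nonneg (zl a b i))))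
  have k4 : (th1*o+th2)/(o*(nsc 8)) ≤ ‖zl a b i/nS‖ := by
    rw [norm_div, hSn, div_le_div_iff₀ (mul_pos hop hSp) hSp]
    have := mul_le_mul_of_nonneg_right k3 hSp.le
    linarith
  have k5 := herr i hi
  have k6 := norm_sub_norm_le (zl a b i/nS) (∑ k ∈ Ico 4096 8192, (((wf 12 k:ℝ)/k:ℝ):ℂ)*rr k^(2*(256*q+i)+1))
  linarith

-- Part N7
theorem ntest_0 : ntest 0 = true := by decide +kernel
theorem ntest_1 : ntest 1 = true := by decide +kernel
theorem ntest_2 : ntest 2 = true := by decide +kernel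
theorem ntest_3 : ntest 3 = true := by decide +kernel

-- Part N8
lemma wf_sum {s : ℂ} (hs : (2:ℂ)^(-s) = -(1/2)) (k : ℕ) :
    ∑ n ∈ Ico (1:ℕ) (2^(k+1)), (n:ℂ)^(-s) = ∑ m ∈ Ico ((2:ℕ)^k) (2^(k+1)), (wf k m:ℂ)*(m:ℂ)^(-s) := by
  induction k with
  | zero => simp [wf]
  | succ k ih =>
    have h1 : ∑ n ∈ Ico (1:ℕ) (2^(k+1+1)), (n:ℂ)^(-s) = ∑ n ∈ Ico (1:ℕ) (2^(k+1)), (n:ℂ)^(-s) + ∑ n ∈ Ico ((2:ℕ)^(k+1)) (2^(k+1+1)), (n:ℂ)^(-s) :=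
      (Finset.sum_Ico_consecutive _ Nat.one_le_two_pow (Nat.pow_le_pow_right (by norm_num) (by omega))).symm
    rw [h1, ih]
    have hdbl : ∀ f : ℕ → ℂ, ∑ m ∈ Ico ((2:ℕ)^(k+1)) (2^(k+1+1)), f m = ∑ m ∈ Ico ((2:ℕ)^k) (2^(k+1)), (f (2*m) + f (2*m+1)) := by
      intro f
      have : ∀ a b : ℕ, a ≤ b → ∑ m ∈ Ico (2*a) (2*b), f m = ∑ m ∈ Ico a b, (f (2*m) + f (2*m+1)) := by
        intro a b hab
        induction b, hab using Nat.le_induction with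
        | base => simp
        | succ b hb ih =>
          rw [Finset.sum_Ico_succ_top hb, ← ih, show 2*(b+1) = 2*b+1+1 by ring, Finset.sum_Ico_succ_top (by omega), Finset.sum_Ico_succ_top (by omega)]
          ring
      have e := this (2^k) (2^(k+1)) (Nat.pow_le_pow_right (by norm_num) (by omega))
      rw [← e]; congr 2 <;> ring
    rw [hdbl, hdbl, ← Finset.sum_add_distrib]
    refine Finset.sum_congr rfl fun m hm => ?_
    have w1 : wf (k+1) (2*m) = 1 - 2*wf k m := by
      rw [wf, if_pos (by omega)]; congr 3; omega
    have w2 : wf (k+1) (2*m+1) = 1 := by rw [wf, if_neg (by omega)]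
    rw [w1, w2]
    have e : (((2*m:ℕ):ℂ))^(-s) = -(1/2)*(m:ℂ)^(-s) := by
      push_cast
      rw [← hs]
      have := Complex.mul_cpow_ofReal_nonneg (a := 2) (b := m) (by norm_num) (Nat.cast_nonneg m) (-s)
      push_cast at this
      exact this
    rw [e]; push_cast; ring

lemma cpow_tj (j : ℕ) {m : ℕ} (hm : 0 < m) : (m:ℂ)^(-((1:ℂ)+(tj (j:ℤ))*Complex.I)) = ((1/m:ℝ):ℂ)*rr m^(2*j+1) := by
  have hm0 : (m:ℂ) ≠ 0 := by exact_mod_cast hm.ne'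
  rw [neg_add, Complex.cpow_add _ _ hm0, Complex.cpow_neg_one]
  congr 1
  · push_cast; rw [one_div]
  · rw [Complex.cpow_def_of_ne_zero hm0, rr, ← Complex.exp_nat_mul, ← Complex.natCast_log]
    congr 1
    unfold tj
    push_cast; ring

lemma two_tj (j : ℕ) : (2:ℂ)^(-((1:ℂ)+(tj (j:ℤ))*Complex.I)) = -(1/2) := by
  have h := cpow_tj j (m := 2) (by norm_num)
  have : rr 2 = -1 := by
    unfold rr
    have h2 : Real.log 2 ≠ 0 := (Real.log_pos (by norm_num)).ne'
    rw [show ((2:ℕ):ℝ) = 2 by norm_num, div_self h2, mul_one]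
    push_cast
    rw [neg_mul, Complex.exp_neg, Complex.exp_pi_mul_I]; norm_num
  rw [this, pow_succ, pow_mul] at h
  push_cast at h
  rw [h]; norm_num

lemma ntest_low (q : ℕ) (hq : q ≤ 3) (h : ntest q = true) : ∀ i < 256,
    274/1000 + (2211/10000)/(2*((256*q+i:ℕ):ℝ)+1) ≤ ‖∑ k ∈ Ico (4096:ℕ) 8192, ((wf 12 k:ℝ)/k:ℝ)*rr k^(2*(256*q+i)+1)‖ := by
  have h' := h
  unfold ntest noff at h'
  have hX : 2 ≤ nX := by norm_num
  have hH : 2*nHX ≤ nX + 900 := by norm_num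
  have hH2 : 10*(nsc 8) + 1000 ≤ nHX := by unfold nsc; simp only [Nat.mul_eq, Nat.pow_eq]; norm_num
  have hN : (10^9:ℝ) ≤ ((nsc 8:ℕ):ℝ) := by
    have : 10^9 ≤ nsc 8 := by unfold nsc; simp only [Nat.mul_eq, Nat.pow_eq]; norm_num
    exact_mod_cast this
  generalize nX = X at *
  generalize nHX = H at *
  have k := ntest_lower hX hH hH2 hq h'
  intro i hi
  refine le_trans ?_ (k i hi)
  have b1 := (ndiv_bd (Nat.mul 290 (nsc 8)) (d := 1000) (by norm_num)).1
  have b2 := (ndiv_bd (Nat.mul 2212 (nsc 8)) (d := 10000) (by norm_num)).1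
  rw [nmul_cast] at b1 b2
  generalize hNN : ((nsc 8:ℕ):ℝ) = N at *
  have ho : (0:ℝ) ≤ ((256*q+i:ℕ):ℝ) := Nat.cast_nonneg _
  generalize ((256*q+i:ℕ):ℝ) = o at *
  generalize ((Nat.div (Nat.mul 290 (nsc 8)) 1000:ℕ):ℝ) = t1 at *
  generalize ((Nat.div (Nat.mul 2212 (nsc 8)) 10000:ℕ):ℝ) = t2 at *
  push_cast at b1 b2
  have hop : 0 < 2*o+1 := by linarith
  have hNp : 0 < N := by linarith
  have e : (t1*(2*o+1)+t2)/((2*o+1)*N) = t1/N + (t2/N)/(2*o+1) := by field_simp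
  rw [e]
  have c1 : 2898/10000 ≤ t1/N := by rw [le_div_iff₀ hNp]; linarith
  have c2 : 2211/10000 ≤ t2/N := by rw [le_div_iff₀ hNp]; linarith
  have c3 := div_le_div_of_nonneg_right c2 hop.le
  linarith

/-- numerical lower bound for zeta at the points `1+i t_j` -/
lemma zeta_num (j : ℕ) (hj : j < 1024) : 19/100 ≤ ‖riemannZeta ((1:ℂ)+(tj (j:ℤ))*Complex.I)‖ := by
  have key : 274/1000 + (2211/10000)/(2*(j:ℝ)+1) ≤ ‖∑ k ∈ Ico (4096:ℕ) 8192, (((wf 12 k:ℝ)/k:ℝ):ℂ)*rr k^(2*j+1)‖ := by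
    have hq : j/256 ≤ 3 := by omega
    have hm : 256*(j/256)+j%256 = j := Nat.div_add_mod j 256
    have ht : ntest (j/256) = true := by
      have : j/256 = 0 ∨ j/256 = 1 ∨ j/256 = 2 ∨ j/256 = 3 := by omega
      rcases this with h | h | h | h <;> rw [h]
      · exact ntest_0
      · exact ntest_1
      · exact ntest_2
      · exact ntest_3
    have := ntest_low (j/256) hq ht (j%256) (Nat.mod_lt _ (by norm_num))
    rw [hm] at this
    exact this
  set s : ℂ := (1:ℂ)+(tj (j:ℤ))*Complex.I with hs
  have hl1 := Real.log_two_gt_d9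
  have hl2 := Real.log_two_lt_d9
  have hl : 0 < Real.log 2 := by linarith
  have hj' : (j:ℝ) ≤ 1023 := by exact_mod_cast (by omega : j ≤ 1023)
  have hj0 : (0:ℝ) ≤ j := Nat.cast_nonneg j
  have etj : tj (j:ℤ) = (2*(j:ℝ)+1)*Real.pi/Real.log 2 := by unfold tj; push_cast; ring
  have ht0 : 0 < tj (j:ℤ) := by rw [etj]; have := Real.pi_pos; positivity
  have ht1 : tj (j:ℤ) ≤ 9280 := by
    rw [etj, div_le_iff₀ hl]
    have := Real.pi_lt_d6
    have := mul_le_mul (show 2*(j:ℝ)+1 ≤ 2047 by linarith) this.le Real.pi_pos.le (by norm_num)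
    linarith
  have ht2 : 1/tj (j:ℤ) ≤ (2211/10000)/(2*(j:ℝ)+1) := by
    rw [etj, div_le_div_iff₀ (by have := Real.pi_pos; positivity) (by linarith), one_mul]
    rw [mul_div_assoc]
    have : 1 ≤ 2211/10000*(Real.pi/Real.log 2) := by
      rw [← mul_div_assoc, le_div_iff₀ hl]; linarith [Real.pi_gt_d6]
    nlinarith
  have hre : s.re = 1 := by simp [hs]
  have him : s.im = tj (j:ℤ) := by simp [hs]
  have hs1 : s ≠ 1 := by
    intro h; rw [h] at him; simp at him; linarith
  have hsum : ∑ n ∈ Ico (1:ℕ) 8192, (n:ℂ)^(-s) = ∑ k ∈ Ico (4096:ℕ) 8192, (((wf 12 k:ℝ)/k:ℝ):ℂ)*rr k^(2*j+1) := by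
    have h := wf_sum (s := s) (two_tj j) 12
    norm_num at h
    rw [h]
    refine Finset.sum_congr rfl fun m hm => ?_
    have hm0 : 0 < m := by have := (Finset.mem_Ico.mp hm).1; omega
    rw [hs, cpow_tj j hm0]
    push_cast; ring
  have hem := emR_bound (N := 8192) (s := s) (by norm_num) hs1 (by rw [hre]; norm_num)
  unfold emR at hem
  rw [hre, hsum] at hem
  have hn1 : ‖s‖ ≤ 9281 := by
    rw [hs]; refine (norm_add_le _ _).trans ?_
    rw [norm_mul, Complex.norm_I, mul_one, Complex.norm_real, Real.norm_eq_abs, abs_of_pos ht0, norm_one]; linarith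
  have hn2 : ‖s+1‖ ≤ 9282 := (norm_add_le _ _).trans (by rw [norm_one]; linarith)
  have hE : ‖s‖*‖s+1‖/(8*(1+1)) * ((8192:ℕ):ℝ)^(-(1:ℝ)-1) ≤ 805/10000 := by
    have e : ((8192:ℕ):ℝ)^(-(1:ℝ)-1) = 1/8192^2 := by
      rw [show (-(1:ℝ)-1) = -((2:ℕ):ℝ) by norm_num, Real.rpow_neg (by norm_num), Real.rpow_natCast]; norm_num
    rw [e]
    have := mul_le_mul hn1 hn2 (norm_nonneg _) (by norm_num)
    linarith
  have hx1 : ‖((8192:ℕ):ℂ)^(-s)/2‖ ≤ 1/10000 := by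
    rw [norm_div, Complex.norm_natCast_cpow_of_pos (by norm_num)]
    rw [Complex.neg_re, hre, Real.rpow_neg_one]; norm_num
  have hx2 : ‖((8192:ℕ):ℂ)^(1-s)/(s-1)‖ ≤ (2211/10000)/(2*(j:ℝ)+1) := by
    rw [norm_div, Complex.norm_natCast_cpow_of_pos (by norm_num)]
    rw [Complex.sub_re, hre, Complex.one_re, sub_self, Real.rpow_zero]
    have : s - 1 = (tj (j:ℤ))*Complex.I := by rw [hs]; ring
    rw [this, norm_mul, Complex.norm_I, mul_one, Complex.norm_real, Real.norm_eq_abs, abs_of_pos ht0]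
    exact ht2
  have hfin := hem.trans hE
  set Sm := ∑ k ∈ Ico (4096:ℕ) 8192, (((wf 12 k:ℝ)/k:ℝ):ℂ)*rr k^(2*j+1)
  set A := ((8192:ℕ):ℂ)^(-s)/2
  set B := ((8192:ℕ):ℂ)^(1-s)/(s-1)
  have e : Sm = riemannZeta s - (riemannZeta s - Sm - A - B) - A - B := by ring
  have t1 : ‖Sm‖ ≤ ‖riemannZeta s‖ + ‖riemannZeta s - Sm - A - B‖ + ‖A‖ + ‖B‖ := by
    conv_lhs => rw [e]
    refine (norm_sub_le _ _).trans (add_le_add ?_ le_rfl)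
    refine (norm_sub_le _ _).trans (add_le_add ?_ le_rfl)
    exact norm_sub_le _ _
  linarith

-- Part H1
lemma blk {τ : ℝ} (h1 : 1 ≤ τ) (h2 : τ ≤ 2) :
    7/5 ≤ ∑ m ∈ range 6, τ/2^m*Real.exp (-((τ/2^m)^2/2)) := by
  have hg : ∀ y : ℝ, 0 ≤ y → y*(1-y^2/2) ≤ y*Real.exp (-(y^2/2)) := by
    intro y hy
    refine mul_le_mul_of_nonneg_left ?_ hy
    have := Real.add_one_le_exp (-(y^2/2)); linarith
  have h0 : τ*(3/10*(22/10-τ^2/2)) ≤ τ*Real.exp (-(τ^2/2)) := by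
    refine mul_le_mul_of_nonneg_left ?_ (by linarith)
    have e : Real.exp (-(τ^2/2)) = Real.exp (-(12/10))*Real.exp (12/10-τ^2/2) := by rw [← Real.exp_add]; ring_nf
    have h3 : (3/10:ℝ) ≤ Real.exp (-(12/10)) := by
      have := Real.exp_bound' (x := 12/10/2) (by norm_num) (by norm_num) (n := 5) (by norm_num)
      have e2 : Real.exp (-(12/10)) = (Real.exp (12/10/2))⁻¹^2 := by
        rw [← Real.exp_neg, ← Real.exp_nat_mul]; norm_num
      have h5 : Real.exp (12/10/2) ≤ 18222/10000 := by
        refine this.trans ?_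
        norm_num [Finset.sum_range_succ, Nat.factorial]
      rw [e2]
      have h6 : (10000/18222:ℝ) ≤ (Real.exp (12/10/2))⁻¹ := by
        rw [show (10000/18222:ℝ) = (18222/10000)⁻¹ by norm_num]
        exact inv_anti₀ (Real.exp_pos _) h5
      nlinarith
    have h4 := Real.add_one_le_exp (12/10-τ^2/2)
    have h7 : (0:ℝ) ≤ 22/10-τ^2/2 := by nlinarith
    rw [e]
    exact mul_le_mul h3 (by linarith) h7 (Real.exp_pos _).le
  have a1 := hg (τ/2) (by linarith)
  have a2 := hg (τ/4) (by linarith)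
  have a3 := hg (τ/8) (by linarith)
  have a4 := hg (τ/16) (by linarith)
  have a5 := hg (τ/32) (by linarith)
  simp only [Finset.sum_range_succ, Finset.sum_range_zero, zero_add]
  norm_num only [pow_zero, div_one, pow_one] at *
  have key : 7/5 ≤ τ*(3/10*(22/10-τ^2/2)) + τ/2*(1-(τ/2)^2/2)+τ/4*(1-(τ/4)^2/2)+τ/8*(1-(τ/8)^2/2)+τ/16*(1-(τ/16)^2/2)+τ/32*(1-(τ/32)^2/2) := by
    nlinarith [mul_nonneg (sub_nonneg.mpr h1) (sub_nonneg.mpr h2), mul_nonneg (mul_nonneg (sub_nonneg.mpr h1) (sub_nonneg.mpr h2)) (show 0 ≤ τ by linarith)]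
  linarith

lemma gmaj {t δ : ℝ} (ht : 9280 ≤ t) (hδ : 5/100000000 ≤ δ) :
    1/t*Real.exp (-(δ^2*t^2/2)) ≤ 5/7*∑ i ∈ range 17, Real.exp (-(t^2/(2*(9280*2^i)^2)))/(9280*2^i) := by
  have ht0 : 0 < t := by linarith
  have hnn : ∀ i ∈ range 17, (0:ℝ) ≤ Real.exp (-(t^2/(2*(9280*2^i)^2)))/(9280*2^i) := fun i _ => by positivity
  by_cases h : 9280*2^12 ≤ t
  · have hs := Finset.single_le_sum hnn (show 12 ∈ range 17 by simp)
    refine le_trans ?_ (mul_le_mul_of_nonneg_left hs (by norm_num))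
    set T : ℝ := 9280*2^12 with hT
    have hT0 : 0 < T := by rw [hT]; norm_num
    have hq : 1 ≤ t/T := by rwa [le_div_iff₀ hT0, one_mul]
    have e1 : δ^2*t^2/2 ≥ t^2/(2*T^2) + 1 := by
      have a : 1/T^2 + 2/T^2 ≤ δ^2 := by
        have : (5/100000000:ℝ)^2 ≤ δ^2 := by gcongr
        refine le_trans ?_ this
        rw [hT]; norm_num
      have a2 : T^2 ≤ t^2 := by gcongr
      have a3 := mul_le_mul_of_nonneg_right a (sq_nonneg t)
      have a4 : 1 ≤ t^2/T^2 := by rw [le_div_iff₀ (by positivity)]; linarith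
      have a5 : (1/T^2 + 2/T^2)*t^2 = 3*(t^2/T^2) := by ring
      have a6 : t^2/(2*T^2) = (t^2/T^2)/2 := by field_simp
      rw [a6]; linarith
    have e2 : Real.exp (-(δ^2*t^2/2)) ≤ Real.exp (-(t^2/(2*T^2)))*(5/7) := by
      have : Real.exp (-(δ^2*t^2/2)) ≤ Real.exp (-(t^2/(2*T^2)))*Real.exp (-1) := by
        rw [← Real.exp_add]; exact Real.exp_le_exp.mpr (by linarith)
      refine this.trans (mul_le_mul_of_nonneg_left ?_ (Real.exp_pos _).le)
      have := Real.exp_neg_one_lt_d9; linarith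
    have e3 : 1/t ≤ 1/T := one_div_le_one_div_of_le hT0 h
    calc 1/t*Real.exp (-(δ^2*t^2/2)) ≤ 1/T*(Real.exp (-(t^2/(2*T^2)))*(5/7)) := mul_le_mul e3 e2 (Real.exp_pos _).le (by positivity)
      _ = _ := by ring
  · push Not at h
    have hex : ∃ i, i < 12 ∧ 9280*2^i ≤ t ∧ t ≤ 9280*2^(i+1) := by
      by_contra hc
      push Not at hc
      have : ∀ i, i ≤ 12 → 9280*2^i ≤ t := by
        intro i hi
        induction i with
        | zero => simpa using ht
        | succ i ih => exact (hc i (by omega) (ih (by omega))).le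
      linarith [this 12 le_rfl]
    obtain ⟨i, hi, ha, hb⟩ := hex
    set T : ℝ := 9280*2^i with hT
    have hT0 : 0 < T := by rw [hT]; positivity
    have hq := blk (τ := t/T) (by rwa [le_div_iff₀ hT0, one_mul]) (by rw [div_le_iff₀ hT0]; rw [hT]; rw [pow_succ] at hb; linarith)
    have hsub : ∑ m ∈ range 6, Real.exp (-(t^2/(2*(9280*2^(i+m))^2)))/(9280*2^(i+m)) ≤ ∑ i ∈ range 17, Real.exp (-(t^2/(2*(9280*2^i)^2)))/(9280*2^i) := by
      have : ∑ m ∈ range 6, Real.exp (-(t^2/(2*(9280*2^(i+m))^2)))/(9280*2^(i+m)) = ∑ m ∈ (range 6).image (fun m => i+m), Real.exp (-(t^2/(2*(9280*2^m)^2)))/(9280*2^m) := by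
        rw [Finset.sum_image]; intro a _ b _ h; simpa using h
      rw [this]
      refine Finset.sum_le_sum_of_subset_of_nonneg ?_ (fun j hj _ => hnn j hj)
      intro j hj
      simp only [Finset.mem_image, Finset.mem_range] at hj ⊢
      obtain ⟨m, hm, rfl⟩ := hj; omega
    refine le_trans ?_ (mul_le_mul_of_nonneg_left hsub (by norm_num))
    have e : ∑ m ∈ range 6, Real.exp (-(t^2/(2*(9280*2^(i+m))^2)))/(9280*2^(i+m)) = 1/t*∑ m ∈ range 6, t/T/2^m*Real.exp (-((t/T/2^m)^2/2)) := by
      rw [Finset.mul_sum]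
      refine Finset.sum_congr rfl fun m _ => ?_
      have e1 : (9280*2^(i+m):ℝ) = T*2^m := by rw [hT, pow_add]; ring
      rw [e1]
      have e2 : t^2/(2*(T*2^m)^2) = (t/T/2^m)^2/2 := by field_simp
      rw [e2]; field_simp
    rw [e]
    have h1 : Real.exp (-(δ^2*t^2/2)) ≤ 1 := Real.exp_le_one_iff.mpr (by have : 0 ≤ δ^2*t^2/2 := by positivity
                                                                         linarith)
    have h2 : 0 < 1/t := by positivity
    have h3 := mul_le_mul_of_nonneg_left h1 h2.le
    have h4 := mul_le_mul_of_nonneg_left hq h2.le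
    linarith

/-- value of `Gf` at the points `1+y+i t_j` -/
lemma Gf_tj (y : ℝ) (j : ℤ) : Gf ((1+y:ℝ)+(tj j)*Complex.I) = iz ((1+y:ℝ)+(tj j)*Complex.I)/((1+(2:ℝ)^(-(1+y)):ℝ):ℂ) := by
  unfold Gf
  congr 1
  have h2 : (2:ℂ) ≠ 0 := by norm_num
  rw [neg_add, Complex.cpow_add _ _ h2]
  have e1 : (2:ℂ)^(-((tj j:ℝ):ℂ)*Complex.I) = -1 := by
    rw [Complex.cpow_def_of_ne_zero h2]
    have e : Complex.log 2 * (-((tj j:ℝ):ℂ)*Complex.I) = (Real.pi:ℂ)*Complex.I + ((-j-1:ℤ):ℂ)*(2*Real.pi*Complex.I) := by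
      have hl : Complex.log 2 = ((Real.log 2:ℝ):ℂ) := by rw [Complex.ofReal_log (by norm_num)]; norm_num
      have h := tj_eq j
      have h' : (Real.log 2) * tj j = (2*j+1)*Real.pi := by
        unfold tj; field_simp
      have h'' : ((Real.log 2:ℝ):ℂ) * ((tj j:ℝ):ℂ) = (2*j+1)*Real.pi := by exact_mod_cast h'
      rw [hl]
      calc ((Real.log 2:ℝ):ℂ) * (-((tj j:ℝ):ℂ)*Complex.I) = -(((Real.log 2:ℝ):ℂ) * ((tj j:ℝ):ℂ))*Complex.I := by ring
        _ = _ := by rw [h'']; push_cast; ring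
    rw [e, Complex.exp_add, Complex.exp_pi_mul_I, Complex.exp_int_mul_two_pi_mul_I]; norm_num
  rw [← neg_mul, e1]
  have e3 : (2:ℂ)^(-((1+y:ℝ):ℂ)) = (((2:ℝ)^(-(1+y)):ℝ):ℂ) := by
    rw [Complex.ofReal_cpow (by norm_num)]; push_cast; rfl
  rw [e3]; push_cast; ring

-- Part H2
noncomputable def dl0 : ℝ := 27/(Real.exp 20 - 7)

lemma exp20_lo : 485000000 ≤ Real.exp 20 := by
  have h := Real.exp_one_gt_d9
  have e : Real.exp 20 = Real.exp 1^20 := by rw [← Real.exp_nat_mul]; norm_num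
  rw [e]
  calc (485000000:ℝ) ≤ 2.7182818283^20 := by norm_num
    _ ≤ _ := by gcongr

lemma exp20_hi : Real.exp 20 ≤ 485200000 := by
  have h := Real.exp_one_lt_d9
  have e : Real.exp 20 = Real.exp 1^20 := by rw [← Real.exp_nat_mul]; norm_num
  rw [e]
  calc Real.exp 1^20 ≤ 2.7182818286^20 := by gcongr
    _ ≤ _ := by norm_num

lemma dl0_lo : 5/100000000 ≤ dl0 := by
  unfold dl0
  have := exp20_lo; have := exp20_hi
  rw [le_div_iff₀ (by linarith)]; linarith

lemma dl0_hi : dl0 ≤ 557/10000000000 := by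
  unfold dl0
  have := exp20_lo; have := exp20_hi
  rw [div_le_iff₀ (by linarith)]; linarith

lemma inv_sq_sum (J : Finset ℤ) : ∑ j ∈ J, 1/(2*(j:ℝ)+1)^2 ≤ 6 := by
  have key : ∀ N : ℕ, ∑ j ∈ Finset.Ico (-(N:ℤ)) N, 1/(2*(j:ℝ)+1)^2 ≤ (6:ℝ) - 4/((N:ℝ)+1) := by
    intro N
    induction N with
    | zero => norm_num
    | succ N ih =>
      have e : Finset.Ico (-((N+1:ℕ):ℤ)) ((N+1:ℕ):ℤ) = insert (N:ℤ) (insert (-(N:ℤ)-1) (Finset.Ico (-(N:ℤ)) N)) := by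
        ext j; simp only [Finset.mem_Ico, Finset.mem_insert]; push_cast; omega
      rw [e, Finset.sum_insert (by simp only [Finset.mem_Ico, Finset.mem_insert]; omega), Finset.sum_insert (by simp only [Finset.mem_Ico]; omega)]
      push_cast
      have h0 : (0:ℝ) ≤ N := Nat.cast_nonneg N
      have h1 : 1/(2*(N:ℝ)+1)^2 + 1/(2*(-(N:ℝ)-1)+1)^2 ≤ 4/(N+1) - 4/(N+1+1) := by
        have : (2*(-(N:ℝ)-1)+1)^2 = (2*N+1)^2 := by ring
        rw [this, div_sub_div _ _ (by positivity) (by positivity), ← add_div, div_le_div_iff₀ (by positivity) (by positivity)]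
        nlinarith
      linarith
  have hsub : ∃ N : ℕ, J ⊆ Finset.Ico (-(N:ℤ)) N := by
    refine ⟨∑ j ∈ J, j.natAbs + 1, fun j hj => ?_⟩
    have := Finset.single_le_sum (f := fun j : ℤ => j.natAbs) (fun _ _ => Nat.zero_le _) hj
    simp only [Finset.mem_Ico]
    omega
  obtain ⟨N, hN⟩ := hsub
  refine (Finset.sum_le_sum_of_subset_of_nonneg hN (fun _ _ _ => by positivity)).trans ((key N).trans ?_)
  have : (0:ℝ) ≤ 4/(N+1) := by positivity
  linarith

lemma mem_ne_one {y t : ℝ} (ht : t ≠ 0) : ((1+y:ℝ):ℂ)+(t:ℂ)*Complex.I ≠ 1 := by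
  intro h
  have := congrArg Complex.im h
  simp at this; exact ht this

lemma Gf_tj_ratio {ε : ℝ} (h0 : 0 ≤ ε) (h1 : ε ≤ 717/200000) (j : ℤ) (ht : 21/10 ≤ |tj j|) (ht2 : 3*|tj j|+7 ≤ Real.exp 20) :
    ‖Gf ((1+ε:ℝ)+(tj j)*Complex.I)‖^2 ≤ 452/10*‖Gf ((1+(717/200000:ℝ):ℝ)+(tj j)*Complex.I)‖^2 := by
  have hne : tj j ≠ 0 := by intro h; rw [h] at ht; norm_num at ht
  have h := inv_zeta_line (L := 20) (t := tj j) (y := ε) le_rfl ht ht2 h0 (by linarith)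
  rw [show (717/10000:ℝ)/20 = 717/200000 by norm_num] at h
  rw [Gf_tj, Gf_tj, iz_eq (mem_ne_one hne), iz_eq (mem_ne_one hne), norm_div, norm_div, Complex.norm_real, Complex.norm_real, Real.norm_eq_abs, Real.norm_eq_abs]
  have p1 : (0:ℝ) < 2^(-(1+ε)) := by positivity
  have p2 : (0:ℝ) < 2^(-(1+(717/200000:ℝ))) := by positivity
  have p3 : (2:ℝ)^(-(1+(717/200000:ℝ))) ≤ 2^(-(1+ε)) := Real.rpow_le_rpow_of_exponent_le (by norm_num) (by linarith)
  rw [abs_of_pos (by linarith), abs_of_pos (by linarith)]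
  set a := ‖(riemannZeta ((1+ε:ℝ)+(tj j)*Complex.I))⁻¹‖
  set b := ‖(riemannZeta ((1+(717/200000:ℝ):ℝ)+(tj j)*Complex.I))⁻¹‖ with hb
  have hb0 : 0 ≤ b := norm_nonneg _
  have h4 : a/(1+2^(-(1+ε))) ≤ 672/100*(b/(1+2^(-(1+(717/200000:ℝ))))) := by
    rw [← mul_div_assoc]
    exact div_le_div₀ (by positivity) h (by linarith) (by linarith)
  have h5 : (a/(1+2^(-(1+ε))))^2 ≤ (672/100*(b/(1+2^(-(1+(717/200000:ℝ))))))^2 := by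
    refine pow_le_pow_left₀ (div_nonneg (norm_nonneg _) (by linarith)) h4 2
  refine h5.trans ?_
  rw [mul_pow]
  exact mul_le_mul_of_nonneg_right (by norm_num) (sq_nonneg _)

lemma Gf_tj_big {ε : ℝ} (h0 : 0 ≤ ε) (h1 : ε ≤ 717/200000) (j : ℤ) (ht2 : Real.exp 20 < 3*|tj j|+7) :
    ‖Gf ((1+ε:ℝ)+(tj j)*Complex.I)‖^2*(1/|tj j| * Real.exp (-(dl0^2*(tj j)^2/2))) ≤ 1/|tj j|^2 := by
  have hlo := exp20_lo
  have hhi := exp20_hi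
  set t := |tj j| with hT
  have ht0 : 0 < t := by linarith
  set q := dl0*t/9 with hq
  have hq' : q = 3*t/(Real.exp 20 - 7) := by rw [hq]; unfold dl0; field_simp; norm_num
  have hq1 : 1 ≤ q := by rw [hq', le_div_iff₀ (by linarith)]; linarith
  have hsq : (tj j)^2 = t^2 := by rw [hT, sq_abs]
  have hL : 20 ≤ Real.log (3*t+7) := by rw [Real.le_log_iff_exp_le (by linarith)]; exact ht2.le
  have hB := inv_zeta_B (L := Real.log (3*t+7)) (s := ((1+ε:ℝ):ℂ)+(tj j:ℂ)*Complex.I) hL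
    (by have : 0 ≤ (239/10000)*(3/4)/Real.log (3*t+7) := by positivity
        simp; linarith) (by simp; linarith) (by rw [Real.exp_log (by linarith)]; simp [hT])
  have hLq : Real.log (3*t+7) ≤ 20*q := by
    have a : Real.log (3*t+7) ≤ 19 + (3*t+7)/Real.exp 20 := by
      have := Real.log_le_sub_one_of_pos (x := (3*t+7)/Real.exp 20) (by positivity)
      rw [Real.log_div (by positivity) (by positivity), Real.log_exp] at this; linarith
    have b : (3*t+7)/Real.exp 20 ≤ q := by
      rw [hq', div_le_div_iff₀ (by linarith) (by linarith)]; nlinarith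
    linarith
  have hiz : ‖Gf ((1+ε:ℝ)+(tj j)*Complex.I)‖ ≤ 17984*q := by
    rw [Gf_tj, norm_div, Complex.norm_real, Real.norm_eq_abs]
    have p1 : (0:ℝ) < 2^(-(1+ε)) := by positivity
    rw [abs_of_pos (by linarith)]
    refine (div_le_self (norm_nonneg _) (by linarith)).trans (hB.trans ?_)
    linarith
  have h2 : ‖Gf ((1+ε:ℝ)+(tj j)*Complex.I)‖^2 ≤ (17984*q)^2 := pow_le_pow_left₀ (norm_nonneg _) hiz 2
  have e1 : dl0^2*(tj j)^2/2 = 81/2*q^2 := by rw [hsq, hq]; ring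
  rw [e1]
  have htq : t ≤ 162000000*q := by
    rw [hq', ← mul_div_assoc, le_div_iff₀ (by linarith)]; nlinarith
  have hq3 : q^3 ≤ Real.exp (2*(q^2-1)) := by
    have a := Real.add_one_le_exp (q^2-1)
    have b : q^3 ≤ (q^2)^2 := by nlinarith [pow_pos (show 0<q by linarith) 3]
    have c : (q^2)^2 ≤ Real.exp (q^2-1)^2 := pow_le_pow_left₀ (by positivity) (by linarith) 2
    rw [← Real.exp_nat_mul] at c
    push_cast at c; linarith
  have hE : Real.exp (-(81/2*q^2)) ≤ Real.exp (-40)*Real.exp (-(2*(q^2-1))) := by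
    rw [← Real.exp_add]; exact Real.exp_le_exp.mpr (by nlinarith)
  have h40 : Real.exp (-40) ≤ 43/10^19 := by
    have e : Real.exp (-40) = Real.exp (-1)^40 := by rw [← Real.exp_nat_mul]; norm_num
    rw [e]
    calc Real.exp (-1)^40 ≤ 0.3678794412^40 := by gcongr; exact Real.exp_neg_one_lt_d9.le
      _ ≤ _ := by norm_num
  have hq3' : q^3*Real.exp (-(81/2*q^2)) ≤ 43/10^19 := by
    calc q^3*Real.exp (-(81/2*q^2)) ≤ Real.exp (2*(q^2-1))*(43/10^19*Real.exp (-(2*(q^2-1)))) :=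
          mul_le_mul hq3 (hE.trans (mul_le_mul_of_nonneg_right h40 (Real.exp_pos _).le)) (Real.exp_pos _).le (Real.exp_pos _).le
      _ = 43/10^19 := by rw [Real.exp_neg (2*(q^2-1))]; field_simp
  have h3 : ‖Gf ((1+ε:ℝ)+(tj j)*Complex.I)‖^2*(1/t * Real.exp (-(81/2*q^2))) ≤ (17984*q)^2*(1/t * Real.exp (-(81/2*q^2))) :=
    mul_le_mul_of_nonneg_right h2 (by positivity)
  refine h3.trans ?_
  rw [le_div_iff₀ (by positivity)]
  have e4 : (17984*q)^2*(1/t * Real.exp (-(81/2*q^2)))*t^2 = 17984^2*q^2*Real.exp (-(81/2*q^2))*t := by field_simp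
  rw [e4]
  have h5 : 17984^2*q^2*Real.exp (-(81/2*q^2))*t ≤ 17984^2*q^2*Real.exp (-(81/2*q^2))*(162000000*q) :=
    mul_le_mul_of_nonneg_left htq (by positivity)
  have e5 : 17984^2*q^2*Real.exp (-(81/2*q^2))*(162000000*q) = 17984^2*162000000*(q^3*Real.exp (-(81/2*q^2))) := by ring
  rw [e5] at h5
  refine h5.trans ((mul_le_mul_of_nonneg_left hq3' (by positivity)).trans ?_)
  norm_num

lemma sqrt2pi_lo : 25066/10000 ≤ Real.sqrt (2*Real.pi) := by
  refine Real.le_sqrt_of_sq_le ?_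
  have := Real.pi_gt_d6; norm_num at this ⊢; linarith

lemma high_sum {ε : ℝ} (h0 : 0 ≤ ε) (h1 : ε ≤ 717/200000) (J : Finset ℤ) (hJ : ∀ j ∈ J, 9280 ≤ |tj j|) :
    ∑ j ∈ J, ‖Gf ((1+ε:ℝ)+(tj j)*Complex.I)‖^2*(1/|tj j| * Real.exp (-(dl0^2*(tj j)^2/2))) ≤ 396 := by
  classical
  set A := J.filter (fun j => 3*|tj j|+7 ≤ Real.exp 20) with hA
  set G : ℤ → ℝ := fun j => ‖Gf ((1+(717/200000:ℝ):ℝ)+(tj j)*Complex.I)‖^2 with hG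
  rw [← Finset.sum_filter_add_sum_filter_not J (fun j => 3*|tj j|+7 ≤ Real.exp 20)]
  have hb : ∑ j ∈ J.filter (fun j => ¬ 3*|tj j|+7 ≤ Real.exp 20), ‖Gf ((1+ε:ℝ)+(tj j)*Complex.I)‖^2*(1/|tj j| * Real.exp (-(dl0^2*(tj j)^2/2))) ≤ 3/10 := by
    have hp : (221/1000:ℝ) ≥ Real.log 2/Real.pi := by
      have := Real.pi_gt_d6; have := Real.log_two_lt_d9
      rw [ge_iff_le, div_le_iff₀ Real.pi_pos]; linarith
    have hp0 : 0 ≤ Real.log 2/Real.pi := div_nonneg l2pos.le Real.pi_pos.le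
    have : ∀ j ∈ J.filter (fun j => ¬ 3*|tj j|+7 ≤ Real.exp 20), ‖Gf ((1+ε:ℝ)+(tj j)*Complex.I)‖^2*(1/|tj j| * Real.exp (-(dl0^2*(tj j)^2/2))) ≤ (Real.log 2/Real.pi)^2*(1/(2*(j:ℝ)+1)^2) := by
      intro j hj
      have hj2 := (Finset.mem_filter.mp hj).2
      push Not at hj2
      refine (Gf_tj_big h0 h1 j hj2).trans (le_of_eq ?_)
      rw [sq_abs]; unfold tj
      have := l2pos; have := Real.pi_pos
      field_simp
    refine (Finset.sum_le_sum this).trans ?_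
    rw [← Finset.mul_sum]
    calc (Real.log 2/Real.pi)^2*∑ j ∈ J.filter (fun j => ¬ 3*|tj j|+7 ≤ Real.exp 20), 1/(2*(j:ℝ)+1)^2 ≤ (221/1000)^2*6 :=
          mul_le_mul (pow_le_pow_left₀ hp0 hp 2) (inv_sq_sum _) (Finset.sum_nonneg fun _ _ => by positivity) (by norm_num)
      _ ≤ _ := by norm_num
  have ha : ∑ j ∈ A, ‖Gf ((1+ε:ℝ)+(tj j)*Complex.I)‖^2*(1/|tj j| * Real.exp (-(dl0^2*(tj j)^2/2))) ≤ 39565/100 := by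
    have t1 : ∀ j ∈ A, ‖Gf ((1+ε:ℝ)+(tj j)*Complex.I)‖^2*(1/|tj j| * Real.exp (-(dl0^2*(tj j)^2/2))) ≤
        ∑ i ∈ range 17, 452/10*(5/7)*(1/(9280*2^i))*(G j*Real.exp (-((tj j)^2/(2*(9280*2^i)^2)))) := by
      intro j hj
      obtain ⟨hj1, hj2⟩ := Finset.mem_filter.mp hj
      have hj3 := hJ j hj1
      have r1 := Gf_tj_ratio h0 h1 j (by linarith) hj2
      have r2 := gmaj hj3 dl0_lo
      rw [sq_abs] at r2
      have := mul_le_mul r1 r2 (by positivity) (by positivity)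
      refine this.trans (le_of_eq ?_)
      rw [Finset.mul_sum, Finset.mul_sum]
      refine Finset.sum_congr rfl fun i _ => ?_
      simp only [hG]
      ring
    refine (Finset.sum_le_sum t1).trans ?_
    rw [Finset.sum_comm]
    have t2 : ∀ i ∈ range 17, ∑ j ∈ A, 452/10*(5/7)*(1/(9280*2^i))*(G j*Real.exp (-((tj j)^2/(2*(9280*2^i)^2)))) ≤
        452/10*(5/7)*(27654/100000)*(5/4 + 187/100*57020/9280*(1/2^i)) := by
      intro i _
      rw [← Finset.mul_sum]
      have hT : (5000:ℝ) ≤ 9280*2^i := by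
        have : (1:ℝ) ≤ 2^i := one_le_pow₀ (by norm_num)
        linarith
      have hm := mv_G (T := 9280*2^i) (x := 717/200000) hT (by norm_num) (by norm_num) A
      have hK : (1+1/(4*(717/200000:ℝ)))*(1+2/((717/200000)*Real.log 2)) ≤ 57020 := by
        have h6 : 2/((717/200000)*Real.log 2) ≤ 8050/10 := by
          have := Real.log_two_gt_d9
          rw [div_le_iff₀ (by linarith)]; linarith
        have h7 : 1+1/(4*(717/200000:ℝ)) ≤ 7074/100 := by norm_num
        have h8 : 0 ≤ 2/((717/200000)*Real.log 2) := by have := l2pos; positivity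
        calc _ ≤ 7074/100*(1+8050/10) := mul_le_mul h7 (by linarith) (by linarith) (by norm_num)
          _ ≤ _ := by norm_num
      have hc : Real.log 2/Real.sqrt (2*Real.pi) ≤ 27654/100000 := by
        have := sqrt2pi_lo
        rw [div_le_iff₀ (by linarith)]; linarith [Real.log_two_lt_d9]
      have hc0 : 0 ≤ Real.log 2/Real.sqrt (2*Real.pi) := div_nonneg l2pos.le (Real.sqrt_nonneg _)
      set T : ℝ := 9280*2^i with hTd
      have hT0 : 0 < T := by linarith
      have hm2 : ∑ j ∈ A, (G j*Real.exp (-((tj j)^2/(2*T^2)))) ≤ 27654/100000*T*(5/4+(187/100)/T*57020) := by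
        refine hm.trans ?_
        have z0 : 0 ≤ (1+1/(4*(717/200000:ℝ)))*(1+2/((717/200000)*Real.log 2)) := by have := l2pos; positivity
        have z1 : 5/4+(187/100)/T*(1+1/(4*(717/200000:ℝ)))*(1+2/((717/200000)*Real.log 2)) ≤ 5/4+(187/100)/T*57020 := by
          rw [mul_assoc]
          have := mul_le_mul_of_nonneg_left hK (show 0 ≤ (187/100)/T by positivity)
          linarith
        refine mul_le_mul (mul_le_mul_of_nonneg_right hc hT0.le) z1 ?_ (by positivity)
        rw [mul_assoc]
        have := mul_nonneg (show 0 ≤ (187/100)/T by positivity) z0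
        linarith
      have := mul_le_mul_of_nonneg_left hm2 (show 0 ≤ 452/10*(5/7)*(1/T) by positivity)
      refine this.trans (le_of_eq ?_)
      rw [hTd]; field_simp; try norm_num
    refine (Finset.sum_le_sum t2).trans ?_
    norm_num [Finset.sum_range_succ]
  linarith

-- Part H3
section
open Topology

lemma Gf_diff {L : ℝ} (hL : 20 ≤ L) {s : ℂ} (hσ : 1 - (39/1000)/L ≤ s.re) (ht : 3*|s.im|+1 ≤ Real.exp L) :
    DifferentiableAt ℂ Gf s := by
  have h1 := zeta1_ne_zero hL hσ ht
  have hre : 0 < s.re := by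
    have : (39/1000)/L ≤ 1/2 := by rw [div_le_iff₀ (by linarith)]; linarith
    linarith
  have h2 : 1 - (2:ℂ)^(-s) ≠ 0 := by
    intro h
    have e : (2:ℂ)^(-s) = 1 := (sub_eq_zero.mp h).symm
    have e2 := congrArg norm e
    have := Complex.norm_natCast_cpow_of_pos (n := 2) (by norm_num) (-s)
    push_cast at this
    rw [this, norm_one, Complex.neg_re] at e2
    have h3 : (2:ℝ)^(-s.re) < 1 := Real.rpow_lt_one_of_one_lt_of_neg (by norm_num) (by linarith)
    linarith
  unfold Gf iz
  refine DifferentiableAt.div (DifferentiableAt.div (by fun_prop) (differentiable_riemannZeta₁ s) h1) ?_ h2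
  refine (differentiableAt_const _).sub ?_
  exact DifferentiableAt.const_cpow (by fun_prop) (Or.inl (by norm_num))

/-- absolute size of the terms on the frequency side -/
noncomputable def psa (ε : ℝ) (j : ℤ) : ℝ :=
  ‖Gf ((1+ε:ℝ)+(tj j)*Complex.I)‖^2*(1/|tj j| * Real.exp (-(dl0^2*(tj j)^2/2)))

lemma odd_harm (n : ℕ) : ∑ j ∈ range (n+1), 1/(2*(j:ℝ)+1) ≤ 1 + 1/2*Real.log (n+1) := by
  induction n with
  | zero => simp
  | succ n ih =>
    rw [Finset.sum_range_succ]
    have hn : (0:ℝ) ≤ n := Nat.cast_nonneg n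
    have h := Real.le_log_one_add_of_nonneg (x := 1/((n:ℝ)+1)) (by positivity)
    have e : 1+1/((n:ℝ)+1) = ((n:ℝ)+1+1)/(n+1) := by field_simp
    rw [e, Real.log_div (by positivity) (by positivity)] at h
    have e2 : 2*(1/((n:ℝ)+1))/(1/((n:ℝ)+1)+2) = 2*(1/(2*((n:ℝ)+1)+1)) := by field_simp; ring
    rw [e2] at h
    push_cast; linarith

lemma tj_neg (j : ℤ) : tj (-1-j) = -tj j := by unfold tj; push_cast; ring

lemma psa_neg (j : ℤ) : psa 0 (-1-j) = psa 0 j := by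
  unfold psa
  have hne : tj j ≠ 0 := by
    unfold tj
    have := l2pos; have := Real.pi_pos
    have h : (2*(j:ℝ)+1) ≠ 0 := by
      have : (2*j+1:ℤ) ≠ 0 := by omega
      exact_mod_cast this
    positivity
  have hne' : tj (-1-j) ≠ 0 := by rw [tj_neg]; exact neg_ne_zero.mpr hne
  have e : ‖Gf ((1+0:ℝ)+(tj (-1-j))*Complex.I)‖ = ‖Gf ((1+0:ℝ)+(tj j)*Complex.I)‖ := by
    rw [Gf_tj, Gf_tj, norm_div, norm_div, iz_eq (mem_ne_one hne'), iz_eq (mem_ne_one hne)]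
    congr 1
    have : (((1+0:ℝ):ℂ)+(tj (-1-j))*Complex.I) = (starRingEnd ℂ) (((1+0:ℝ):ℂ)+(tj j)*Complex.I) := by
      rw [tj_neg, map_add, map_mul, Complex.conj_ofReal, Complex.conj_ofReal, Complex.conj_I]; push_cast; ring
    rw [this, riemannZeta_conj, norm_inv, norm_inv, RCLike.norm_conj]
  rw [e, tj_neg, abs_neg, neg_sq]

lemma psa_low (j : ℕ) (hj : j < 1024) : psa 0 (j:ℤ) ≤ 1232/100*(2207/10000)*(1/(2*(j:ℝ)+1)) := by
  have hl := l2pos; have hp := Real.pi_pos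
  have h := zeta_num j hj
  have htp : 0 < tj (j:ℤ) := by unfold tj; push_cast; positivity
  unfold psa
  rw [Gf_tj, iz_eq (mem_ne_one htp.ne'), norm_div, norm_inv, Complex.norm_real, Real.norm_eq_abs]
  have e : (((1+0:ℝ):ℂ)+(tj (j:ℤ))*Complex.I) = (1:ℂ)+(tj (j:ℤ))*Complex.I := by push_cast; ring
  rw [e]
  have e2 : (2:ℝ)^(-(1+0:ℝ)) = 1/2 := by rw [add_zero, Real.rpow_neg_one]; norm_num
  rw [e2]
  have h1 : ‖riemannZeta ((1:ℂ)+(tj (j:ℤ))*Complex.I)‖⁻¹/|1+1/2| ≤ 100/19/(3/2) := by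
    rw [abs_of_pos (by norm_num)]
    have : ‖riemannZeta ((1:ℂ)+(tj (j:ℤ))*Complex.I)‖⁻¹ ≤ 100/19 := by
      rw [show (100/19:ℝ) = (19/100)⁻¹ by norm_num]; exact inv_anti₀ (by norm_num) h
    rw [show (1+1/2:ℝ) = 3/2 by norm_num]
    exact div_le_div_of_nonneg_right this (by norm_num)
  have h2 := pow_le_pow_left₀ (by positivity) h1 2
  have h3 : 1/|tj (j:ℤ)| ≤ 2207/10000*(1/(2*(j:ℝ)+1)) := by
    rw [abs_of_pos htp]
    have : 1/tj (j:ℤ) = Real.log 2/Real.pi*(1/(2*(j:ℝ)+1)) := by unfold tj; push_cast; field_simp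
    rw [this]
    refine mul_le_mul_of_nonneg_right ?_ (by positivity)
    rw [div_le_iff₀ hp]
    linarith [Real.pi_gt_d6, Real.log_two_lt_d9]
  have h4 : Real.exp (-(dl0^2*(tj (j:ℤ))^2/2)) ≤ 1 := Real.exp_le_one_iff.mpr (by
    have : 0 ≤ dl0^2*(tj (j:ℤ))^2/2 := by positivity
    linarith)
  have h5 : 1/|tj (j:ℤ)| * Real.exp (-(dl0^2*(tj (j:ℤ))^2/2)) ≤ 2207/10000*(1/(2*(j:ℝ)+1)) := by
    refine le_trans (mul_le_of_le_one_right (by positivity) h4) h3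
  refine (mul_le_mul h2 h5 (by positivity) (by positivity)).trans ?_
  have : (0:ℝ) ≤ 2207/10000*(1/(2*(j:ℝ)+1)) := by positivity
  have e3 : (100/19/(3/2):ℝ)^2 ≤ 1232/100 := by norm_num
  rw [mul_assoc]
  exact mul_le_mul_of_nonneg_right e3 this

lemma sum_sym (f : ℤ → ℝ) (hf : ∀ j, f (-1-j) = f j) (N : ℕ) : ∑ j ∈ Finset.Ico (-(N:ℤ)) N, f j = 2*∑ j ∈ range N, f (j:ℤ) := by
  induction N with
  | zero => simp
  | succ N ih =>
    have e : Finset.Ico (-((N+1:ℕ):ℤ)) ((N+1:ℕ):ℤ) = insert (N:ℤ) (insert (-1-(N:ℤ)) (Finset.Ico (-(N:ℤ)) N)) := by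
      ext j; simp only [Finset.mem_Ico, Finset.mem_insert]; push_cast; omega
    rw [e, Finset.sum_insert (by simp only [Finset.mem_Ico, Finset.mem_insert]; omega), Finset.sum_insert (by simp only [Finset.mem_Ico]; omega), ih, hf, Finset.sum_range_succ]
    ring

lemma odd_harm' (n : ℕ) (hn : 0 < n) : ∑ j ∈ range n, 1/(2*(j:ℝ)+1) ≤ 1 + 1/2*Real.log n := by
  obtain ⟨m, rfl⟩ := Nat.exists_eq_succ_of_ne_zero hn.ne'
  have := odd_harm m
  push_cast; exact this

lemma low_aux (N : ℕ) (hN0 : 0 < N) (hN : N ≤ 1024) : ∑ j ∈ Finset.Ico (-(N:ℤ)) N, psa 0 j ≤ 2*(1232/100*(2207/10000)*(1 + 1/2*Real.log N)) := by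
  rw [sum_sym _ psa_neg]
  have h1 : ∑ j ∈ range N, psa 0 (j:ℤ) ≤ ∑ j ∈ range N, 1232/100*(2207/10000)*(1/(2*(j:ℝ)+1)) :=
    Finset.sum_le_sum fun j hj => psa_low j (lt_of_lt_of_le (Finset.mem_range.mp hj) hN)
  rw [← Finset.mul_sum] at h1
  have h2 := odd_harm' N hN0
  linarith

lemma low0 : ∑ j ∈ Finset.Ico (-(1024:ℕ):ℤ) (1024:ℕ), psa 0 j ≤ 25 := by
  refine (low_aux 1024 (by norm_num) le_rfl).trans ?_
  have h3 : Real.log ((1024:ℕ):ℝ) = 10*Real.log 2 := by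
    rw [show ((1024:ℕ):ℝ) = 2^10 by norm_num, Real.log_pow]; norm_num
  rw [h3]
  have := Real.log_two_lt_d9
  norm_num only at this ⊢
  linarith

lemma psa_tendsto (j : ℤ) : Tendsto (fun ε : ℝ => psa ε j) (𝓝[>] 0) (𝓝 (psa 0 j)) := by
  have hd : DifferentiableAt ℂ Gf (((1+0:ℝ):ℂ)+(tj j)*Complex.I) := by
    refine Gf_diff (L := 20 + Real.log (3*|tj j|+1)) ?_ ?_ ?_
    · have := Real.log_nonneg (x := 3*|tj j|+1) (by have := abs_nonneg (tj j); linarith)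
      linarith
    · have := Real.log_nonneg (x := 3*|tj j|+1) (by have := abs_nonneg (tj j); linarith)
      have : 0 ≤ (39/1000)/(20 + Real.log (3*|tj j|+1)) := by positivity
      simp; linarith
    · rw [Real.exp_add, Real.exp_log (by positivity)]
      have h := exp20_lo
      have := abs_nonneg (tj j)
      simp only [Complex.add_im, Complex.ofReal_im, Complex.mul_im, Complex.ofReal_re, Complex.I_im, Complex.I_re]
      norm_num
      nlinarith
  have hc : ContinuousAt (fun ε : ℝ => psa ε j) 0 := by
    unfold psa
    refine ContinuousAt.mul (ContinuousAt.pow (ContinuousAt.norm ?_) 2) continuousAt_const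
    refine ContinuousAt.comp (g := Gf) (f := fun ε : ℝ => ((1+ε:ℝ):ℂ)+(tj j)*Complex.I) hd.continuousAt ?_
    fun_prop
  exact hc.tendsto.mono_left nhdsWithin_le_nhds

lemma psa_nonneg (ε : ℝ) (j : ℤ) : 0 ≤ psa ε j := by unfold psa; positivity

lemma psa_sum : ∀ᶠ ε in 𝓝[>] (0:ℝ), ∀ J : Finset ℤ, ∑ j ∈ J, psa ε j ≤ 422 := by
  have ht : Tendsto (fun ε : ℝ => ∑ j ∈ Finset.Ico (-(1024:ℕ):ℤ) (1024:ℕ), psa ε j) (𝓝[>] 0) (𝓝 (∑ j ∈ Finset.Ico (-(1024:ℕ):ℤ) (1024:ℕ), psa 0 j)) :=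
    tendsto_finsetSum _ fun j _ => psa_tendsto j
  have h1 : ∀ᶠ ε in 𝓝[>] (0:ℝ), ∑ j ∈ Finset.Ico (-(1024:ℕ):ℤ) (1024:ℕ), psa ε j < 26 :=
    ht.eventually_lt_const (lt_of_le_of_lt low0 (by norm_num))
  have h2 : ∀ᶠ ε in 𝓝[>] (0:ℝ), ε ∈ Set.Ioo (0:ℝ) (717/200000) := Ioo_mem_nhdsGT (by norm_num)
  filter_upwards [h1, h2] with ε ha hb J
  rw [← Finset.sum_filter_add_sum_filter_not J (fun j => j ∈ Finset.Ico (-(1024:ℕ):ℤ) (1024:ℕ))]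
  have b1 : ∑ j ∈ J.filter (fun j => j ∈ Finset.Ico (-(1024:ℕ):ℤ) (1024:ℕ)), psa ε j ≤ 26 := by
    refine le_trans (Finset.sum_le_sum_of_subset_of_nonneg ?_ (fun j _ _ => psa_nonneg ε j)) ha.le
    intro j hj; exact (Finset.mem_filter.mp hj).2
  have b2 := high_sum hb.1.le hb.2.le (J.filter (fun j => ¬ j ∈ Finset.Ico (-(1024:ℕ):ℤ) (1024:ℕ))) (by
    intro j hj
    have h := (Finset.mem_filter.mp hj).2
    rw [Finset.mem_Ico] at h
    have h3 : (2049:ℤ) ≤ |2*j+1| := by rw [le_abs]; push_cast at h; omega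
    have h4 : (2049:ℝ) ≤ |2*(j:ℝ)+1| := by exact_mod_cast h3
    unfold tj
    have hl := l2pos; have hp := Real.pi_pos
    rw [abs_div, abs_mul, abs_of_pos hp, abs_of_pos hl, le_div_iff₀ hl]
    have := mul_le_mul_of_nonneg_right h4 hp.le
    linarith [Real.pi_gt_d6, Real.log_two_lt_d9])
  have e : ∀ j, psa ε j = ‖Gf ((1+ε:ℝ)+(tj j)*Complex.I)‖^2*(1/|tj j| * Real.exp (-(dl0^2*(tj j)^2/2))) := fun _ => rfl
  simp only [← e] at b2
  linarith

end

-- Part P1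
noncomputable def zz : ArithmeticFunction ℤ := muo*muo
noncomputable def ZZ (y : ℝ) : ℝ := ∑ n ∈ Finset.Icc 1 ⌊y⌋₊, ((zz n : ℤ):ℝ)

lemma cnt_le (a M N : ℕ) (ha : 0 < a) (hMN : M ≤ N) :
    (((Finset.Ioc M N).filter (fun n => a ∣ n ∧ Odd (n/a))).card:ℝ) ≤ ((N:ℝ)-M)/(2*a)+1 := by
  have hsub : (Finset.Ioc M N).filter (fun n => a ∣ n ∧ Odd (n/a)) ⊆ (Finset.Ioc M N).filter (fun n => n ≡ a [MOD (2*a)]) := by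
    intro n hn
    simp only [Finset.mem_filter] at hn ⊢
    refine ⟨hn.1, ?_⟩
    obtain ⟨h1, k, hk⟩ := hn.2
    have : n = a*(2*k+1) := by rw [← hk, Nat.mul_div_cancel' h1]
    rw [this]
    have e : a*(2*k+1) = a + 2*a*k := by ring
    rw [e]
    exact (Nat.modEq_iff_dvd' (by omega)).mpr ⟨k, by omega⟩ |>.symm
  have h1 := Finset.card_le_card hsub
  have h2 := Nat.Ioc_filter_modEq_card M N (r := 2*a) (by omega) a
  have h3 : (((Finset.Ioc M N).filter (fun n => n ≡ a [MOD (2*a)])).card:ℝ) ≤ ((N:ℝ)-M)/(2*a)+1 := by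
    have ha' : (0:ℝ) < a := by exact_mod_cast ha
    have h0 : (M:ℝ) ≤ N := by exact_mod_cast hMN
    have h4 : ((((Finset.Ioc M N).filter (fun n => n ≡ a [MOD (2*a)])).card:ℤ):ℝ) ≤ ((N:ℝ)-M)/(2*a)+1 := by
      rw [h2]
      push_cast
      refine max_le ?_ (by have : 0 ≤ ((N:ℝ)-M)/(2*a) := div_nonneg (by linarith) (by positivity)
                           linarith)
      have f1 := Int.floor_le (((N:ℚ)-a)/(2*a))
      have f2 := Int.lt_floor_add_one (((M:ℚ)-a)/(2*a))
      have f3 : ((⌊((N:ℚ)-a)/(2*a)⌋:ℚ) - ⌊((M:ℚ)-a)/(2*a)⌋) ≤ ((N:ℚ)-M)/(2*a)+1 := by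
        have : ((N:ℚ)-a)/(2*a) - ((M:ℚ)-a)/(2*a) = ((N:ℚ)-M)/(2*a) := by ring
        linarith
      have f4 : (((((⌊((N:ℚ)-a)/(2*a)⌋:ℚ) - ⌊((M:ℚ)-a)/(2*a)⌋):ℚ)):ℝ) ≤ ((((N:ℚ)-M)/(2*a)+1:ℚ):ℝ) := by exact_mod_cast f3
      push_cast at f4
      exact f4
    exact_mod_cast h4
  refine le_trans ?_ h3
  exact_mod_cast h1

lemma zz_le (n R : ℕ) (hn : 0 < n) (hR : n < (R+1)*(R+1)) :
    |((zz n:ℤ):ℝ)| ≤ 2*(((Finset.Icc 1 R).filter (fun a => a ∣ n ∧ Odd (n/a))).card:ℝ) := by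
  have h0 : |zz n| ≤ ∑ i ∈ n.divisorsAntidiagonal, (if Odd i.1 ∧ Odd i.2 then (1:ℤ) else 0) := by
    unfold zz
    rw [ArithmeticFunction.mul_apply]
    refine (Finset.abs_sum_le_sum_abs _ _).trans (Finset.sum_le_sum fun i _ => ?_)
    rw [abs_mul]
    have a1 := abs_muo_le i.1
    have a2 := abs_muo_le i.2
    split_ifs with h
    · nlinarith [abs_nonneg (muo i.1), abs_nonneg (muo i.2)]
    · rw [not_and_or] at h
      rcases h with h | h
      · rw [muo_apply i.1, if_neg h]; simp
      · rw [muo_apply i.2, if_neg h]; simp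
  have h1 : ∑ i ∈ n.divisorsAntidiagonal, (if Odd i.1 ∧ Odd i.2 then (1:ℤ) else 0) ≤
      ∑ i ∈ n.divisorsAntidiagonal, (if i.1 ≤ R ∧ Odd i.2 then (1:ℤ) else 0) + ∑ i ∈ n.divisorsAntidiagonal, (if i.2 ≤ R ∧ Odd i.1 then (1:ℤ) else 0) := by
    rw [← Finset.sum_add_distrib]
    refine Finset.sum_le_sum fun i hi => ?_
    have hi' := (Nat.mem_divisorsAntidiagonal.mp hi).1
    have : i.1 ≤ R ∨ i.2 ≤ R := by
      by_contra hc; push Not at hc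
      have := Nat.mul_le_mul hc.1 hc.2
      simp only [Nat.succ_eq_add_one] at this
      omega
    rcases this with h | h
    · by_cases h1 : Odd i.1 <;> by_cases h2 : Odd i.2 <;> by_cases h3 : i.2 ≤ R <;> simp [h, h1, h2, h3]
    · by_cases h1 : Odd i.1 <;> by_cases h2 : Odd i.2 <;> by_cases h3 : i.1 ≤ R <;> simp [h, h1, h2, h3]
  have h2 : ∑ i ∈ n.divisorsAntidiagonal, (if i.1 ≤ R ∧ Odd i.2 then (1:ℤ) else 0) ≤ (((Finset.Icc 1 R).filter (fun a => a ∣ n ∧ Odd (n/a))).card:ℤ) := by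
    rw [Nat.sum_divisorsAntidiagonal (fun a b => if a ≤ R ∧ Odd b then (1:ℤ) else 0), ← Finset.sum_filter, Finset.sum_const, nsmul_eq_mul, mul_one]
    have : (n.divisors.filter (fun i => i ≤ R ∧ Odd (n/i))) ⊆ ((Finset.Icc 1 R).filter (fun a => a ∣ n ∧ Odd (n/a))) := by
      intro a ha
      simp only [Finset.mem_filter, Nat.mem_divisors, Finset.mem_Icc] at ha ⊢
      exact ⟨⟨Nat.pos_of_dvd_of_pos ha.1.1 hn, ha.2.1⟩, ha.1.1, ha.2.2⟩
    exact_mod_cast Finset.card_le_card this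
  have h3 : ∑ i ∈ n.divisorsAntidiagonal, (if i.2 ≤ R ∧ Odd i.1 then (1:ℤ) else 0) = ∑ i ∈ n.divisorsAntidiagonal, (if i.1 ≤ R ∧ Odd i.2 then (1:ℤ) else 0) := by
    rw [Nat.sum_divisorsAntidiagonal (fun a b => if a ≤ R ∧ Odd b then (1:ℤ) else 0), Nat.sum_divisorsAntidiagonal' (fun a b => if b ≤ R ∧ Odd a then (1:ℤ) else 0)]
  have h4 : |zz n| ≤ 2*(((Finset.Icc 1 R).filter (fun a => a ∣ n ∧ Odd (n/a))).card:ℤ) := by linarith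
  exact_mod_cast h4

lemma harm_le (R : ℕ) (hR : 0 < R) : ∑ a ∈ Finset.Icc 1 R, 1/(a:ℝ) ≤ 1 + Real.log R := by
  have := harmonic_le_one_add_log R
  rw [harmonic_eq_sum_Icc] at this
  push_cast at this
  simpa using this

lemma ZZ_incr {y y' : ℝ} (hy : 0 ≤ y) (hyy : y ≤ y') (hy1 : 1 ≤ y') :
    |ZZ y' - ZZ y| ≤ (y'-y)*(1+Real.log y'/2) + 3*Real.sqrt y' := by
  set M := ⌊y⌋₊ with hM
  set N := ⌊y'⌋₊ with hN
  have hMN : M ≤ N := Nat.floor_mono hyy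
  have hN1 : 1 ≤ N := by rw [hN]; exact Nat.le_floor (by simpa using hy1)
  set R := Nat.sqrt N with hR
  have hR0 : 0 < R := Nat.sqrt_pos.mpr hN1
  have hNy : (N:ℝ) ≤ y' := Nat.floor_le (by linarith)
  have hMy : y < M + 1 := Nat.lt_floor_add_one y
  have hRy : (R:ℝ) ≤ Real.sqrt y' := by
    refine Real.le_sqrt_of_sq_le (le_trans ?_ hNy)
    have := Nat.sqrt_le N
    rw [sq]; exact_mod_cast this
  have e : ZZ y' - ZZ y = ∑ n ∈ Finset.Ioc M N, ((zz n:ℤ):ℝ) := by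
    unfold ZZ
    have eI : ∀ k : ℕ, Finset.Icc 1 k = Finset.Ioc 0 k := fun k => by ext; simp [Nat.lt_iff_add_one_le]
    rw [← hM, ← hN, eI, eI]
    rw [← Finset.sum_Ioc_consecutive _ (Nat.zero_le M) hMN]; ring
  have h1 : |ZZ y' - ZZ y| ≤ ∑ n ∈ Finset.Ioc M N, 2*(((Finset.Icc 1 R).filter (fun a => a ∣ n ∧ Odd (n/a))).card:ℝ) := by
    rw [e]
    refine (Finset.abs_sum_le_sum_abs _ _).trans (Finset.sum_le_sum fun n hn => ?_)
    rw [Finset.mem_Ioc] at hn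
    refine zz_le n R (by omega) ?_
    have h := Nat.lt_succ_sqrt N
    exact lt_of_le_of_lt hn.2 h
  have h2 : ∑ n ∈ Finset.Ioc M N, (((Finset.Icc 1 R).filter (fun a => a ∣ n ∧ Odd (n/a))).card:ℝ) =
      ∑ a ∈ Finset.Icc 1 R, (((Finset.Ioc M N).filter (fun n => a ∣ n ∧ Odd (n/a))).card:ℝ) := by
    simp only [Finset.card_filter]
    push_cast
    rw [Finset.sum_comm]
  rw [← Finset.mul_sum, h2] at h1
  have h3 : ∑ a ∈ Finset.Icc 1 R, (((Finset.Ioc M N).filter (fun n => a ∣ n ∧ Odd (n/a))).card:ℝ) ≤ ∑ a ∈ Finset.Icc 1 R, (((N:ℝ)-M)/2*(1/(a:ℝ))+1) := by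
    refine Finset.sum_le_sum fun a ha => ?_
    have ha0 : 0 < a := (Finset.mem_Icc.mp ha).1
    refine (cnt_le a M N ha0 hMN).trans (le_of_eq ?_)
    have : (a:ℝ) ≠ 0 := by exact_mod_cast ha0.ne'
    field_simp
  rw [Finset.sum_add_distrib, ← Finset.mul_sum, Finset.sum_const, Nat.card_Icc, nsmul_eq_mul, mul_one] at h3
  have h4 := harm_le R hR0
  have hlog : Real.log R ≤ Real.log y'/2 := by
    have : Real.log R ≤ Real.log (Real.sqrt y') := Real.log_le_log (by exact_mod_cast hR0) hRy
    rwa [Real.log_sqrt (by linarith)] at this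
  have hnm : (0:ℝ) ≤ (N:ℝ)-M := by
    have : (M:ℝ) ≤ N := by exact_mod_cast hMN
    linarith
  have h5 := mul_le_mul_of_nonneg_left (h4.trans (by linarith : 1+Real.log R ≤ 1+Real.log y'/2)) hnm
  have h6 : ((R+1-1:ℕ):ℝ) ≤ Real.sqrt y' := by rw [Nat.add_sub_cancel]; exact hRy
  have hlg : 0 ≤ Real.log y' := Real.log_nonneg hy1
  have h7 : ((N:ℝ)-M)*(1+Real.log y'/2) ≤ (y'-y+1)*(1+Real.log y'/2) := mul_le_mul_of_nonneg_right (by linarith) (by linarith)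
  have h8 : 1+Real.log y'/2 ≤ Real.sqrt y' := by
    have := Real.log_le_sub_one_of_pos (x := Real.sqrt y') (Real.sqrt_pos.mpr (by linarith))
    rw [Real.log_sqrt (by linarith)] at this; linarith
  nlinarith

noncomputable def phie (ε v : ℝ) : ℝ := ZZ (Real.exp v)*Real.exp (-((1+ε)*v))

lemma ZZ_lt_one {y : ℝ} (hy : y < 1) : ZZ y = 0 := by
  unfold ZZ
  rw [Nat.floor_eq_zero.mpr hy]; simp

lemma phie_neg {ε v : ℝ} (hv : v < 0) : phie ε v = 0 := by
  unfold phie; rw [ZZ_lt_one (by simpa using hv), zero_mul]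

lemma ZZ_bd {v : ℝ} (hv : 0 ≤ v) : |ZZ (Real.exp v)| ≤ Real.exp v*(4+v/2) := by
  have h := ZZ_incr (y := 0) (y' := Real.exp v) le_rfl (Real.exp_pos v).le (Real.one_le_exp hv)
  rw [ZZ_lt_one (show (0:ℝ) < 1 by norm_num), Real.log_exp] at h
  have : Real.sqrt (Real.exp v) ≤ Real.exp v := by
    rw [Real.sqrt_le_left (Real.exp_pos v).le]
    nlinarith [Real.one_le_exp hv]
  simp only [sub_zero] at h
  nlinarith

lemma phie_bd {ε v : ℝ} (hv : 0 ≤ v) : |phie ε v| ≤ (4+v/2)*Real.exp (-(ε*v)) := by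
  unfold phie
  rw [abs_mul, abs_of_pos (Real.exp_pos _)]
  calc |ZZ (Real.exp v)| * Real.exp (-((1+ε)*v)) ≤ Real.exp v*(4+v/2)*Real.exp (-((1+ε)*v)) := mul_le_mul_of_nonneg_right (ZZ_bd hv) (Real.exp_pos _).le
    _ = (4+v/2)*(Real.exp v*Real.exp (-((1+ε)*v))) := by ring
    _ = _ := by rw [← Real.exp_add]; ring_nf

lemma phie_incr {ε a b : ℝ} (h0 : 0 ≤ ε) (h1 : ε ≤ 1/100) (hab : a ≤ b) (hb : 0 ≤ b) :
    |phie ε b - phie ε a| ≤ (b-a)*(6+101/100*b) + 3*Real.exp (-(b/2)) := by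
  have e : phie ε b - phie ε a = Real.exp (-((1+ε)*b))*(ZZ (Real.exp b) - ZZ (Real.exp a)) + ZZ (Real.exp a)*(Real.exp (-((1+ε)*b)) - Real.exp (-((1+ε)*a))) := by
    unfold phie; ring
  rw [e]
  have t1 : |Real.exp (-((1+ε)*b))*(ZZ (Real.exp b) - ZZ (Real.exp a))| ≤ (b-a)*(1+b/2) + 3*Real.exp (-(b/2)) := by
    rw [abs_mul, abs_of_pos (Real.exp_pos _)]
    have h := ZZ_incr (y := Real.exp a) (y' := Real.exp b) (Real.exp_pos a).le (Real.exp_le_exp.mpr hab) (Real.one_le_exp hb)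
    rw [Real.log_exp] at h
    have h2 : Real.exp (-((1+ε)*b)) ≤ Real.exp (-b) := Real.exp_le_exp.mpr (by nlinarith)
    have h3 := mul_le_mul h2 h (abs_nonneg _) (Real.exp_pos _).le
    refine h3.trans ?_
    have s : Real.sqrt (Real.exp b) = Real.exp (b/2) := (Real.exp_half b).symm
    rw [s, mul_add]
    have e1 : Real.exp (-b)*(3*Real.exp (b/2)) = 3*Real.exp (-(b/2)) := by
      rw [mul_left_comm, ← Real.exp_add]; ring_nf
    have e2 : Real.exp (-b)*((Real.exp b - Real.exp a)*(1+b/2)) = (1-Real.exp (a-b))*(1+b/2) := by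
      rw [← mul_assoc, mul_sub, ← Real.exp_add, ← Real.exp_add]; rw [neg_add_cancel, Real.exp_zero, neg_add_eq_sub]
    rw [e1, e2]
    have := Real.add_one_le_exp (a-b)
    have := mul_le_mul_of_nonneg_right (by linarith : 1-Real.exp (a-b) ≤ b-a) (by linarith : 0 ≤ 1+b/2)
    linarith
  have t2 : |ZZ (Real.exp a)*(Real.exp (-((1+ε)*b)) - Real.exp (-((1+ε)*a)))| ≤ (b-a)*(101/100*(4+b/2)) := by
    rcases lt_or_ge a 0 with ha | ha
    · rw [ZZ_lt_one (by simpa using ha), zero_mul, abs_zero]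
      have : 0 ≤ b-a := by linarith
      positivity
    · rw [abs_mul]
      have h := ZZ_bd ha
      have h4 : |Real.exp (-((1+ε)*b)) - Real.exp (-((1+ε)*a))| ≤ Real.exp (-a)*((1+ε)*(b-a)) := by
        have e1 : Real.exp (-((1+ε)*b)) = Real.exp (-((1+ε)*a))*Real.exp (-((1+ε)*(b-a))) := by rw [← Real.exp_add]; ring_nf
        have h5 := Real.add_one_le_exp (-((1+ε)*(b-a)))
        have h6 : Real.exp (-((1+ε)*(b-a))) ≤ 1 := Real.exp_le_one_iff.mpr (by nlinarith)
        have h7 : Real.exp (-((1+ε)*a)) ≤ Real.exp (-a) := Real.exp_le_exp.mpr (by nlinarith)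
        have e2 : Real.exp (-((1+ε)*b)) - Real.exp (-((1+ε)*a)) = -(Real.exp (-((1+ε)*a))*(1-Real.exp (-((1+ε)*(b-a))))) := by rw [e1]; ring
        rw [e2, abs_neg, abs_of_nonneg (mul_nonneg (Real.exp_pos _).le (by linarith))]
        exact mul_le_mul h7 (by linarith) (by linarith) (Real.exp_pos _).le
      have h8 := mul_le_mul h h4 (abs_nonneg _) (by positivity)
      refine h8.trans ?_
      have e3 : Real.exp a*(4+a/2)*(Real.exp (-a)*((1+ε)*(b-a))) = (4+a/2)*((1+ε)*(b-a)) := by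
        have : Real.exp a*Real.exp (-a) = 1 := by rw [← Real.exp_add]; simp
        linear_combination (4+a/2)*((1+ε)*(b-a))*this
      rw [e3]
      have h9 : (1+ε)*(4+a/2) ≤ 101/100*(4+b/2) := mul_le_mul (by linarith) (by linarith) (by linarith) (by norm_num)
      have := mul_le_mul_of_nonneg_left h9 (by linarith : 0 ≤ b-a)
      linarith
  refine (abs_add_le _ _).trans ?_
  nlinarith

lemma phie_diff {ε v w : ℝ} (h0 : 0 ≤ ε) (h1 : ε ≤ 1/100) (hv : 0 ≤ v) :
    |phie ε v - phie ε (v-w)| ≤ |w| * (6+101/100*(v+|w|)) + 3*Real.exp (-(v/2)) := by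
  rcases le_total 0 w with hw | hw
  · have h := phie_incr h0 h1 (show v-w ≤ v by linarith) hv
    rw [abs_of_nonneg hw]
    nlinarith
  · have h := phie_incr h0 h1 (show v ≤ v-w by linarith) (by linarith)
    rw [abs_sub_comm, abs_of_nonpos hw]
    have : Real.exp (-((v-w)/2)) ≤ Real.exp (-(v/2)) := Real.exp_le_exp.mpr (by linarith)
    nlinarith

-- Part P2
lemma ZZ_meas : Measurable ZZ := by
  unfold ZZ
  exact (measurable_from_nat (f := fun N : ℕ => ∑ n ∈ Finset.Icc 1 N, ((zz n : ℤ):ℝ))).comp Nat.measurable_floor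

lemma phie_meas (ε : ℝ) : Measurable (phie ε) := by
  unfold phie
  exact (ZZ_meas.comp Real.measurable_exp).mul (by fun_prop)

noncomputable def gam (δ : ℝ) : MeasureTheory.Measure ℝ := ProbabilityTheory.gaussianReal 0 (Real.toNNReal (δ^2))

instance (δ : ℝ) : MeasureTheory.IsProbabilityMeasure (gam δ) := by unfold gam; infer_instance

noncomputable def phit (ε δ v : ℝ) : ℝ := ∫ w, phie ε (v-w) ∂(gam δ)

lemma gam_sq_int (δ : ℝ) : MeasureTheory.Integrable (fun w : ℝ => w^2) (gam δ) := by
  have := (ProbabilityTheory.memLp_id_gaussianReal (μ := 0) (v := Real.toNNReal (δ^2)) 2).integrable_sq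
  simpa [gam] using this

lemma gam_sq (δ : ℝ) : ∫ w, w^2 ∂(gam δ) = δ^2 := by
  have h := ProbabilityTheory.variance_fun_id_gaussianReal (μ := 0) (v := Real.toNNReal (δ^2))
  rw [ProbabilityTheory.variance_eq_integral measurable_id'.aemeasurable, ProbabilityTheory.integral_id_gaussianReal] at h
  simp only [sub_zero] at h
  unfold gam
  rw [h, Real.coe_toNNReal _ (sq_nonneg δ)]

lemma gam_exp_int (δ c : ℝ) : MeasureTheory.Integrable (fun w : ℝ => Real.exp (c*w)) (gam δ) :=
  ProbabilityTheory.integrable_exp_mul_gaussianReal c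

lemma gam_exp (δ c : ℝ) : ∫ w, Real.exp (c*w) ∂(gam δ) = Real.exp (c^2*δ^2/2) := by
  have h := congrFun (ProbabilityTheory.mgf_fun_id_gaussianReal (μ := 0) (v := Real.toNNReal (δ^2))) c
  unfold ProbabilityTheory.mgf at h
  unfold gam
  rw [h, Real.coe_toNNReal _ (sq_nonneg δ)]
  congr 1; ring

lemma phie_exp_bd {ε C c : ℝ} (hC : 0 ≤ C) (h : ∀ y, 0 ≤ y → |phie ε y| ≤ C*Real.exp (c*y)) (y : ℝ) : |phie ε y| ≤ C*Real.exp (c*y) := by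
  rcases lt_or_ge y 0 with hy | hy
  · rw [phie_neg hy, abs_zero]; positivity
  · exact h y hy

lemma phie_exp10 {ε : ℝ} (hε : 0 ≤ ε) (y : ℝ) : |phie ε y| ≤ 4*Real.exp (10*y) := by
  refine phie_exp_bd (by norm_num) (fun y hy => ?_) y
  refine (phie_bd hy).trans ?_
  have h1 : Real.exp (-(ε*y)) ≤ 1 := Real.exp_le_one_iff.mpr (by nlinarith)
  have h2 := Real.add_one_le_exp (10*y)
  nlinarith [Real.exp_pos (-(ε*y))]

lemma phie_expe {ε : ℝ} (hε : 0 < ε) (y : ℝ) : |phie ε y| ≤ (4+1/ε)*Real.exp (-(ε/2)*y) := by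
  refine phie_exp_bd (by positivity) (fun y hy => ?_) y
  refine (phie_bd hy).trans ?_
  have e : Real.exp (-(ε*y)) = Real.exp (-(ε/2)*y)*Real.exp (-(ε/2)*y) := by rw [← Real.exp_add]; ring_nf
  have h2 : (4+y/2)*Real.exp (-(ε/2)*y) ≤ 4+1/ε := by
    have h3 := Real.add_one_le_exp (ε/2*y)
    have e2 : Real.exp (-(ε/2)*y) = (Real.exp (ε/2*y))⁻¹ := by rw [← Real.exp_neg]; ring_nf
    rw [e2, ← div_eq_mul_inv, div_le_iff₀ (Real.exp_pos _)]
    have h4 : (4+1/ε)*(ε/2*y+1) ≤ (4+1/ε)*Real.exp (ε/2*y) := mul_le_mul_of_nonneg_left h3 (by positivity)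
    refine le_trans ?_ h4
    have e3 : (4+1/ε)*(ε/2*y+1) = 4 + y/2 + 2*ε*y+1/ε := by field_simp; ring
    rw [e3]
    have : 0 < 1/ε := by positivity
    have := mul_nonneg hε.le hy
    linarith
  rw [e, ← mul_assoc]
  exact mul_le_mul_of_nonneg_right h2 (Real.exp_pos _).le

lemma phit_int {ε : ℝ} (hε : 0 ≤ ε) (δ v : ℝ) : MeasureTheory.Integrable (fun w => phie ε (v-w)) (gam δ) := by
  refine MeasureTheory.Integrable.mono' (g := fun w => 4*Real.exp (10*v)*Real.exp ((-10)*w)) ((gam_exp_int δ (-10)).const_mul _) ((phie_meas ε).comp (by fun_prop)).aestronglyMeasurable (Eventually.of_forall fun w => ?_)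
  rw [Real.norm_eq_abs]
  refine (phie_exp10 hε _).trans (le_of_eq ?_)
  rw [mul_assoc, ← Real.exp_add]; ring_nf

lemma phit_exp {ε C c : ℝ} (h : ∀ y, |phie ε y| ≤ C*Real.exp (c*y)) (δ v : ℝ) : |phit ε δ v| ≤ C*Real.exp (c*v)*Real.exp (c^2*δ^2/2) := by
  unfold phit
  rw [← Real.norm_eq_abs]
  have h2 : ∫ w, C*Real.exp (c*v)*Real.exp ((-c)*w) ∂(gam δ) = C*Real.exp (c*v)*Real.exp (c^2*δ^2/2) := by
    rw [MeasureTheory.integral_const_mul, gam_exp]; ring_nf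
  rw [← h2]
  refine MeasureTheory.norm_integral_le_of_norm_le ((gam_exp_int δ (-c)).const_mul _) (Eventually.of_forall fun w => ?_)
  rw [Real.norm_eq_abs]
  refine (h _).trans (le_of_eq ?_)
  rw [mul_assoc, ← Real.exp_add]; ring_nf

lemma phit_close {ε δ v : ℝ} (h0 : 0 ≤ ε) (h1 : ε ≤ 1/100) (hδ : 0 < δ) (hv : 0 ≤ v) :
    |phie ε v - phit ε δ v| ≤ δ*(6+101/100*v) + 101/100*δ^2 + 3*Real.exp (-(v/2)) := by
  have e : phie ε v - phit ε δ v = ∫ w, (phie ε v - phie ε (v-w)) ∂(gam δ) := by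
    rw [MeasureTheory.integral_sub (MeasureTheory.integrable_const _) (phit_int h0 δ v)]
    simp [phit]
  rw [e, ← Real.norm_eq_abs]
  set A := 6+101/100*v with hA
  have hA0 : 0 ≤ A := by rw [hA]; positivity
  have hi : MeasureTheory.Integrable (fun w : ℝ => (A/(2*δ)+101/100)*w^2 + (δ/2*A+3*Real.exp (-(v/2)))) (gam δ) :=
    ((gam_sq_int δ).const_mul _).add (MeasureTheory.integrable_const _)
  have e2 : ∫ w, ((A/(2*δ)+101/100)*w^2 + (δ/2*A+3*Real.exp (-(v/2)))) ∂(gam δ) = δ*A + 101/100*δ^2 + 3*Real.exp (-(v/2)) := by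
    rw [MeasureTheory.integral_add ((gam_sq_int δ).const_mul _) (MeasureTheory.integrable_const _), MeasureTheory.integral_const_mul, gam_sq]
    simp only [MeasureTheory.integral_const, MeasureTheory.probReal_univ, one_smul, smul_eq_mul, one_mul]
    field_simp; ring
  rw [← e2]
  refine MeasureTheory.norm_integral_le_of_norm_le hi (Eventually.of_forall fun w => ?_)
  rw [Real.norm_eq_abs]
  refine (phie_diff h0 h1 hv).trans ?_
  have h3 : |w| ≤ w^2/(2*δ)+δ/2 := by
    rw [div_add_div _ _ (by positivity) (by norm_num), le_div_iff₀ (by positivity)]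
    nlinarith [sq_nonneg (|w|-δ), sq_abs w]
  have h4 : |w| * A ≤ (w^2/(2*δ)+δ/2)*A := mul_le_mul_of_nonneg_right h3 hA0
  have e3 : |w| * (6+101/100*(v+|w|)) = |w| * A + 101/100*w^2 := by rw [hA, ← sq_abs w]; ring
  rw [e3]
  have e4 : (w^2/(2*δ)+δ/2)*A = A/(2*δ)*w^2+δ/2*A := by ring
  linarith

-- Part P3
lemma zz_LSeries {s : ℂ} (hs : 1 < s.re) : LSeriesSummable (fun n => ((zz n : ℤ):ℂ)) s ∧ LSeries (fun n => ((zz n : ℤ):ℂ)) s = (Gf s)^2 := by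
  have e : (fun n => ((zz n : ℤ):ℂ)) = LSeries.convolution (fun n => ((muo n : ℤ):ℂ)) (fun n => ((muo n : ℤ):ℂ)) := by
    funext n
    rw [LSeries.convolution_def]
    unfold zz
    rw [ArithmeticFunction.mul_apply]
    push_cast
    rfl
  rw [e]
  refine ⟨(muo_summable hs).convolution (muo_summable hs), ?_⟩
  rw [LSeries_convolution' (muo_summable hs) (muo_summable hs), muo_LSeries hs, sq]

lemma ZZ_bigO {ε : ℝ} (hε : 0 < ε) : (fun n : ℕ => ∑ k ∈ Finset.Icc 1 n, ((zz k : ℤ):ℂ)) =O[atTop] fun n => (n:ℝ)^(1+ε/2) := by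
  refine Asymptotics.IsBigO.of_bound (4+1/ε) ?_
  filter_upwards [eventually_ge_atTop 1] with n hn
  have hn1 : (1:ℝ) ≤ n := by exact_mod_cast hn
  have hn0 : (0:ℝ) < n := by linarith
  have h := ZZ_bd (v := Real.log n) (Real.log_nonneg hn1)
  rw [Real.exp_log hn0] at h
  have e : ∑ k ∈ Finset.Icc 1 n, ((zz k : ℤ):ℂ) = ((ZZ n:ℝ):ℂ) := by
    unfold ZZ; rw [Nat.floor_natCast]; push_cast; rfl
  rw [e, Complex.norm_real, Real.norm_eq_abs, Real.norm_eq_abs, abs_of_pos (Real.rpow_pos_of_pos hn0 _)]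
  refine h.trans ?_
  have h2 := Real.log_le_rpow_div hn0.le (ε := ε/2) (by positivity)
  have h3 : (1:ℝ) ≤ (n:ℝ)^(ε/2) := Real.one_le_rpow hn1 (by positivity)
  rw [Real.rpow_add hn0, Real.rpow_one]
  have h4 : (n:ℝ)^(ε/2)/(ε/2) = 2*((1/ε)*(n:ℝ)^(ε/2)) := by field_simp
  rw [h4] at h2
  have : 4 + Real.log n/2 ≤ (4+1/ε)*(n:ℝ)^(ε/2) := by nlinarith
  calc (n:ℝ)*(4+Real.log n/2) ≤ n*((4+1/ε)*(n:ℝ)^(ε/2)) := mul_le_mul_of_nonneg_left this hn0.le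
    _ = _ := by ring

noncomputable def Ft (ε ξ : ℝ) : ℂ := (Gf ((1+ε:ℝ)+ξ*Complex.I))^2/((1+ε:ℝ)+ξ*Complex.I)

lemma phie_laplace {ε : ℝ} (hε : 0 < ε) (ξ : ℝ) : ∫ y : ℝ, Complex.exp (-(ξ*y)*Complex.I) * ((phie ε y : ℝ):ℂ) = Ft ε ξ := by
  set s : ℂ := (1+ε:ℝ)+ξ*Complex.I with hs
  have hre : s.re = 1+ε := by rw [hs]; simp
  have hs0 : s ≠ 0 := by intro h; rw [h] at hre; simp at hre; linarith
  have hz := zz_LSeries (s := s) (by rw [hre]; linarith)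
  have h := LSeries_eq_mul_integral (fun n => ((zz n : ℤ):ℂ)) (r := 1+ε/2) (by positivity) (s := s) (by rw [hre]; linarith) hz.1 (ZZ_bigO hε)
  rw [hz.2] at h
  have h2 : Ft ε ξ = ∫ t in Set.Ioi (1 : ℝ), (∑ k ∈ Finset.Icc 1 ⌊t⌋₊, ((zz k:ℤ):ℂ)) * (t:ℂ) ^ (-(s + 1)) := by
    unfold Ft; rw [← hs, h]; field_simp
  rw [h2]
  have himg : Real.exp '' (Set.Ioi 0) = Set.Ioi 1 := by
    ext x; constructor
    · rintro ⟨y, hy, rfl⟩; simpa using hy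
    · intro hx
      have hx' : (1:ℝ) < x := hx
      exact ⟨Real.log x, Real.log_pos hx', Real.exp_log (by linarith)⟩
  rw [← himg, MeasureTheory.integral_image_eq_integral_abs_deriv_smul measurableSet_Ioi (fun x _ => (Real.hasDerivAt_exp x).hasDerivWithinAt) Real.exp_injective.injOn]
  rw [← MeasureTheory.setIntegral_univ, MeasureTheory.setIntegral_eq_of_subset_of_ae_diff_eq_zero (s := Set.Ici 0) MeasurableSet.univ.nullMeasurableSet (Set.subset_univ _)]
  · rw [MeasureTheory.integral_Ici_eq_integral_Ioi]
    refine MeasureTheory.setIntegral_congr_fun measurableSet_Ioi (fun y _ => ?_)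
    have e1 : (∑ k ∈ Finset.Icc 1 ⌊Real.exp y⌋₊, ((zz k:ℤ):ℂ)) = ((ZZ (Real.exp y):ℝ):ℂ) := by
      unfold ZZ; push_cast; rfl
    rw [e1, abs_of_pos (Real.exp_pos y)]
    have e2 : ((Real.exp y:ℝ):ℂ)^(-(s+1)) = Complex.exp (-(s+1)*y) := by
      rw [Complex.cpow_def_of_ne_zero (by exact_mod_cast (Real.exp_pos y).ne'), ← Complex.ofReal_log (Real.exp_pos y).le, Real.log_exp, mul_comm]
    rw [e2]
    unfold phie
    rw [Complex.real_smul]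
    push_cast
    rw [mul_comm (ZZ _ :ℂ), mul_comm (ZZ _ :ℂ), ← mul_assoc, ← mul_assoc, ← Complex.exp_add, ← Complex.exp_add]
    congr 2
    rw [hs]; push_cast; ring
  · refine Eventually.of_forall fun y hy => ?_
    have : y < 0 := by simpa using hy
    rw [phie_neg this]; simp

open scoped FourierTransform in
lemma phie_fourier {ε : ℝ} (hε : 0 < ε) (x : ℝ) : 𝓕 (fun y => ((phie ε y:ℝ):ℂ)) x = Ft ε (2*Real.pi*x) := by
  rw [Real.fourier_real_eq_integral_exp_smul, ← phie_laplace hε]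
  congr 1; funext y
  rw [smul_eq_mul]; congr 2; push_cast; ring

lemma phie_integrable {ε : ℝ} (hε : 0 < ε) : MeasureTheory.Integrable (phie ε) := by
  have h1 : MeasureTheory.IntegrableOn (fun y : ℝ => (4+1/ε)*Real.exp (-(ε/2)*y)) (Set.Ioi 0) := (exp_neg_integrableOn_Ioi 0 (by positivity)).const_mul _
  have h2 : MeasureTheory.IntegrableOn (phie ε) (Set.Ioi 0) :=
    MeasureTheory.Integrable.mono' h1 (phie_meas ε).aestronglyMeasurable (Eventually.of_forall fun y => by
      rw [Real.norm_eq_abs]; exact phie_expe hε y)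
  have h3 : MeasureTheory.IntegrableOn (phie ε) (Set.Ici 0) := (integrableOn_Ici_iff_integrableOn_Ioi (f := phie ε) (b := 0)).mpr h2
  refine h3.integrable_of_forall_notMem_eq_zero (fun y hy => phie_neg (by simpa using hy))

lemma Ft_cont {ε : ℝ} (hε : 0 < ε) : Continuous (Ft ε) := by
  unfold Ft
  refine Continuous.div (Continuous.pow ?_ 2) (by fun_prop) (fun x h => ?_)
  · rw [continuous_iff_continuousAt]; intro ξ
    have h1 : DifferentiableAt ℂ Gf ((1+ε:ℝ)+ξ*Complex.I) := by
      refine Gf_diff (L := 20+3*|ξ|) (by linarith [abs_nonneg ξ]) ?_ ?_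
      · have : 0 ≤ (39/1000:ℝ)/(20+3*|ξ|) := by positivity
        simp; linarith
      · have := Real.add_one_le_exp (20+3*|ξ|)
        simp; linarith
    exact ContinuousAt.comp (f := fun ξ : ℝ => ((1+ε:ℝ)+ξ*Complex.I : ℂ)) h1.continuousAt (by fun_prop)
  · have := congrArg Complex.re h
    simp at this; linarith

lemma Ft_bd {ε : ℝ} (hε : 0 < ε) : ∃ C, ∀ ξ, ‖Ft ε ξ‖ ≤ C := by
  refine ⟨∫ y, ‖((phie ε y:ℝ):ℂ)‖, fun ξ => ?_⟩
  rw [← phie_laplace hε]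
  refine (MeasureTheory.norm_integral_le_integral_norm _).trans (le_of_eq ?_)
  congr 1; funext y
  rw [norm_mul]
  have : ‖Complex.exp (-(ξ*y)*Complex.I)‖ = 1 := by
    have := Complex.norm_exp_ofReal_mul_I (-(ξ*y)); push_cast at this; exact this
  rw [this, one_mul]

-- Part P3b
noncomputable def gv (δ v x : ℝ) : ℂ := Complex.exp (2*Real.pi*(v*x)*Complex.I) * Complex.exp (-(2*Real.pi^2*δ^2*x^2))

lemma gv_eq (δ v x : ℝ) : gv δ v x = Complex.exp (-(2*Real.pi^2*δ^2)*x^2 + (2*Real.pi*v*Complex.I)*x+0) := by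
  unfold gv; rw [← Complex.exp_add]; congr 1; ring

lemma gv_re {δ : ℝ} (hδ : 0 < δ) : 0 < ((2*Real.pi^2*δ^2 : ℂ)).re := by
  have : (2*Real.pi^2*δ^2 : ℂ) = ((2*Real.pi^2*δ^2:ℝ):ℂ) := by push_cast; rfl
  rw [this, Complex.ofReal_re]; positivity

lemma gv_integrable {δ : ℝ} (hδ : 0 < δ) (v : ℝ) : MeasureTheory.Integrable (gv δ v) := by
  have := integrable_cexp_quadratic (gv_re hδ) (2*Real.pi*v*Complex.I) 0
  exact this.congr (Eventually.of_forall fun x => (gv_eq δ v x).symm)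

open scoped FourierTransform in
lemma gv_fourier {δ : ℝ} (hδ : 0 < δ) (v y : ℝ) : 𝓕 (gv δ v) y = ((ProbabilityTheory.gaussianPDFReal 0 (Real.toNNReal (δ^2)) (v-y):ℝ):ℂ) := by
  rw [Real.fourier_real_eq_integral_exp_smul]
  have h := fourierIntegral_gaussian (gv_re hδ) (2*Real.pi*(v-y))
  have e : ∀ x : ℝ, Complex.exp (((-2*Real.pi*x*y:ℝ):ℂ)*Complex.I) • gv δ v x = Complex.exp (Complex.I*(2*Real.pi*(v-y))*x)*Complex.exp (-(2*Real.pi^2*δ^2)*x^2) := by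
    intro x
    unfold gv
    rw [smul_eq_mul, ← mul_assoc, ← Complex.exp_add]
    congr 2
    · push_cast; ring
    · ring
  simp_rw [e]
  rw [h]
  unfold ProbabilityTheory.gaussianPDFReal
  rw [Real.coe_toNNReal _ (sq_nonneg δ)]
  push_cast
  have hpi : (Real.pi:ℂ) ≠ 0 := by exact_mod_cast Real.pi_ne_zero
  have hd : (δ:ℂ) ≠ 0 := by exact_mod_cast hδ.ne'
  congr 1
  · have e1 : (Real.pi:ℂ)/(2*Real.pi^2*δ^2) = (((2*Real.pi*δ^2)⁻¹:ℝ):ℂ) := by push_cast; field_simp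
    rw [e1]
    have : (1/2:ℂ) = ((1/2:ℝ):ℂ) := by push_cast; rfl
    rw [this, ← Complex.ofReal_cpow (by positivity), ← Real.sqrt_eq_rpow, Real.sqrt_inv]
    push_cast; rfl
  · congr 1
    field_simp; ring

open scoped FourierTransform in
lemma phit_rep {ε δ : ℝ} (hε : 0 < ε) (hδ : 0 < δ) (v : ℝ) : ((phit ε δ v:ℝ):ℂ) = ∫ x : ℝ, Ft ε (2*Real.pi*x) * gv δ v x := by
  have h := VectorFourier.integral_fourierIntegral_smul_eq_flip (L := innerₗ ℝ) (e := Real.fourierChar) (μ := MeasureTheory.volume) (ν := MeasureTheory.volume) (f := fun y : ℝ => ((phie ε y:ℝ):ℂ)) (g := gv δ v)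
    Real.continuous_fourierChar continuous_inner (phie_integrable hε).ofReal (gv_integrable hδ v)
  rw [flip_innerₗ] at h
  have e1 : ∀ x, VectorFourier.fourierIntegral Real.fourierChar MeasureTheory.volume (innerₗ ℝ) (fun y : ℝ => ((phie ε y:ℝ):ℂ)) x = Ft ε (2*Real.pi*x) := fun x => phie_fourier hε x
  have e2 : ∀ x, VectorFourier.fourierIntegral Real.fourierChar MeasureTheory.volume (innerₗ ℝ) (gv δ v) x = _ := fun x => gv_fourier hδ v x
  simp_rw [e1, e2, smul_eq_mul] at h
  rw [h]
  have hv : Real.toNNReal (δ^2) ≠ 0 := by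
    rw [Ne, Real.toNNReal_eq_zero, not_le]; positivity
  unfold phit gam
  rw [ProbabilityTheory.integral_gaussianReal_eq_integral_smul hv, ← integral_complex_ofReal]
  rw [← MeasureTheory.integral_sub_left_eq_self _ MeasureTheory.volume v]
  congr 1; funext x
  simp; ring

lemma norm_gv (δ v x : ℝ) : ‖gv δ v x‖ = Real.exp (-(2*Real.pi^2*δ^2*x^2)) := by
  unfold gv
  rw [norm_mul]
  have h1 := Complex.norm_exp_ofReal_mul_I (2*Real.pi*(v*x)); push_cast at h1
  rw [h1, one_mul]
  have : (-(2*Real.pi^2*δ^2*x^2):ℂ) = ((-(2*Real.pi^2*δ^2*x^2):ℝ):ℂ) := by push_cast; rfl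
  rw [this, Complex.norm_exp_ofReal]

lemma gv_cont (δ v : ℝ) : Continuous (gv δ v) := by unfold gv; fun_prop

-- Part P3c
lemma summ_exp_nat {c : ℝ} (hc : 0 < c) : Summable (fun n : ℕ => Real.exp (-(c*n))) := by
  have h := summable_geometric_of_lt_one (r := Real.exp (-c)) (Real.exp_pos _).le (Real.exp_lt_one_iff.mpr (by linarith))
  refine h.congr (fun n => ?_)
  rw [← Real.exp_nat_mul]; congr 1; ring

lemma phit_summable {ε : ℝ} (hε : 0 < ε) (δ u : ℝ) : Summable (fun n : ℤ => phit ε δ (u-n*Real.log 2)) := by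
  refine Summable.of_nat_of_neg ?_ ?_
  · refine Summable.of_norm_bounded (g := fun n : ℕ => (4*Real.exp (10*u)*Real.exp (10^2*δ^2/2))*Real.exp (-(10*Real.log 2*n))) ((summ_exp_nat (by have := l2pos; positivity)).mul_left _) (fun n => ?_)
    rw [Real.norm_eq_abs]
    refine (phit_exp (phie_exp10 hε.le) δ _).trans (le_of_eq ?_)
    have : Real.exp (10*(u-((n:ℤ):ℝ)*Real.log 2)) = Real.exp (10*u)*Real.exp (-(10*Real.log 2*n)) := by
      rw [← Real.exp_add]; congr 1; push_cast; ring
    rw [this]; ring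
  · refine Summable.of_norm_bounded (g := fun n : ℕ => ((4+1/ε)*Real.exp (-(ε/2)*u)*Real.exp ((-(ε/2))^2*δ^2/2))*Real.exp (-((ε/2)*Real.log 2*n))) ((summ_exp_nat (by have := l2pos; positivity)).mul_left _) (fun n => ?_)
    rw [Real.norm_eq_abs]
    refine (phit_exp (phie_expe hε) δ _).trans (le_of_eq ?_)
    have : Real.exp (-(ε/2)*(u-((-(n:ℤ):ℤ):ℝ)*Real.log 2)) = Real.exp (-(ε/2)*u)*Real.exp (-((ε/2)*Real.log 2*n)) := by
      rw [← Real.exp_add]; congr 1; push_cast; ring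
    rw [this]; ring

noncomputable def pf (ε δ u y : ℝ) : ℂ := Ft ε (2*Real.pi*(y/Real.log 2)) * gv δ u (y/Real.log 2)

lemma pf_cont {ε : ℝ} (hε : 0 < ε) (δ u : ℝ) : Continuous (pf ε δ u) := by
  unfold pf
  exact ((Ft_cont hε).comp (by fun_prop)).mul ((gv_cont δ u).comp (by fun_prop))

lemma pf_decay {ε δ : ℝ} (hε : 0 < ε) (hδ : 0 < δ) (u : ℝ) : (pf ε δ u) =O[cocompact ℝ] fun x : ℝ => |x|^(-2:ℝ) := by
  obtain ⟨C, hC⟩ := Ft_bd hε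
  have hC0 : 0 ≤ C := (norm_nonneg _).trans (hC 0)
  have hl := l2pos
  have hpi := Real.pi_pos
  set c := 2*Real.pi^2*δ^2/(Real.log 2)^2 with hc
  have hc0 : 0 < c := by rw [hc]; positivity
  refine Asymptotics.IsBigO.of_bound (C/c) ?_
  have h0 : ∀ᶠ x : ℝ in cocompact ℝ, x ≠ 0 := cocompact_le_cofinite ((Set.finite_singleton (0:ℝ)).compl_mem_cofinite)
  filter_upwards [h0] with x hx
  unfold pf
  rw [norm_mul, norm_gv]
  have hx2 : 0 < x^2 := by positivity
  have e : 2*Real.pi^2*δ^2*(x/Real.log 2)^2 = c*x^2 := by rw [hc]; field_simp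
  have e2 : |x|^(-2:ℝ) = (x^2)⁻¹ := by
    rw [Real.rpow_neg (abs_nonneg x)]; norm_num
  rw [e, e2, Real.norm_eq_abs, abs_of_pos (inv_pos.mpr hx2), Real.exp_neg]
  have h1 := Real.add_one_le_exp (c*x^2)
  have h2 : (Real.exp (c*x^2))⁻¹ ≤ (c*x^2)⁻¹ := inv_anti₀ (by positivity) (by linarith)
  calc _ ≤ C*(c*x^2)⁻¹ := mul_le_mul (hC _) h2 (by positivity) hC0
    _ = _ := by field_simp

open scoped FourierTransform in
lemma pf_fourier {ε δ : ℝ} (hε : 0 < ε) (hδ : 0 < δ) (u : ℝ) (n : ℤ) : 𝓕 (pf ε δ u) (n:ℝ) = ((Real.log 2 * phit ε δ (u-n*Real.log 2):ℝ):ℂ) := by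
  have hl := l2pos
  rw [Real.fourier_real_eq_integral_exp_smul]
  have e : ∀ y : ℝ, Complex.exp (((-2*Real.pi*y*n:ℝ):ℂ)*Complex.I) • pf ε δ u y = (fun x : ℝ => Ft ε (2*Real.pi*x) * gv δ (u-n*Real.log 2) x) (y/Real.log 2) := by
    intro y
    unfold pf gv
    have hl' : ((Real.log 2:ℝ):ℂ) ≠ 0 := by exact_mod_cast hl.ne'
    have e1 : Complex.exp (2*Real.pi*(((u-n*Real.log 2:ℝ):ℂ)*((y/Real.log 2:ℝ):ℂ))*Complex.I) = Complex.exp (((-2*Real.pi*y*n:ℝ):ℂ)*Complex.I)*Complex.exp (2*Real.pi*(u*((y/Real.log 2:ℝ):ℂ))*Complex.I) := by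
      rw [← Complex.exp_add]; congr 1
      simp only [Complex.ofReal_mul, Complex.ofReal_div, Complex.ofReal_sub, Complex.ofReal_neg, Complex.ofReal_ofNat, Complex.ofReal_intCast]
      generalize ((Real.log 2:ℝ):ℂ) = l at *
      field_simp; ring
    simp only []
    rw [e1, smul_eq_mul]; ring
  simp_rw [e]
  rw [MeasureTheory.Measure.integral_comp_div (fun x : ℝ => Ft ε (2*Real.pi*x) * gv δ (u-n*Real.log 2) x) (Real.log 2), ← phit_rep hε hδ, abs_of_pos hl, Complex.real_smul, Complex.ofReal_mul]

open scoped FourierTransform in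
lemma poisson_bd {ε δ B : ℝ} (hε : 0 < ε) (hδ : 0 < δ)
    (hB : ∀ J : Finset ℤ, ∑ j ∈ J, ‖Gf ((1+ε:ℝ)+(tj j)*Complex.I)‖^2*(1/|tj j| * Real.exp (-(δ^2*(tj j)^2/2))) ≤ B) (u : ℝ) :
    |∑' n : ℤ, (-1:ℝ)^n*phit ε δ (u-n*Real.log 2)| ≤ B/Real.log 2 := by
  have hl := l2pos
  have hpi := Real.pi_pos
  have hF : Summable fun n : ℤ => 𝓕 (pf ε δ u) (n:ℝ) := by
    simp_rw [pf_fourier hε hδ]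
    exact Complex.summable_ofReal.mpr ((phit_summable hε δ u).mul_left (Real.log 2))
  have h := Real.tsum_eq_tsum_fourier_of_rpow_decay_of_summable (pf_cont hε δ u) (b := 2) (by norm_num) (pf_decay hε hδ u) hF (1/2)
  have e1 : ∀ n : ℤ, 𝓕 (pf ε δ u) (n:ℝ) * fourier n ((1/2:ℝ):UnitAddCircle) = ((Real.log 2 * ((-1)^n*phit ε δ (u-n*Real.log 2)):ℝ):ℂ) := by
    intro n
    rw [pf_fourier hε hδ, fourier_coe_apply]
    have : Complex.exp (2*Real.pi*Complex.I*n*((1/2:ℝ):ℂ)/((1:ℝ):ℂ)) = (((-1:ℝ)^n:ℝ):ℂ) := by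
      push_cast
      rw [← Complex.exp_pi_mul_I, ← Complex.exp_int_mul]
      congr 1; field_simp
    rw [this, ← Complex.ofReal_mul]
    congr 1; ring
  simp_rw [e1] at h
  rw [← Complex.ofReal_tsum, tsum_mul_left] at h
  have h2 : Real.log 2 * |∑' n : ℤ, (-1:ℝ)^n*phit ε δ (u-n*Real.log 2)| = ‖∑' n : ℤ, pf ε δ u (1/2+n)‖ := by
    rw [h, Complex.norm_real, Real.norm_eq_abs, abs_mul, abs_of_pos hl]
  rw [le_div_iff₀ hl, mul_comm, h2]
  have h3 : ∀ n : ℤ, ‖pf ε δ u (1/2+n)‖ ≤ ‖Gf ((1+ε:ℝ)+(tj n)*Complex.I)‖^2*(1/|tj n| * Real.exp (-(δ^2*(tj n)^2/2))) := by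
    intro n
    unfold pf
    rw [norm_mul, norm_gv]
    have e3 : 2*Real.pi*((1/2+(n:ℝ))/Real.log 2) = tj n := by unfold tj; field_simp; ring
    have e4 : 2*Real.pi^2*δ^2*((1/2+(n:ℝ))/Real.log 2)^2 = δ^2*(tj n)^2/2 := by rw [← e3]; ring
    rw [e3, e4]
    unfold Ft
    rw [norm_div, norm_pow, div_eq_mul_one_div, mul_assoc]
    refine mul_le_mul_of_nonneg_left (mul_le_mul_of_nonneg_right ?_ (Real.exp_pos _).le) (by positivity)
    have ht : 0 < |tj n| := by
      rw [abs_pos]; unfold tj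
      have : (2*(n:ℝ)+1) ≠ 0 := by
        have : (2*n+1:ℤ) ≠ 0 := by omega
        exact_mod_cast this
      positivity
    refine one_div_le_one_div_of_le ht ?_
    refine le_trans (le_of_eq ?_) (Complex.abs_im_le_norm _)
    simp
  have hs : Summable (fun n : ℤ => ‖pf ε δ u (1/2+n)‖) :=
    summable_of_sum_le (fun _ => norm_nonneg _) (fun J => (Finset.sum_le_sum fun n _ => h3 n).trans (hB J))
  refine (norm_tsum_le_tsum_norm hs).trans ?_
  exact hs.tsum_le_of_sum_le (fun J => (Finset.sum_le_sum fun n _ => h3 n).trans (hB J))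

-- Part P4
noncomputable def Qs (ε δ v : ℝ) (s : ℂ) : ℂ := (Gf s)^2/s * Complex.exp ((s-(1+ε:ℝ))*v + δ^2*(s-(1+ε:ℝ))^2/2)

lemma norm_Qs (ε δ v σ ξ : ℝ) : ‖Qs ε δ v (σ+ξ*Complex.I)‖ = ‖Gf (σ+ξ*Complex.I)‖^2/‖(σ+ξ*Complex.I:ℂ)‖*Real.exp ((σ-(1+ε))*v+δ^2*((σ-(1+ε))^2-ξ^2)/2) := by
  unfold Qs
  rw [norm_mul, norm_div, norm_pow, Complex.norm_exp]
  congr 2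
  have : ((σ+ξ*Complex.I-((1+ε:ℝ):ℂ))*v + (δ:ℂ)^2*(σ+ξ*Complex.I-((1+ε:ℝ):ℂ))^2/2) = (((σ-(1+ε))*v+δ^2*((σ-(1+ε))^2-ξ^2)/2:ℝ):ℂ) + ((ξ*v+δ^2*(σ-(1+ε))*ξ:ℝ):ℂ)*Complex.I := by
    push_cast
    linear_combination ((δ:ℂ)^2*ξ^2/2)*Complex.I_sq
  rw [this, Complex.add_re, Complex.re_ofReal_mul, Complex.I_re, mul_zero, add_zero, Complex.ofReal_re]

lemma Qs_line (ε δ v ξ : ℝ) : Qs ε δ v (((1+ε:ℝ):ℂ)+ξ*Complex.I) = Ft ε (2*Real.pi*(ξ/(2*Real.pi))) * gv δ v (ξ/(2*Real.pi)) := by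
  have hpi := Real.pi_pos
  have e : 2*Real.pi*(ξ/(2*Real.pi)) = ξ := by field_simp
  rw [e]
  unfold Qs Ft gv
  rw [← Complex.exp_add]
  congr 2
  have hp : (Real.pi:ℂ) ≠ 0 := by exact_mod_cast hpi.ne'
  simp only [Complex.ofReal_div, Complex.ofReal_mul, Complex.ofReal_ofNat]
  rw [add_sub_cancel_left]
  field_simp
  linear_combination ((δ:ℂ)^2*ξ^2)*Complex.I_sq

lemma phit_Qs {ε δ : ℝ} (hε : 0 < ε) (hδ : 0 < δ) (v : ℝ) :
    MeasureTheory.Integrable (fun ξ : ℝ => Qs ε δ v (((1+ε:ℝ):ℂ)+ξ*Complex.I)) ∧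
    |phit ε δ v| = 1/(2*Real.pi)*‖∫ ξ : ℝ, Qs ε δ v (((1+ε:ℝ):ℂ)+ξ*Complex.I)‖ := by
  have hpi := Real.pi_pos
  have hp : (0:ℝ) < 2*Real.pi := by positivity
  simp_rw [Qs_line]
  constructor
  · have h1 : MeasureTheory.Integrable (fun x : ℝ => Ft ε (2*Real.pi*x) * gv δ v x) := by
      obtain ⟨C, hC⟩ := Ft_bd hε
      refine (gv_integrable hδ v).bdd_mul (((Ft_cont hε).comp (by fun_prop)).aestronglyMeasurable) (c := C) (Eventually.of_forall fun x => hC _)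
    exact h1.comp_div hp.ne'
  · rw [MeasureTheory.Measure.integral_comp_div (fun x : ℝ => Ft ε (2*Real.pi*x) * gv δ v x), ← phit_rep hε hδ, norm_smul, Complex.norm_real, Real.norm_eq_abs, Real.norm_eq_abs, abs_abs, abs_of_pos hp]
    field_simp

lemma Gf_le {s : ℂ} (hs : 1-1/1000 ≤ s.re) : ‖Gf s‖ ≤ 201/100*‖iz s‖ := by
  unfold Gf
  rw [norm_div, div_le_iff₀']
  · have h : (100/201:ℝ) ≤ ‖1-(2:ℂ)^(-s)‖ := by
      have h1 := norm_sub_norm_le (1:ℂ) ((2:ℂ)^(-s))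
      have := Complex.norm_natCast_cpow_of_pos (n := 2) (by norm_num) (-s)
      push_cast at this
      rw [this, norm_one, Complex.neg_re] at h1
      have h2 : (2:ℝ)^(-s.re) ≤ (2:ℝ)^(-(1-1/1000:ℝ)) := Real.rpow_le_rpow_of_exponent_le (by norm_num) (by linarith)
      have h3 : (2:ℝ)^(-(1-1/1000:ℝ)) ≤ 101/201 := by
        have e : (2:ℝ)^(-(1-1/1000:ℝ)) = 1/2*(2:ℝ)^(1/1000:ℝ) := by
          rw [show (-(1-1/1000:ℝ)) = -1+1/1000 by ring, Real.rpow_add (by norm_num), Real.rpow_neg_one]; norm_num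
        rw [e]
        have : (2:ℝ)^(1/1000:ℝ) ≤ 202/201 := by
          have h4 : (2:ℝ) ≤ (202/201)^(1000:ℕ) := by
            have := one_add_mul_le_pow (a := (1/201:ℝ)) (by norm_num) 1000
            refine le_trans (by norm_num) (this.trans (le_of_eq ?_))
            congr 1; norm_num
          calc (2:ℝ)^(1/1000:ℝ) ≤ ((202/201:ℝ)^(1000:ℕ))^(1/1000:ℝ) := Real.rpow_le_rpow (by norm_num) h4 (by norm_num)
            _ = 202/201 := by rw [← Real.rpow_natCast, ← Real.rpow_mul (by norm_num)]; norm_num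
        linarith
      linarith
    nlinarith [norm_nonneg (iz s)]
  · rw [norm_pos_iff]
    intro h
    have e : (2:ℂ)^(-s) = 1 := (sub_eq_zero.mp h).symm
    have e2 := congrArg norm e
    have := Complex.norm_natCast_cpow_of_pos (n := 2) (by norm_num) (-s)
    push_cast at this
    rw [this, norm_one, Complex.neg_re] at e2
    have h3 : (2:ℝ)^(-s.re) < 1 := Real.rpow_lt_one_of_one_lt_of_neg (by norm_num) (by linarith)
    linarith

lemma arsinh_int {H : ℝ} (hH : 0 ≤ H) : ∫ x in (-H)..H, (√(1+x^2))⁻¹ ≤ 2*Real.log (2*H+1) := by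
  rw [intervalIntegral.integral_eq_sub_of_hasDerivAt (fun x _ => Real.hasDerivAt_arsinh x)]
  · rw [Real.arsinh_neg]
    have : Real.arsinh H ≤ Real.log (2*H+1) := by
      unfold Real.arsinh
      have h1 : √(1+H^2) ≤ 1+H := by
        rw [Real.sqrt_le_left (by linarith)]; nlinarith
      exact Real.log_le_log (by positivity) (by linarith)
    linarith
  · refine ContinuousOn.intervalIntegrable (Continuous.continuousOn ?_)
    refine Continuous.inv₀ (by fun_prop) (fun x => ?_)
    have : (0:ℝ) < 1+x^2 := by positivity
    exact (Real.sqrt_pos.mpr this).ne'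

lemma gauss_tail {a H : ℝ} (ha : 0 < a) (hH : 0 ≤ H) : MeasureTheory.IntegrableOn (fun x : ℝ => x*Real.exp (-(a*x^2/2))) (Set.Ioi H) ∧ ∫ x in Set.Ioi H, x*Real.exp (-(a*x^2/2)) = Real.exp (-(a*H^2/2))/a := by
  have hd : ∀ x ∈ Set.Ici H, HasDerivAt (fun x : ℝ => -(Real.exp (-(a*x^2/2))/a)) (x*Real.exp (-(a*x^2/2))) x := by
    intro x _
    have h1 : HasDerivAt (fun x : ℝ => -(a*x^2/2)) (-(a*x)) x := by
      have := (((hasDerivAt_pow 2 x).const_mul a).div_const 2).neg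
      refine this.congr_deriv ?_
      push_cast; ring
    refine ((h1.exp.div_const a).neg).congr_deriv ?_
    field_simp
  have hp : ∀ x ∈ Set.Ioi H, 0 ≤ x*Real.exp (-(a*x^2/2)) := fun x hx => mul_nonneg (hH.trans (le_of_lt hx)) (Real.exp_pos _).le
  have ht : Tendsto (fun x : ℝ => -(Real.exp (-(a*x^2/2))/a)) atTop (nhds 0) := by
    have h1 : Tendsto (fun x : ℝ => a*x^2/2) atTop atTop := by
      have := (tendsto_pow_atTop (α := ℝ) (n := 2) (by norm_num)).const_mul_atTop (show 0 < a/2 by positivity)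
      refine this.congr (fun x => by ring)
    have h2 := ((Real.tendsto_exp_neg_atTop_nhds_zero.comp h1).div_const a).neg
    simpa using h2
  refine ⟨MeasureTheory.integrableOn_Ioi_deriv_of_nonneg' hd hp ht, ?_⟩
  rw [MeasureTheory.integral_Ioi_of_hasDerivAt_of_nonneg' hd hp ht]; ring

-- Part P4b
lemma Qs_bd_aux {ε δ v L H B : ℝ} (hL : 20 ≤ L) (hH : H = (Real.exp L-7)/3) (hB : B = 64*(1+14*L))
    {σ ξ : ℝ} (hσ0 : 1-(239/10000)*(3/4)/L ≤ σ) (hσ1 : σ ≤ 2) (hξ : |ξ| ≤ H) :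
    ‖Gf (σ+ξ*Complex.I)‖^2 ≤ 405/100*B^2 := by
  have hsm : (239/10000)*(3/4)/L ≤ 1/1000 := by rw [div_le_iff₀ (by linarith)]; linarith
  have h1 := inv_zeta_B hL (s := (σ+ξ*Complex.I:ℂ)) (by simpa using hσ0) (by simpa using hσ1) (by simp; rw [hH] at hξ; linarith)
  rw [← hB] at h1
  have h2 := Gf_le (s := (σ+ξ*Complex.I:ℂ)) (by simp; linarith)
  have h3 : ‖Gf (σ+ξ*Complex.I)‖ ≤ 201/100*B := by linarith
  calc ‖Gf (σ+ξ*Complex.I)‖^2 ≤ (201/100*B)^2 := pow_le_pow_left₀ (norm_nonneg _) h3 2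
    _ ≤ _ := by nlinarith [sq_nonneg B]

lemma Qs_tail_bd {ε δ v L H B : ℝ} (hε : 0 < ε) (hε1 : ε ≤ 1/100) (hL : 20 ≤ L) (hH : H = (Real.exp L-7)/3) (hH0 : 0 < H) (hB : B = 64*(1+14*L))
    {ξ : ℝ} (hξ : H ≤ |ξ|) : ‖Qs ε δ v (((1+ε:ℝ):ℂ)+ξ*Complex.I)‖ ≤ 405/100*B^2/H^2*(|ξ| * Real.exp (-(δ^2*|ξ|^2/2))) := by
  have hx0 : 0 < |ξ| := by linarith
  set M := Real.log (3*|ξ|+7) with hM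
  have hexp : Real.exp M = 3*|ξ|+7 := Real.exp_log (by linarith)
  have hLM : L ≤ M := by
    rw [hM, Real.le_log_iff_exp_le (by linarith)]
    have : Real.exp L = 3*H+7 := by rw [hH]; ring
    linarith
  have hMx : M ≤ L*(|ξ|/H) := by
    have h1 : M ≤ Real.log (Real.exp L*(|ξ|/H)) := by
      rw [hM]
      refine Real.log_le_log (by linarith) ?_
      have : Real.exp L = 3*H+7 := by rw [hH]; ring
      rw [this, add_mul, mul_assoc, mul_div_cancel₀ _ hH0.ne']
      have : 1 ≤ |ξ|/H := by rw [le_div_iff₀ hH0]; linarith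
      linarith
    rw [Real.log_mul (Real.exp_pos L).ne' (by positivity), Real.log_exp] at h1
    have h2 := Real.log_le_sub_one_of_pos (show 0 < |ξ|/H by positivity)
    have : 1 ≤ |ξ|/H := by rw [le_div_iff₀ hH0]; linarith
    nlinarith
  have h0 : 0 ≤ (239/10000)*(3/4)/M := by have : 0 < M := by linarith
                                          positivity
  have h1 := Qs_bd_aux (ε := ε) (δ := δ) (v := v) (L := M) (H := |ξ|) (by linarith) (by rw [hexp]; ring) rfl (σ := 1+ε) (ξ := ξ) (by linarith) (by linarith) le_rfl
  have h2 : 64*(1+14*M) ≤ B*(|ξ|/H) := by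
    have : 1 ≤ |ξ|/H := by rw [le_div_iff₀ hH0]; linarith
    rw [hB]; nlinarith
  have h3 : (64*(1+14*M))^2 ≤ (B*(|ξ|/H))^2 := pow_le_pow_left₀ (by linarith) h2 2
  rw [norm_Qs]
  have e : (1+ε-(1+ε))*v+δ^2*((1+ε-(1+ε))^2-ξ^2)/2 = -(δ^2*|ξ|^2/2) := by rw [sq_abs]; ring
  rw [e]
  have h4 : |ξ| ≤ ‖(((1+ε:ℝ):ℂ)+ξ*Complex.I)‖ := by
    refine le_trans (le_of_eq ?_) (Complex.abs_im_le_norm _); simp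
  rw [← mul_assoc]
  refine mul_le_mul_of_nonneg_right ?_ (Real.exp_pos _).le
  rw [div_le_iff₀ (by linarith)]
  calc _ ≤ 405/100*(64*(1+14*M))^2 := h1
    _ ≤ 405/100*(B*(|ξ|/H))^2 := by linarith
    _ = 405/100*B^2/H^2*|ξ| * |ξ| := by field_simp
    _ ≤ _ := mul_le_mul_of_nonneg_left h4 (by positivity)

lemma exp_small {x : ℝ} (hx : x ≤ 1/1000) : Real.exp x ≤ 101/100 := by
  have h1 : Real.exp x ≤ Real.exp (1/1000) := Real.exp_le_exp.mpr hx
  have h2 := Real.exp_bound_div_one_sub_of_interval (x := 1/1000) (by norm_num) (by norm_num)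
  norm_num at h2
  linarith [h1.trans h2]

set_option maxHeartbeats 1000000 in
lemma phit_shift {ε δ v L H B : ℝ} (hε : 0 < ε) (hε1 : ε ≤ 1/100) (hδ : 0 < δ) (hδ1 : δ ≤ 1/1000) (hv : 0 ≤ v)
    (hL : 20 ≤ L) (hH : H = (Real.exp L-7)/3) (hB : B = 64*(1+14*L)) (h9 : 9 ≤ δ*H) :
    |phit ε δ v| ≤ 4/3*B^2*L*Real.exp (-(v*((239/10000)*(3/4)/L))) + 1/50*B^2*Real.exp (-(δ^2*H^2/2)) := by
  set η := (239/10000)*(3/4)/L with hη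
  have hη0 : 0 < η := by rw [hη]; positivity
  have hη1 : η ≤ 1/1000 := by rw [hη, div_le_iff₀ (by linarith)]; linarith
  have hH0 : 9000 ≤ H := by nlinarith
  have hB0 : 0 < B := by rw [hB]; positivity
  have hpi := Real.pi_pos
  have hpi3 := Real.pi_gt_three
  have hpi4 := Real.pi_gt_d2
  obtain ⟨hitg, hval⟩ := phit_Qs hε hδ v
  set q : ℝ → ℂ := fun ξ => Qs ε δ v (((1+ε:ℝ):ℂ)+ξ*Complex.I) with hq
  set K := 405/100*B^2 with hK
  have hK0 : 0 < K := by rw [hK]; positivity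
  set E := Real.exp (-(δ^2*H^2/2)) with hE
  have hE0 : 0 < E := Real.exp_pos _
  -- tails
  have htail : ∀ g : ℝ → ℂ, (∀ x, H < x → ‖g x‖ ≤ K/H^2*(x*Real.exp (-(δ^2*x^2/2)))) → ‖∫ x in Set.Ioi H, g x‖ ≤ K/81*E := by
    intro g hg
    obtain ⟨t1, t2⟩ := gauss_tail (a := δ^2) (H := H) (by positivity) (by linarith)
    have h1 : ‖∫ x in Set.Ioi H, g x‖ ≤ ∫ x in Set.Ioi H, K/H^2*(x*Real.exp (-(δ^2*x^2/2))) :=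
      MeasureTheory.norm_integral_le_of_norm_le (t1.const_mul _) ((MeasureTheory.ae_restrict_iff' measurableSet_Ioi).mpr (Eventually.of_forall fun x hx => hg x hx))
    rw [MeasureTheory.integral_const_mul, t2] at h1
    refine h1.trans ?_
    have e1 : K/H^2*(E/δ^2) = K*E/(δ*H)^2 := by field_simp
    rw [← hE, e1]
    have h2 : 81 ≤ (δ*H)^2 := by nlinarith
    calc K*E/(δ*H)^2 ≤ K*E/81 := div_le_div_of_nonneg_left (by positivity) (by norm_num) h2
      _ = _ := by ring
  have ht1 : ‖∫ x in Set.Ioi H, q x‖ ≤ K/81*E := htail q (fun x hx => by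
    have h := Qs_tail_bd (ε := ε) (δ := δ) (v := v) hε hε1 hL hH (by linarith) hB (ξ := x) (by rw [abs_of_pos (by linarith)]; exact hx.le)
    rw [abs_of_pos (show 0 < x by linarith)] at h
    exact h)
  have ht2 : ‖∫ x in Set.Iic (-H), q x‖ ≤ K/81*E := by
    rw [← integral_comp_neg_Ioi]
    refine htail (fun x => q (-x)) (fun x hx => ?_)
    have h := Qs_tail_bd (ε := ε) (δ := δ) (v := v) hε hε1 hL hH (by linarith) hB (ξ := -x) (by rw [abs_neg, abs_of_pos (by linarith)]; exact hx.le)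
    rw [abs_neg, abs_of_pos (show 0 < x by linarith)] at h
    exact h
  -- rectangle
  have hrect := Complex.integral_boundary_rect_eq_zero_of_differentiableOn (Qs ε δ v) ⟨1-η, -H⟩ ⟨1+ε, H⟩ (by
    intro s hs
    have hs1 := hs.1
    have hs2 := hs.2
    rw [Set.mem_preimage, Set.uIcc_of_le (by simp only; linarith)] at hs1
    rw [Set.mem_preimage, Set.uIcc_of_le (by simp only; linarith)] at hs2
    simp only [Set.mem_Icc] at hs1 hs2
    have hd : DifferentiableAt ℂ Gf s := by
      refine Gf_diff hL ?_ ?_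
      · have : η ≤ (39/1000)/L := by rw [hη]; exact div_le_div_of_nonneg_right (by norm_num) (by linarith)
        linarith [hs1.1]
      · have : |s.im| ≤ H := abs_le.mpr hs2
        rw [hH] at this; linarith
    have hs0 : s ≠ 0 := by
      intro h; rw [h] at hs1; simp at hs1; linarith [hs1.1]
    unfold Qs
    refine DifferentiableAt.differentiableWithinAt ?_
    exact ((hd.pow 2).div differentiableAt_id hs0).mul (by fun_prop))
  simp only at hrect
  have hhor : ∀ y : ℝ, |y| = H → ‖∫ x in (1-η)..(1+ε), Qs ε δ v ((x:ℂ)+(y:ℂ)*Complex.I)‖ ≤ K/9000*(101/100)*E*(2/100) := by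
    intro y hy
    have h1 : ‖∫ x in (1-η)..(1+ε), Qs ε δ v ((x:ℂ)+(y:ℂ)*Complex.I)‖ ≤ K/9000*(101/100)*E*|(1+ε)-(1-η)| := by
      refine intervalIntegral.norm_integral_le_of_norm_le_const (fun x hx => ?_)
      rw [Set.uIoc_of_le (by linarith)] at hx
      obtain ⟨hx1, hx2⟩ := hx
      rw [norm_Qs]
      have a1 := Qs_bd_aux (ε := ε) (δ := δ) (v := v) hL hH hB (σ := x) (ξ := y) hx1.le (by linarith) hy.le
      have a2 : H ≤ ‖((x:ℂ)+y*Complex.I)‖ := by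
        rw [← hy]; refine le_trans (le_of_eq ?_) (Complex.abs_im_le_norm _); simp
      have a3 : ‖Gf ((x:ℂ)+y*Complex.I)‖^2/‖((x:ℂ)+y*Complex.I)‖ ≤ K/9000 := div_le_div₀ hK0.le a1 (by norm_num) (by linarith)
      have hy2 : y^2 = H^2 := by rw [← hy, sq_abs]
      have a4 : Real.exp ((x-(1+ε))*v+δ^2*((x-(1+ε))^2-y^2)/2) ≤ 101/100*E := by
        have e : (x-(1+ε))*v+δ^2*((x-(1+ε))^2-y^2)/2 = ((x-(1+ε))*v+δ^2*(x-(1+ε))^2/2) + (-(δ^2*H^2/2)) := by rw [hy2]; ring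
        rw [e, Real.exp_add]
        refine mul_le_mul_of_nonneg_right (exp_small ?_) hE0.le
        have b1 : (x-(1+ε))*v ≤ 0 := mul_nonpos_of_nonpos_of_nonneg (by linarith) hv
        have b2 : (x-(1+ε))^2 ≤ 1 := by rw [sq_le_one_iff_abs_le_one, abs_le]; constructor <;> linarith
        have b3 : δ^2 ≤ 1/1000 := by nlinarith
        have b5 := mul_le_mul b3 b2 (sq_nonneg _) (by norm_num)
        linarith
      calc _ ≤ K/9000*(101/100*E) := mul_le_mul a3 a4 (Real.exp_pos _).le (by positivity)
        _ = _ := by ring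
    refine h1.trans (mul_le_mul_of_nonneg_left ?_ (by positivity))
    rw [abs_of_pos (by linarith)]; linarith
  have hb := hhor (-H) (by rw [abs_neg, abs_of_pos (by linarith)])
  have htp := hhor H (abs_of_pos (by linarith))
  have hleft : ‖∫ y in (-H)..H, Qs ε δ v (((1-η:ℝ):ℂ)+(y:ℂ)*Complex.I)‖ ≤ K*(101/100)*(1001/1000)*1.001*Real.exp (-(v*η))*(2*L) := by
    have hii : IntervalIntegrable (fun x : ℝ => (√(1+x^2))⁻¹) MeasureTheory.volume (-H) H := by
      refine ContinuousOn.intervalIntegrable (Continuous.continuousOn ?_)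
      refine Continuous.inv₀ (by fun_prop) (fun x => ?_)
      have : (0:ℝ) < 1+x^2 := by positivity
      exact (Real.sqrt_pos.mpr this).ne'
    have h1 : ‖∫ y in (-H)..H, Qs ε δ v (((1-η:ℝ):ℂ)+(y:ℂ)*Complex.I)‖ ≤ ∫ y in (-H)..H, K*(101/100)*(1001/1000)*1.001*Real.exp (-(v*η))*(√(1+y^2))⁻¹ := by
      refine intervalIntegral.norm_integral_le_of_norm_le (by linarith) (Eventually.of_forall fun y hy => ?_) (hii.const_mul _)
      rw [norm_Qs]
      have a1 := Qs_bd_aux (ε := ε) (δ := δ) (v := v) hL hH hB (σ := 1-η) (ξ := y) le_rfl (by linarith) (abs_le.mpr ⟨hy.1.le, hy.2⟩)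
      have hsq : 0 < √(1+y^2) := Real.sqrt_pos.mpr (by positivity)
      have a2 : 999/1000*√(1+y^2) ≤ ‖((((1-η:ℝ):ℂ))+y*Complex.I)‖ := by
        rw [Complex.norm_add_mul_I]
        refine Real.le_sqrt_of_sq_le ?_
        rw [mul_pow, Real.sq_sqrt (by positivity)]
        have c1 : (999/1000:ℝ)^2 ≤ (1-η)^2 := pow_le_pow_left₀ (by norm_num) (by linarith) 2
        have c2 := sq_nonneg y
        norm_num at c1 ⊢
        linarith
      have a3 : ‖Gf (((1-η:ℝ):ℂ)+y*Complex.I)‖^2/‖(((1-η:ℝ):ℂ)+y*Complex.I)‖ ≤ K/(999/1000*√(1+y^2)) := div_le_div₀ hK0.le a1 (by positivity) a2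
      have a4 : Real.exp (((1-η)-(1+ε))*v+δ^2*(((1-η)-(1+ε))^2-y^2)/2) ≤ 101/100*Real.exp (-(v*η)) := by
        have e : ((1-η)-(1+ε))*v+δ^2*(((1-η)-(1+ε))^2-y^2)/2 = (-(ε*v)+δ^2*((η+ε)^2-y^2)/2) + (-(v*η)) := by ring
        rw [e, Real.exp_add]
        refine mul_le_mul_of_nonneg_right (exp_small ?_) (Real.exp_pos _).le
        have b1 : 0 ≤ ε*v := by positivity
        have b2 : (η+ε)^2 ≤ 1 := by rw [sq_le_one_iff_abs_le_one, abs_le]; constructor <;> linarith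
        have b3 : δ^2 ≤ 1/1000 := by nlinarith
        have b4 := mul_nonneg (sq_nonneg δ) (sq_nonneg y)
        have b5 := mul_le_mul b3 b2 (sq_nonneg _) (by norm_num)
        have b6 : δ^2*((η+ε)^2-y^2)/2 = δ^2*(η+ε)^2/2-δ^2*y^2/2 := by ring
        rw [b6]
        linarith
      refine (mul_le_mul a3 a4 (Real.exp_pos _).le (by positivity)).trans ?_
      have e : K/(999/1000*√(1+y^2))*(101/100*Real.exp (-(v*η))) = (1000/999)*(K*(101/100)*Real.exp (-(v*η))*(√(1+y^2))⁻¹) := by field_simp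
      have e2 : K*(101/100)*(1001/1000)*1.001*Real.exp (-(v*η))*(√(1+y^2))⁻¹ = (1001/1000*1.001)*(K*(101/100)*Real.exp (-(v*η))*(√(1+y^2))⁻¹) := by ring
      rw [e, e2]
      refine mul_le_mul_of_nonneg_right (by norm_num) (by positivity)
    rw [intervalIntegral.integral_const_mul] at h1
    refine h1.trans (mul_le_mul_of_nonneg_left ?_ (by positivity))
    refine (arsinh_int (by linarith)).trans ?_
    have : Real.log (2*H+1) ≤ L := by
      rw [Real.log_le_iff_le_exp (by linarith)]
      have : Real.exp L = 3*H+7 := by rw [hH]; ring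
      linarith
    linarith
  -- combine
  have hR : ‖∫ y in (-H)..H, q y‖ ≤ K*(101/100)*(1001/1000)*1.001*Real.exp (-(v*η))*(2*L) + 2*(K/9000*(101/100)*E*(2/100)) := by
    have e : ‖∫ y in (-H)..H, q y‖ = ‖Complex.I • ∫ y in (-H)..H, q y‖ := by rw [norm_smul, Complex.norm_I, one_mul]
    have e2 : Complex.I • (∫ y in (-H)..H, q y) = Complex.I • (∫ y in (-H)..H, Qs ε δ v (((1-η:ℝ):ℂ)+(y:ℂ)*Complex.I)) - (∫ x in (1-η)..(1+ε), Qs ε δ v ((x:ℂ)+((-H:ℝ):ℂ)*Complex.I)) + (∫ x in (1-η)..(1+ε), Qs ε δ v ((x:ℂ)+((H:ℝ):ℂ)*Complex.I)) := by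
      linear_combination hrect
    rw [e, e2]
    refine (norm_add_le _ _).trans ?_
    refine (add_le_add_left (norm_sub_le _ _) _).trans ?_
    rw [norm_smul, Complex.norm_I, one_mul]
    linarith
  have hsplit : ∫ ξ, q ξ = (∫ x in Set.Iic (-H), q x) + (∫ y in (-H)..H, q y) + ∫ x in Set.Ioi H, q x := by
    rw [← intervalIntegral.integral_Iic_sub_Iic hitg.integrableOn hitg.integrableOn, add_sub_cancel, intervalIntegral.integral_Iic_add_Ioi hitg.integrableOn hitg.integrableOn]
  have hfin : ‖∫ ξ, q ξ‖ ≤ K*(101/100)*(1001/1000)*1.001*Real.exp (-(v*η))*(2*L) + 2*(K/9000*(101/100)*E*(2/100)) + 2*(K/81*E) := by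
    rw [hsplit]
    have := norm_add_le ((∫ x in Set.Iic (-H), q x) + (∫ y in (-H)..H, q y)) (∫ x in Set.Ioi H, q x)
    have := norm_add_le (∫ x in Set.Iic (-H), q x) (∫ y in (-H)..H, q y)
    linarith
  rw [hval]
  have hA : 0 ≤ B^2*L*Real.exp (-(v*η)) := by positivity
  have hA2 : 0 ≤ B^2*E := by positivity
  have h2pi : 1/(2*Real.pi) ≤ 1/6.28 := one_div_le_one_div_of_le (by norm_num) (by linarith)
  refine (mul_le_mul h2pi hfin (norm_nonneg _) (by norm_num)).trans ?_
  have e : (1/6.28:ℝ)*(K*(101/100)*(1001/1000)*1.001*Real.exp (-(v*η))*(2*L) + 2*(K/9000*(101/100)*E*(2/100)) + 2*(K/81*E)) = ((1/6.28)*(405/100*(101/100)*(1001/1000)*1.001*2))*(B^2*L*Real.exp (-(v*η))) + ((1/6.28)*(405/100*(2/9000*(101/100)*(2/100)+2/81)))*(B^2*E) := by rw [hK]; ring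
  rw [e]
  norm_num
  linarith

-- Part P4c
lemma exp32 : Real.exp (-(3199/100)) ≤ 1/72000000000000 := by
  have h1 := exp20_lo
  have h2 : Real.exp (801/100) ≤ 3100 := by
    have e : Real.exp (801/100) = Real.exp 1^8*Real.exp (1/100) := by
      rw [← Real.exp_nat_mul, ← Real.exp_add]; norm_num
    have h3 := Real.exp_one_lt_d9
    have h4 : Real.exp 1^8 ≤ (2.7182818286:ℝ)^8 := pow_le_pow_left₀ (Real.exp_pos _).le h3.le 8
    have h5 := Real.exp_bound_div_one_sub_of_interval (x := 1/100) (by norm_num) (by norm_num)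
    rw [e]
    calc _ ≤ (2.7182818286:ℝ)^8*(1/(1-1/100)) := mul_le_mul h4 h5 (Real.exp_pos _).le (by norm_num)
      _ ≤ 3100 := by norm_num
  have e : Real.exp (-(3199/100)) = Real.exp (801/100)/(Real.exp 20*Real.exp 20) := by
    rw [← Real.exp_add, ← Real.exp_sub]; norm_num
  rw [e]
  have h6 : (485000000:ℝ)*485000000 ≤ Real.exp 20*Real.exp 20 := mul_le_mul h1 h1 (by norm_num) (Real.exp_pos _).le
  calc _ ≤ (3100:ℝ)/(485000000*485000000) := div_le_div₀ (by norm_num) h2 (by norm_num) h6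
    _ ≤ _ := by norm_num

lemma phit_far {ε δ v : ℝ} (hε : 0 < ε) (hε1 : ε ≤ 1/100) (hδ : 0 < δ) (hδ1 : δ ≤ 1/1000) (hv : 35700 ≤ v)
    (h9 : 9*√(v/35700) ≤ δ*((Real.exp (20*√(v/35700))-7)/3)) :
    |phit ε δ v| ≤ 12/100000*(35700/v)^8 := by
  set r := √(v/35700) with hr
  have hv0 : 0 < v := by linarith
  have hr2 : r^2 = v/35700 := Real.sq_sqrt (by positivity)
  have hr1 : 1 ≤ r := by
    rw [hr]; refine Real.le_sqrt_of_sq_le ?_; rw [le_div_iff₀ (by norm_num)]; linarith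
  have hve : v = 35700*r^2 := by rw [hr2]; field_simp
  have hr0 : 0 < r := by linarith
  set H := (Real.exp (20*r)-7)/3 with hH
  have h := phit_shift hε hε1 hδ hδ1 hv0.le (L := 20*r) (by linarith) hH (B := 64*(1+14*(20*r))) rfl (by linarith)
  refine h.trans ?_
  have hB : (64*(1+14*(20*r)))^2 ≤ 323424256*r^2 := by
    have : (64*(1+14*(20*r)))^2 ≤ (17984*r)^2 := pow_le_pow_left₀ (by positivity) (by linarith) 2
    linarith
  set B := 64*(1+14*(20*r)) with hBd
  set X := Real.exp (-(3199/100*r)) with hX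
  have hX0 : 0 < X := Real.exp_pos _
  have e1 : Real.exp (-(v*((239/10000)*(3/4)/(20*r)))) ≤ X := by
    refine Real.exp_le_exp.mpr (neg_le_neg ?_)
    have : v*((239/10000)*(3/4)/(20*r)) = 35700*(239/10000)*(3/4)/20*r := by rw [hve]; field_simp
    rw [this]
    refine mul_le_mul_of_nonneg_right (by norm_num) hr0.le
  have e2 : Real.exp (-(δ^2*H^2/2)) ≤ X := by
    refine Real.exp_le_exp.mpr (neg_le_neg ?_)
    have h1 : (9*r)^2 ≤ (δ*H)^2 := pow_le_pow_left₀ (by positivity) h9 2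
    have h2 : δ^2*H^2 = (δ*H)^2 := by ring
    rw [h2]; nlinarith
  have t1 : 4/3*B^2*(20*r)*Real.exp (-(v*((239/10000)*(3/4)/(20*r)))) ≤ 4/3*(323424256*r^2)*(20*r)*X := by
    refine mul_le_mul (mul_le_mul_of_nonneg_right ?_ (by positivity)) e1 (Real.exp_pos _).le (by positivity)
    linarith
  have t2 : 1/50*B^2*Real.exp (-(δ^2*H^2/2)) ≤ 1/50*(323424256*r^2)*X := by
    refine mul_le_mul ?_ e2 (Real.exp_pos _).le (by positivity)
    linarith
  have t3 : r^2*X ≤ r^3*X := mul_le_mul_of_nonneg_right (pow_le_pow_right₀ hr1 (by norm_num)) hX0.le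
  have t4 : r^19*X ≤ 1/72000000000000 := by
    refine le_trans ?_ exp32
    have h1 : r^19 ≤ Real.exp (19*(r-1)) := by
      have : r ≤ Real.exp (r-1) := by have := Real.add_one_le_exp (r-1); linarith
      calc r^19 ≤ (Real.exp (r-1))^19 := pow_le_pow_left₀ hr0.le this 19
        _ = _ := by rw [← Real.exp_nat_mul]; norm_num
    calc r^19*X ≤ Real.exp (19*(r-1))*X := mul_le_mul_of_nonneg_right h1 hX0.le
      _ = Real.exp (19*(r-1)+-(3199/100*r)) := by rw [hX, ← Real.exp_add]
      _ ≤ _ := Real.exp_le_exp.mpr (by linarith)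
  have t5 : (35700/v)^8 = 1/r^16 := by
    rw [hve]
    have : (35700/(35700*r^2)) = 1/r^2 := by field_simp
    rw [this, div_pow, ← pow_mul]; norm_num
  have t6 : r^3*X ≤ 1/72000000000000*(1/r^16) := by
    rw [mul_one_div, le_div_iff₀ (by positivity)]
    calc r^3*X*r^16 = r^19*X := by ring
      _ ≤ _ := t4
  rw [t5]
  have : 0 < 1/r^16 := by positivity
  calc _ ≤ 4/3*(323424256*r^2)*(20*r)*X + 1/50*(323424256*r^2)*X := add_le_add t1 t2
    _ = (4/3*323424256*20)*(r^3*X) + (1/50*323424256)*(r^2*X) := by ring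
    _ ≤ (4/3*323424256*20+1/50*323424256)*(1/72000000000000*(1/r^16)) := by linarith
    _ ≤ _ := by rw [← mul_assoc]; exact mul_le_mul_of_nonneg_right (by norm_num) this.le

lemma exp20r {r : ℝ} (hr : 1 ≤ r) : r^20*(Real.exp 20-7) ≤ Real.exp (20*r)-7 := by
  have h : r^20*Real.exp 20 ≤ Real.exp (20*r) := by
    have : r ≤ Real.exp (r-1) := by have := Real.add_one_le_exp (r-1); linarith
    have h1 : r^20 ≤ Real.exp (20*(r-1)) := by
      calc r^20 ≤ (Real.exp (r-1))^20 := pow_le_pow_left₀ (by linarith) this 20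
        _ = _ := by rw [← Real.exp_nat_mul]; norm_num
    calc _ ≤ Real.exp (20*(r-1))*Real.exp 20 := mul_le_mul_of_nonneg_right h1 (Real.exp_pos _).le
      _ = _ := by rw [← Real.exp_add]; ring_nf
  have : 1 ≤ r^20 := one_le_pow₀ hr
  linarith

/-- contributions of far points -/
lemma far_dl0 {ε v : ℝ} (hε : 0 < ε) (hε1 : ε ≤ 1/100) (hv : 35700 ≤ v) : |phit ε dl0 v| ≤ 12/100000*(35700/v)^8 := by
  have h1 := dl0_lo
  have h2 := dl0_hi
  have h3 := exp20_lo
  refine phit_far hε hε1 (by linarith) (by linarith) hv ?_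
  set r := √(v/35700) with hr
  have hr1 : 1 ≤ r := by
    rw [hr]; refine Real.le_sqrt_of_sq_le ?_; rw [le_div_iff₀ (by norm_num)]; linarith
  have h4 := exp20r hr1
  have h5 : r ≤ r^20 := le_self_pow₀ hr1 (by norm_num)
  have h6 : r*(Real.exp 20-7) ≤ Real.exp (20*r)-7 := (mul_le_mul_of_nonneg_right h5 (by linarith)).trans h4
  have e : 9*r = dl0*(r*(Real.exp 20-7)/3) := by
    unfold dl0
    have : Real.exp 20 - 7 ≠ 0 := by linarith
    field_simp; norm_num
  rw [e]
  exact mul_le_mul_of_nonneg_left (by linarith) (by linarith)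

lemma far_phie {ε v : ℝ} (hε : 0 < ε) (hε1 : ε ≤ 1/100) (hv : 35700 ≤ v) : |phie ε v| ≤ 22/10000*(35700/v)^8 := by
  have h1 := dl0_lo
  have h2 := dl0_hi
  have h3 := exp20_lo
  have hv0 : 0 < v := by linarith
  set r := √(v/35700) with hr
  have hr1 : 1 ≤ r := by
    rw [hr]; refine Real.le_sqrt_of_sq_le ?_; rw [le_div_iff₀ (by norm_num)]; linarith
  have hr2 : r^2 = v/35700 := Real.sq_sqrt (by positivity)
  have hve : v = 35700*r^2 := by rw [hr2]; field_simp
  have hr0 : 0 < r := by linarith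
  have h4 := exp20r hr1
  have hr20 : 0 < r^20 := by positivity
  have hY : 0 < Real.exp (20*r)-7 := lt_of_lt_of_le (mul_pos hr20 (by linarith)) h4
  set δ := 27*r/(Real.exp (20*r)-7) with hδ
  have hδ0 : 0 < δ := by rw [hδ]; positivity
  have hδ2 : δ ≤ dl0*(1/r^19) := by
    have : 27*r/(Real.exp (20*r)-7) ≤ 27*r/(r^20*(Real.exp 20-7)) := div_le_div_of_nonneg_left (by positivity) (mul_pos hr20 (by linarith)) h4
    refine this.trans (le_of_eq ?_)
    unfold dl0
    have : Real.exp 20 - 7 ≠ 0 := by linarith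
    field_simp
  have h19 : 1/r^19 ≤ 1 := by rw [div_le_one (by positivity)]; exact one_le_pow₀ hr1
  have hδ3 : δ ≤ dl0 := hδ2.trans (by nlinarith)
  have hf := phit_far hε hε1 hδ0 (by linarith) hv (by
    rw [← hr, hδ]; refine le_of_eq ?_; generalize Real.exp (20*r)-7 = Y at hY ⊢; field_simp; norm_num)
  have hc := phit_close hε.le hε1 hδ0 hv0.le
  have t5 : (35700/v)^8 = 1/r^16 := by
    rw [hve]
    have : (35700/(35700*r^2)) = 1/r^2 := by field_simp
    rw [this, div_pow, ← pow_mul]; norm_num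
  rw [t5] at hf ⊢
  have hP : 0 < 1/r^16 := by positivity
  have hPle : 1/r^19 * r^2 ≤ 1/r^16 := by
    rw [div_mul_eq_mul_div, one_mul, div_le_div_iff₀ (by positivity) (by positivity)]
    calc r^2*r^16 = r^18 := by ring
      _ ≤ r^19 := pow_le_pow_right₀ hr1 (by norm_num)
      _ = _ := by ring
  have hP2 : 1/r^19 ≤ 1/r^16 := one_div_le_one_div_of_le (by positivity) (pow_le_pow_right₀ hr1 (by norm_num))
  have a1 : δ*(6+101/100*v) ≤ dl0*36064*(1/r^16) := by
    have b1 : 6+101/100*v ≤ 36064*r^2 := by rw [hve]; nlinarith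
    calc δ*(6+101/100*v) ≤ (dl0*(1/r^19))*(36064*r^2) := mul_le_mul hδ2 b1 (by positivity) (by positivity)
      _ = dl0*36064*(1/r^19*r^2) := by ring
      _ ≤ _ := mul_le_mul_of_nonneg_left hPle (by linarith)
  have a2 : 101/100*δ^2 ≤ 1/100000*(1/r^16) := by
    have : δ^2 ≤ 1/1000000*(1/r^16) := by
      rw [sq]
      exact mul_le_mul (by linarith) ((hδ2.trans (by nlinarith : dl0*(1/r^19) ≤ 1/r^19)).trans hP2) hδ0.le (by norm_num)
    linarith
  have a3 : 3*Real.exp (-(v/2)) ≤ 1/100000*(1/r^16) := by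
    have b1 : r^16 ≤ Real.exp (v/4) := by
      have : r ≤ Real.exp (r-1) := by have := Real.add_one_le_exp (r-1); linarith
      calc r^16 ≤ (Real.exp (r-1))^16 := pow_le_pow_left₀ hr0.le this 16
        _ = Real.exp (16*(r-1)) := by rw [← Real.exp_nat_mul]; norm_num
        _ ≤ _ := Real.exp_le_exp.mpr (by rw [hve]; nlinarith)
    have b2 : (485000000:ℝ) ≤ Real.exp (v/4) := h3.trans (Real.exp_le_exp.mpr (by linarith))
    have e : Real.exp (-(v/2)) = 1/Real.exp (v/4)*(1/Real.exp (v/4)) := by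
      rw [one_div, ← Real.exp_neg, ← Real.exp_add]; ring_nf
    rw [e]
    have b3 : 1/Real.exp (v/4) ≤ 1/r^16 := one_div_le_one_div_of_le (by positivity) b1
    have b4 : 1/Real.exp (v/4) ≤ 1/485000000 := one_div_le_one_div_of_le (by norm_num) b2
    have := mul_le_mul b4 b3 (by positivity) (by norm_num)
    linarith
  have a4 : dl0*36064*(1/r^16) ≤ 2009/1000000*(1/r^16) := mul_le_mul_of_nonneg_right (by linarith) hP.le
  have := abs_sub_abs_le_abs_sub (phie ε v) (phit ε δ v)
  linarith

-- Part P5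
lemma tele_sum {p u M m : ℝ} {Γ : ℝ → ℝ} {β : ℤ → ℝ} (h0 : ∀ n, 0 ≤ β n)
    (h1 : ∀ n : ℤ, β n ≤ Γ (u-n*p+p) - Γ (u-n*p)) (hM : ∀ v, Γ v ≤ M) (hm : ∀ v, m ≤ Γ v) (J : Finset ℤ) :
    ∑ n ∈ J, β n ≤ M - m := by
  set K : ℕ := ∑ j ∈ J, j.natAbs with hK
  have hsub : J ⊆ (range (2*K+1)).image (fun j : ℕ => (j:ℤ)-K) := by
    intro n hn
    have : n.natAbs ≤ K := by
      rw [hK]; exact Finset.single_le_sum (f := fun j : ℤ => j.natAbs) (fun _ _ => Nat.zero_le _) hn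
    rw [Finset.mem_image]
    refine ⟨(n+K).toNat, ?_, ?_⟩
    · rw [Finset.mem_range]; omega
    · omega
  refine (Finset.sum_le_sum_of_subset_of_nonneg hsub (fun n _ _ => h0 n)).trans ?_
  rw [Finset.sum_image (fun a _ b _ h => by simpa using h)]
  have h2 : ∑ j ∈ range (2*K+1), β ((j:ℤ)-K) ≤ ∑ j ∈ range (2*K+1), ((fun i : ℕ => Γ (u+K*p+p-i*p)) j - (fun i : ℕ => Γ (u+K*p+p-i*p)) (j+1)) := by
    refine Finset.sum_le_sum fun j _ => ?_
    refine (h1 _).trans (le_of_eq ?_)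
    push_cast
    congr 2 <;> ring
  refine h2.trans ?_
  rw [Finset.sum_range_sub']
  linarith [hM (u+K*p+p-((0:ℕ):ℝ)*p), hm (u+K*p+p-((2*K+1:ℕ):ℝ)*p)]

noncomputable def Ga1 (v : ℝ) : ℝ := 402/100*Real.exp (10*min (v-Real.log 2) 0)
noncomputable def Ga2 (v : ℝ) : ℝ := dl0*(601/100*(max 0 (min v (35700+Real.log 2)))+101/200*(max 0 (min v (35700+Real.log 2)))^2)/Real.log 2
noncomputable def Ga3 (v : ℝ) : ℝ := -(1025/100*Real.exp (-(max v 0/2)))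
noncomputable def Ga4 (v : ℝ) : ℝ := -(171/10*(35700/max (v-Real.log 2) (35700-Real.log 2))^7)

lemma l2lo : (6931/10000:ℝ) ≤ Real.log 2 := by have := Real.log_two_gt_d9; linarith
lemma l2hi : Real.log 2 ≤ 6932/10000 := by have := Real.log_two_lt_d9; linarith

lemma Ga1_mono {v w : ℝ} (h : v ≤ w) : Ga1 v ≤ Ga1 w := by
  unfold Ga1
  have : min (v-Real.log 2) 0 ≤ min (w-Real.log 2) 0 := min_le_min (by linarith) le_rfl
  have := Real.exp_le_exp.mpr (show 10*min (v-Real.log 2) 0 ≤ 10*min (w-Real.log 2) 0 by linarith)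
  linarith

lemma Ga2_mono {v w : ℝ} (h : v ≤ w) : Ga2 v ≤ Ga2 w := by
  unfold Ga2
  have h1 : max 0 (min v (35700+Real.log 2)) ≤ max 0 (min w (35700+Real.log 2)) := max_le_max le_rfl (min_le_min h le_rfl)
  have h2 : 0 ≤ max 0 (min v (35700+Real.log 2)) := le_max_left _ _
  have h3 := pow_le_pow_left₀ h2 h1 2
  have := dl0_lo
  exact div_le_div_of_nonneg_right (mul_le_mul_of_nonneg_left (by linarith) (by linarith)) l2pos.le

lemma Ga3_mono {v w : ℝ} (h : v ≤ w) : Ga3 v ≤ Ga3 w := by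
  unfold Ga3
  have h1 : max v 0 ≤ max w 0 := max_le_max h le_rfl
  have := Real.exp_le_exp.mpr (show -(max w 0/2) ≤ -(max v 0/2) by linarith)
  linarith

lemma Ga4_mono {v w : ℝ} (h : v ≤ w) : Ga4 v ≤ Ga4 w := by
  unfold Ga4
  have hp := l2hi
  have h1 : max (v-Real.log 2) (35700-Real.log 2) ≤ max (w-Real.log 2) (35700-Real.log 2) := max_le_max (by linarith) le_rfl
  have h2 : 0 < max (v-Real.log 2) (35700-Real.log 2) := lt_of_lt_of_le (by linarith) (le_max_right _ _)
  have h3 := pow_le_pow_left₀ (div_nonneg (by norm_num) (h2.le.trans h1)) (div_le_div_of_nonneg_left (by norm_num : (0:ℝ) ≤ 35700) h2 h1) 7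
  linarith

lemma Ga_up (v : ℝ) : Ga1 v + Ga2 v + Ga3 v + Ga4 v ≤ 402/100 + 52 := by
  have hp := l2hi
  have hp2 := l2lo
  have h1 : Ga1 v ≤ 402/100 := by
    unfold Ga1
    have : Real.exp (10*min (v-Real.log 2) 0) ≤ 1 := Real.exp_le_one_iff.mpr (by linarith [min_le_right (v-Real.log 2) 0])
    linarith
  have h3 : Ga3 v ≤ 0 := by unfold Ga3; have := Real.exp_pos (-(max v 0/2)); linarith
  have h4 : Ga4 v ≤ 0 := by
    unfold Ga4
    have h2 : 0 < max (v-Real.log 2) (35700-Real.log 2) := lt_of_lt_of_le (by linarith) (le_max_right _ _)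
    have : 0 ≤ (35700/max (v-Real.log 2) (35700-Real.log 2))^7 := by positivity
    linarith
  have h2 : Ga2 v ≤ 52 := by
    unfold Ga2
    set x := max 0 (min v (35700+Real.log 2)) with hx
    have hx0 : 0 ≤ x := le_max_left _ _
    have hx1 : x ≤ 35701 := max_le (by norm_num) ((min_le_right _ _).trans (by linarith))
    have hx2 := pow_le_pow_left₀ hx0 hx1 2
    have := dl0_lo
    have := dl0_hi
    rw [div_le_iff₀ l2pos]
    have : dl0*(601/100*x+101/200*x^2) ≤ 557/10000000000*(601/100*35701+101/200*35701^2) := mul_le_mul (by linarith) (by linarith) (by positivity) (by norm_num)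
    norm_num at this
    linarith
  linarith

lemma Ga_lo (v : ℝ) : -(1025/100) - 1715/100 ≤ Ga1 v + Ga2 v + Ga3 v + Ga4 v := by
  have hp := l2hi
  have hp2 := l2lo
  have := dl0_lo
  have h1 : 0 ≤ Ga1 v := by unfold Ga1; positivity
  have h2 : 0 ≤ Ga2 v := by
    unfold Ga2
    have hx0 : 0 ≤ max 0 (min v (35700+Real.log 2)) := le_max_left _ _
    have := l2pos
    have : 0 < dl0 := by linarith
    positivity
  have h3 : -(1025/100) ≤ Ga3 v := by
    unfold Ga3
    have : Real.exp (-(max v 0/2)) ≤ 1 := Real.exp_le_one_iff.mpr (by linarith [le_max_right v 0])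
    linarith
  have h4 : -(1715/100) ≤ Ga4 v := by
    unfold Ga4
    have h2 : 35699 ≤ max (v-Real.log 2) (35700-Real.log 2) := le_trans (by linarith) (le_max_right _ _)
    have h3 : (35700/max (v-Real.log 2) (35700-Real.log 2))^7 ≤ (35700/35699)^7 :=
      pow_le_pow_left₀ (by positivity) (div_le_div_of_nonneg_left (by norm_num) (by norm_num) h2) 7
    norm_num at h3 ⊢
    linarith
  linarith

lemma inc1 {v : ℝ} (hv : v < 0) : 401/100*Real.exp (10*v) ≤ Ga1 (v+Real.log 2) - Ga1 v := by
  unfold Ga1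
  have hp := l2pos
  rw [add_sub_cancel_right, min_eq_left hv.le, min_eq_left (by linarith)]
  have e : Real.exp (10*(v-Real.log 2)) = Real.exp (10*v)*(1/1024) := by
    rw [mul_sub, Real.exp_sub, show (10:ℝ)*Real.log 2 = ((10:ℕ):ℝ)*Real.log 2 by norm_num, Real.exp_nat_mul, Real.exp_log (by norm_num)]
    norm_num; ring
  rw [e]
  have := Real.exp_pos (10*v)
  linarith

lemma inc2 {v : ℝ} (hv : 0 ≤ v) (hv2 : v ≤ 35700) : dl0*(601/100+101/100*v) ≤ Ga2 (v+Real.log 2) - Ga2 v := by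
  unfold Ga2
  have hp := l2pos
  have := dl0_lo
  rw [min_eq_left (by linarith), min_eq_left (by linarith), max_eq_right (by linarith), max_eq_right hv, ← sub_div, le_div_iff₀ hp]
  have h2 : 0 ≤ dl0*(101/200*Real.log 2^2) := by
    have : 0 < dl0 := by linarith
    positivity
  nlinarith

lemma inc3 {v : ℝ} (hv : 0 ≤ v) : 3*Real.exp (-(v/2)) ≤ Ga3 (v+Real.log 2) - Ga3 v := by
  unfold Ga3
  have hp := l2pos
  rw [max_eq_left (by linarith), max_eq_left hv]
  have e : Real.exp (-((v+Real.log 2)/2)) = Real.exp (-(v/2))*Real.exp (-(Real.log 2/2)) := by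
    rw [← Real.exp_add]; ring_nf
  have h : Real.exp (-(Real.log 2/2)) ≤ 7072/10000 := by
    have e2 : Real.exp (-(Real.log 2/2))^2 = 1/2 := by
      rw [← Real.exp_nat_mul, show ((2:ℕ):ℝ)*(-(Real.log 2/2)) = -Real.log 2 by push_cast; ring, Real.exp_neg, Real.exp_log (by norm_num)]; norm_num
    have := Real.exp_pos (-(Real.log 2/2))
    nlinarith
  rw [e]
  have := Real.exp_pos (-(v/2))
  nlinarith

lemma inc4 {v : ℝ} (hv : 35700 ≤ v) : 232/100000*(35700/v)^8 ≤ Ga4 (v+Real.log 2) - Ga4 v := by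
  unfold Ga4
  have hp := l2lo
  have hp2 := l2hi
  rw [add_sub_cancel_right, max_eq_left (by linarith), max_eq_left (by linarith)]
  set p := Real.log 2
  have hvp : 0 < v-p := by linarith
  have hv0 : 0 < v := by linarith
  have h1 : (35700/v)^7*(1+7*(p/v)) ≤ (35700/(v-p))^7 := by
    have e : 35700/(v-p) = 35700/v*(v/(v-p)) := by field_simp
    rw [e, mul_pow]
    refine mul_le_mul_of_nonneg_left ?_ (by positivity)
    have h2 : 1+p/v ≤ v/(v-p) := by
      rw [le_div_iff₀ hvp]
      have : (1+p/v)*(v-p) = v-p^2/v := by field_simp; ring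
      rw [this]
      have : 0 ≤ p^2/v := by positivity
      linarith
    have h3 := one_add_mul_le_pow (a := p/v) (by have : 0 < p/v := by positivity
                                                 linarith) 7
    push_cast at h3
    exact h3.trans (pow_le_pow_left₀ (by positivity) h2 7)
  have e2 : (35700/v)^7*(7*(p/v)) = 7*p/35700*(35700/v)^8 := by field_simp
  have h8 : 0 ≤ (35700/v)^8 := by positivity
  have h9 : 232/100000*(35700/v)^8 ≤ 171/10*(7*p/35700*(35700/v)^8) := by
    rw [← mul_assoc]; exact mul_le_mul_of_nonneg_right (by linarith) h8
  have e3 : (35700/v)^7*(1+7*(p/v)) = (35700/v)^7 + (35700/v)^7*(7*(p/v)) := by ring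
  rw [e3, e2] at h1
  linarith

-- Part P5b
noncomputable def Gat (v : ℝ) : ℝ := Ga1 v + Ga2 v + Ga3 v + Ga4 v

noncomputable def Dn (ε u : ℝ) (n : ℤ) : ℝ := if 0 ≤ n then (-1:ℝ)^n*phie ε (u-n*Real.log 2) else 0

lemma abs_neg_one_zpow_mul (n : ℤ) (x : ℝ) : |(-1:ℝ)^n*x| = |x| := by
  rw [abs_mul, abs_zpow, abs_neg, abs_one, one_zpow, one_mul]

lemma DT_bd {ε u : ℝ} (hε : 0 < ε) (hε1 : ε ≤ 1/100) (hu : 35700 ≤ u) (n : ℤ) :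
    |Dn ε u n - (-1:ℝ)^n*phit ε dl0 (u-n*Real.log 2)| ≤ Gat (u-n*Real.log 2+Real.log 2) - Gat (u-n*Real.log 2) := by
  set v := u-n*Real.log 2 with hv
  have hp := l2pos
  have hd1 := dl0_lo
  have hd2 := dl0_hi
  have m1 := Ga1_mono (show v ≤ v+Real.log 2 by linarith)
  have m2 := Ga2_mono (show v ≤ v+Real.log 2 by linarith)
  have m3 := Ga3_mono (show v ≤ v+Real.log 2 by linarith)
  have m4 := Ga4_mono (show v ≤ v+Real.log 2 by linarith)
  unfold Gat
  rcases lt_or_ge v 0 with h | h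
  · have hD : Dn ε u n = 0 := by
      unfold Dn; rw [← hv, phie_neg h, mul_zero, ite_self]
    rw [hD, zero_sub, abs_neg, abs_neg_one_zpow_mul]
    have h1 := phit_exp (phie_exp10 hε.le) dl0 v
    have h2 : Real.exp (10^2*dl0^2/2) ≤ 401/400 := by
      have : 10^2*dl0^2/2 ≤ 1/1000 := by nlinarith
      have h3 := Real.exp_bound_div_one_sub_of_interval (x := 1/1000) (by norm_num) (by norm_num)
      have h4 := Real.exp_le_exp.mpr this
      norm_num at h3
      linarith
    have h3 := inc1 h
    have h4 := Real.exp_pos (10*v)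
    have h5 : 4*Real.exp (10*v)*Real.exp (10^2*dl0^2/2) ≤ 4*Real.exp (10*v)*(401/400) := mul_le_mul_of_nonneg_left h2 (by positivity)
    linarith
  rcases le_or_gt v 35700 with h' | h'
  · have hn : 0 ≤ n := by
      by_contra hc
      have : (n:ℝ) ≤ -1 := by exact_mod_cast (by omega : n ≤ -1)
      nlinarith
    have hD : Dn ε u n = (-1:ℝ)^n*phie ε v := by unfold Dn; rw [if_pos hn]
    rw [hD, ← mul_sub, abs_neg_one_zpow_mul]
    have h1 := phit_close hε.le hε1 (show 0 < dl0 by linarith) h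
    have h2 := inc2 h h'
    have h3 := inc3 h
    have h4 : 101/100*dl0^2 ≤ 1/100*dl0 := by nlinarith
    nlinarith
  · have h1 := far_dl0 hε hε1 h'.le
    have h2 := far_phie hε hε1 h'.le
    have h3 := inc4 h'.le
    have hD : |Dn ε u n| ≤ |phie ε v| := by
      unfold Dn; split_ifs
      · rw [abs_neg_one_zpow_mul]
      · simp
    have h5 := abs_sub (Dn ε u n) ((-1:ℝ)^n*phit ε dl0 v)
    rw [abs_neg_one_zpow_mul] at h5
    linarith

lemma Dn_sum (ε u : ℝ) {N : ℕ} (hN : u < N*Real.log 2) :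
    HasSum (Dn ε u) (∑ k ∈ range N, (-1:ℝ)^k*phie ε (u-k*Real.log 2)) := by
  have h : HasSum (Dn ε u) (∑ b ∈ (range N).map Nat.castEmbedding, Dn ε u b) := hasSum_sum_of_ne_finset_zero (by
    intro n hn
    unfold Dn
    split_ifs with h
    · obtain ⟨k, rfl⟩ := Int.eq_ofNat_of_zero_le h
      have hk : N ≤ k := by
        by_contra hc
        exact hn (by simp; omega)
      have : (N:ℝ) ≤ k := by exact_mod_cast hk
      have := mul_le_mul_of_nonneg_right this l2pos.le
      rw [phie_neg (by push_cast; linarith), mul_zero]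
    · rfl)
  rw [Finset.sum_map] at h
  convert h using 2 with k
  simp [Dn]

lemma weps_bd {ε u : ℝ} (hε : 0 < ε) (hε1 : ε ≤ 1/100) (hB : ∀ J : Finset ℤ, ∑ j ∈ J, psa ε j ≤ 422)
    (hu : 35700 ≤ u) {N : ℕ} (hN : u < N*Real.log 2) :
    |∑ k ∈ range N, (-1:ℝ)^k*phie ε (u-k*Real.log 2)| ≤ 693 := by
  have hd := dl0_lo
  have hT0 := phit_summable hε dl0 u
  have hT : Summable (fun n : ℤ => (-1:ℝ)^n*phit ε dl0 (u-n*Real.log 2)) := by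
    refine Summable.of_norm ?_
    refine hT0.norm.congr fun n => ?_
    rw [Real.norm_eq_abs, Real.norm_eq_abs, abs_neg_one_zpow_mul]
  have hP := poisson_bd hε (show 0 < dl0 by linarith) hB u
  have hD := Dn_sum ε u hN
  have hfin : ∀ J : Finset ℤ, ∑ n ∈ J, |Dn ε u n - (-1:ℝ)^n*phit ε dl0 (u-n*Real.log 2)| ≤ (402/100+52) - (-(1025/100)-1715/100) := by
    intro J
    exact tele_sum (fun n => abs_nonneg _) (DT_bd hε hε1 hu) (fun v => Ga_up v) (fun v => Ga_lo v) J
  have hs : Summable (fun n => |Dn ε u n - (-1:ℝ)^n*phit ε dl0 (u-n*Real.log 2)|) := (hD.summable.sub hT).abs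
  have h1 := hs.tsum_le_of_sum_le hfin
  have h2 : |∑' n, (Dn ε u n - (-1:ℝ)^n*phit ε dl0 (u-n*Real.log 2))| ≤ ∑' n, |Dn ε u n - (-1:ℝ)^n*phit ε dl0 (u-n*Real.log 2)| := by
    have := norm_tsum_le_tsum_norm (f := fun n => Dn ε u n - (-1:ℝ)^n*phit ε dl0 (u-n*Real.log 2)) hs
    simpa [Real.norm_eq_abs] using this
  rw [hD.summable.tsum_sub hT, hD.tsum_eq] at h2
  have h3 := abs_sub_abs_le_abs_sub (∑ k ∈ range N, (-1:ℝ)^k*phie ε (u-k*Real.log 2)) (∑' n : ℤ, (-1:ℝ)^n*phit ε dl0 (u-n*Real.log 2))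
  have h4 : 422/Real.log 2 ≤ 609 := by
    rw [div_le_iff₀ l2pos]; have := l2lo; linarith
  linarith

lemma w0_bd {u : ℝ} (hu : 35700 ≤ u) {N : ℕ} (hN : u < N*Real.log 2) :
    |∑ k ∈ range N, (-1:ℝ)^k*phie 0 (u-k*Real.log 2)| ≤ 693 := by
  have hc : Continuous (fun ε : ℝ => |∑ k ∈ range N, (-1:ℝ)^k*phie ε (u-k*Real.log 2)|) := by
    unfold phie
    fun_prop
  have ht : Tendsto (fun ε : ℝ => |∑ k ∈ range N, (-1:ℝ)^k*phie ε (u-k*Real.log 2)|) (nhdsWithin 0 (Set.Ioi 0)) (nhds (|∑ k ∈ range N, (-1:ℝ)^k*phie 0 (u-k*Real.log 2)|)) :=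
    (hc.tendsto 0).mono_left nhdsWithin_le_nhds
  refine le_of_tendsto ht ?_
  filter_upwards [psa_sum, Ioo_mem_nhdsGT (show (0:ℝ) < 1/100 by norm_num)] with ε h1 h2
  exact weps_bd h2.1 h2.2.le h1 hu hN

lemma w0_triv {u : ℝ} (hu : u ≤ 35700) (N : ℕ) :
    |∑ k ∈ range N, (-1:ℝ)^k*phie 0 (u-k*Real.log 2)| ≤ 51600*17854 := by
  refine (Finset.abs_sum_le_sum_abs _ _).trans ?_
  have : ∀ k ∈ range N, |(-1:ℝ)^k*phie 0 (u-k*Real.log 2)| ≤ if k < 51600 then 17854 else 0 := by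
    intro k _
    rw [abs_mul, abs_pow, abs_neg, abs_one, one_pow, one_mul]
    rcases lt_or_ge (u-k*Real.log 2) 0 with h | h
    · rw [phie_neg h]; split_ifs <;> norm_num
    · have h1 := phie_bd (ε := 0) h
      have h2 : 0 ≤ k*Real.log 2 := mul_nonneg (Nat.cast_nonneg _) l2pos.le
      simp only [zero_mul, neg_zero, Real.exp_zero, mul_one] at h1
      rw [if_pos]
      · linarith
      · by_contra hc
        have h3 : (51600:ℝ) ≤ k := by exact_mod_cast not_lt.mp hc
        have := l2lo
        nlinarith
  refine (Finset.sum_le_sum this).trans ?_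
  rw [← Finset.sum_filter, Finset.sum_const, nsmul_eq_mul]
  refine mul_le_mul_of_nonneg_right ?_ (by norm_num)
  have h1 : ((range N).filter (fun k => k < 51600)).card ≤ (range 51600).card := Finset.card_le_card (fun k hk => by
    rw [Finset.mem_range]; exact (Finset.mem_filter.mp hk).2)
  rw [card_range] at h1
  exact_mod_cast h1

-- Part Q1
noncomputable def gz : ArithmeticFunction ℤ := ⟨fun n => if Odd n then (-2)^(cardFactors n) else 0, by simp⟩
noncomputable def zo : ArithmeticFunction ℤ := ⟨fun n => if Odd n then 1 else 0, by simp⟩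
noncomputable def hh : ArithmeticFunction ℤ := gz*zo*zo

lemma gz_apply (n : ℕ) : gz n = if Odd n then (-2)^(cardFactors n) else 0 := rfl
lemma zo_apply (n : ℕ) : zo n = if Odd n then 1 else 0 := rfl

lemma gz_mult : gz.IsMultiplicative := by
  rw [IsMultiplicative.iff_ne_zero]
  refine ⟨by simp [gz_apply], fun {m n} hm hn _ => ?_⟩
  rw [gz_apply, gz_apply, gz_apply, cardFactors_mul hm hn, pow_add]
  by_cases h1 : Odd m <;> by_cases h2 : Odd n <;> simp [Nat.odd_mul, h1, h2]

lemma zo_mult : zo.IsMultiplicative := by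
  rw [IsMultiplicative.iff_ne_zero]
  refine ⟨by simp [zo_apply], fun {m n} hm hn _ => ?_⟩
  rw [zo_apply, zo_apply, zo_apply]
  by_cases h1 : Odd m <;> by_cases h2 : Odd n <;> simp [Nat.odd_mul, h1, h2]

lemma hh_mult : hh.IsMultiplicative := (gz_mult.mul zo_mult).mul zo_mult

lemma muo_zo : muo*zo = 1 := by
  ext n
  rcases Nat.even_or_odd n with h | h
  · rcases Nat.eq_zero_or_pos n with h0 | h0
    · simp [h0]
    rw [one_apply_ne (by rintro rfl; simp at h), ArithmeticFunction.mul_apply]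
    refine Finset.sum_eq_zero fun i hi => ?_
    have hi' := (Nat.mem_divisorsAntidiagonal.mp hi).1
    rw [muo_apply, zo_apply]
    rw [← hi', Nat.even_mul] at h
    rcases h with h | h
    · rw [if_neg (Nat.not_odd_iff_even.mpr h), zero_mul]
    · rw [if_neg (Nat.not_odd_iff_even.mpr h), mul_zero]
  · rw [← moebius_mul_coe_zeta, ArithmeticFunction.mul_apply, ArithmeticFunction.mul_apply]
    refine Finset.sum_congr rfl fun i hi => ?_
    have hi' := Nat.mem_divisorsAntidiagonal.mp hi
    rw [← hi'.1, Nat.odd_mul] at h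
    have : i.2 ≠ 0 := by rintro h0; simp [h0] at h
    rw [muo_apply, zo_apply, if_pos h.1, if_pos h.2, natCoe_apply, zeta_apply, if_neg this]; simp

lemma hh_zz : hh*zz = gz := by
  have : hh*zz = gz*(muo*zo)*(muo*zo) := by unfold hh zz; ring
  rw [this, muo_zo, mul_one, mul_one]

lemma mul_zo_pp (F : ArithmeticFunction ℤ) {p : ℕ} (hp : p.Prime) (h2 : Odd p) (a : ℕ) :
    (F*zo) (p^a) = ∑ i ∈ range (a+1), F (p^i) := by
  rw [ArithmeticFunction.mul_apply, Nat.sum_divisorsAntidiagonal (fun i j => F i*zo j), Nat.sum_divisors_prime_pow hp]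
  refine Finset.sum_congr rfl fun i hi => ?_
  have hi' : i ≤ a := by rw [Finset.mem_range] at hi; omega
  rw [Nat.pow_div hi' hp.pos, zo_apply, if_pos (h2.pow), mul_one]

lemma hh_pp {p : ℕ} (hp : p.Prime) (h2 : Odd p) (a : ℕ) : 9*hh (p^a) = 4*(-2)^a+3*a+5 := by
  have h1 : ∀ b : ℕ, 3*(gz*zo) (p^b) = 1+2*(-2)^b := by
    intro b
    rw [mul_zo_pp _ hp h2]
    have : ∀ i ∈ range (b+1), gz (p^i) = (-2)^i := by
      intro i _; rw [gz_apply, if_pos h2.pow, cardFactors_apply_prime_pow hp]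
    rw [Finset.sum_congr rfl this]
    clear this
    induction b with
    | zero => simp
    | succ b ih => rw [Finset.sum_range_succ, mul_add, ih]; ring
  unfold hh
  rw [mul_zo_pp _ hp h2]
  induction a with
  | zero => simp; have := h1 0; simp at this; omega
  | succ a ih =>
    rw [Finset.sum_range_succ, mul_add, ih, show (9:ℤ)*(gz*zo) (p^(a+1)) = 3*(3*(gz*zo) (p^(a+1))) by ring, h1]
    push_cast; ring

lemma hh_even {n : ℕ} (h : Even n) : hh n = 0 := by
  unfold hh
  have key : ∀ F : ArithmeticFunction ℤ, (∀ n, Even n → F n = 0) → ∀ n, Even n → (F*zo) n = 0 := by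
    intro F hF n h
    rw [ArithmeticFunction.mul_apply]
    refine Finset.sum_eq_zero fun i hi => ?_
    have hi' := (Nat.mem_divisorsAntidiagonal.mp hi).1
    rw [← hi', Nat.even_mul] at h
    rcases h with h | h
    · rw [hF _ h, zero_mul]
    · rw [zo_apply, if_neg (Nat.not_odd_iff_even.mpr h), mul_zero]
  refine key _ (key _ (fun n h => ?_)) n h
  rw [gz_apply, if_neg (Nat.not_odd_iff_even.mpr h)]

noncomputable def Fh (m : ℕ) : ℝ := |((hh m:ℤ):ℝ)|/m

lemma Fh_nonneg (m : ℕ) : 0 ≤ Fh m := by unfold Fh; positivity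
lemma Fh_one : Fh 1 = 1 := by unfold Fh; rw [hh_mult.map_one]; simp
lemma Fh_mul {m n : ℕ} (h : Nat.Coprime m n) : Fh (m*n) = Fh m*Fh n := by
  unfold Fh; rw [hh_mult.map_mul_of_coprime h]; push_cast; rw [abs_mul]; ring

lemma Fh_pp {p : ℕ} (hp : p.Prime) (h2 : Odd p) :
    Fh (p^0) = 1 ∧ Fh (p^1) = 0 ∧ ∀ a : ℕ, Fh (p^(a+2)) ≤ 3/(p:ℝ)^2*(2/p)^a := by
  refine ⟨by rw [pow_zero, Fh_one], ?_, fun a => ?_⟩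
  · have := hh_pp hp h2 1
    have : hh (p^1) = 0 := by push_cast at this; omega
    unfold Fh; rw [this]; simp
  · have h := hh_pp hp h2 (a+2)
    have hr : 9*((hh (p^(a+2)):ℤ):ℝ) = 16*(-2)^a+3*a+11 := by
      have : ((9*hh (p^(a+2)):ℤ):ℝ) = ((4*(-2)^(a+2)+3*(a+2:ℕ)+5:ℤ):ℝ) := by rw [h]
      push_cast at this; rw [this]; ring
    have hb : 3*(a:ℝ)+11 ≤ 11*2^a := by
      have : 1+(a:ℝ) ≤ 2^a := by
        have := one_add_mul_le_pow (a := (1:ℝ)) (by norm_num) a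
        norm_num at this; linarith
      have : (0:ℝ) ≤ a := by positivity
      linarith
    have hp0 : (0:ℝ) < p := by exact_mod_cast hp.pos
    have h3 : |((hh (p^(a+2)):ℤ):ℝ)| ≤ 3*2^a := by
      have h4 : |(-2:ℝ)^a| = 2^a := by rw [abs_pow, abs_neg]; norm_num
      have h5 := abs_le.mp h4.le
      have : (0:ℝ) ≤ a := by positivity
      rw [abs_le]; constructor <;> linarith [h5.1, h5.2]
    unfold Fh
    rw [show 3/(p:ℝ)^2*(2/p)^a = 3*2^a/((p^(a+2):ℕ):ℝ) by push_cast; rw [div_pow, pow_add]; field_simp]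
    exact div_le_div_of_nonneg_right h3 (by positivity)

lemma Fh_local {p : ℕ} (hp : p.Prime) : Summable (fun n => Fh (p^n)) ∧
    ∑' n, Fh (p^n) ≤ if p = 2 then 1 else 1+3/((p:ℝ)*(p-2)) := by
  rcases hp.eq_two_or_odd' with h | h
  · subst h
    have hz : ∀ n ∉ ({0}:Finset ℕ), Fh (2^n) = 0 := by
      intro n hn
      unfold Fh
      rw [hh_even ((Nat.even_pow.mpr ⟨even_two, by simpa using hn⟩))]; simp
    refine ⟨summable_of_ne_finset_zero hz, ?_⟩
    rw [tsum_eq_sum hz, if_pos rfl]; simp [Fh_one]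
  · obtain ⟨h0, h1, h2⟩ := Fh_pp hp h
    have hp3 : (3:ℝ) ≤ p := by
      have := hp.two_le
      have : p ≠ 2 := by rintro rfl; revert h; decide
      exact_mod_cast (by omega : 3 ≤ p)
    have hr : 2/(p:ℝ) < 1 := by rw [div_lt_one (by linarith)]; linarith
    have hg := (hasSum_geometric_of_lt_one (show 0 ≤ 2/(p:ℝ) by positivity) hr).mul_left (3/(p:ℝ)^2)
    have hs2 : Summable (fun a => Fh (p^(a+2))) := Summable.of_nonneg_of_le (fun _ => Fh_nonneg _) h2 hg.summable
    have hs : Summable (fun n => Fh (p^n)) := (summable_nat_add_iff 2).mp hs2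
    refine ⟨hs, ?_⟩
    have hne : p ≠ 2 := by rintro rfl; revert h; decide
    rw [if_neg hne, ← hs.sum_add_tsum_nat_add 2, Finset.sum_range_succ, Finset.sum_range_one, h0, h1, add_zero]
    have h3 := hs2.tsum_le_tsum h2 hg.summable
    rw [hg.tsum_eq] at h3
    have e : 3/(p:ℝ)^2*(1-2/(p:ℝ))⁻¹ = 3/((p:ℝ)*(p-2)) := by
      have : (p:ℝ)-2 ≠ 0 := by intro h; linarith
      have : (1:ℝ)-2/p = (p-2)/p := by field_simp
      rw [this, inv_div]; field_simp
    linarith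

noncomputable def Gp (p : ℕ) : ℝ := 1+3/((p:ℝ)*(p-2))

lemma prod_tail (K : ℕ) : ∏ k ∈ range K, Gp (2*k+17) ≤ Real.exp (3/2*(1/15-1/(2*K+15))) := by
  induction K with
  | zero => norm_num
  | succ K ih =>
    rw [Finset.prod_range_succ]
    have hk : (0:ℝ) ≤ K := by positivity
    have h1 : Gp (2*K+17) ≤ Real.exp (3/(((2*K+17:ℕ):ℝ)*((2*K+17:ℕ)-2))) := by
      unfold Gp; have := Real.add_one_le_exp (3/(((2*K+17:ℕ):ℝ)*((2*K+17:ℕ)-2))); linarith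
    have h0 : 0 ≤ Gp (2*K+17) := by
      unfold Gp
      have : (0:ℝ) ≤ ((2*K+17:ℕ):ℝ)-2 := by push_cast; linarith
      positivity
    refine (mul_le_mul ih h1 h0 (Real.exp_pos _).le).trans (le_of_eq ?_)
    rw [← Real.exp_add]; congr 1; push_cast
    have : (2*(K:ℝ)+17-2) ≠ 0 := by rw [show 2*(K:ℝ)+17-2 = 2*K+15 by ring]; positivity
    field_simp; ring

lemma prod_primes (N : ℕ) : ∏ p ∈ N.primesBelow, (if p = 2 then 1 else Gp p) ≤ 305/100 := by
  set S : Finset ℕ := ({2,3,5,7,11,13}:Finset ℕ) ∪ (range N).image (fun k => 2*k+17)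
  have hg1 : ∀ p, 2 ≤ p → (1:ℝ) ≤ if p = 2 then 1 else Gp p := by
    intro p hp
    split_ifs
    · rfl
    · unfold Gp
      have : (0:ℝ) ≤ (p:ℝ)-2 := sub_nonneg.mpr (by exact_mod_cast hp)
      have : 0 ≤ 3/((p:ℝ)*(p-2)) := by positivity
      linarith
  have hS2 : ∀ p ∈ S, 2 ≤ p := by
    intro p hp
    simp only [S, Finset.mem_union, Finset.mem_image, Finset.mem_insert, Finset.mem_singleton] at hp
    rcases hp with hp | ⟨k, _, hk⟩ <;> omega
  have hsub : N.primesBelow ⊆ S := by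
    intro p hp
    have hpN := Nat.lt_of_mem_primesBelow hp
    have hpp := Nat.prime_of_mem_primesBelow hp
    simp only [S, Finset.mem_union, Finset.mem_image, Finset.mem_range]
    by_cases h : p < 17
    · left
      interval_cases p <;> first | decide | (exfalso; revert hpp; decide)
    · right
      have := hpp.eq_two_or_odd
      exact ⟨(p-17)/2, by omega, by omega⟩
  have h1 : ∏ p ∈ N.primesBelow, (if p = 2 then 1 else Gp p) ≤ ∏ p ∈ S, (if p = 2 then 1 else Gp p) := by
    rw [← Finset.prod_sdiff hsub]
    refine le_mul_of_one_le_left (Finset.prod_nonneg fun p hp => le_trans zero_le_one (hg1 p (hS2 p (hsub hp)))) ?_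
    exact Finset.prod_induction _ (fun x : ℝ => 1 ≤ x) (fun a b => one_le_mul_of_one_le_of_one_le) le_rfl
      (fun p hp => hg1 p (hS2 p (Finset.mem_sdiff.mp hp).1))
  refine h1.trans ?_
  rw [Finset.prod_union, Finset.prod_image (fun a _ b _ h => by simpa using h)]
  · have h2 : ∏ x ∈ range N, (if 2*x+17 = 2 then 1 else Gp (2*x+17)) ≤ 1/(1-1/10) := by
      have : ∀ x ∈ range N, (if 2*x+17 = 2 then 1 else Gp (2*x+17)) = Gp (2*x+17) := fun x _ => if_neg (by omega)
      rw [Finset.prod_congr rfl this]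
      refine (prod_tail N).trans ?_
      have h3 := Real.exp_bound_div_one_sub_of_interval (x := 1/10) (by norm_num) (by norm_num)
      refine le_trans (Real.exp_le_exp.mpr ?_) h3
      have : (0:ℝ) ≤ 1/(2*N+15) := by positivity
      linarith
    have h3 : ∏ p ∈ ({2,3,5,7,11,13}:Finset ℕ), (if p = 2 then 1 else Gp p) ≤ 2742/1000 := by
      simp [Gp]; norm_num
    refine (mul_le_mul h3 h2 (Finset.prod_nonneg fun x _ => le_trans zero_le_one (hg1 _ (by omega))) (by norm_num)).trans ?_
    norm_num
  · rw [Finset.disjoint_left]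
    intro p hp hp2
    simp only [Finset.mem_image, Finset.mem_insert, Finset.mem_singleton] at hp hp2
    obtain ⟨k, _, hk⟩ := hp2
    omega

lemma Fh_fin (A : Finset ℕ) : ∑ m ∈ A, Fh m ≤ 305/100 := by
  obtain ⟨N, hN⟩ : ∃ N : ℕ, ∀ m ∈ A, m < N := ⟨A.sup id + 1, fun m hm => Nat.lt_succ_of_le (Finset.le_sup (f := id) hm)⟩
  obtain ⟨h1, h2⟩ := EulerProduct.summable_and_hasSum_smoothNumbers_prod_primesBelow_tsum (f := Fh) Fh_one (fun h => Fh_mul h)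
    (fun hp => (Fh_local hp).1.norm) N
  have h3 : ∏ p ∈ N.primesBelow, ∑' n : ℕ, Fh (p^n) ≤ 305/100 := by
    refine (Finset.prod_le_prod (fun p _ => tsum_nonneg fun n => Fh_nonneg _) fun p hp => ?_).trans (prod_primes N)
    exact (Fh_local (Nat.prime_of_mem_primesBelow hp)).2
  have h4 : ∑ m ∈ A, Fh m = ∑ m ∈ A.filter (· ∈ N.smoothNumbers), Fh m := by
    symm
    refine Finset.sum_filter_of_ne fun m hm hne => ?_
    have h0 : m ≠ 0 := by rintro rfl; apply hne; simp [Fh]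
    exact Nat.mem_smoothNumbers_of_lt (Nat.pos_of_ne_zero h0) (hN m hm)
  rw [h4, ← Finset.sum_subtype_of_mem (p := (· ∈ N.smoothNumbers)) Fh (fun x hx => (Finset.mem_filter.mp hx).2)]
  refine (h2.summable.sum_le_tsum _ (fun i _ => Fh_nonneg _)).trans ?_
  rw [h2.tsum_eq]; exact h3

-- Part Q2
noncomputable def Sg (X : ℕ) : ℝ := ∑ n ∈ Icc 1 X, ((gz n:ℤ):ℝ)
noncomputable def Wn (X : ℕ) : ℝ := ∑ n ∈ Icc 1 X, (-2:ℝ)^(cardFactors n)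

lemma Wn_step (X : ℕ) : Wn X = Sg X - 2*Wn (X/2) := by
  induction X with
  | zero => simp [Wn, Sg]
  | succ X ih =>
    have e1 : Wn (X+1) = Wn X + (-2:ℝ)^(cardFactors (X+1)) := by
      unfold Wn; rw [Finset.sum_Icc_succ_top (by omega)]
    have e2 : Sg (X+1) = Sg X + ((gz (X+1):ℤ):ℝ) := by
      unfold Sg; rw [Finset.sum_Icc_succ_top (by omega)]
    rw [e1, e2, ih, gz_apply]
    rcases Nat.even_or_odd (X+1) with h | h
    · obtain ⟨k, hk⟩ := h
      have hX : X/2+1 = (X+1)/2 := by omega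
      have e3 : Wn (X/2+1) = Wn (X/2) + (-2:ℝ)^(cardFactors (X/2+1)) := by
        unfold Wn; rw [Finset.sum_Icc_succ_top (by omega)]
      have e4 : cardFactors (X+1) = cardFactors (X/2+1) + 1 := by
        rw [show X+1 = 2*(X/2+1) by omega, cardFactors_mul (by norm_num) (by omega), cardFactors_apply_prime Nat.prime_two, add_comm]
      rw [← hX, e3, e4, if_neg (Nat.not_odd_iff_even.mpr ⟨k, hk⟩)]
      push_cast; ring
    · have hX : (X+1)/2 = X/2 := by obtain ⟨k, hk⟩ := h; omega
      rw [hX, if_pos h]; push_cast; ring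

lemma Wn_iter (X N : ℕ) : Wn X = ∑ k ∈ range N, (-2:ℝ)^k*Sg (X/2^k) + (-2:ℝ)^N*Wn (X/2^N) := by
  induction N with
  | zero => simp
  | succ N ih =>
    rw [Finset.sum_range_succ, ih, Wn_step (X/2^N), Nat.div_div_eq_div_mul, ← pow_succ]; ring

lemma ZZ_zero {y : ℝ} (h : y < 1) : ZZ y = 0 := by
  unfold ZZ; rw [Nat.floor_eq_zero.mpr h]; simp

lemma Sg_eq (y : ℝ) {M : ℕ} (hM : ⌊y⌋₊ ≤ M) : Sg ⌊y⌋₊ = ∑ m ∈ Icc 1 M, ((hh m:ℤ):ℝ)*ZZ (y/m) := by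
  have h := sum_Ioc_mul_eq_sum_sum hh zz ⌊y⌋₊
  rw [hh_zz] at h
  have h2 : Sg ⌊y⌋₊ = ∑ m ∈ Icc 1 ⌊y⌋₊, ((hh m:ℤ):ℝ)*ZZ (y/m) := by
    unfold Sg ZZ
    simp_rw [Nat.floor_div_natCast]
    exact_mod_cast h
  rw [h2]
  refine Finset.sum_subset (Finset.Icc_subset_Icc le_rfl hM) fun m hm hn => ?_
  rw [Finset.mem_Icc] at hm hn
  have h3 : y < m := by
    have : ⌊y⌋₊ < m := by omega
    exact (Nat.floor_lt' (by omega)).mp this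
  have hm0 : (0:ℝ) < m := by exact_mod_cast hm.1
  rw [ZZ_zero (by rw [div_lt_one hm0]; exact h3), mul_zero]

lemma W_rep {x : ℝ} (hx : 1 ≤ x) {N : ℕ} (hN : x < 2^N) :
    W x = x*∑ m ∈ Icc 1 ⌊x⌋₊, ((hh m:ℤ):ℝ)/m*∑ k ∈ range N, (-1:ℝ)^k*phie 0 (Real.log (x/m)-k*Real.log 2) := by
  have hfl : ⌊x⌋₊ < 2^N := by rw [Nat.floor_lt (by linarith)]; exact_mod_cast hN
  have h1 : W x = Wn ⌊x⌋₊ := rfl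
  rw [h1, Wn_iter _ N, Nat.div_eq_of_lt hfl, show Wn 0 = 0 by simp [Wn], mul_zero, add_zero]
  have h2 : ∀ k ∈ range N, (-2:ℝ)^k*Sg (⌊x⌋₊/2^k) = ∑ m ∈ Icc 1 ⌊x⌋₊, (-2:ℝ)^k*(((hh m:ℤ):ℝ)*ZZ (x/2^k/m)) := by
    intro k _
    rw [← Finset.mul_sum]
    have := Nat.floor_div_natCast x (2^k)
    rw [← this, Sg_eq (M := ⌊x⌋₊) _ (by rw [this]; exact Nat.div_le_self _ _)]
    push_cast; rfl
  rw [Finset.sum_congr rfl h2, Finset.sum_comm, Finset.mul_sum]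
  refine Finset.sum_congr rfl fun m hm => ?_
  have hm0 : (0:ℝ) < m := by exact_mod_cast (Finset.mem_Icc.mp hm).1
  rw [Finset.mul_sum, Finset.mul_sum]
  refine Finset.sum_congr rfl fun k _ => ?_
  have hxm : 0 < x/m := by positivity
  have e : Real.exp (Real.log (x/m)-k*Real.log 2) = x/2^k/m := by
    rw [Real.exp_sub, Real.exp_log hxm, Real.exp_nat_mul, Real.exp_log (by norm_num)]; ring
  unfold phie
  rw [Real.exp_neg, add_zero, one_mul, e, show (-2:ℝ)^k = (-1)^k*2^k by rw [← mul_pow]; norm_num]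
  generalize ZZ (x/2^k/m) = z
  field_simp

lemma Fh_tail : ∃ K : ℕ, ∀ A : Finset ℕ, ∑ m ∈ A.filter (K ≤ ·), Fh m ≤ 1/10^8 := by
  have hs : Summable Fh := summable_of_sum_le Fh_nonneg Fh_fin
  have ht := hs.hasSum.tendsto_sum_nat
  obtain ⟨K, hK⟩ := (ht.eventually_const_lt (show (∑' m, Fh m) - 1/10^8 < ∑' m, Fh m by norm_num)).exists
  refine ⟨K, fun A => ?_⟩
  have hd : Disjoint (A.filter (K ≤ ·)) (range K) := by
    rw [Finset.disjoint_left]; intro m h1 h2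
    have := (Finset.mem_filter.mp h1).2
    rw [Finset.mem_range] at h2; omega
  have h := hs.sum_le_tsum (A.filter (K ≤ ·) ∪ range K) (fun m _ => Fh_nonneg m)
  rw [Finset.sum_union hd] at h
  linarith

lemma W_upper : ∀ᶠ x : ℝ in atTop, |W x|/x ≤ 2260 := by
  obtain ⟨K, hK⟩ := Fh_tail
  filter_upwards [eventually_ge_atTop (1:ℝ), eventually_ge_atTop (K*Real.exp 35700)] with x hx hxK
  have hx0 : 0 < x := by linarith
  obtain ⟨N, hN⟩ := pow_unbounded_of_one_lt x (show (1:ℝ) < 2 by norm_num)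
  rw [W_rep hx hN, abs_mul, abs_of_pos hx0, mul_div_cancel_left₀ _ hx0.ne']
  have h1 : ∀ m ∈ Icc 1 ⌊x⌋₊, |((hh m:ℤ):ℝ)/m*∑ k ∈ range N, (-1:ℝ)^k*phie 0 (Real.log (x/m)-k*Real.log 2)| ≤
      693*Fh m + 51600*17854*(if K ≤ m then Fh m else 0) := by
    intro m hm
    have hm1 : (1:ℝ) ≤ m := by exact_mod_cast (Finset.mem_Icc.mp hm).1
    have hm0 : (0:ℝ) < m := by linarith
    have hxm : 0 < x/m := by positivity
    have hF := Fh_nonneg m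
    have e : |((hh m:ℤ):ℝ)/m| = Fh m := by unfold Fh; rw [abs_div, abs_of_pos hm0]
    rw [abs_mul, e]
    rcases le_or_gt 35700 (Real.log (x/m)) with h | h
    · have hlt : Real.log (x/m) < N*Real.log 2 := by
        rw [← Real.log_pow]
        refine Real.log_lt_log hxm (lt_of_le_of_lt ?_ hN)
        exact div_le_self hx0.le hm1
      have h2 := mul_le_mul_of_nonneg_left (w0_bd h hlt) hF
      have h3 : (0:ℝ) ≤ if K ≤ m then Fh m else 0 := by split_ifs <;> linarith
      linarith
    · have h2 := mul_le_mul_of_nonneg_left (w0_triv h.le N) hF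
      have h3 : K ≤ m := by
        have h4 : x/m < Real.exp 35700 := (Real.log_lt_iff_lt_exp hxm).mp h
        rw [div_lt_iff₀ hm0] at h4
        have h5 : (K:ℝ)*Real.exp 35700 < m*Real.exp 35700 := by linarith
        exact_mod_cast (lt_of_mul_lt_mul_right h5 (Real.exp_pos _).le).le
      rw [if_pos h3]; linarith
  refine (Finset.abs_sum_le_sum_abs _ _).trans ((Finset.sum_le_sum h1).trans ?_)
  rw [Finset.sum_add_distrib, ← Finset.mul_sum, ← Finset.mul_sum, ← Finset.sum_filter]
  have h2 := Fh_fin (Icc 1 ⌊x⌋₊)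
  have h3 := hK (Icc 1 ⌊x⌋₊)
  linarith

lemma W_lower : ∃ᶠ x : ℝ in atTop, 1/2 ≤ |W x|/x := by
  rw [frequently_atTop]
  intro a
  obtain ⟨k, hk⟩ := pow_unbounded_of_one_lt (max a 0+1) (show (1:ℝ) < 2 by norm_num)
  have ha := le_max_left a 0
  have h0 := le_max_right a 0
  have e0 : W ((2^k:ℕ):ℝ) = W ((2^k-1:ℕ):ℝ) + (-2:ℝ)^k := by
    unfold W
    rw [Nat.floor_natCast, Nat.floor_natCast]
    have h1 : 2^k = (2^k-1)+1 := by have := Nat.two_pow_pos k; omega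
    conv_lhs => rw [h1]
    rw [Finset.sum_Icc_succ_top (by omega), ← h1, cardFactors_apply_prime_pow Nat.prime_two]
  have hc : ((2^k-1:ℕ):ℝ) = 2^k-1 := by rw [Nat.cast_sub Nat.one_le_two_pow]; push_cast; ring
  rw [hc] at e0
  push_cast at e0
  have h4 : |(-2:ℝ)^k| = 2^k := by rw [abs_pow, abs_neg]; norm_num
  have h5 := abs_sub (W (2^k)) (W (2^k-1))
  rw [e0, add_sub_cancel_left, h4, ← e0] at h5
  by_cases h : (2:ℝ)^k/2 ≤ |W (2^k)|
  · refine ⟨2^k, by linarith, ?_⟩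
    rw [le_div_iff₀ (by positivity)]; linarith
  · refine ⟨2^k-1, by linarith, ?_⟩
    rw [le_div_iff₀ (by linarith)]; linarith

theorem sW_bounds :
    1 / 2 ≤ Filter.limsup (fun x : ℝ => |W x| / x) Filter.atTop ∧
      Filter.limsup (fun x : ℝ => |W x| / x) Filter.atTop ≤ 2260 := by
  have hb : IsBoundedUnder (· ≤ ·) atTop (fun x : ℝ => |W x| / x) := ⟨2260, W_upper⟩
  refine ⟨le_limsup_of_frequently_le W_lower hb, limsup_le_of_le ?_ W_upper⟩
  refine IsCoboundedUnder.of_frequently_ge (a := 1/2) W_lower
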